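/- Let M ≥ 1 be an integer, 2/M < r < ∞, and 1 < p_m < ∞ for m = 1, …, M, with 1/p = Σ_{m=1}^M 1/p_m. Fix φ and φ_i as in the context. There exists a constant C such that for all f_m ∈ L^{p_m}(ℝ), m = 1, …, M: ‖ sup_{(N_k)} ( Σ_{k≥1} | Σ_{N_{k−1} < i_1 < ⋯ < i_M ≤ N_k} Π_{m=1}^M (φ_{i_m} * f_m)(x) |^r )^{1/r} ‖_{L^p(dx)} ≤ C Π_{m=1}^M ‖f_m‖_{L^{p_m}}, where for each x the supremum is taken over all increasing sequences of integers (N_k)_{k≥0}. -/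

import Mathlib

open MeasureTheory ENNReal
open scoped FourierTransform NNReal

noncomputable section

/-- The dilate `φ_i(x) = 2^i φ(2^i x)` of a Schwartz function `φ`. -/
def dilate (φ : SchwartzMap ℝ ℂ) (i : ℤ) : ℝ → ℂ :=
  fun x => ((2 : ℝ) ^ i : ℝ) • φ (((2 : ℝ) ^ i) * x)

/-- Convolution `(φ_i * h)(x) = ∫ φ_i(x - y) h(y) dy`. -/
def conv (φi : ℝ → ℂ) (h : ℝ → ℂ) : ℝ → ℂ :=
  fun x => ∫ y : ℝ, φi (x - y) * h y

namespace VP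

section Lbasic
variable {Ω : Type*} [MeasurableSpace Ω]

/-- Upper integral of a real function (negative part discarded). -/
def L (μ : Measure Ω) (X : Ω → ℝ) : ℝ≥0∞ := ∫⁻ x, ENNReal.ofReal (X x) ∂μ

variable {μ : Measure Ω}

lemma L_mono {X Y : Ω → ℝ} (h : ∀ x, X x ≤ Y x) : L μ X ≤ L μ Y :=
  lintegral_mono fun x => ENNReal.ofReal_le_ofReal (h x)

lemma L_mul {c : ℝ} (hc : 0 ≤ c) (X : Ω → ℝ) :
    L μ (fun x => c * X x) = ENNReal.ofReal c * L μ X := by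
  unfold L
  rw [← lintegral_const_mul' _ _ ENNReal.ofReal_ne_top]
  exact lintegral_congr fun x => ENNReal.ofReal_mul hc

lemma L_add {X Y : Ω → ℝ} (hX : Measurable X) (h0 : ∀ x, 0 ≤ X x) (h1 : ∀ x, 0 ≤ Y x) :
    L μ (fun x => X x + Y x) = L μ X + L μ Y := by
  unfold L
  rw [← lintegral_add_left hX.ennreal_ofReal]
  exact lintegral_congr fun x => ENNReal.ofReal_add (h0 x) (h1 x)

lemma L_add_le {X Y : Ω → ℝ} (hX : Measurable X) :
    L μ (fun x => X x + Y x) ≤ L μ X + L μ Y := by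
  unfold L
  rw [← lintegral_add_left hX.ennreal_ofReal]
  exact lintegral_mono fun x => ENNReal.ofReal_add_le

lemma L_comp {θ : Ω → Ω} (hθ : MeasurePreserving θ μ μ) {X : Ω → ℝ} (hX : Measurable X) :
    L μ (fun x => X (θ x)) = L μ X := by
  unfold L
  exact hθ.lintegral_comp hX.ennreal_ofReal

lemma absorb {A B : ℝ≥0∞} {c : ℝ} (hc : 0 ≤ c) (hc1 : c < 1) (hA : A ≠ ∞)
    (h : A ≤ ENNReal.ofReal c * A + B) : A ≤ ENNReal.ofReal (1 / (1 - c)) * B := by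
  by_cases hB : B = ∞
  · rw [hB, ENNReal.mul_top]
    · exact le_top
    · simp only [ne_eq, ENNReal.ofReal_eq_zero, not_le]
      exact one_div_pos.2 (by linarith)
  have h' := ENNReal.toReal_mono (by simp [ENNReal.add_eq_top, ENNReal.mul_eq_top, hA, hB]) h
  rw [ENNReal.toReal_add (by simp [ENNReal.mul_eq_top, hA]) hB, ENNReal.toReal_mul,
    ENNReal.toReal_ofReal hc] at h'
  rw [← ENNReal.ofReal_toReal hA, ← ENNReal.ofReal_toReal hB,
    ← ENNReal.ofReal_mul (one_div_pos.2 (by linarith)).le]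
  apply ENNReal.ofReal_le_ofReal
  rw [one_div, inv_mul_eq_div, le_div_iff₀ (by linarith)]
  linarith

/-- Generic Doob maximal lemma. -/
lemma doob_gen (X m : ℕ → Ω → ℝ) (hX : ∀ n, Measurable (X n)) (hX0 : ∀ n x, 0 ≤ X n x)
    (hm0 : ∀ x, m 0 x = X 0 x) (hm : ∀ n x, m (n + 1) x = max (m n x) (X (n + 1) x))
    {τ : ℝ} (hτ : 1 < τ) (K : ℕ) (hfin : ∀ n ≤ K, L μ (fun x => X n x ^ τ) ≠ ∞)
    (hsub : ∀ n < K, L μ (fun x => m n x ^ (τ - 1) * X n x) ≤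
      L μ (fun x => m n x ^ (τ - 1) * X (n + 1) x)) :
    L μ (fun x => m K x ^ τ) ≤
      ENNReal.ofReal (τ * ((τ / (τ - 1)) ^ τ / τ)) * L μ (fun x => X K x ^ τ) := by
  set κ := τ / (τ - 1) with hκ
  have hτ1 : 0 < τ - 1 := by linarith
  have hκ0 : 0 < κ := by positivity
  have hconj : κ.HolderConjugate τ := by
    refine ⟨?_, hκ0, by linarith⟩
    rw [hκ]; field_simp; ring
  have hmm : ∀ n, Measurable (m n) := by
    intro n
    induction n with
    | zero =>
      have : m 0 = X 0 := funext hm0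
      rw [this]; exact hX 0
    | succ n ih =>
      have : m (n + 1) = fun x => max (m n x) (X (n + 1) x) := funext (hm n)
      rw [this]; exact ih.max (hX _)
  have hmX : ∀ n x, X n x ≤ m n x := by
    intro n x
    cases n with
    | zero => rw [hm0]
    | succ n => rw [hm]; exact le_max_right _ _
  have hmn : ∀ n x, 0 ≤ m n x := fun n x => (hX0 n x).trans (hmX n x)
  have hpw : ∀ a b : ℝ, 0 ≤ a → 0 ≤ b → a ^ (τ - 1) * b ≤ a ^ τ / κ + b ^ τ / τ := by
    intro a b ha hb
    have := Real.young_inequality_of_nonneg (Real.rpow_nonneg ha (τ - 1)) hb hconj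
    rwa [← Real.rpow_mul ha, show (τ - 1) * κ = τ by rw [hκ]; field_simp] at this
  have hself : ∀ a : ℝ, 0 ≤ a → a ^ (τ - 1) * a = a ^ τ := by
    intro a ha
    nth_rewrite 2 [← Real.rpow_one a]
    rw [← Real.rpow_add' ha (by linarith)]
    congr 1; ring
  have hmfin : ∀ n ≤ K, L μ (fun x => m n x ^ τ) ≠ ∞ := by
    intro n
    induction n with
    | zero => intro h; simpa [hm0] using hfin 0 h
    | succ n ih =>
      intro h
      have h1 := ih (by omega)
      have h2 := hfin (n + 1) h
      refine ne_top_of_le_ne_top (ENNReal.add_ne_top.2 ⟨h1, h2⟩) ?_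
      rw [← L_add ((hmm n).pow_const _) (fun x => Real.rpow_nonneg (hmn _ _) _)
        (fun x => Real.rpow_nonneg (hX0 _ _) _)]
      apply L_mono
      intro x
      rw [hm]
      rcases le_total (m n x) (X (n + 1) x) with h | h
      · rw [max_eq_right h]; linarith [Real.rpow_nonneg (hmn n x) τ]
      · rw [max_eq_left h]; linarith [Real.rpow_nonneg (hX0 (n+1) x) τ]
  have hbfin : ∀ n ≤ K, L μ (fun x => m n x ^ (τ - 1) * X n x) ≠ ∞ := by
    intro n hn
    refine ne_top_of_le_ne_top (hmfin n hn) (L_mono fun x => ?_)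
    rw [← hself _ (hmn n x)]
    exact mul_le_mul_of_nonneg_left (hmX n x) (Real.rpow_nonneg (hmn n x) _)
  have key : ∀ n ≤ K, L μ (fun x => m n x ^ τ) ≤
      ENNReal.ofReal κ * L μ (fun x => m n x ^ (τ - 1) * X n x) := by
    have hκ1 : 1 ≤ κ := by rw [hκ, le_div_iff₀ hτ1]; linarith
    intro n
    induction n with
    | zero =>
      intro _
      rw [← L_mul hκ0.le]
      apply L_mono
      intro x
      rw [hm0, hself _ (hX0 0 x)]
      nlinarith [Real.rpow_nonneg (hX0 0 x) τ]
    | succ n ih =>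
      intro hn
      have ih' := ih (by omega)
      have hs := hsub n (by omega)
      have hpt : L μ (fun x => m (n + 1) x ^ τ + κ * (m n x ^ (τ - 1) * X (n + 1) x)) ≤
          L μ (fun x => κ * (m (n + 1) x ^ (τ - 1) * X (n + 1) x) + m n x ^ τ) := by
        apply L_mono
        intro x
        rw [hm]
        rcases le_total (m n x) (X (n + 1) x) with h | h
        · rw [max_eq_right h, hself _ (hX0 _ x)]
          have := mul_le_mul_of_nonneg_left (hpw _ _ (hmn n x) (hX0 (n+1) x)) hκ0.le
          have e1 : κ * (m n x ^ τ / κ + X (n + 1) x ^ τ / τ) =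
            m n x ^ τ + (κ - 1) * X (n+1) x ^ τ := by
            rw [hκ]; field_simp; ring
          rw [e1] at this
          linarith
        · rw [max_eq_left h]; linarith
      have mX : ∀ n k, Measurable (fun x => m n x ^ (τ - 1) * X k x) := fun n k =>
        ((hmm n).pow_const _).mul (hX k)
      have pX : ∀ n k x, 0 ≤ m n x ^ (τ - 1) * X k x := fun n k x =>
        mul_nonneg (Real.rpow_nonneg (hmn n x) _) (hX0 k x)
      rw [L_add ((hmm _).pow_const _) (fun x => Real.rpow_nonneg (hmn _ _) _)
          (fun x => mul_nonneg hκ0.le (pX _ _ x)),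
        L_add ((mX _ _).const_mul κ) (fun x => mul_nonneg hκ0.le (pX _ _ x))
          (fun x => Real.rpow_nonneg (hmn _ _) _), L_mul hκ0.le, L_mul hκ0.le] at hpt
      have hb := hbfin n (by omega)
      have : L μ (fun x => m (n + 1) x ^ τ) + ENNReal.ofReal κ * L μ (fun x => m n x ^ (τ - 1) * X n x)
          ≤ ENNReal.ofReal κ * L μ (fun x => m (n + 1) x ^ (τ - 1) * X (n + 1) x) +
          ENNReal.ofReal κ * L μ (fun x => m n x ^ (τ - 1) * X n x) := by
        refine le_trans ?_ (hpt.trans ?_)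
        · gcongr
        · gcongr
      exact (ENNReal.add_le_add_iff_right (ENNReal.mul_ne_top ENNReal.ofReal_ne_top hb)).1 this
  have h1 := key K le_rfl
  have h2 : L μ (fun x => m K x ^ τ) ≤ ENNReal.ofReal (1 / κ) * L μ (fun x => m K x ^ τ) +
      ENNReal.ofReal (κ ^ τ / τ) * L μ (fun x => X K x ^ τ) := by
    refine h1.trans ?_
    rw [← L_mul hκ0.le, ← L_mul (by positivity), ← L_mul (by positivity),
      ← L_add (((hmm _).pow_const _).const_mul _) (fun x => mul_nonneg (by positivity)
        (Real.rpow_nonneg (hmn _ _) _)) (fun x => mul_nonneg (by positivity)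
        (Real.rpow_nonneg (hX0 _ _) _))]
    apply L_mono
    intro x
    have := hpw _ _ (hmn K x) (mul_nonneg hκ0.le (hX0 K x))
    rw [Real.mul_rpow hκ0.le (hX0 K x)] at this
    calc _ = m K x ^ (τ - 1) * (κ * X K x) := by ring
      _ ≤ _ := this
      _ = _ := by ring
  have h3 := absorb (by positivity) (by rw [hκ, div_lt_one (by positivity), lt_div_iff₀ hτ1]; linarith)
    (hmfin K le_rfl) h2
  refine h3.trans (le_of_eq ?_)
  rw [← mul_assoc, ← ENNReal.ofReal_mul]
  · congr 3
    rw [hκ]; field_simp; ring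
  · have : 1 - 1 / κ = 1 / τ := by rw [hκ]; field_simp; ring
    rw [this]; positivity

end Lbasic
end VP

namespace VP

section Flip
variable {Ω : Type*} [MeasurableSpace Ω] {μ : Measure Ω}

structure IsDiff (θ : ℕ → Ω → Ω) (d : ℕ → Ω → ℂ) : Prop where
  meas : ∀ i, Measurable (d i)
  flip : ∀ i x, d i (θ i x) = - d i x
  inv : ∀ i j, i < j → ∀ x, d i (θ j x) = d i x

structure IsPred {E : Type*} [MeasurableSpace E] (θ : ℕ → Ω → Ω) (H : ℕ → Ω → E) : Prop where
  meas : ∀ i, Measurable (H i)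
  inv : ∀ i j, i ≤ j → ∀ x, H i (θ j x) = H i x

def S (d : ℕ → Ω → ℂ) (n : ℕ) (x : Ω) : ℂ := ∑ i ∈ Finset.range n, d i x
def Sq (d : ℕ → Ω → ℂ) (n : ℕ) (x : Ω) : ℝ := ∑ i ∈ Finset.range n, ‖d i x‖ ^ 2
def mx (d : ℕ → Ω → ℂ) : ℕ → Ω → ℝ
  | 0, _ => 0
  | n + 1, x => max (mx d n x) ‖S d (n + 1) x‖

variable {θ : ℕ → Ω → Ω} {d e : ℕ → Ω → ℂ}

lemma S_succ (d : ℕ → Ω → ℂ) (n x) : S d (n + 1) x = S d n x + d n x := Finset.sum_range_succ _ _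
lemma Sq_succ (d : ℕ → Ω → ℂ) (n x) : Sq d (n + 1) x = Sq d n x + ‖d n x‖ ^ 2 :=
  Finset.sum_range_succ _ _
@[simp] lemma S_zero (d : ℕ → Ω → ℂ) (x) : S d 0 x = 0 := rfl
@[simp] lemma Sq_zero (d : ℕ → Ω → ℂ) (x) : Sq d 0 x = 0 := rfl
lemma Sq_nonneg (d : ℕ → Ω → ℂ) (n x) : 0 ≤ Sq d n x := Finset.sum_nonneg fun _ _ => by positivity
lemma Sq_mono (d : ℕ → Ω → ℂ) (x) : Monotone fun n => Sq d n x :=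
  monotone_nat_of_le_succ fun n => by rw [Sq_succ]; linarith [sq_nonneg ‖d n x‖]
lemma mx_mono (d : ℕ → Ω → ℂ) (x) : Monotone fun n => mx d n x :=
  monotone_nat_of_le_succ fun n => le_max_left _ _
lemma mx_nonneg (d : ℕ → Ω → ℂ) (n x) : 0 ≤ mx d n x := mx_mono d x (Nat.zero_le n)
lemma S_le_mx (d : ℕ → Ω → ℂ) {k n : ℕ} (h : k ≤ n) (x) : ‖S d k x‖ ≤ mx d n x := by
  refine le_trans ?_ (mx_mono d x h)
  cases k with
  | zero => simp [mx]
  | succ k => exact le_max_right _ _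
lemma mx_le {d : ℕ → Ω → ℂ} {n : ℕ} {x} {B : ℝ} (hB : 0 ≤ B) (h : ∀ k ≤ n, ‖S d k x‖ ≤ B) :
    mx d n x ≤ B := by
  induction n with
  | zero => simpa [mx]
  | succ n ih => exact max_le (ih fun k hk => h k (by omega)) (h _ le_rfl)

lemma IsDiff.S_pred (h : IsDiff θ d) : IsPred θ (S d) where
  meas n := Finset.measurable_sum _ fun i _ => h.meas i
  inv n j hn x := Finset.sum_congr rfl fun i hi => h.inv i j (by
    have := Finset.mem_range.1 hi; omega) x

lemma IsDiff.norm_pred (h : IsDiff θ d) : IsPred θ (fun n x => ‖d n x‖) where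
  meas n := (h.meas n).norm
  inv n j hn x := by
    rcases hn.eq_or_lt with rfl | hn
    · rw [h.flip, norm_neg]
    · rw [h.inv _ _ hn]

lemma IsDiff.Sq_pred' (h : IsDiff θ d) : IsPred θ (fun n => Sq d (n + 1)) where
  meas n := Finset.measurable_sum _ fun i _ => (h.meas i).norm.pow_const 2
  inv n j hn x := Finset.sum_congr rfl fun i hi => by
    rw [h.norm_pred.inv i j (by have := Finset.mem_range.1 hi; omega) x]

lemma IsDiff.Sq_meas (h : IsDiff θ d) (n) : Measurable (Sq d n) :=
  Finset.measurable_sum _ fun i _ => (h.meas i).norm.pow_const 2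

lemma IsDiff.mx_pred (h : IsDiff θ d) : IsPred θ (mx d) where
  meas n := by
    induction n with
    | zero => exact measurable_const
    | succ n ih => exact ih.max (h.S_pred.meas _).norm
  inv n := by
    induction n with
    | zero => intros; rfl
    | succ n ih =>
      intro j hj x
      simp only [mx]
      rw [ih j (by omega), h.S_pred.inv _ _ hj]

lemma IsPred.comp {E F : Type*} [MeasurableSpace E] [MeasurableSpace F] {H : ℕ → Ω → E}
    (h : IsPred θ H) {g : E → F} (hg : Measurable g) : IsPred θ (fun n x => g (H n x)) where
  meas n := hg.comp (h.meas n)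
  inv n j hn x := by rw [h.inv n j hn]

lemma IsPred.comp2 {E F G : Type*} [MeasurableSpace E] [MeasurableSpace F] [MeasurableSpace G]
    {H : ℕ → Ω → E} {H' : ℕ → Ω → F}
    (h : IsPred θ H) (h' : IsPred θ H') {g : E → F → G} (hg : Measurable (Function.uncurry g)) :
    IsPred θ (fun n x => g (H n x) (H' n x)) where
  meas n := hg.comp ((h.meas n).prodMk (h'.meas n))
  inv n j hn x := by rw [h.inv n j hn, h'.inv n j hn]

lemma IsPred.mul_diff {H : ℕ → Ω → ℂ} (h : IsPred θ H) (hd : IsDiff θ d) :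
    IsDiff θ (fun n x => H n x * d n x) where
  meas n := (h.meas n).mul (hd.meas n)
  flip n x := by rw [h.inv n n le_rfl, hd.flip]; ring
  inv n j hn x := by rw [h.inv n j hn.le, hd.inv _ _ hn]

lemma IsDiff.const_mul (c : ℂ) (hd : IsDiff θ d) : IsDiff θ (fun n x => c * d n x) where
  meas n := (hd.meas n).const_mul c
  flip n x := by rw [hd.flip]; ring
  inv n j hn x := by rw [hd.inv _ _ hn]

/-- symmetrisation -/
lemma L_symm (hθ : ∀ n, MeasurePreserving (θ n) μ μ) (hd : IsDiff θ d) (n : ℕ)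
    (Φ : ℝ → ℂ → ℂ → ℝ) (hΦ : Measurable (fun p : ℝ × ℂ × ℂ => Φ p.1 p.2.1 p.2.2))
    (hΦ0 : ∀ a b c, 0 ≤ Φ a b c) {ρ : Ω → ℝ} {F : Ω → ℂ} (hρ : Measurable ρ) (hF : Measurable F)
    (hρi : ∀ x, ρ (θ n x) = ρ x) (hFi : ∀ x, F (θ n x) = F x) :
    2 * L μ (fun x => Φ (ρ x) (F x) (d n x)) =
      L μ (fun x => Φ (ρ x) (F x) (d n x) + Φ (ρ x) (F x) (- d n x)) := by
  have m1 : Measurable (fun x => Φ (ρ x) (F x) (d n x)) :=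
    hΦ.comp (hρ.prodMk (hF.prodMk (hd.meas n)))
  rw [L_add m1 (fun x => hΦ0 _ _ _) (fun x => hΦ0 _ _ _), two_mul]
  congr 1
  rw [← L_comp (hθ n) m1]
  simp only [hρi, hFi, hd.flip]

lemma L_orth (hθ : ∀ n, MeasurePreserving (θ n) μ μ) (hd : IsDiff θ d) (n : ℕ)
    {ρ : Ω → ℝ} (hρ : Measurable ρ) (hρ0 : ∀ x, 0 ≤ ρ x) (hρi : ∀ x, ρ (θ n x) = ρ x)
    {F : Ω → ℂ} (hF : Measurable F) (hFi : ∀ x, F (θ n x) = F x) :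
    L μ (fun x => ρ x * ‖F x + d n x‖ ^ 2) =
      L μ (fun x => ρ x * ‖F x‖ ^ 2) + L μ (fun x => ρ x * ‖d n x‖ ^ 2) := by
  have h := L_symm hθ hd n (fun a b c => |a| * ‖b + c‖ ^ 2) (by fun_prop) (fun a b c => by positivity)
    hρ hF hρi hFi
  have e : ∀ x, |ρ x| * ‖F x + d n x‖ ^ 2 + |ρ x| * ‖F x + -d n x‖ ^ 2 =
      2 * (ρ x * ‖F x‖ ^ 2 + ρ x * ‖d n x‖ ^ 2) := by
    intro x
    have := parallelogram_law_with_norm ℝ (F x) (d n x)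
    rw [abs_of_nonneg (hρ0 x), ← sub_eq_add_neg]
    linear_combination (ρ x) * this
  simp only [e] at h
  rw [L_mul (by norm_num), ENNReal.ofReal_ofNat] at h
  have h2 := (ENNReal.mul_right_inj (by norm_num) (by norm_num)).1 h
  rw [← L_add (by fun_prop) (fun x => mul_nonneg (hρ0 x) (by positivity))
    (fun x => mul_nonneg (hρ0 x) (by positivity)), ← h2]
  simp only [abs_of_nonneg (hρ0 _)]

lemma L_S_sq (hθ : ∀ n, MeasurePreserving (θ n) μ μ) (hd : IsDiff θ d) (n : ℕ) :
    L μ (fun x => ‖S d n x‖ ^ 2) = L μ (Sq d n) := by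
  induction n with
  | zero => simp [L]
  | succ n ih =>
    have := L_orth hθ hd n (ρ := fun _ => 1) measurable_const (by simp) (by simp)
      (hd.S_pred.meas n) (fun x => hd.S_pred.inv n n le_rfl x)
    simp only [one_mul] at this
    simp only [S_succ, this, ih]
    rw [← L_add (hd.Sq_meas n) (Sq_nonneg d n) (fun x => by positivity)]
    congr 1
    ext x; rw [Sq_succ]

lemma doob_two (hθ : ∀ n, MeasurePreserving (θ n) μ μ) (hd : IsDiff θ d) (n : ℕ) :
    L μ (fun x => mx d n x ^ 2) ≤ ENNReal.ofReal 4 * L μ (Sq d n) := by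
  by_cases hfin : L μ (Sq d n) = ∞
  · rw [hfin, ENNReal.mul_top (by simp)]; exact le_top
  have hX : ∀ n, Measurable (fun x => ‖S d n x‖) := fun n => (hd.S_pred.meas n).norm
  have := doob_gen (μ := μ) (fun n x => ‖S d n x‖) (mx d) hX (fun n x => norm_nonneg _)
    (fun x => by simp [mx]) (fun n x => rfl) (τ := 2) (by norm_num) n
    (by
      intro k hk
      simp only [Real.rpow_ofNat]
      rw [L_S_sq hθ hd]
      exact ne_top_of_le_ne_top hfin (L_mono fun x => Sq_mono d x hk))
    (by
      intro k hk
      norm_num only [Real.rpow_one]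
      have h := L_symm hθ hd k (fun a b c => |a| * ‖b + c‖) (by fun_prop)
        (fun a b c => by positivity)
        (hd.mx_pred.meas k) (hd.S_pred.meas k) (hd.mx_pred.inv k k le_rfl) (hd.S_pred.inv k k le_rfl)
      have h2 : 2 * L μ (fun x => mx d k x * ‖S d k x‖) ≤
          2 * L μ (fun x => |mx d k x| * ‖S d k x + d k x‖) := by
        rw [h, ← ENNReal.ofReal_ofNat, ← L_mul (by norm_num)]
        apply L_mono
        intro x
        rw [abs_of_nonneg (mx_nonneg d k x)]
        have : 2 * ‖S d k x‖ ≤ ‖S d k x + d k x‖ + ‖S d k x + -d k x‖ := by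
          have := norm_add_le (S d k x + d k x) (S d k x + -d k x)
          rw [show S d k x + d k x + (S d k x + -d k x) = 2 * S d k x by ring, norm_mul] at this
          simpa using this
        have := mul_le_mul_of_nonneg_left this (mx_nonneg d k x)
        linarith
      have h3 := (ENNReal.mul_le_mul_iff_right (by norm_num) (by norm_num)).1 h2
      simpa only [S_succ, abs_of_nonneg (mx_nonneg d _ _)] using h3)
  simp only [Real.rpow_ofNat] at this
  rw [L_S_sq hθ hd] at this
  refine this.trans (le_of_eq ?_)
  norm_num

lemma S_norm_sq (d : ℕ → Ω → ℂ) (n : ℕ) (x : Ω) : ‖S d n x‖ ^ 2 =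
    Sq d n x + 2 * (S (fun i x => (starRingEnd ℂ) (S d i x) * d i x) n x).re := by
  induction n with
  | zero => simp
  | succ n ih =>
    rw [S_succ, Sq_succ, S_succ, Complex.add_re]
    have : ‖S d n x + d n x‖ ^ 2 = ‖S d n x‖ ^ 2 + ‖d n x‖ ^ 2 +
        2 * ((starRingEnd ℂ) (S d n x) * d n x).re := by
      simp only [← Complex.normSq_eq_norm_sq, Complex.normSq_apply, Complex.add_re, Complex.add_im,
        Complex.mul_re, Complex.conj_re, Complex.conj_im]
      ring
    rw [this, ih]; ring

lemma norm_S_sq_le (d : ℕ → Ω → ℂ) (n : ℕ) (x : Ω) : ‖S d n x‖ ^ 2 ≤ n * Sq d n x := by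
  have h1 : ‖S d n x‖ ≤ ∑ i ∈ Finset.range n, ‖d i x‖ := norm_sum_le _ _
  have h2 := sq_sum_le_card_mul_sum_sq (s := Finset.range n) (f := fun i => ‖d i x‖)
  rw [Finset.card_range] at h2
  exact (pow_le_pow_left₀ (norm_nonneg _) h1 2).trans h2

lemma mx_sq_le (d : ℕ → Ω → ℂ) (n : ℕ) (x : Ω) : mx d n x ^ 2 ≤ n * Sq d n x := by
  have : mx d n x ≤ Real.sqrt (n * Sq d n x) := by
    refine mx_le (Real.sqrt_nonneg _) fun k hk => Real.le_sqrt_of_sq_le ?_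
    refine (norm_S_sq_le d k x).trans ?_
    have := Sq_mono d x hk
    have h0 := Sq_nonneg d k x
    have : (k:ℝ) ≤ n := by exact_mod_cast hk
    gcongr
  have := pow_le_pow_left₀ (mx_nonneg d n x) this 2
  rwa [Real.sq_sqrt (mul_nonneg (Nat.cast_nonneg _) (Sq_nonneg d n x))] at this

lemma Sq_mul_le (H : ℕ → Ω → ℂ) (d : ℕ → Ω → ℂ) (n : ℕ) (x : Ω) {B : ℝ}
    (h : ∀ i < n, ‖H i x‖ ≤ B) : Sq (fun i x => H i x * d i x) n x ≤ B ^ 2 * Sq d n x := by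
  unfold Sq
  rw [Finset.mul_sum]
  refine Finset.sum_le_sum fun i hi => ?_
  rw [norm_mul, mul_pow]
  have := h i (Finset.mem_range.1 hi)
  gcongr

lemma add_pow_le2 {a b : ℝ} (ha : 0 ≤ a) (hb : 0 ≤ b) (n : ℕ) :
    (a + b) ^ n ≤ 2 ^ n * (a ^ n + b ^ n) := by
  have h1 : a + b ≤ 2 * max a b := by linarith [le_max_left a b, le_max_right a b]
  calc (a + b) ^ n ≤ (2 * max a b) ^ n := by gcongr
    _ = 2 ^ n * (max a b) ^ n := mul_pow _ _ _
    _ ≤ _ := by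
      gcongr
      rcases le_total a b with h | h
      · rw [max_eq_right h]; linarith [pow_nonneg ha n]
      · rw [max_eq_left h]; linarith [pow_nonneg hb n]

theorem bdg (hθ : ∀ n, MeasurePreserving (θ n) μ μ) (k : ℕ) : ∃ C : ℝ, 0 ≤ C ∧
    ∀ d : ℕ → Ω → ℂ, IsDiff θ d → ∀ n,
    L μ (fun x => mx d n x ^ (2 * 2 ^ k)) ≤ ENNReal.ofReal C * L μ (fun x => Sq d n x ^ (2 ^ k)) := by
  induction k with
  | zero => exact ⟨4, by norm_num, fun d hd n => by simpa using doob_two hθ hd n⟩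
  | succ k ih =>
    obtain ⟨C, hC, ih⟩ := ih
    set j := 2 ^ k with hj
    have hj2 : 2 ^ (k + 1) = 2 * j := by rw [hj]; ring
    rw [hj2]
    set E : ℝ := 2 ^ (2 * j) with hE
    have hE0 : 0 ≤ E := by positivity
    -- mx^{4j} ≤ E Sq^{2j} + E^2 mR^{2j}
    refine ⟨1 / (1 - 1 / 2) * (E + E ^ 4 * (C + 1) ^ 2), by positivity, fun d hd n => ?_⟩
    by_cases hfin : L μ (fun x => Sq d n x ^ (2 * j)) = ∞
    · rw [hfin, ENNReal.mul_top]
      · exact le_top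
      · have : 0 < 1 / (1 - 1 / 2 : ℝ) * (E + E ^ 4 * (C + 1) ^ 2) := by positivity
        simpa using this
    set R : ℕ → Ω → ℂ := fun i x => (starRingEnd ℂ) (S d i x) * d i x with hR
    have hRd : IsDiff θ R := (hd.S_pred.comp (g := fun z => (starRingEnd ℂ) z)
      Complex.continuous_conj.measurable).mul_diff hd
    have hpt : ∀ x, mx d n x ^ (2 * (2 * j)) ≤ E * Sq d n x ^ (2 * j) + E ^ 2 * mx R n x ^ (2 * j) := by
      intro x
      have h0 := Sq_nonneg d n x
      have h0' := mx_nonneg R n x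
      have h1 : mx d n x ^ 2 ≤ Sq d n x + 2 * mx R n x := by
        have : mx d n x ≤ Real.sqrt (Sq d n x + 2 * mx R n x) := by
          refine mx_le (Real.sqrt_nonneg _) fun k hk => Real.le_sqrt_of_sq_le ?_
          rw [S_norm_sq]
          have := Sq_mono d x hk
          have h2 := (Complex.re_le_norm _).trans (S_le_mx R hk x)
          simp only at this
          linarith
        have := pow_le_pow_left₀ (mx_nonneg d n x) this 2
        rwa [Real.sq_sqrt (by positivity)] at this
      calc mx d n x ^ (2 * (2 * j)) = (mx d n x ^ 2) ^ (2 * j) := pow_mul _ _ _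
        _ ≤ (Sq d n x + 2 * mx R n x) ^ (2 * j) := by gcongr
        _ ≤ E * (Sq d n x ^ (2 * j) + (2 * mx R n x) ^ (2 * j)) := add_pow_le2 h0 (by positivity) _
        _ = _ := by rw [mul_pow]; ring
    have hS := hd.Sq_meas n
    have hM := hd.mx_pred.meas n
    have hMR := hRd.mx_pred.meas n
    have hL1 : L μ (fun x => mx d n x ^ (2 * (2 * j))) ≤
        ENNReal.ofReal E * L μ (fun x => Sq d n x ^ (2 * j)) +
        ENNReal.ofReal (E ^ 2) * L μ (fun x => mx R n x ^ (2 * j)) := by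
      rw [← L_mul hE0, ← L_mul (by positivity)]
      exact (L_mono hpt).trans (L_add_le (by fun_prop))
    have hL2 : ENNReal.ofReal (E ^ 2) * L μ (fun x => mx R n x ^ (2 * j)) ≤
        ENNReal.ofReal (1 / 2) * L μ (fun x => mx d n x ^ (2 * (2 * j))) +
        ENNReal.ofReal (E ^ 4 * (C + 1) ^ 2) * L μ (fun x => Sq d n x ^ (2 * j)) := by
      calc _ ≤ ENNReal.ofReal (E ^ 2) * (ENNReal.ofReal C * L μ (fun x => Sq R n x ^ j)) := by
            gcongr; exact ih R hRd n
        _ = L μ (fun x => (E ^ 2 * C) * Sq R n x ^ j) := by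
            rw [L_mul (by positivity), ENNReal.ofReal_mul (by positivity), mul_assoc]
        _ ≤ L μ (fun x => (1 / 2) * mx d n x ^ (2 * (2 * j)) +
            (E ^ 4 * (C + 1) ^ 2) * Sq d n x ^ (2 * j)) := by
            apply L_mono
            intro x
            have h0 := Sq_nonneg d n x
            have h1 : Sq R n x ≤ mx d n x ^ 2 * Sq d n x := Sq_mul_le _ _ _ _ fun i hi => by
              rw [RCLike.norm_conj]; exact S_le_mx d hi.le x
            have h2 : Sq R n x ^ j ≤ mx d n x ^ (2 * j) * Sq d n x ^ j := by
              calc _ ≤ (mx d n x ^ 2 * Sq d n x) ^ j := pow_le_pow_left₀ (Sq_nonneg _ _ _) h1 j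
                _ = _ := by rw [mul_pow, pow_mul]
            set a := mx d n x ^ (2 * j)
            set b := Sq d n x ^ j
            have ea : mx d n x ^ (2 * (2 * j)) = a ^ 2 := by rw [← pow_mul]; ring_nf
            have eb : Sq d n x ^ (2 * j) = b ^ 2 := by rw [← pow_mul]; ring_nf
            have hb : 0 ≤ b := by positivity
            have ha : 0 ≤ a := pow_nonneg (mx_nonneg _ _ _) _
            rw [ea, eb]
            have : (E ^ 2 * C) * Sq R n x ^ j ≤ (E ^ 2 * (C + 1)) * (a * b) := by
              apply mul_le_mul _ h2 (pow_nonneg (Sq_nonneg _ _ _) _) (by positivity)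
              nlinarith [sq_nonneg E]
            nlinarith [sq_nonneg (a - (E ^ 2 * (C + 1)) * b), mul_nonneg (sq_nonneg (E ^ 2 * (C+1))) (sq_nonneg b)]
        _ ≤ _ := by
            rw [← L_mul (by positivity), ← L_mul (by positivity)]
            exact L_add_le (by fun_prop)
    have hfin2 : L μ (fun x => mx d n x ^ (2 * (2 * j))) ≠ ∞ := by
      refine ne_top_of_le_ne_top (ENNReal.mul_ne_top (ENNReal.ofReal_ne_top
        (r := (n : ℝ) ^ (2 * j))) hfin) ?_
      rw [← L_mul (by positivity)]
      apply L_mono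
      intro x
      rw [pow_mul, ← mul_pow]
      exact pow_le_pow_left₀ (by positivity) (mx_sq_le d n x) _
    rw [ENNReal.ofReal_mul (by norm_num), mul_assoc]
    apply absorb (by norm_num) (by norm_num) hfin2
    calc _ ≤ _ := hL1
      _ ≤ ENNReal.ofReal E * L μ (fun x => Sq d n x ^ (2 * j)) +
          (ENNReal.ofReal (1 / 2) * L μ (fun x => mx d n x ^ (2 * (2 * j))) +
        ENNReal.ofReal (E ^ 4 * (C + 1) ^ 2) * L μ (fun x => Sq d n x ^ (2 * j))) := by gcongr
      _ = _ := by rw [ENNReal.ofReal_add hE0 (by positivity)]; ring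
end Flip
end VP

namespace VP

section Stop
variable {Ω : Type*} [MeasurableSpace Ω] {μ : Measure Ω}

def Zd (d e : ℕ → Ω → ℂ) : ℕ → Ω → ℂ := fun i x => S d i x * e i x
def U (d e : ℕ → Ω → ℂ) (n : ℕ) (x : Ω) : ℝ := mx d n x + mx e n x + Real.sqrt (mx (Zd d e) n x)
def Pi (d e : ℕ → Ω → ℂ) (s t : ℕ) (x : Ω) : ℂ :=
  S (Zd d e) t x - S (Zd d e) s x - S d s x * (S e t x - S e s x)

variable {θ : ℕ → Ω → Ω} {d e : ℕ → Ω → ℂ}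

lemma U_mono (d e : ℕ → Ω → ℂ) (x : Ω) : Monotone fun n => U d e n x := by
  intro a b h
  have h1 := mx_mono d x h
  have h2 := mx_mono e x h
  have h3 := Real.sqrt_le_sqrt (mx_mono (Zd d e) x h)
  simp only at h1 h2 h3
  simp only [U]; linarith

lemma U_nonneg (d e : ℕ → Ω → ℂ) (n x) : 0 ≤ U d e n x := by
  have h1 := mx_nonneg d n x
  have h2 := mx_nonneg e n x
  unfold U; positivity

lemma Pi_chen (d e : ℕ → Ω → ℂ) (s u t x) : Pi d e s t x =
    Pi d e s u x + Pi d e u t x + (S d u x - S d s x) * (S e t x - S e u x) := by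
  unfold Pi; ring

lemma Pi_self (d e : ℕ → Ω → ℂ) (s x) : Pi d e s s x = 0 := by unfold Pi; ring

lemma Pi_succ (d e : ℕ → Ω → ℂ) (s n x) : Pi d e s (n + 1) x =
    Pi d e s n x + (S d n x - S d s x) * e n x := by
  unfold Pi; rw [S_succ, S_succ]; unfold Zd; ring

lemma S_sub_le_U (d e : ℕ → Ω → ℂ) {s t : ℕ} (h : s ≤ t) (x) :
    ‖S d t x - S d s x‖ ≤ 2 * U d e t x := by
  have h1 := S_le_mx d h x
  have h2 := S_le_mx d le_rfl x (n := t)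
  have h3 := norm_sub_le (S d t x) (S d s x)
  have h4 := mx_nonneg e t x
  have := Real.sqrt_nonneg (mx (Zd d e) t x)
  unfold U; linarith

lemma Pi_le_U (d e : ℕ → Ω → ℂ) {s t : ℕ} (h : s ≤ t) (x) :
    ‖Pi d e s t x‖ ≤ 2 * U d e t x ^ 2 := by
  have h1 := S_le_mx d h x
  have h2 := S_le_mx (Zd d e) le_rfl x (n := t)
  have h2' := S_le_mx (Zd d e) h x
  have h3 := S_le_mx e le_rfl x (n := t)
  have h3' := S_le_mx e h x
  have hz := mx_nonneg (Zd d e) t x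
  have hd := mx_nonneg d t x
  have he := mx_nonneg e t x
  have hsq := Real.sq_sqrt hz
  have hs0 := Real.sqrt_nonneg (mx (Zd d e) t x)
  have e1 : ‖Pi d e s t x‖ ≤ ‖S (Zd d e) t x‖ + ‖S (Zd d e) s x‖ +
      ‖S d s x‖ * (‖S e t x‖ + ‖S e s x‖) := by
    unfold Pi
    refine (norm_sub_le _ _).trans ?_
    rw [norm_mul]
    gcongr
    · exact norm_sub_le _ _
    · exact norm_sub_le _ _
  have e2 : ‖S d s x‖ * (‖S e t x‖ + ‖S e s x‖) ≤ mx d t x * (2 * mx e t x) := by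
    apply mul_le_mul h1 (by linarith) (by positivity) hd
  unfold U
  nlinarith [mul_nonneg hd he, mul_nonneg hd hs0, mul_nonneg he hs0, sq_nonneg (mx d t x), sq_nonneg (mx e t x)]

def bad (d e : ℕ → Ω → ℂ) (δ : ℝ) (s n : ℕ) (x : Ω) : Prop :=
  2 * U d e s x < U d e n x ∨ δ * U d e s x < ‖S d n x - S d s x‖ ∨
  δ * U d e s x < ‖S e n x - S e s x‖ ∨ δ ^ 2 * U d e s x ^ 2 < ‖Pi d e s n x‖

open scoped Classical in
def tau (d e : ℕ → Ω → ℂ) (δ : ℝ) : ℕ → Ω → ℕ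
  | 0, _ => 0
  | n + 1, x => if bad d e δ (tau d e δ n x) (n + 1) x then n + 1 else tau d e δ n x

lemma tau_le (d e : ℕ → Ω → ℂ) (δ : ℝ) (n x) : tau d e δ n x ≤ n := by
  induction n with
  | zero => simp [tau]
  | succ n ih =>
    simp only [tau]
    split_ifs <;> omega

lemma tau_good (d e : ℕ → Ω → ℂ) {δ : ℝ} (hδ : 0 ≤ δ) (n x) : ¬ bad d e δ (tau d e δ n x) n x := by
  have hself : ∀ n, ¬ bad d e δ n n x := by
    intro n
    have := U_nonneg d e n x
    simp only [bad, Pi_self, sub_self, norm_zero, not_or, not_lt]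
    refine ⟨by linarith, by positivity, by positivity, by positivity⟩
  cases n with
  | zero => exact hself 0
  | succ n =>
    simp only [tau]
    split_ifs with h
    · exact hself _
    · exact h

lemma tau_tau (d e : ℕ → Ω → ℂ) (δ : ℝ) (n x) :
    tau d e δ (tau d e δ n x) x = tau d e δ n x := by
  induction n with
  | zero => simp [tau]
  | succ n ih =>
    by_cases h : bad d e δ (tau d e δ n x) (n + 1) x
    · have : tau d e δ (n + 1) x = n + 1 := by simp only [tau]; rw [if_pos h]
      rw [this, this]
    · have : tau d e δ (n + 1) x = tau d e δ n x := by simp only [tau]; rw [if_neg h]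
      rw [this, ih]

lemma tau_gt (d e : ℕ → Ω → ℂ) (δ : ℝ) {s t : ℕ} (h : s ≤ t) (x) :
    tau d e δ t x = tau d e δ s x ∨ s < tau d e δ t x := by
  induction t, h using Nat.le_induction with
  | base => exact Or.inl rfl
  | succ t ht ih =>
    simp only [tau]
    split_ifs with hb
    · right; omega
    · exact ih

lemma window_bound (d e : ℕ → Ω → ℂ) {δ : ℝ} (hδ : 0 ≤ δ) {s t : ℕ} (h : s ≤ t) (x)
    (hst : tau d e δ t x = tau d e δ s x) :
    ‖S d t x - S d s x‖ ≤ 2 * δ * U d e t x ∧ ‖Pi d e s t x‖ ≤ 4 * δ ^ 2 * U d e t x ^ 2 := by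
  have h1 := tau_good d e hδ s x
  have h2 := tau_good d e hδ t x
  have h3 : U d e (tau d e δ t x) x ≤ U d e t x := U_mono d e x (tau_le d e δ t x)
  rw [hst] at h2 h3
  set τ := tau d e δ s x
  simp only [bad, not_or, not_lt] at h1 h2
  have h0 := U_nonneg d e τ x
  have h0' := U_nonneg d e t x
  set Uτ := U d e τ x
  set Ut := U d e t x
  have hδU : δ * Uτ ≤ δ * Ut := by gcongr
  have hδU2 : δ ^ 2 * Uτ ^ 2 ≤ δ ^ 2 * Ut ^ 2 := by gcongr
  constructor
  · have := norm_sub_le (S d t x - S d τ x) (S d s x - S d τ x)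
    rw [show S d t x - S d τ x - (S d s x - S d τ x) = S d t x - S d s x by ring] at this
    linarith [h1.2.1, h2.2.1]
  · have e1 : Pi d e s t x = Pi d e τ t x - Pi d e τ s x -
        (S d s x - S d τ x) * ((S e t x - S e τ x) - (S e s x - S e τ x)) := by
      rw [Pi_chen d e τ s t x]; ring
    have e2 : ‖Pi d e s t x‖ ≤ ‖Pi d e τ t x‖ + ‖Pi d e τ s x‖ +
        ‖S d s x - S d τ x‖ * (‖S e t x - S e τ x‖ + ‖S e s x - S e τ x‖) := by
      rw [e1]
      refine (norm_sub_le _ _).trans ?_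
      rw [norm_mul]
      gcongr
      · exact norm_sub_le _ _
      · exact norm_sub_le _ _
    have e3 : ‖S d s x - S d τ x‖ * (‖S e t x - S e τ x‖ + ‖S e s x - S e τ x‖) ≤
        (δ * Uτ) * (δ * Uτ + δ * Uτ) := by
      apply mul_le_mul h1.2.1 (by linarith [h1.2.2.1, h2.2.2.1]) (by positivity) (by positivity)
    have := h1.2.2.2
    have := h2.2.2.2
    nlinarith

def term (d e : ℕ → Ω → ℂ) (r : ℝ) (j n : ℕ) (x : Ω) : ℝ :=
  if tau d e (1 / 2 ^ j) n x = n then (64 * ((1 / 2 ^ j) ^ 2 * U d e n x ^ 2)) ^ r else 0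

lemma term_nonneg (d e : ℕ → Ω → ℂ) (r : ℝ) (j n x) : 0 ≤ term d e r j n x := by
  unfold term; split_ifs
  · positivity
  · rfl

lemma exists_level {y B c : ℝ} (hy : 0 < y) (hc : 1 < c) (hyB : y ≤ B) :
    ∃ j : ℕ, (1 / c ^ j) * B < y ∧ y ≤ c * ((1 / c ^ j) * B) := by
  classical
  have hex : ∃ j : ℕ, (1 / c ^ j) * B < y := by
    obtain ⟨j, hj⟩ := pow_unbounded_of_one_lt (B / y) hc
    refine ⟨j, ?_⟩
    rw [div_lt_iff₀ hy] at hj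
    rw [one_div, inv_mul_eq_div, div_lt_iff₀ (by positivity)]
    linarith
  refine ⟨Nat.find hex, Nat.find_spec hex, ?_⟩
  rcases hj : Nat.find hex with _ | j
  · have := Nat.find_spec hex
    rw [hj] at this
    simp at this
    linarith
  · have := Nat.find_min hex (m := j) (by omega)
    rw [not_lt] at this
    refine this.trans (le_of_eq ?_)
    rw [pow_succ]; field_simp

lemma halt_found (d e : ℕ → Ω → ℂ) {r : ℝ} (hr : 0 < r) {s t : ℕ} (h : s ≤ t) (x) (j : ℕ) {y : ℝ}
    (hy0 : 0 ≤ y) (hy : y ≤ 16 * ((1 / 2 ^ j) ^ 2 * U d e t x ^ 2))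
    (hne : tau d e (1 / 2 ^ j) t x ≠ tau d e (1 / 2 ^ j) s x) :
    ∃ n ∈ Finset.Ioc s t, y ^ r ≤ term d e r j n x := by
  set δ : ℝ := 1 / 2 ^ j with hδ
  have hδ0 : 0 ≤ δ := by positivity
  refine ⟨tau d e δ t x, Finset.mem_Ioc.2 ⟨?_, tau_le _ _ _ _ _⟩, ?_⟩
  · exact (tau_gt d e δ h x).resolve_left hne
  · unfold term
    rw [← hδ, if_pos (tau_tau d e δ t x)]
    have h2 := tau_good d e hδ0 t x
    simp only [bad, not_or, not_lt] at h2
    apply Real.rpow_le_rpow hy0 _ hr.le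
    refine hy.trans ?_
    have h3 : U d e t x ^ 2 ≤ (2 * U d e (tau d e δ t x) x) ^ 2 :=
      pow_le_pow_left₀ (U_nonneg _ _ _ _) h2.1 2
    nlinarith [sq_nonneg δ, mul_le_mul_of_nonneg_left h3 (sq_nonneg δ)]

lemma Pi_term (d e : ℕ → Ω → ℂ) {r : ℝ} (hr : 0 < r) {s t : ℕ} (h : s ≤ t) (x) :
    ENNReal.ofReal (‖Pi d e s t x‖ ^ r) ≤
      ∑ n ∈ Finset.Ioc s t, ∑' j, ENNReal.ofReal (term d e r j n x) := by
  rcases (norm_nonneg (Pi d e s t x)).eq_or_lt with h0 | h0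
  · rw [← h0, Real.zero_rpow hr.ne']; simp
  have hU := Pi_le_U d e h x
  obtain ⟨j, hj1, hj2⟩ := exists_level (c := 4) (B := 4 * U d e t x ^ 2) h0 (by norm_num)
    (by nlinarith [sq_nonneg (U d e t x)])
  have e4 : (1 / (4:ℝ) ^ j) = (1 / 2 ^ j) ^ 2 := by
    rw [div_pow, one_pow, ← pow_mul, mul_comm, pow_mul]; norm_num
  rw [e4] at hj1 hj2
  obtain ⟨n, hn, hle⟩ := halt_found d e hr h x j h0.le (by linarith) (by
    intro hst
    have := (window_bound d e (by positivity) h x hst).2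
    linarith)
  refine (ENNReal.ofReal_le_ofReal hle).trans ?_
  refine le_trans ?_ (Finset.single_le_sum (f := fun n => ∑' j, ENNReal.ofReal (term d e r j n x))
    (fun _ _ => zero_le) hn)
  exact ENNReal.le_tsum j

lemma S_term (d e : ℕ → Ω → ℂ) {r : ℝ} (hr : 0 < r) {s t : ℕ} (h : s ≤ t) (x) :
    ENNReal.ofReal (‖S d t x - S d s x‖ ^ (2 * r)) ≤
      ∑ n ∈ Finset.Ioc s t, ∑' j, ENNReal.ofReal (term d e r j n x) := by
  rcases (norm_nonneg (S d t x - S d s x)).eq_or_lt with h0 | h0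
  · rw [← h0, Real.zero_rpow (by positivity)]; simp
  have hU := S_sub_le_U d e h x
  obtain ⟨j, hj1, hj2⟩ := exists_level (c := 2) (B := 2 * U d e t x) h0 (by norm_num) hU
  obtain ⟨n, hn, hle⟩ := halt_found d e hr h x j (y := ‖S d t x - S d s x‖ ^ 2) (by positivity)
    (by
      have := pow_le_pow_left₀ h0.le hj2 2
      nlinarith) (by
    intro hst
    have := (window_bound d e (by positivity) h x hst).1
    linarith)
  rw [Real.rpow_mul h0.le, Real.rpow_ofNat]
  refine (ENNReal.ofReal_le_ofReal hle).trans ?_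
  refine le_trans ?_ (Finset.single_le_sum (f := fun n => ∑' j, ENNReal.ofReal (term d e r j n x))
    (fun _ _ => zero_le) hn)
  exact ENNReal.le_tsum j

/-! counting -/
def Q (d e : ℕ → Ω → ℂ) (δ : ℝ) (K : ℕ) (x : Ω) : ℝ :=
  ∑ n ∈ Finset.range K, if tau d e δ (n + 1) x = n + 1 then δ ^ 2 * U d e (n + 1) x ^ 2 else 0

def Hf (d e : ℕ → Ω → ℂ) (δ : ℝ) (i : ℕ) (x : Ω) : ℂ :=
  2 * (starRingEnd ℂ) (S d i x - S d (tau d e δ i x) x)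
def Hg (d e : ℕ → Ω → ℂ) (δ : ℝ) (i : ℕ) (x : Ω) : ℂ :=
  2 * (starRingEnd ℂ) (S e i x - S e (tau d e δ i x) x)
def nu (d e : ℕ → Ω → ℂ) (δ : ℝ) (i : ℕ) (x : Ω) : ℝ := (δ ^ 2 * U d e (tau d e δ i x) x ^ 2)⁻¹
def HY (d e : ℕ → Ω → ℂ) (δ : ℝ) (i : ℕ) (x : Ω) : ℂ :=
  2 * (nu d e δ i x * (starRingEnd ℂ) (Pi d e (tau d e δ i x) i x)) *
    (S d i x - S d (tau d e δ i x) x)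

lemma norm_add_sq_c (X y : ℂ) : ‖X + y‖ ^ 2 = ‖X‖ ^ 2 + ‖y‖ ^ 2 +
    (2 * (starRingEnd ℂ) X * y).re := by
  simp only [← Complex.normSq_eq_norm_sq, Complex.normSq_apply, Complex.add_re, Complex.add_im,
    Complex.mul_re, Complex.mul_im, Complex.conj_re, Complex.conj_im, Complex.re_ofNat, Complex.im_ofNat]
  ring

lemma pot_arith1 {Q u B sd se rf rg ry a b c a1 b1 c1 nd ne hf hg hy : ℝ}
    (key : u ≤ 4 / 3 * (u - B) + 4 * (a1 + b1 + c1))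
    (ih : Q ≤ 4 / 3 * B + 4 * ((sd + rf - a) + (se + rg - b) + (se + ry - c)))
    (hY : c1 ≤ c + ne + hy) (hf' : a1 = a + nd + hf) (hg' : b1 = b + ne + hg) :
    Q + u ≤ 4 / 3 * u + 4 * ((sd + nd + (rf + hf) - 0) + (se + ne + (rg + hg) - 0) +
      (se + ne + (ry + hy) - 0)) := by linarith

lemma pot_arith2 {Q B sd se rf rg ry a b c c1 nd ne hf hg hy : ℝ}
    (ih : Q ≤ B + 4 * ((sd + rf - a) + (se + rg - b) + (se + ry - c)))
    (hY : c1 ≤ c + ne + hy) :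
    Q + 0 ≤ B + 4 * ((sd + nd + (rf + hf) - (a + nd + hf)) + (se + ne + (rg + hg) - (b + ne + hg)) +
      (se + ne + (ry + hy) - c1)) := by linarith

lemma Q_pot (d e : ℕ → Ω → ℂ) {δ : ℝ} (hδ : 0 < δ) (n : ℕ) (x : Ω) :
    Q d e δ n x ≤ 4 / 3 * δ ^ 2 * U d e (tau d e δ n x) x ^ 2 +
     4 * ((Sq d n x + (S (fun i x => Hf d e δ i x * d i x) n x).re -
        ‖S d n x - S d (tau d e δ n x) x‖ ^ 2) +
      (Sq e n x + (S (fun i x => Hg d e δ i x * e i x) n x).re -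
        ‖S e n x - S e (tau d e δ n x) x‖ ^ 2) +
      (Sq e n x + (S (fun i x => HY d e δ i x * e i x) n x).re -
        nu d e δ n x * ‖Pi d e (tau d e δ n x) n x‖ ^ 2)) := by
  induction n with
  | zero =>
    simp only [Q, tau, S_zero, Sq_zero, Pi_self]
    simp
    positivity
  | succ n ih =>
    have hgood := tau_good d e hδ.le n x
    set τ := tau d e δ n x with hτ
    have hU0 := U_nonneg d e τ x
    have hU1 := U_nonneg d e (n + 1) x
    have hUm : U d e τ x ≤ U d e (n + 1) x := U_mono d e x ((tau_le d e δ n x).trans (Nat.le_succ n))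
    simp only [bad, not_or, not_lt] at hgood
    set B := δ ^ 2 * U d e τ x ^ 2 with hB
    have hB0 : 0 ≤ B := by positivity
    have hnu : nu d e δ n x = B⁻¹ := rfl
    have hf : ‖S d (n + 1) x - S d τ x‖ ^ 2 = ‖S d n x - S d τ x‖ ^ 2 + ‖d n x‖ ^ 2 +
        (Hf d e δ n x * d n x).re := by
      rw [S_succ, show S d n x + d n x - S d τ x = (S d n x - S d τ x) + d n x by ring,
        norm_add_sq_c]; rfl
    have hg : ‖S e (n + 1) x - S e τ x‖ ^ 2 = ‖S e n x - S e τ x‖ ^ 2 + ‖e n x‖ ^ 2 +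
        (Hg d e δ n x * e n x).re := by
      rw [S_succ, show S e n x + e n x - S e τ x = (S e n x - S e τ x) + e n x by ring,
        norm_add_sq_c]; rfl
    have hY : B⁻¹ * ‖Pi d e τ (n + 1) x‖ ^ 2 ≤ B⁻¹ * ‖Pi d e τ n x‖ ^ 2 + ‖e n x‖ ^ 2 +
        (HY d e δ n x * e n x).re := by
      rw [Pi_succ, norm_add_sq_c]
      have e1 : (HY d e δ n x * e n x).re = B⁻¹ * (2 * (starRingEnd ℂ) (Pi d e τ n x) *
          ((S d n x - S d τ x) * e n x)).re := by
        rw [← Complex.re_ofReal_mul]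
        congr 1
        unfold HY
        rw [hnu, ← hτ]
        ring
      have e2 : B⁻¹ * ‖(S d n x - S d τ x) * e n x‖ ^ 2 ≤ ‖e n x‖ ^ 2 := by
        rw [norm_mul, mul_pow]
        have h1 : ‖S d n x - S d τ x‖ ^ 2 ≤ B := by
          rw [hB, ← mul_pow]; exact pow_le_pow_left₀ (norm_nonneg _) hgood.2.1 2
        have : B⁻¹ * ‖S d n x - S d τ x‖ ^ 2 ≤ 1 := by
          calc _ ≤ B⁻¹ * B := by gcongr
            _ ≤ 1 := inv_mul_le_one
        calc _ = (B⁻¹ * ‖S d n x - S d τ x‖ ^ 2) * ‖e n x‖ ^ 2 := by ring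
          _ ≤ 1 * ‖e n x‖ ^ 2 := by gcongr
          _ = _ := one_mul _
      rw [e1]; linarith
    have hQ : Q d e δ (n + 1) x = Q d e δ n x +
        if tau d e δ (n + 1) x = n + 1 then δ ^ 2 * U d e (n + 1) x ^ 2 else 0 :=
      Finset.sum_range_succ _ _
    rw [hQ]
    have E1 := S_succ (fun i x => Hf d e δ i x * d i x) n x
    have E2 := S_succ (fun i x => Hg d e δ i x * e i x) n x
    have E3 := S_succ (fun i x => HY d e δ i x * e i x) n x
    by_cases hb : bad d e δ τ (n + 1) x
    · have ht : tau d e δ (n + 1) x = n + 1 := by simp only [tau]; rw [if_pos hb]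
      rw [if_pos ht, ht, Sq_succ, Sq_succ, sub_self, sub_self, Pi_self, E1, E2, E3, Complex.add_re,
        Complex.add_re, Complex.add_re, norm_zero, zero_pow two_ne_zero, mul_zero]
      rw [hnu] at ih
      have key : δ ^ 2 * U d e (n + 1) x ^ 2 ≤ 4 / 3 * (δ ^ 2 * U d e (n + 1) x ^ 2 - B) +
          4 * (‖S d (n + 1) x - S d τ x‖ ^ 2 + ‖S e (n + 1) x - S e τ x‖ ^ 2 +
            B⁻¹ * ‖Pi d e τ (n + 1) x‖ ^ 2) := by
        have hBm : B ≤ δ ^ 2 * U d e (n + 1) x ^ 2 := by rw [hB]; gcongr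
        have p1 := sq_nonneg ‖S d (n + 1) x - S d τ x‖
        have p2 := sq_nonneg ‖S e (n + 1) x - S e τ x‖
        have p3 : 0 ≤ B⁻¹ * ‖Pi d e τ (n + 1) x‖ ^ 2 := by positivity
        by_cases ha : 2 * U d e τ x < U d e (n + 1) x
        · have : 4 * B ≤ δ ^ 2 * U d e (n + 1) x ^ 2 := by
            have := mul_le_mul_of_nonneg_left
              (pow_le_pow_left₀ (by positivity) ha.le 2) (sq_nonneg δ)
            calc 4 * B = δ ^ 2 * (2 * U d e τ x) ^ 2 := by rw [hB]; ring
              _ ≤ _ := this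
          linarith
        · have h4 : δ ^ 2 * U d e (n + 1) x ^ 2 ≤ 4 * B := by
            have := mul_le_mul_of_nonneg_left
              (pow_le_pow_left₀ hU1 (not_lt.1 ha) 2) (sq_nonneg δ)
            calc _ ≤ δ ^ 2 * (2 * U d e τ x) ^ 2 := this
              _ = 4 * B := by rw [hB]; ring
          rcases hb with hb | hb | hb | hb
          · exact absurd hb ha
          · have := pow_le_pow_left₀ (by positivity) hb.le 2
            rw [mul_pow, ← hB] at this
            linarith
          · have := pow_le_pow_left₀ (by positivity) hb.le 2
            rw [mul_pow, ← hB] at this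
            linarith
          · rw [← hB] at hb
            rcases hB0.eq_or_lt with h0 | h0
            · rw [← h0] at h4 hBm ⊢; linarith
            · have : B ≤ B⁻¹ * ‖Pi d e τ (n + 1) x‖ ^ 2 := by
                rw [inv_mul_eq_div, le_div_iff₀ h0, sq]
                exact mul_le_mul hb.le hb.le hB0 (norm_nonneg _)
              linarith
      rw [mul_assoc, ← hB] at ih
      rw [mul_assoc (4 / 3 : ℝ)]
      exact pot_arith1 key ih hY hf hg
    · have ht : tau d e δ (n + 1) x = τ := by simp only [tau]; rw [if_neg hb]
      have ht' : ¬ (tau d e δ (n + 1) x = n + 1) := by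
        rw [ht]; have := tau_le d e δ n x; omega
      have hnu' : nu d e δ (n + 1) x = B⁻¹ := by unfold nu; rw [ht]
      rw [if_neg ht', ht, hnu', hf, hg, Sq_succ, Sq_succ, E1, E2, E3, Complex.add_re,
        Complex.add_re, Complex.add_re]
      rw [hnu] at ih
      exact pot_arith2 ih hY

lemma Q_bound (d e : ℕ → Ω → ℂ) {δ : ℝ} (hδ : 0 < δ) (hδ1 : δ ≤ 1) (n : ℕ) (x : Ω) :
    Q d e δ n x ≤ 4 * (U d e n x ^ 2 + Sq d n x + 2 * Sq e n x +
      mx (fun i x => Hf d e δ i x * d i x) n x + mx (fun i x => Hg d e δ i x * e i x) n x +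
      mx (fun i x => HY d e δ i x * e i x) n x) := by
  refine (Q_pot d e hδ n x).trans ?_
  have h1 := (Complex.re_le_norm _).trans (S_le_mx (fun i x => Hf d e δ i x * d i x) (le_refl n) x)
  have h2 := (Complex.re_le_norm _).trans (S_le_mx (fun i x => Hg d e δ i x * e i x) (le_refl n) x)
  have h3 := (Complex.re_le_norm _).trans (S_le_mx (fun i x => HY d e δ i x * e i x) (le_refl n) x)
  have hU : U d e (tau d e δ n x) x ≤ U d e n x := U_mono d e x (tau_le d e δ n x)
  have hU' : δ ^ 2 * U d e (tau d e δ n x) x ^ 2 ≤ 1 * U d e n x ^ 2 := by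
    have := U_nonneg d e (tau d e δ n x) x
    gcongr
    exact pow_le_one₀ hδ.le hδ1
  have p3 : 0 ≤ nu d e δ n x * ‖Pi d e (tau d e δ n x) n x‖ ^ 2 := by unfold nu; positivity
  have p1 := sq_nonneg ‖S d n x - S d (tau d e δ n x) x‖
  have p2 := sq_nonneg ‖S e n x - S e (tau d e δ n x) x‖
  have p0 := sq_nonneg (U d e n x)
  linarith

lemma H_bounds (d e : ℕ → Ω → ℂ) {δ : ℝ} (hδ : 0 < δ) (hδ1 : δ ≤ 1) {i n : ℕ} (hi : i < n) (x : Ω) :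
    ‖Hf d e δ i x‖ ≤ 2 * U d e n x ∧ ‖Hg d e δ i x‖ ≤ 2 * U d e n x ∧
    ‖HY d e δ i x‖ ≤ 2 * U d e n x := by
  have h := tau_good d e hδ.le i x
  have hU : U d e (tau d e δ i x) x ≤ U d e n x := U_mono d e x ((tau_le d e δ i x).trans hi.le)
  simp only [bad, not_or, not_lt] at h
  have h0 := U_nonneg d e (tau d e δ i x) x
  have hδU : δ * U d e (tau d e δ i x) x ≤ 1 * U d e n x := by gcongr
  have hn := norm_nonneg (S d i x - S d (tau d e δ i x) x)
  have hn' := norm_nonneg (Pi d e (tau d e δ i x) i x)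
  refine ⟨?_, ?_, ?_⟩
  · unfold Hf; rw [norm_mul, RCLike.norm_conj, RCLike.norm_ofNat]; linarith
  · unfold Hg; rw [norm_mul, RCLike.norm_conj, RCLike.norm_ofNat]; linarith
  · unfold HY nu
    rw [norm_mul, norm_mul, norm_mul, RCLike.norm_conj, RCLike.norm_ofNat, Complex.norm_real,
      Real.norm_of_nonneg (by positivity)]
    set B := δ ^ 2 * U d e (tau d e δ i x) x ^ 2 with hB
    have hB0 : 0 ≤ B := by positivity
    have e1 : B⁻¹ * ‖Pi d e (tau d e δ i x) i x‖ ≤ 1 := by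
      calc _ ≤ B⁻¹ * B := by gcongr; exact h.2.2.2
        _ ≤ 1 := inv_mul_le_one
    calc _ ≤ 2 * 1 * (1 * U d e n x) := by
          gcongr
          linarith [h.2.1]
      _ = _ := by ring

/-! predictability -/
lemma IsDiff.Zd (hd : IsDiff θ d) (he : IsDiff θ e) : IsDiff θ (Zd d e) := hd.S_pred.mul_diff he

lemma U_pred (hd : IsDiff θ d) (he : IsDiff θ e) : IsPred θ (U d e) where
  meas n := by
    have := hd.mx_pred.meas n
    have := he.mx_pred.meas n
    have := (hd.Zd he).mx_pred.meas n
    unfold U; fun_prop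
  inv n j h x := by
    unfold U; rw [hd.mx_pred.inv n j h, he.mx_pred.inv n j h, (hd.Zd he).mx_pred.inv n j h]

lemma meas_at {E : Type*} [MeasurableSpace E] {F : ℕ → Ω → E} (hF : ∀ n, Measurable (F n))
    {τ : Ω → ℕ} (hτ : Measurable τ) : Measurable (fun x => F (τ x) x) := by
  have : Measurable (fun p : ℕ × Ω => F p.1 p.2) := measurable_from_prod_countable_right hF
  exact this.comp (hτ.prodMk measurable_id)

lemma tau_pred (hd : IsDiff θ d) (he : IsDiff θ e) (δ : ℝ) : IsPred θ (tau d e δ) where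
  meas n := by
    induction n with
    | zero => exact measurable_const
    | succ n ih =>
      have hU := meas_at (U_pred hd he).meas ih
      have hS := meas_at hd.S_pred.meas ih
      have hS' := meas_at he.S_pred.meas ih
      have hZ := meas_at (hd.Zd he).S_pred.meas ih
      have h1 := (U_pred hd he).meas (n + 1)
      have h2 := hd.S_pred.meas (n + 1)
      have h3 := he.S_pred.meas (n + 1)
      have h4 := (hd.Zd he).S_pred.meas (n + 1)
      refine Measurable.ite ?_ measurable_const ih
      have m1 : MeasurableSet {x | 2 * U d e (tau d e δ n x) x < U d e (n + 1) x} :=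
        measurableSet_lt (by fun_prop) (by fun_prop)
      have m2 : MeasurableSet {x | δ * U d e (tau d e δ n x) x <
          ‖S d (n + 1) x - S d (tau d e δ n x) x‖} :=
        measurableSet_lt (by fun_prop) (by fun_prop)
      have m3 : MeasurableSet {x | δ * U d e (tau d e δ n x) x <
          ‖S e (n + 1) x - S e (tau d e δ n x) x‖} :=
        measurableSet_lt (by fun_prop) (by fun_prop)
      have m4 : MeasurableSet {x | δ ^ 2 * U d e (tau d e δ n x) x ^ 2 <
          ‖Pi d e (tau d e δ n x) (n + 1) x‖} := by
        unfold Pi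
        exact measurableSet_lt (by fun_prop) (by fun_prop)
      exact m1.union (m2.union (m3.union m4))
  inv n := by
    induction n with
    | zero => intros; rfl
    | succ n ih =>
      intro j hj x
      have e0 := ih j (by omega) x
      have hle := tau_le d e δ n x
      have : bad d e δ (tau d e δ n x) (n + 1) (θ j x) ↔ bad d e δ (tau d e δ n x) (n + 1) x := by
        unfold bad Pi
        have hj' : tau d e δ n x ≤ j := by omega
        rw [(U_pred hd he).inv _ j hj', (U_pred hd he).inv _ j hj,
          hd.S_pred.inv _ j hj', hd.S_pred.inv _ j hj, he.S_pred.inv _ j hj',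
          he.S_pred.inv _ j hj, (hd.Zd he).S_pred.inv _ j hj', (hd.Zd he).S_pred.inv _ j hj]
      by_cases hb : bad d e δ (tau d e δ n x) (n + 1) x
      · have hb' : bad d e δ (tau d e δ n (θ j x)) (n + 1) (θ j x) := by rw [e0]; exact this.2 hb
        simp only [tau]; rw [if_pos hb, if_pos hb']
      · have hb' : ¬ bad d e δ (tau d e δ n (θ j x)) (n + 1) (θ j x) := by
          rw [e0]; exact fun h => hb (this.1 h)
        simp only [tau]; rw [if_neg hb, if_neg hb', e0]

lemma IsPred.at_tau {E : Type*} [MeasurableSpace E] (hd : IsDiff θ d) (he : IsDiff θ e) (δ : ℝ)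
    {F : ℕ → Ω → E} (hF : IsPred θ F) : IsPred θ (fun n x => F (tau d e δ n x) x) where
  meas n := meas_at hF.meas ((tau_pred hd he δ).meas n)
  inv n j hj x := by
    rw [(tau_pred hd he δ).inv n j hj, hF.inv _ _ ((tau_le d e δ n x).trans hj)]

lemma H_pred (hd : IsDiff θ d) (he : IsDiff θ e) (δ : ℝ) :
    IsPred θ (Hf d e δ) ∧ IsPred θ (Hg d e δ) ∧ IsPred θ (HY d e δ) := by
  have a1 := IsPred.at_tau hd he δ hd.S_pred
  have a2 := IsPred.at_tau hd he δ he.S_pred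
  have a3 := IsPred.at_tau hd he δ (hd.Zd he).S_pred
  have a4 := IsPred.at_tau hd he δ (U_pred hd he)
  refine ⟨⟨fun n => ?_, fun n j h x => ?_⟩, ⟨fun n => ?_, fun n j h x => ?_⟩,
    ⟨fun n => ?_, fun n j h x => ?_⟩⟩
  · have := a1.meas n
    have := hd.S_pred.meas n
    unfold Hf; fun_prop
  · have := a1.inv n j h x
    unfold Hf; rw [this, hd.S_pred.inv n j h]
  · have := a2.meas n
    have := he.S_pred.meas n
    unfold Hg; fun_prop
  · have := a2.inv n j h x
    unfold Hg; rw [this, he.S_pred.inv n j h]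
  · have := a1.meas n
    have := a2.meas n
    have := a3.meas n
    have := a4.meas n
    have := hd.S_pred.meas n
    have := he.S_pred.meas n
    have := (hd.Zd he).S_pred.meas n
    unfold HY nu Pi; fun_prop
  · have h1 := a1.inv n j h x
    have h2 := a2.inv n j h x
    have h3 := a3.inv n j h x
    have h4 := a4.inv n j h x
    unfold HY nu Pi
    rw [h1, h2, h3, h4, hd.S_pred.inv n j h, he.S_pred.inv n j h, (hd.Zd he).S_pred.inv n j h]
end Stop
end VP

namespace VP

lemma tsum_mul_rpow_le {ι : Type*} (a y : ι → ℝ≥0∞) {ρ : ℝ} (hρ : 0 < ρ) :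
    (∑' l, a l * y l) ^ ρ ≤ (∑' l, a l) ^ ρ * ∑' l, y l ^ ρ := by
  have h : ∀ l, y l ≤ (∑' l, y l ^ ρ) ^ (1 / ρ) := by
    intro l
    rw [one_div, ENNReal.le_rpow_inv_iff hρ]
    exact ENNReal.le_tsum (f := fun l => y l ^ ρ) l
  calc _ ≤ (∑' l, a l * (∑' l, y l ^ ρ) ^ (1 / ρ)) ^ ρ := by
        gcongr with l; exact h l
    _ = _ := by
      rw [ENNReal.tsum_mul_right, ENNReal.mul_rpow_of_nonneg _ _ hρ.le, ← ENNReal.rpow_mul,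
        one_div, inv_mul_cancel₀ hρ.ne', ENNReal.rpow_one]

lemma add_rpow_le2 (a b : ℝ≥0∞) {ρ : ℝ} (hρ : 0 ≤ ρ) :
    (a + b) ^ ρ ≤ 2 ^ ρ * (a ^ ρ + b ^ ρ) := by
  have h1 : a + b ≤ 2 * max a b := by
    rw [two_mul]; exact add_le_add (le_max_left _ _) (le_max_right _ _)
  calc (a + b) ^ ρ ≤ (2 * max a b) ^ ρ := by gcongr
    _ = 2 ^ ρ * (max a b) ^ ρ := ENNReal.mul_rpow_of_nonneg _ _ hρ
    _ ≤ _ := by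
      gcongr
      rcases le_total a b with h | h
      · rw [max_eq_right h]; exact le_add_self
      · rw [max_eq_left h]; exact le_self_add

section PropA
variable {Ω : Type*} [MeasurableSpace Ω] {μ : Measure Ω}
variable {θ : ℕ → Ω → Ω} {d e : ℕ → Ω → ℂ}

def Vhat (d e : ℕ → Ω → ℂ) (r : ℝ) (K : ℕ) (x : Ω) : ℝ≥0∞ :=
  ∑ n ∈ Finset.Ioc 0 K, ∑' j, ENNReal.ofReal (term d e r j n x)

lemma Q_nonneg (d e : ℕ → Ω → ℂ) (δ K x) : 0 ≤ Q d e δ K x :=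
  Finset.sum_nonneg fun i _ => by split_ifs <;> positivity

lemma sum_term_le (d e : ℕ → Ω → ℂ) {r : ℝ} (hr : 1 < r) (j K : ℕ) (x : Ω) :
    ∑ n ∈ Finset.Ioc 0 K, term d e r j n x ≤
      64 ^ r * (((1 / 2 ^ j) ^ (r - 1) * (1 / 2 ^ j) ^ (r - 1)) *
        ((U d e K x ^ 2) ^ r + (Q d e (1 / 2 ^ j) K x) ^ r)) := by
  set δ : ℝ := 1 / 2 ^ j with hδ
  have hδ0 : 0 < δ := by positivity
  have hU0 := U_nonneg d e K x
  have e1 : ∑ n ∈ Finset.Ioc 0 K, term d e r j n x ≤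
      64 ^ r * ((δ ^ 2 * U d e K x ^ 2) ^ (r - 1) * Q d e δ K x) := by
    unfold Q
    rw [Finset.mul_sum, Finset.mul_sum]
    have : Finset.Ioc 0 K = (Finset.range K).image (fun n => n + 1) := by
      ext n; simp only [Finset.mem_Ioc, Finset.mem_image, Finset.mem_range]
      constructor
      · intro h; exact ⟨n - 1, by omega, by omega⟩
      · rintro ⟨m, h, rfl⟩; omega
    rw [this, Finset.sum_image (by intro a _ b _ h; simpa using h)]
    refine Finset.sum_le_sum fun n hn => ?_
    have hU := U_nonneg d e (n + 1) x
    unfold term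
    rw [← hδ]
    split_ifs with h
    · rw [Real.mul_rpow (by norm_num) (by positivity)]
      have : (δ ^ 2 * U d e (n + 1) x ^ 2) ^ r =
          (δ ^ 2 * U d e (n + 1) x ^ 2) ^ (r - 1) * (δ ^ 2 * U d e (n + 1) x ^ 2) := by
        conv_rhs => rw [← Real.rpow_one (δ ^ 2 * U d e (n + 1) x ^ 2), ← Real.rpow_mul (by positivity), one_mul]
        rw [← Real.rpow_add' (by positivity) (by linarith)]
        congr 1; ring
      rw [this]
      have hm : U d e (n + 1) x ≤ U d e K x := U_mono d e x (by
        have := Finset.mem_range.1 hn; omega)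
      gcongr
    · simp
  refine e1.trans ?_
  have e2 : (δ ^ 2 * U d e K x ^ 2) ^ (r - 1) = (δ ^ (r - 1) * δ ^ (r - 1)) * (U d e K x ^ 2) ^ (r - 1) := by
    rw [Real.mul_rpow (by positivity) (by positivity), sq δ, Real.mul_rpow hδ0.le hδ0.le]
  rw [e2, mul_assoc (δ ^ (r - 1) * δ ^ (r - 1))]
  gcongr
  set u := U d e K x ^ 2
  set q := Q d e δ K x with hq
  have hq0 : 0 ≤ q := Q_nonneg _ _ _ _ _
  have hu0 : 0 ≤ u := by positivity
  have hs : ∀ a : ℝ, 0 ≤ a → a ^ (r - 1) * a = a ^ r := by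
    intro a ha
    nth_rewrite 2 [← Real.rpow_one a]
    rw [← Real.rpow_add' ha (by linarith)]
    congr 1; ring
  rcases le_total q u with h | h
  · calc _ ≤ u ^ (r - 1) * u := by gcongr
      _ = u ^ r := hs u hu0
      _ ≤ _ := by linarith [Real.rpow_nonneg hq0 r]
  · calc _ ≤ q ^ (r - 1) * q := by gcongr
      _ = q ^ r := hs q hq0
      _ ≤ _ := by linarith [Real.rpow_nonneg hu0 r]

lemma L_le2 {X Y Z : Ω → ℝ} {c : ℝ} (hc : 0 ≤ c) (hY : Measurable Y) (h : ∀ x, X x ≤ c * (Y x + Z x)) :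
    L μ X ≤ ENNReal.ofReal c * (L μ Y + L μ Z) := by
  refine (L_mono h).trans ?_
  rw [L_mul hc]
  gcongr
  exact L_add_le hY

/-- norm bound for transforms -/
lemma L_transform (hθ : ∀ n, MeasurePreserving (θ n) μ μ) (k : ℕ) : ∃ C : ℝ≥0,
    ∀ (d : ℕ → Ω → ℂ) (H : ℕ → Ω → ℂ) (W : Ω → ℝ) (n : ℕ), IsDiff θ d → IsPred θ H → Measurable W →
    (∀ x, ∀ i < n, ‖H i x‖ ≤ W x) →
    L μ (fun x => mx (fun i x => H i x * d i x) n x ^ (2 * 2 ^ k)) ≤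
      C * (L μ (fun x => W x ^ (4 * 2 ^ k)) + L μ (fun x => Sq d n x ^ (2 * 2 ^ k))) := by
  obtain ⟨C, hC, h⟩ := bdg (μ := μ) hθ k
  refine ⟨C.toNNReal, fun d H W n hd hH hW hb => ?_⟩
  refine (h _ (hH.mul_diff hd) n).trans ?_
  have : ((C.toNNReal : ℝ≥0) : ℝ≥0∞) = ENNReal.ofReal C := rfl
  rw [this]
  gcongr
  have := L_le2 (μ := μ) (c := 1) (X := fun x => Sq (fun i x => H i x * d i x) n x ^ 2 ^ k)
    (Y := fun x => W x ^ (4 * 2 ^ k)) (Z := fun x => Sq d n x ^ (2 * 2 ^ k)) (by norm_num)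
    (by fun_prop) (fun x => by
      have h1 := pow_le_pow_left₀ (Sq_nonneg _ _ _) (Sq_mul_le H d n x (hb x)) (2 ^ k)
      refine h1.trans ?_
      rw [mul_pow, one_mul]
      have e1 : W x ^ (4 * 2 ^ k) = ((W x ^ 2) ^ 2 ^ k) ^ 2 := by
        rw [← pow_mul, ← pow_mul]; ring_nf
      have e2 : Sq d n x ^ (2 * 2 ^ k) = (Sq d n x ^ 2 ^ k) ^ 2 := by
        rw [← pow_mul]; ring_nf
      rw [e1, e2]
      nlinarith [sq_nonneg ((W x ^ 2) ^ 2 ^ k - Sq d n x ^ 2 ^ k), sq_nonneg ((W x ^ 2) ^ 2 ^ k),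
        sq_nonneg (Sq d n x ^ 2 ^ k)])
  simpa using this

lemma L_U (hθ : ∀ n, MeasurePreserving (θ n) μ μ) (k : ℕ) : ∃ C : ℝ≥0,
    ∀ (d e : ℕ → Ω → ℂ) (n : ℕ), IsDiff θ d → IsDiff θ e →
    L μ (fun x => U d e n x ^ (4 * 2 ^ k)) ≤
      C * (L μ (fun x => Sq d n x ^ (2 * 2 ^ k)) + L μ (fun x => Sq e n x ^ (2 * 2 ^ k))) := by
  obtain ⟨C1, hC1, h1⟩ := bdg (μ := μ) hθ (k + 1)
  obtain ⟨C2, h2⟩ := L_transform (μ := μ) hθ k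
  set i := 2 ^ k with hi
  have hi2 : 2 ^ (k + 1) = 2 * i := by rw [hi]; ring
  have hi4 : 2 * (2 * i) = 4 * i := by ring
  rw [hi2, hi4] at h1
  refine ⟨(2 ^ (4 * i) * 2 ^ (4 * i)) * (C1.toNNReal + C1.toNNReal + C2 * (C1.toNNReal + 1)), fun d e n hd he => ?_⟩
  have h2' := h2 e (S d) (mx d n) n he hd.S_pred (hd.mx_pred.meas n) (fun x i hi => S_le_mx d hi.le x)
  have hd' := h1 d hd n
  have he' := h1 e he n
  set Ld := L μ (fun x => Sq d n x ^ (2 * i))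
  set Le := L μ (fun x => Sq e n x ^ (2 * i))
  have md := hd.mx_pred.meas n
  have me := he.mx_pred.meas n
  have mz := (hd.Zd he).mx_pred.meas n
  have hpt : ∀ x, U d e n x ^ (4 * i) ≤ (2 ^ (4 * i) * 2 ^ (4 * i)) *
      ((mx d n x ^ (4 * i) + mx e n x ^ (4 * i)) + mx (Zd d e) n x ^ (2 * i)) := by
    intro x
    have p1 := mx_nonneg d n x
    have p2 := mx_nonneg e n x
    have p3 := mx_nonneg (Zd d e) n x
    unfold U
    refine (add_pow_le2 (by positivity) (Real.sqrt_nonneg _) _).trans ?_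
    have e1 : Real.sqrt (mx (Zd d e) n x) ^ (4 * i) = mx (Zd d e) n x ^ (2 * i) := by
      rw [show 4 * i = 2 * (2 * i) by ring, pow_mul, Real.sq_sqrt p3]
    rw [e1, mul_assoc]
    gcongr
    rw [mul_add]
    gcongr
    · exact add_pow_le2 p1 p2 _
    · have : (1:ℝ) ≤ 2 ^ (4 * i) := one_le_pow₀ (by norm_num)
      nlinarith [pow_nonneg p3 (2 * i)]
  have := L_le2 (μ := μ) (by positivity) (by fun_prop) hpt
  have h3 : L μ (fun x => mx d n x ^ (4 * i) + mx e n x ^ (4 * i)) ≤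
      ENNReal.ofReal C1 * Ld + ENNReal.ofReal C1 * Le :=
    (L_add_le (by fun_prop)).trans (add_le_add hd' he')
  have h4 : L μ (fun x => mx (Zd d e) n x ^ (2 * i)) ≤ C2 * (ENNReal.ofReal C1 * Ld + Le) :=
    h2'.trans (by gcongr)
  refine this.trans ?_
  have hc : ENNReal.ofReal (2 ^ (4 * i) * 2 ^ (4 * i)) = ((2 ^ (4 * i) * 2 ^ (4 * i) : ℝ≥0) : ℝ≥0∞) := by
    rw [ENNReal.ofReal_mul (by positivity), ENNReal.ofReal_pow (by norm_num), ENNReal.ofReal_ofNat]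
    push_cast; rfl
  have hC : ENNReal.ofReal C1 = ((C1.toNNReal : ℝ≥0) : ℝ≥0∞) := rfl
  rw [hC] at h3 h4
  rw [hc]
  generalize ((2 ^ (4 * i) * 2 ^ (4 * i) : ℝ≥0)) = D
  rw [ENNReal.coe_mul, mul_assoc]
  gcongr
  refine (add_le_add h3 h4).trans ?_
  push_cast
  set c1 : ℝ≥0∞ := ((C1.toNNReal : ℝ≥0) : ℝ≥0∞)
  set c2 : ℝ≥0∞ := (C2 : ℝ≥0∞)
  calc c1 * Ld + c1 * Le + c2 * (c1 * Ld + Le) ≤ c1 * Ld + c1 * Le + c2 * (c1 * Ld + Le) +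
        (c1 * Ld + c1 * Le + c2 * Ld + c2 * c1 * Le) := le_self_add
    _ = _ := by ring

lemma pow_le6 {a b c d e f : ℝ} (ha : 0 ≤ a) (hb : 0 ≤ b) (hc : 0 ≤ c) (hd : 0 ≤ d) (he : 0 ≤ e)
    (hf : 0 ≤ f) (n : ℕ) : (4 * (a + b + 2 * c + d + e + f)) ^ n ≤
      (4 * 12) ^ n * (a ^ n + (b ^ n + (c ^ n + (d ^ n + (e ^ n + f ^ n))))) := by
  have key : ∀ m : ℝ, 0 ≤ m → a ≤ m → b ≤ m → c ≤ m → d ≤ m → e ≤ m → f ≤ m →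
      m ^ n ≤ (a ^ n + (b ^ n + (c ^ n + (d ^ n + (e ^ n + f ^ n))))) →
      (4 * (a + b + 2 * c + d + e + f)) ^ n ≤
      (4 * 12) ^ n * (a ^ n + (b ^ n + (c ^ n + (d ^ n + (e ^ n + f ^ n))))) := by
    intro m hm h1 h2 h3 h4 h5 h6 h7
    calc (4 * (a + b + 2 * c + d + e + f)) ^ n ≤ (4 * 12 * m) ^ n := by
          exact pow_le_pow_left₀ (by positivity) (by linarith) n
      _ = (4 * 12) ^ n * m ^ n := mul_pow _ _ _
      _ ≤ _ := by gcongr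
  have q1 := pow_nonneg ha n
  have q2 := pow_nonneg hb n
  have q3 := pow_nonneg hc n
  have q4 := pow_nonneg hd n
  have q5 := pow_nonneg he n
  have q6 := pow_nonneg hf n
  obtain ⟨m, hm, hmax⟩ := Finset.exists_max_image ({a, b, c, d, e, f} : Finset ℝ) id (by simp)
  simp only [Finset.mem_insert, Finset.mem_singleton, id, forall_eq_or_imp, forall_eq] at hm hmax
  obtain ⟨h1, h2, h3, h4, h5, h6⟩ := hmax
  refine key m (ha.trans h1) h1 h2 h3 h4 h5 h6 ?_
  rcases hm with rfl | rfl | rfl | rfl | rfl | rfl <;> linarith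

lemma L_Q (hθ : ∀ n, MeasurePreserving (θ n) μ μ) (k : ℕ) : ∃ C : ℝ≥0,
    ∀ (d e : ℕ → Ω → ℂ) (n : ℕ) (δ : ℝ), 0 < δ → δ ≤ 1 → IsDiff θ d → IsDiff θ e →
    L μ (fun x => Q d e δ n x ^ (2 * 2 ^ k)) ≤
      C * (L μ (fun x => Sq d n x ^ (2 * 2 ^ k)) + L μ (fun x => Sq e n x ^ (2 * 2 ^ k))) := by
  obtain ⟨C1, h1⟩ := L_U (μ := μ) hθ k
  obtain ⟨C2, h2⟩ := L_transform (μ := μ) hθ k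
  set i := 2 ^ k with hi
  set D : ℝ≥0 := 2 ^ (4 * i) with hD
  refine ⟨(4 * 12) ^ (2 * i) * (C1 + 1 + 1 + 3 * (C2 * (D * C1 + 1))), fun d e n δ hδ hδ1 hd he => ?_⟩
  have hU := h1 d e n hd he
  obtain ⟨p1, p2, p3⟩ := H_pred hd he δ
  have mU : Measurable (U d e n) := (U_pred hd he).meas n
  have f1 := h2 d (Hf d e δ) (fun x => 2 * U d e n x) n hd p1 (by fun_prop)
    (fun x i hi => (H_bounds d e hδ hδ1 hi x).1)
  have f2 := h2 e (Hg d e δ) (fun x => 2 * U d e n x) n he p2 (by fun_prop)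
    (fun x i hi => (H_bounds d e hδ hδ1 hi x).2.1)
  have f3 := h2 e (HY d e δ) (fun x => 2 * U d e n x) n he p3 (by fun_prop)
    (fun x i hi => (H_bounds d e hδ hδ1 hi x).2.2)
  have hDr : ENNReal.ofReal (2 ^ (4 * i)) = (D : ℝ≥0∞) := by
    rw [hD, ENNReal.ofReal_pow (by norm_num), ENNReal.ofReal_ofNat]; push_cast; rfl
  simp only [mul_pow] at f1 f2 f3
  rw [L_mul (by positivity), hDr] at f1 f2 f3
  set Ld := L μ (fun x => Sq d n x ^ (2 * i))
  set Le := L μ (fun x => Sq e n x ^ (2 * i))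
  set B := Ld + Le
  have m1 := (p1.mul_diff hd).mx_pred.meas n
  have m2 := (p2.mul_diff he).mx_pred.meas n
  have m3 := (p3.mul_diff he).mx_pred.meas n
  have ms := hd.Sq_meas n
  have ms' := he.Sq_meas n
  have hpt : ∀ x, Q d e δ n x ^ (2 * i) ≤ (4 * 12) ^ (2 * i) * (U d e n x ^ (4 * i) +
      (Sq d n x ^ (2 * i) + (Sq e n x ^ (2 * i) + (mx (fun i x => Hf d e δ i x * d i x) n x ^ (2 * i) +
      (mx (fun i x => Hg d e δ i x * e i x) n x ^ (2 * i) +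
       mx (fun i x => HY d e δ i x * e i x) n x ^ (2 * i)))))) := by
    intro x
    refine (pow_le_pow_left₀ (Q_nonneg _ _ _ _ _) (Q_bound d e hδ hδ1 n x) _).trans ?_
    refine (pow_le6 (by positivity) (Sq_nonneg _ _ _) (Sq_nonneg _ _ _) (mx_nonneg _ _ _)
      (mx_nonneg _ _ _) (mx_nonneg _ _ _) _).trans ?_
    rw [← pow_mul, show 2 * (2 * i) = 4 * i by ring]
  refine (L_le2 (μ := μ) (by positivity) (by fun_prop) hpt).trans ?_
  have hc : ENNReal.ofReal ((4 * 12) ^ (2 * i)) = (((4 * 12) ^ (2 * i) : ℝ≥0) : ℝ≥0∞) := by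
    rw [ENNReal.ofReal_pow (by norm_num), ENNReal.ofReal_mul (by norm_num), ENNReal.ofReal_ofNat,
      ENNReal.ofReal_ofNat]; push_cast; rfl
  rw [hc, ENNReal.coe_mul, mul_assoc]
  gcongr
  have g : ∀ (Y : Ω → ℝ) (X : ℝ≥0∞), X ≤ B → L μ Y ≤ C2 * (D * L μ (fun x => U d e n x ^ (4 * i)) + X) →
      L μ Y ≤ C2 * (D * C1 + 1) * B := by
    intro Y X hX hY
    refine hY.trans ?_
    calc _ ≤ (C2 : ℝ≥0∞) * (D * (C1 * B) + B) := by gcongr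
      _ = _ := by ring
  have g1 := g _ _ le_self_add f1
  have g2 := g _ _ le_add_self f2
  have g3 := g _ _ le_add_self f3
  calc _ ≤ C1 * B + (B + (B + (C2 * (D * C1 + 1) * B + (C2 * (D * C1 + 1) * B +
        C2 * (D * C1 + 1) * B)))) := by
        refine add_le_add hU ((L_add_le (by fun_prop)).trans (add_le_add le_self_add ?_))
        refine ((L_add_le (by fun_prop)).trans (add_le_add le_add_self ?_))
        refine ((L_add_le (by fun_prop)).trans (add_le_add g1 ?_))
        exact ((L_add_le (by fun_prop)).trans (add_le_add g2 g3))
    _ = _ := by push_cast; ring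
end PropA
end VP

namespace VP

lemma geom_ne_top {g : ℝ≥0∞} (h : g < 1) : ∑' j : ℕ, g ^ j ≠ ∞ := by
  rw [ENNReal.tsum_geometric]
  exact ENNReal.inv_ne_top.2 (tsub_pos_of_lt h).ne'

section PropA
variable {Ω : Type*} [MeasurableSpace Ω] {μ : Measure Ω}
variable {θ : ℕ → Ω → Ω} {d e : ℕ → Ω → ℂ}

lemma Q_meas (hd : IsDiff θ d) (he : IsDiff θ e) (δ K) : Measurable (Q d e δ K) := by
  unfold Q
  refine Finset.measurable_sum _ fun n _ => ?_
  refine Measurable.ite ?_ ?_ measurable_const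
  · exact (tau_pred hd he δ).meas (n + 1) (measurableSet_singleton _)
  · have := (U_pred hd he).meas (n + 1); fun_prop

lemma term_meas (hd : IsDiff θ d) (he : IsDiff θ e) (r j n) : Measurable (term d e r j n) := by
  unfold term
  refine Measurable.ite ?_ ?_ measurable_const
  · exact (tau_pred hd he _).meas n (measurableSet_singleton _)
  · have := (U_pred hd he).meas n; fun_prop

lemma Vhat_meas (hd : IsDiff θ d) (he : IsDiff θ e) (r K) : Measurable (Vhat d e r K) := by
  unfold Vhat
  refine Finset.measurable_sum _ fun n _ => ?_
  refine Measurable.ennreal_tsum fun j => ?_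
  exact (term_meas hd he r j n).ennreal_ofReal

def gr (r : ℝ) : ℝ≥0∞ := ENNReal.ofReal ((1 / 2) ^ (r - 1))

lemma gr_lt {r : ℝ} (hr : 1 < r) : gr r < 1 := by
  unfold gr
  rw [← ENNReal.ofReal_one]
  refine (ENNReal.ofReal_lt_ofReal_iff one_pos).2 ?_
  exact Real.rpow_lt_one (by norm_num) (by norm_num) (by linarith)

lemma Vhat_le (d e : ℕ → Ω → ℂ) {r : ℝ} (hr : 1 < r) (K : ℕ) (x : Ω) : Vhat d e r K x ≤
    ∑' j, gr r ^ j * (gr r ^ j * (ENNReal.ofReal (64 ^ r) * (ENNReal.ofReal ((U d e K x ^ 2) ^ r)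
      + ENNReal.ofReal ((Q d e (1 / 2 ^ j) K x) ^ r)))) := by
  unfold Vhat
  rw [← Summable.tsum_finsetSum (fun _ _ => ENNReal.summable)]
  refine ENNReal.tsum_le_tsum fun j => ?_
  rw [← ENNReal.ofReal_sum_of_nonneg (fun n _ => term_nonneg _ _ _ _ _ _)]
  refine (ENNReal.ofReal_le_ofReal (sum_term_le d e hr j K x)).trans ?_
  have hq := Q_nonneg d e (1 / 2 ^ j) K x
  have hg : gr r ^ j = ENNReal.ofReal ((1 / 2 ^ j) ^ (r - 1)) := by
    unfold gr
    rw [← ENNReal.ofReal_pow (by positivity), ← Real.rpow_natCast, ← Real.rpow_mul (by norm_num),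
      mul_comm, Real.rpow_mul (by norm_num), Real.rpow_natCast, one_div_pow]
  rw [hg, ENNReal.ofReal_mul (by positivity), ENNReal.ofReal_mul (by positivity),
    ENNReal.ofReal_mul (by positivity), ENNReal.ofReal_add (by positivity) (by positivity)]
  apply le_of_eq; ring

theorem propA (hθ : ∀ n, MeasurePreserving (θ n) μ μ) {r : ℝ} (hr : 1 < r) (k : ℕ) : ∃ C : ℝ≥0,
    ∀ (d e : ℕ → Ω → ℂ) (K : ℕ), IsDiff θ d → IsDiff θ e →
    ∫⁻ x, Vhat d e r K x ^ (((2 * 2 ^ k : ℕ) : ℝ) / r) ∂μ ≤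
      C * (L μ (fun x => Sq d K x ^ (2 * 2 ^ k)) + L μ (fun x => Sq e K x ^ (2 * 2 ^ k))) := by
  obtain ⟨C1, h1⟩ := L_U (μ := μ) hθ k
  obtain ⟨C2, h2⟩ := L_Q (μ := μ) hθ k
  set i := 2 ^ k with hi
  have hipos : 0 < i := by positivity
  set κ : ℝ := ((2 * i : ℕ) : ℝ) / r with hκ
  have hκ0 : 0 < κ := by have : 0 < ((2 * i : ℕ) : ℝ) := by positivity
                         positivity
  have hr0 : 0 < r := by linarith
  set g := gr r with hg
  have hg1 : g < 1 := gr_lt hr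
  set A : ℝ≥0∞ := ∑' j : ℕ, g ^ j with hA
  set A' : ℝ≥0∞ := ∑' j : ℕ, (g ^ κ) ^ j with hA'
  have hAt : A ≠ ∞ := geom_ne_top hg1
  have hAt' : A' ≠ ∞ := geom_ne_top (ENNReal.rpow_lt_one hg1 hκ0)
  set D : ℝ≥0∞ := ENNReal.ofReal (64 ^ r) ^ κ * 2 ^ κ with hD
  have hDt : D ≠ ∞ := by
    rw [hD]
    exact ENNReal.mul_ne_top (ENNReal.rpow_ne_top_of_nonneg hκ0.le ENNReal.ofReal_ne_top)
      (ENNReal.rpow_ne_top_of_nonneg hκ0.le (by simp))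
  set E : ℝ≥0∞ := A ^ κ * (A' * (D * (C1 + C2))) with hE
  have hEt : E ≠ ∞ := by
    rw [hE]
    refine ENNReal.mul_ne_top (ENNReal.rpow_ne_top_of_nonneg hκ0.le hAt) (ENNReal.mul_ne_top hAt'
      (ENNReal.mul_ne_top hDt (by simp)))
  refine ⟨E.toNNReal, fun d e K hd he => ?_⟩
  rw [ENNReal.coe_toNNReal hEt]
  have hU := h1 d e K hd he
  have hpw : ∀ a : ℝ, 0 ≤ a → ENNReal.ofReal (a ^ r) ^ κ = ENNReal.ofReal (a ^ (2 * i)) := by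
    intro a ha
    rw [ENNReal.ofReal_rpow_of_nonneg (by positivity) hκ0.le, ← Real.rpow_mul ha, hκ,
      mul_div_cancel₀ _ hr0.ne', Real.rpow_natCast]
  set B := L μ (fun x => Sq d K x ^ (2 * i)) + L μ (fun x => Sq e K x ^ (2 * i)) with hB
  have hpt : ∀ x, Vhat d e r K x ^ κ ≤ A ^ κ * ∑' j : ℕ, (g ^ κ) ^ j * (D *
      (ENNReal.ofReal (U d e K x ^ (4 * i)) + ENNReal.ofReal (Q d e (1 / 2 ^ j) K x ^ (2 * i)))) := by
    intro x
    refine (ENNReal.rpow_le_rpow (Vhat_le d e hr K x) hκ0.le).trans ?_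
    refine (tsum_mul_rpow_le _ _ hκ0).trans ?_
    gcongr with j
    rw [ENNReal.mul_rpow_of_nonneg _ _ hκ0.le, ENNReal.mul_rpow_of_nonneg _ _ hκ0.le]
    have e1 : (gr r ^ j) ^ κ = (g ^ κ) ^ j := by
      rw [← ENNReal.rpow_natCast, ← ENNReal.rpow_natCast, ← ENNReal.rpow_mul, ← ENNReal.rpow_mul,
        mul_comm]
    rw [e1, hD, mul_assoc (ENNReal.ofReal (64 ^ r) ^ κ)]
    gcongr
    refine (add_rpow_le2 _ _ hκ0.le).trans ?_
    rw [hpw _ (by positivity), hpw _ (Q_nonneg _ _ _ _ _), ← pow_mul, show 2 * (2 * i) = 4 * i by ring]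
  have mU := (U_pred hd he).meas K
  have mQ : ∀ δ, Measurable (Q d e δ K) := fun δ => Q_meas hd he δ K
  calc _ ≤ ∫⁻ x, A ^ κ * ∑' j : ℕ, (g ^ κ) ^ j * (D *
      (ENNReal.ofReal (U d e K x ^ (4 * i)) + ENNReal.ofReal (Q d e (1 / 2 ^ j) K x ^ (2 * i)))) ∂μ :=
        lintegral_mono hpt
    _ = A ^ κ * ∑' j : ℕ, (g ^ κ) ^ j * (D * (L μ (fun x => U d e K x ^ (4 * i)) +
          L μ (fun x => Q d e (1 / 2 ^ j) K x ^ (2 * i)))) := by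
        rw [lintegral_const_mul _ (by fun_prop), lintegral_tsum (fun j => by fun_prop)]
        congr 1
        refine tsum_congr fun j => ?_
        rw [lintegral_const_mul _ (by fun_prop), lintegral_const_mul _ (by fun_prop),
          lintegral_add_left (by fun_prop)]
        rfl
    _ ≤ A ^ κ * ∑' j : ℕ, (g ^ κ) ^ j * (D * (C1 * B + C2 * B)) := by
        gcongr with j
        exact h2 d e K _ (by positivity) (by
          rw [div_le_one (by positivity)]; exact one_le_pow₀ (by norm_num)) hd he
    _ = E * B := by
        rw [ENNReal.tsum_mul_right, hE, ← hA']; ring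
end PropA

/-! ### Variation functionals -/
section Var
variable {ι : Type*} [LinearOrder ι]

def Var (F : ι → ι → ℝ≥0∞) (s t : ι) : ℝ≥0∞ :=
  ⨆ (n : ℕ) (N : ℕ → ι) (_ : Monotone N) (_ : s ≤ N 0) (_ : N n ≤ t),
    ∑ k ∈ Finset.range n, F (N k) (N (k + 1))

lemma le_Var (F : ι → ι → ℝ≥0∞) {s t : ι} (n : ℕ) (N : ℕ → ι) (hN : Monotone N) (h1 : s ≤ N 0)
    (h2 : N n ≤ t) : ∑ k ∈ Finset.range n, F (N k) (N (k + 1)) ≤ Var F s t := by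
  unfold Var
  exact le_iSup_of_le n (le_iSup_of_le N (le_iSup_of_le hN (le_iSup_of_le h1
    (le_iSup_of_le h2 le_rfl))))

lemma Var_le {F : ι → ι → ℝ≥0∞} {s t : ι} {B : ℝ≥0∞} (h : ∀ (n : ℕ) (N : ℕ → ι), Monotone N →
    s ≤ N 0 → N n ≤ t → ∑ k ∈ Finset.range n, F (N k) (N (k + 1)) ≤ B) : Var F s t ≤ B := by
  unfold Var
  exact iSup_le fun n => iSup_le fun N => iSup_le fun hN => iSup_le fun h1 => iSup_le fun h2 =>
    h n N hN h1 h2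

lemma single_le_Var (F : ι → ι → ℝ≥0∞) {s t a b : ι} (h1 : s ≤ a) (h : a ≤ b) (h2 : b ≤ t) :
    F a b ≤ Var F s t := by
  have := le_Var F (s := s) (t := t) 1 (fun k => if k = 0 then a else b) (by
    refine monotone_nat_of_le_succ fun n => ?_
    rcases Nat.eq_zero_or_pos n with rfl | hn
    · simpa
    · simp [hn.ne']) (by simpa) (by simpa)
  simpa using this

lemma Var_mono {F G : ι → ι → ℝ≥0∞} {s t s' t' : ι} (hs : s' ≤ s) (ht : t ≤ t')
    (h : ∀ a b, s ≤ a → a ≤ b → b ≤ t → F a b ≤ G a b) : Var F s t ≤ Var G s' t' := by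
  refine Var_le fun n N hN h1 h2 => ?_
  refine (Finset.sum_le_sum fun k hk => ?_).trans (le_Var G n N hN (hs.trans h1) (h2.trans ht))
  have := Finset.mem_range.1 hk
  exact h _ _ (h1.trans (hN (by omega))) (hN (by omega)) ((hN (by omega)).trans h2)

/-- superadditivity -/
lemma Var_superadd (F : ι → ι → ℝ≥0∞) {s u t : ι} (hsu : s ≤ u) (hut : u ≤ t) :
    Var F s u + Var F u t ≤ Var F s t := by
  have key : ∀ (n : ℕ) (N : ℕ → ι), Monotone N → s ≤ N 0 → N n ≤ u →
     ∀ (n' : ℕ) (N' : ℕ → ι), Monotone N' → u ≤ N' 0 → N' n' ≤ t →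
     ∑ k ∈ Finset.range n, F (N k) (N (k + 1)) + ∑ k ∈ Finset.range n', F (N' k) (N' (k + 1)) ≤
       Var F s t := by
    intro n N hN h1 h2 n' N' hN' h1' h2'
    set P : ℕ → ι := fun k => if k ≤ n then N k else N' (k - (n + 1)) with hP
    have hPm : Monotone P := by
      refine monotone_nat_of_le_succ fun k => ?_
      simp only [hP]
      split_ifs with ha hb hb
      · exact hN (by omega)
      · have : k = n := by omega
        subst this; simpa using h2.trans h1'
      · omega
      · exact hN' (by omega)
    have := le_Var F (s := s) (t := t) (n + 1 + n') P hPm (by simpa [hP]) (by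
      simp only [hP]
      rw [if_neg (by omega)]; simpa using h2')
    refine le_trans ?_ this
    rw [Finset.sum_range_add, Finset.sum_range_succ]
    gcongr ?_ + ?_
    · refine le_trans (le_of_eq ?_) le_self_add
      refine Finset.sum_congr rfl fun k hk => ?_
      have := Finset.mem_range.1 hk
      simp only [hP]
      rw [if_pos (by omega), if_pos (by omega)]
    · refine le_of_eq ?_
      refine Finset.sum_congr rfl fun k hk => ?_
      simp only [hP]
      rw [if_neg (by omega), if_neg (by omega)]
      congr 2 <;> omega
  have k1 : ∀ (n' : ℕ) (N' : ℕ → ι), Monotone N' → u ≤ N' 0 → N' n' ≤ t →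
     Var F s u + ∑ k ∈ Finset.range n', F (N' k) (N' (k + 1)) ≤ Var F s t := by
    intro n' N' hN' h1' h2'
    by_cases ht : Var F s t = ∞
    · rw [ht]; exact le_top
    have hfin : ∑ k ∈ Finset.range n', F (N' k) (N' (k + 1)) ≠ ∞ :=
      ne_top_of_le_ne_top ht (le_Var F n' N' hN' (hsu.trans h1') h2')
    refine (ENNReal.le_sub_iff_add_le_right hfin (le_Var F n' N' hN' (hsu.trans h1') h2')).1 ?_
    refine Var_le fun n N hN h1 h2 => ?_
    refine ENNReal.le_sub_of_add_le_right hfin (key n N hN h1 h2 n' N' hN' h1' h2')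
  by_cases ht : Var F s t = ∞
  · rw [ht]; exact le_top
  have hfin : Var F s u ≠ ∞ := ne_top_of_le_ne_top ht (Var_mono le_rfl hut fun _ _ _ _ _ => le_rfl)
  have hle := Var_mono (F := F) (G := F) (le_refl s) hut fun _ _ _ _ _ => le_rfl
  refine (ENNReal.le_sub_iff_add_le_left hfin hle).1 ?_
  refine Var_le fun n' N' hN' h1' h2' => ?_
  exact ENNReal.le_sub_of_add_le_left hfin (k1 n' N' hN' h1' h2')

lemma Var_measurable {Ω : Type*} [MeasurableSpace Ω] [Countable ι] (F : ι → ι → Ω → ℝ≥0∞)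
    (hF : ∀ a b, Measurable (F a b)) (s t : ι) :
    Measurable (fun x => Var (fun a b => F a b x) s t) := by
  have : (fun x => Var (fun a b => F a b x) s t) = fun x => ⨆ (n : ℕ) (v : Fin (n + 1) → ι)
      (_ : Monotone v ∧ s ≤ v 0 ∧ v (Fin.last n) ≤ t),
      ∑ k : Fin n, F (v k.castSucc) (v k.succ) x := by
    funext x
    apply le_antisymm
    · refine Var_le fun n N hN h1 h2 => ?_
      refine le_iSup_of_le n (le_iSup_of_le (fun k => N k) (le_iSup_of_le ⟨?_, ?_, ?_⟩ ?_))
      · intro a b h; exact hN h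
      · simpa using h1
      · simpa using h2
      · rw [Finset.sum_range]; simp
    · refine iSup_le fun n => iSup_le fun v => iSup_le fun ⟨hv, h1, h2⟩ => ?_
      have := le_Var (fun a b => F a b x) (s := s) (t := t) n
        (fun k => v ⟨min k n, by omega⟩) (fun a b h => hv (by
          rw [Fin.le_def]; simp only; omega)) (by simpa using h1) (by
          simp only [min_self]; exact h2)
      refine le_trans (le_of_eq ?_) this
      rw [Finset.sum_range]
      refine Finset.sum_congr rfl fun k _ => ?_
      have e1 : (⟨min (k : ℕ) n, by omega⟩ : Fin (n + 1)) = k.castSucc := by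
        ext; simp [k.2.le]
      have e2 : (⟨min ((k : ℕ) + 1) n, by omega⟩ : Fin (n + 1)) = k.succ := by
        ext; simp
      rw [e1, e2]
  rw [this]
  refine Measurable.iSup fun n => Measurable.iSup fun v => Measurable.iSup fun _ => ?_
  exact Finset.measurable_sum _ fun k _ => hF _ _

lemma Var_self {F : ι → ι → ℝ≥0∞} (h : ∀ a, F a a = 0) (s : ι) : Var F s s = 0 := by
  refine le_antisymm (Var_le fun n N hN h1 h2 => le_of_eq ?_) bot_le
  refine Finset.sum_eq_zero fun k hk => ?_
  have := Finset.mem_range.1 hk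
  have e : ∀ j ≤ n, N j = s := fun j hj => le_antisymm ((hN hj).trans h2) (h1.trans (hN (by omega)))
  rw [e k (by omega), e (k + 1) (by omega), h]

lemma Var_const_mul (F : ι → ι → ℝ≥0∞) (c : ℝ≥0∞) (s t : ι) :
    Var (fun a b => c * F a b) s t = c * Var F s t := by
  unfold Var
  simp only [ENNReal.mul_iSup, Finset.mul_sum]

lemma Var_add_le (F G : ι → ι → ℝ≥0∞) (s t : ι) :
    Var (fun a b => F a b + G a b) s t ≤ Var F s t + Var G s t := by
  refine Var_le fun n N hN h1 h2 => ?_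
  rw [Finset.sum_add_distrib]
  exact add_le_add (le_Var F n N hN h1 h2) (le_Var G n N hN h1 h2)

lemma Var_tsum_le {κ : Type*} (F : κ → ι → ι → ℝ≥0∞) (s t : ι) :
    Var (fun a b => ∑' l, F l a b) s t ≤ ∑' l, Var (F l) s t := by
  refine Var_le fun n N hN h1 h2 => ?_
  rw [← Summable.tsum_finsetSum (fun _ _ => ENNReal.summable)]
  exact ENNReal.tsum_le_tsum fun l => le_Var (F l) n N hN h1 h2

/-- control bound: additive dominating function -/
lemma Var_le_of_sum {F : ℕ → ℕ → ℝ≥0∞} {c : ℕ → ℝ≥0∞} {s t : ℕ}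
    (h : ∀ a b, s ≤ a → a ≤ b → b ≤ t → F a b ≤ ∑ n ∈ Finset.Ioc a b, c n) :
    Var F s t ≤ ∑ n ∈ Finset.Ioc s t, c n := by
  refine Var_le fun n N hN h1 h2 => ?_
  have : ∀ m ≤ n, ∑ k ∈ Finset.range m, F (N k) (N (k + 1)) ≤ ∑ j ∈ Finset.Ioc (N 0) (N m), c j := by
    intro m hm
    induction m with
    | zero => simp
    | succ m ih =>
      rw [Finset.sum_range_succ, ← Finset.sum_Ioc_consecutive c (hN (Nat.zero_le m)) (hN (Nat.le_succ m))]
      exact add_le_add (ih (by omega)) (h _ _ (h1.trans (hN (by omega))) (hN (by omega))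
        ((hN hm).trans h2))
  refine (this n le_rfl).trans ?_
  exact Finset.sum_le_sum_of_subset (Finset.Ioc_subset_Ioc h1 h2)
end Var
end VP

namespace VP

lemma two_rpow_ne_top (x : ℝ) : (2 : ℝ≥0∞) ^ x ≠ ∞ := by
  simp [ENNReal.rpow_eq_top_iff]
lemma two_rpow_pos (x : ℝ) : 0 < (2 : ℝ≥0∞) ^ x := ENNReal.rpow_pos (by norm_num) (by norm_num)

lemma two_rpow_add (x y : ℝ) : (2 : ℝ≥0∞) ^ (x + y) = 2 ^ x * 2 ^ y :=
  ENNReal.rpow_add _ _ (by norm_num) (by norm_num)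

lemma min_one_rpow (y : ℝ≥0∞) {c : ℝ} (hc : 0 ≤ c) : min 1 (y ^ c) = (min 1 y) ^ c := by
  rcases hc.eq_or_lt with rfl | hc'
  · simp
  rcases le_total 1 y with h | h
  · rw [min_eq_left h, ENNReal.one_rpow, min_eq_left (ENNReal.one_le_rpow h hc')]
  · rw [min_eq_right h, min_eq_right (ENNReal.rpow_le_one h hc)]

lemma exists_two_rpow {F : ℝ≥0∞} (h0 : F ≠ 0) (ht : F ≠ ∞) :
    ∃ n : ℤ, (2 : ℝ≥0∞) ^ (n : ℝ) < F ∧ F ≤ 2 ^ ((n : ℝ) + 1) := by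
  obtain ⟨n, h1, h2⟩ := ENNReal.exists_mem_Ioc_zpow h0 ht (y := 2) (by norm_num) (by norm_num)
  refine ⟨n, ?_, ?_⟩
  · rwa [ENNReal.rpow_intCast]
  · have : ((n : ℝ) + 1) = ((n + 1 : ℤ) : ℝ) := by push_cast; rfl
    rwa [this, ENNReal.rpow_intCast]

lemma dy_sum {p s : ℝ} (hp : 0 < p) (hs : p < s) : ∃ G : ℝ≥0∞, G ≠ ∞ ∧ ∀ F : ℝ≥0∞, F ≠ ∞ →
    ∑' n : ℤ, (2 : ℝ≥0∞) ^ (((n : ℝ) + 1) * p) * (min 1 (F * 2 ^ (-(n : ℝ)))) ^ s ≤ G * F ^ p := by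
  have hs0 : 0 < s := hp.trans hs
  set G0 : ℝ≥0∞ := ∑' j : ℤ, (2 : ℝ≥0∞) ^ ((j : ℝ) * p) * (min 1 (2 ^ (-(j : ℝ)))) ^ s with hG0
  have hfin : G0 ≠ ∞ := by
    have h1 : ∀ (j : ℕ), (2 : ℝ≥0∞) ^ (((j : ℤ) : ℝ) * p) * (min 1 (2 ^ (-((j : ℤ) : ℝ)))) ^ s ≤
        (2 ^ (-(s - p))) ^ j := by
      intro j
      calc _ ≤ (2 : ℝ≥0∞) ^ (((j : ℤ) : ℝ) * p) * (2 ^ (-((j : ℤ) : ℝ))) ^ s := by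
            gcongr; exact min_le_right _ _
        _ = _ := by
          rw [← ENNReal.rpow_mul, ← two_rpow_add, ← ENNReal.rpow_natCast, ← ENNReal.rpow_mul]
          congr 1; push_cast; ring
    have h2 : ∀ (j : ℕ), (2 : ℝ≥0∞) ^ (((-((j : ℤ) + 1) : ℤ) : ℝ) * p) *
        (min 1 (2 ^ (-((-((j : ℤ) + 1) : ℤ) : ℝ)))) ^ s ≤ (2 ^ (-p)) ^ j := by
      intro j
      calc _ ≤ (2 : ℝ≥0∞) ^ (((-((j : ℤ) + 1) : ℤ) : ℝ) * p) * 1 ^ s := by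
            gcongr; exact min_le_left _ _
        _ ≤ _ := by
          rw [ENNReal.one_rpow, mul_one, ← ENNReal.rpow_natCast, ← ENNReal.rpow_mul]
          refine ENNReal.rpow_le_rpow_of_exponent_le (by norm_num) ?_
          push_cast; nlinarith
    have hlt : ∀ c : ℝ, 0 < c → (2 : ℝ≥0∞) ^ (-c) < 1 := fun c hc =>
      ENNReal.rpow_lt_one_of_one_lt_of_neg (by norm_num) (by linarith)
    rw [hG0, tsum_of_nat_of_neg_add_one ENNReal.summable ENNReal.summable]
    refine ENNReal.add_ne_top.2 ⟨?_, ?_⟩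
    · exact ne_top_of_le_ne_top (geom_ne_top (hlt _ (by linarith))) (ENNReal.tsum_le_tsum h1)
    · exact ne_top_of_le_ne_top (geom_ne_top (hlt _ hp)) (ENNReal.tsum_le_tsum h2)
  refine ⟨2 ^ p * 2 ^ p * G0, ENNReal.mul_ne_top (ENNReal.mul_ne_top (two_rpow_ne_top _)
    (two_rpow_ne_top _)) hfin, fun F hF => ?_⟩
  rcases eq_or_ne F 0 with rfl | h0
  · rw [ENNReal.tsum_eq_zero.2]
    · exact bot_le
    · intro n; simp [hs0]
  obtain ⟨m, hm1, hm2⟩ := exists_two_rpow h0 hF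
  rw [← (Equiv.addRight (m + 1)).tsum_eq]
  calc _ ≤ ∑' j : ℤ, (2 : ℝ≥0∞) ^ (((m : ℝ) + 2) * p) * ((2 : ℝ≥0∞) ^ ((j : ℝ) * p) * (min 1 (2 ^ (-(j : ℝ)))) ^ s) := by
        refine ENNReal.tsum_le_tsum fun j => ?_
        simp only [Equiv.coe_addRight]
        rw [← mul_assoc, ← two_rpow_add]
        refine mul_le_mul' (le_of_eq ?_) ?_
        · congr 1; push_cast; ring
        · gcongr
          calc F * 2 ^ (-((j + (m + 1) : ℤ) : ℝ)) ≤ 2 ^ ((m : ℝ) + 1) * 2 ^ (-((j + (m + 1) : ℤ) : ℝ)) := by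
                gcongr
            _ = _ := by rw [← two_rpow_add]; congr 1; push_cast; ring
    _ = 2 ^ (((m : ℝ) + 2) * p) * G0 := by rw [ENNReal.tsum_mul_left]
    _ ≤ _ := by
      have : (2 : ℝ≥0∞) ^ (((m : ℝ) + 2) * p) = 2 ^ p * 2 ^ p * (2 ^ (m : ℝ)) ^ p := by
        rw [← ENNReal.rpow_mul, ← two_rpow_add, ← two_rpow_add]; congr 1; ring
      rw [this]
      calc 2 ^ p * 2 ^ p * (2 ^ (m : ℝ)) ^ p * G0 = 2 ^ p * 2 ^ p * G0 * (2 ^ (m : ℝ)) ^ p := by ring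
        _ ≤ _ := by gcongr

lemma le_dy_sum {W : ℝ≥0∞} {p : ℝ} (hp : 0 < p) :
    W ^ p ≤ ∑' n : ℤ, (2 : ℝ≥0∞) ^ (((n : ℝ) + 1) * p) * (if (2 : ℝ≥0∞) ^ (n : ℝ) < W then 1 else 0) := by
  rcases eq_or_ne W 0 with rfl | h0
  · simp [hp]
  rcases eq_or_ne W ∞ with rfl | ht
  · rw [ENNReal.top_rpow_of_pos hp, top_le_iff]
    refine ENNReal.eq_top_of_forall_nnreal_le fun c => ?_
    obtain ⟨n, hn⟩ := pow_unbounded_of_one_lt c (NNReal.one_lt_rpow (x := 2) (by norm_num) hp)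
    refine le_trans ?_ (ENNReal.le_tsum (n : ℤ))
    rw [if_pos (lt_top_iff_ne_top.2 (two_rpow_ne_top _)), mul_one]
    calc (c : ℝ≥0∞) ≤ (((2 : ℝ≥0) ^ p) ^ n : ℝ≥0) := by exact_mod_cast hn.le
      _ = ((2 : ℝ≥0∞) ^ p) ^ n := by
        push_cast; rw [ENNReal.coe_rpow_of_nonneg _ hp.le]; rfl
      _ ≤ _ := by
        rw [← ENNReal.rpow_natCast, ← ENNReal.rpow_mul]
        refine ENNReal.rpow_le_rpow_of_exponent_le (by norm_num) ?_
        push_cast; nlinarith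
  obtain ⟨n, h1, h2⟩ := exists_two_rpow h0 ht
  refine le_trans ?_ (ENNReal.le_tsum n)
  rw [if_pos h1, mul_one, ENNReal.rpow_mul]
  exact ENNReal.rpow_le_rpow h2 hp.le

section Lenglart
variable {Ω : Type*} [MeasurableSpace Ω] {μ : Measure Ω}
variable {θ : ℕ → Ω → Ω} {d e : ℕ → Ω → ℂ}

structure IsFun (θ : ℕ → Ω → Ω) (K : ℕ) (W : (ℕ → Ω → ℂ) → (ℕ → Ω → ℂ) → Ω → ℝ≥0∞) : Prop where
  loc : ∀ d e d' e' x, (∀ i < K, d i x = d' i x) → (∀ i < K, e i x = e' i x) → W d e x = W d' e' x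
  hom : ∀ (a b : ℝ) d e x, 0 < a → 0 < b →
    W (fun i x => (a : ℂ) * d i x) (fun i x => (b : ℂ) * e i x) x = ENNReal.ofReal (a * b) * W d e x
  meas : ∀ d e, IsDiff θ d → IsDiff θ e → Measurable (W d e)

open scoped Classical in
def tr (d e : ℕ → Ω → ℂ) (A B : ℝ) (i : ℕ) (x : Ω) : ℂ :=
  if Sq d (i + 1) x ≤ A ∧ Sq e (i + 1) x ≤ B then 1 else 0

lemma tr_pred (hd : IsDiff θ d) (he : IsDiff θ e) (A B : ℝ) : IsPred θ (tr d e A B) := by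
  unfold tr
  refine ⟨fun i => ?_, fun i j h x => ?_⟩
  · refine Measurable.ite ?_ measurable_const measurable_const
    exact (measurableSet_le (hd.Sq_meas _) measurable_const).inter
      (measurableSet_le (he.Sq_meas _) measurable_const)
  · have e1 := hd.Sq_pred'.inv i j h x
    have e2 := he.Sq_pred'.inv i j h x
    rw [e1, e2]

lemma tr_Sq (f : ℕ → Ω → ℂ) (A B : ℝ) (hA : 0 ≤ A) (hB : 0 ≤ B) (d e : ℕ → Ω → ℂ) (K : ℕ) (x : Ω) :
    Sq (fun i x => tr d e A B i x * d i x) K x ≤ min A (Sq d K x) ∧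
    Sq (fun i x => tr d e A B i x * e i x) K x ≤ min B (Sq e K x) := by
  classical
  induction K with
  | zero => simp [hA, hB]
  | succ K ih =>
    obtain ⟨h1, h2⟩ := ih
    have hn1 : ‖tr d e A B K x * d K x‖ ^ 2 = (if Sq d (K + 1) x ≤ A ∧ Sq e (K + 1) x ≤ B then 1 else 0) * ‖d K x‖ ^ 2 := by
      unfold tr; split_ifs <;> simp
    have hn2 : ‖tr d e A B K x * e K x‖ ^ 2 = (if Sq d (K + 1) x ≤ A ∧ Sq e (K + 1) x ≤ B then 1 else 0) * ‖e K x‖ ^ 2 := by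
      unfold tr; split_ifs <;> simp
    rw [Sq_succ (fun i x => tr d e A B i x * d i x) K, Sq_succ (fun i x => tr d e A B i x * e i x) K,
      hn1, hn2]
    have hd' := Sq_succ d K x
    have he' := Sq_succ e K x
    have p1 := sq_nonneg ‖d K x‖
    have p2 := sq_nonneg ‖e K x‖
    obtain ⟨h1, h1'⟩ := le_min_iff.1 h1
    obtain ⟨h2, h2'⟩ := le_min_iff.1 h2
    split_ifs with h
    · exact ⟨le_min (by linarith [h.1]) (by linarith), le_min (by linarith [h.2]) (by linarith)⟩
    · exact ⟨le_min (by linarith) (by linarith), le_min (by linarith) (by linarith)⟩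

lemma Sq_const (c : ℝ) (d : ℕ → Ω → ℂ) (K x) : Sq (fun i x => (c : ℂ) * d i x) K x = c ^ 2 * Sq d K x := by
  unfold Sq
  rw [Finset.mul_sum]
  refine Finset.sum_congr rfl fun i _ => ?_
  rw [norm_mul, mul_pow, Complex.norm_real, Real.norm_eq_abs, sq_abs]

lemma level {K : ℕ} {W} (hW : IsFun θ K W) {C0 : ℝ≥0} {j : ℕ} (hj : 0 < j)
    (hb : ∀ d e, IsDiff θ d → IsDiff θ e → ∫⁻ x, W d e x ^ j ∂μ ≤
      C0 * (L μ (fun x => Sq d K x ^ j) + L μ (fun x => Sq e K x ^ j)))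
    (hd : IsDiff θ d) (he : IsDiff θ e) {α β : ℝ} (hα : 0 < α) (hβ : 0 < β) :
    μ {x | ENNReal.ofReal (α * β) < W d e x} ≤ (C0 + 1) *
      (∫⁻ x, min 1 (ENNReal.ofReal (Sq d K x / α ^ 2)) ^ j ∂μ +
       ∫⁻ x, min 1 (ENNReal.ofReal (Sq e K x / β ^ 2)) ^ j ∂μ) := by
  set T := tr d e (α ^ 2) (β ^ 2) with hT
  have hTp : IsPred θ T := tr_pred hd he _ _
  set d' : ℕ → Ω → ℂ := fun i x => T i x * d i x with hd'
  set e' : ℕ → Ω → ℂ := fun i x => T i x * e i x with he'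
  have id' : IsDiff θ d' := hTp.mul_diff hd
  have ie' : IsDiff θ e' := hTp.mul_diff he
  set d2 : ℕ → Ω → ℂ := fun i x => ((α⁻¹ : ℝ) : ℂ) * d' i x with hd2
  set e2 : ℕ → Ω → ℂ := fun i x => ((β⁻¹ : ℝ) : ℂ) * e' i x with he2
  have id2 : IsDiff θ d2 := id'.const_mul _
  have ie2 : IsDiff θ e2 := ie'.const_mul _
  have hsub : {x | ENNReal.ofReal (α * β) < W d e x} ⊆
      {x | (1 : ℝ≥0∞) ≤ min 1 (ENNReal.ofReal (Sq d K x / α ^ 2)) ^ j} ∪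
      {x | (1 : ℝ≥0∞) ≤ min 1 (ENNReal.ofReal (Sq e K x / β ^ 2)) ^ j} ∪
      {x | (1 : ℝ≥0∞) ≤ W d2 e2 x ^ j} := by
    intro x hx
    simp only [Set.mem_setOf_eq] at hx
    by_cases h1 : Sq d K x ≤ α ^ 2
    · by_cases h2 : Sq e K x ≤ β ^ 2
      · right
        have hT1 : ∀ i < K, T i x = 1 := by
          intro i hi
          rw [hT]; unfold tr
          rw [if_pos ⟨(Sq_mono d x (by omega : i + 1 ≤ K)).trans h1,
            (Sq_mono e x (by omega : i + 1 ≤ K)).trans h2⟩]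
        have hl : W d' e' x = W d e x := hW.loc _ _ _ _ x
          (fun i hi => by simp only [hd', hT1 i hi, one_mul])
          (fun i hi => by simp only [he', hT1 i hi, one_mul])
        have hh := hW.hom α⁻¹ β⁻¹ d' e' x (by positivity) (by positivity)
        simp only [Set.mem_setOf_eq]
        refine one_le_pow₀ ?_
        change 1 ≤ W d2 e2 x
        rw [hd2, he2, hh, hl]
        calc (1 : ℝ≥0∞) = ENNReal.ofReal (α⁻¹ * β⁻¹) * ENNReal.ofReal (α * β) := by
              rw [← ENNReal.ofReal_mul (by positivity), ← ENNReal.ofReal_one]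
              congr 1; field_simp
          _ ≤ _ := by gcongr
      · left; right
        simp only [Set.mem_setOf_eq]
        refine one_le_pow₀ (le_min le_rfl ?_)
        rw [ENNReal.one_le_ofReal, one_le_div (by positivity)]; linarith
    · left; left
      simp only [Set.mem_setOf_eq]
      refine one_le_pow₀ (le_min le_rfl ?_)
      rw [ENNReal.one_le_ofReal, one_le_div (by positivity)]; linarith
  have mk : ∀ f : Ω → ℝ≥0∞, Measurable f → μ {x | (1 : ℝ≥0∞) ≤ f x} ≤ ∫⁻ x, f x ∂μ := by
    intro f hf
    have := mul_meas_ge_le_lintegral hf 1 (μ := μ)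
    rwa [one_mul] at this
  have m1 := hd.Sq_meas K
  have m2 := he.Sq_meas K
  have mW := hW.meas _ _ id2 ie2
  have hts := tr_Sq d (α ^ 2) (β ^ 2) (by positivity) (by positivity) d e K
  have gen : ∀ (a : ℝ) (f g : ℕ → Ω → ℂ), 0 < a → (∀ x, Sq f K x ≤ min (a ^ 2) (Sq g K x)) →
      L μ (fun x => Sq (fun i x => ((a⁻¹ : ℝ) : ℂ) * f i x) K x ^ j) ≤
      ∫⁻ x, min 1 (ENNReal.ofReal (Sq g K x / a ^ 2)) ^ j ∂μ := by
    intro a f g ha h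
    refine lintegral_mono fun x => ?_
    rw [ENNReal.ofReal_pow (Sq_nonneg _ _ _)]
    gcongr
    obtain ⟨h1, h2⟩ := le_min_iff.1 (h x)
    rw [Sq_const]
    have e1 : (a⁻¹) ^ 2 * Sq f K x = Sq f K x / a ^ 2 := by field_simp
    rw [e1]
    refine le_min ?_ ?_
    · rw [ENNReal.ofReal_le_one, div_le_one (by positivity)]; exact h1
    · exact ENNReal.ofReal_le_ofReal (by gcongr)
  have g1 := gen α d' d hα (fun x => (hts x).1)
  have g2 := gen β e' e hβ (fun x => (hts x).2)
  set I := ∫⁻ x, min 1 (ENNReal.ofReal (Sq d K x / α ^ 2)) ^ j ∂μ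
  set J := ∫⁻ x, min 1 (ENNReal.ofReal (Sq e K x / β ^ 2)) ^ j ∂μ
  calc _ ≤ μ ({x | (1 : ℝ≥0∞) ≤ min 1 (ENNReal.ofReal (Sq d K x / α ^ 2)) ^ j} ∪
      {x | (1 : ℝ≥0∞) ≤ min 1 (ENNReal.ofReal (Sq e K x / β ^ 2)) ^ j} ∪
      {x | (1 : ℝ≥0∞) ≤ W d2 e2 x ^ j}) := measure_mono hsub
    _ ≤ I + J + C0 * (I + J) := by
      refine (measure_union_le _ _).trans (add_le_add ((measure_union_le _ _).trans (add_le_add ?_ ?_)) ?_)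
      · exact mk _ (by fun_prop)
      · exact mk _ (by fun_prop)
      · refine (mk _ (by fun_prop)).trans ((hb d2 e2 id2 ie2).trans ?_)
        gcongr
    _ = _ := by ring

lemma level_sum {p p1 : ℝ} (hp : 0 < p) (hp1 : 0 < p1) {j : ℕ} (hj : p1 < 2 * j) : ∃ G : ℝ≥0∞, G ≠ ∞ ∧
    ∀ (X : Ω → ℝ), Measurable X → (∀ x, 0 ≤ X x) →
    ∑' n : ℤ, (2 : ℝ≥0∞) ^ (((n : ℝ) + 1) * p) *
      ∫⁻ x, min 1 (ENNReal.ofReal (X x / ((2 : ℝ) ^ ((n : ℝ) * (p / p1))) ^ 2)) ^ j ∂μ ≤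
      G * ∫⁻ x, ENNReal.ofReal (X x) ^ (p1 / 2) ∂μ := by
  obtain ⟨G, hG, h⟩ := dy_sum (p := p) (s := 2 * j * p / p1) hp (by
    rw [lt_div_iff₀ hp1]; nlinarith)
  refine ⟨G, hG, fun X hX hX0 => ?_⟩
  calc _ = ∫⁻ x, ∑' n : ℤ, (2 : ℝ≥0∞) ^ (((n : ℝ) + 1) * p) *
      min 1 (ENNReal.ofReal (X x / ((2 : ℝ) ^ ((n : ℝ) * (p / p1))) ^ 2)) ^ j ∂μ := by
        rw [lintegral_tsum (fun n => by fun_prop)]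
        refine tsum_congr fun n => ?_
        rw [lintegral_const_mul _ (by fun_prop)]
    _ ≤ ∫⁻ x, G * ENNReal.ofReal (X x) ^ (p1 / 2) ∂μ := by
        refine lintegral_mono fun x => ?_
        have := h (ENNReal.ofReal (X x) ^ (p1 / (2 * p)))
          (ENNReal.rpow_ne_top_of_nonneg (by positivity) ENNReal.ofReal_ne_top)
        rw [← ENNReal.rpow_mul] at this
        have e0 : p1 / (2 * p) * p = p1 / 2 := by field_simp
        rw [e0] at this
        refine le_trans (le_of_eq ?_) this
        refine tsum_congr fun n => ?_
        congr 1
        have e1 : ENNReal.ofReal (X x / ((2 : ℝ) ^ ((n : ℝ) * (p / p1))) ^ 2) =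
            (ENNReal.ofReal (X x) ^ (p1 / (2 * p)) * 2 ^ (-(n : ℝ))) ^ (2 * p / p1) := by
          rw [ENNReal.mul_rpow_of_nonneg _ _ (by positivity), ← ENNReal.rpow_mul, ← ENNReal.rpow_mul,
            show p1 / (2 * p) * (2 * p / p1) = 1 by field_simp, ENNReal.rpow_one, div_eq_mul_inv,
            ENNReal.ofReal_mul (hX0 x)]
          congr 1
          rw [← Real.rpow_natCast, ← Real.rpow_mul (by norm_num), ← Real.rpow_neg (by norm_num),
            ← ENNReal.ofReal_rpow_of_pos (by norm_num), ENNReal.ofReal_ofNat]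
          congr 1; push_cast; ring
        rw [e1, min_one_rpow _ (by positivity), ← ENNReal.rpow_natCast, ← ENNReal.rpow_mul]
        congr 1; ring
    _ = _ := lintegral_const_mul _ (by fun_prop)

theorem lenglart {p p1 p2 : ℝ} (hp : 0 < p) (hp1 : 0 < p1) (hp2 : 0 < p2) (hpp : 1 / p = 1 / p1 + 1 / p2)
    {j : ℕ} (hj1 : p1 < 2 * j) (hj2 : p2 < 2 * j) (C0 : ℝ≥0) : ∃ C : ℝ≥0, ∀ K W,
    IsFun θ K W → (∀ d e, IsDiff θ d → IsDiff θ e → ∫⁻ x, W d e x ^ j ∂μ ≤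
      C0 * (L μ (fun x => Sq d K x ^ j) + L μ (fun x => Sq e K x ^ j))) →
    ∀ d e, IsDiff θ d → IsDiff θ e → ∫⁻ x, W d e x ^ p ∂μ ≤
      C * (∫⁻ x, ENNReal.ofReal (Sq d K x) ^ (p1 / 2) ∂μ + ∫⁻ x, ENNReal.ofReal (Sq e K x) ^ (p2 / 2) ∂μ) := by
  obtain ⟨G1, hG1, h1⟩ := level_sum (μ := μ) hp hp1 hj1
  obtain ⟨G2, hG2, h2⟩ := level_sum (μ := μ) hp hp2 hj2
  have hE : (C0 + 1) * (G1 + G2) ≠ ∞ := ENNReal.mul_ne_top (by simp) (by simp [hG1, hG2])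
  refine ⟨((C0 + 1) * (G1 + G2)).toNNReal, fun K W hW hb d e hd he => ?_⟩
  rw [ENNReal.coe_toNNReal hE]
  have hj : 0 < j := by
    rcases Nat.eq_zero_or_pos j with rfl | h
    · simp at hj1; linarith
    · exact h
  have mW := hW.meas d e hd he
  have hsum : p / p1 + p / p2 = 1 := by
    have : p * (1 / p) = p * (1 / p1 + 1 / p2) := by rw [hpp]
    rw [mul_one_div_cancel hp.ne'] at this
    rw [this]; ring
  have hlev : ∀ n : ℤ, μ {x | (2 : ℝ≥0∞) ^ (n : ℝ) < W d e x} ≤ (C0 + 1) *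
      (∫⁻ x, min 1 (ENNReal.ofReal (Sq d K x / ((2 : ℝ) ^ ((n : ℝ) * (p / p1))) ^ 2)) ^ j ∂μ +
       ∫⁻ x, min 1 (ENNReal.ofReal (Sq e K x / ((2 : ℝ) ^ ((n : ℝ) * (p / p2))) ^ 2)) ^ j ∂μ) := by
    intro n
    have := level (μ := μ) hW hj hb hd he (α := (2 : ℝ) ^ ((n : ℝ) * (p / p1)))
      (β := (2 : ℝ) ^ ((n : ℝ) * (p / p2))) (by positivity) (by positivity)
    rw [← Real.rpow_add (by norm_num), ← mul_add, hsum, mul_one,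
      ← ENNReal.ofReal_rpow_of_pos (by norm_num), ENNReal.ofReal_ofNat] at this
    exact this
  have mset : ∀ n : ℤ, MeasurableSet {x | (2 : ℝ≥0∞) ^ (n : ℝ) < W d e x} := fun n =>
    measurableSet_lt measurable_const mW
  have mind : ∀ n : ℤ, Measurable (fun x => if (2 : ℝ≥0∞) ^ (n : ℝ) < W d e x then (1 : ℝ≥0∞) else 0) :=
    fun n => Measurable.ite (mset n) measurable_const measurable_const
  set I := ∫⁻ x, ENNReal.ofReal (Sq d K x) ^ (p1 / 2) ∂μ
  set J := ∫⁻ x, ENNReal.ofReal (Sq e K x) ^ (p2 / 2) ∂μ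
  calc _ ≤ ∫⁻ x, ∑' n : ℤ, (2 : ℝ≥0∞) ^ (((n : ℝ) + 1) * p) *
        (if (2 : ℝ≥0∞) ^ (n : ℝ) < W d e x then 1 else 0) ∂μ := lintegral_mono fun x => le_dy_sum hp
    _ = ∑' n : ℤ, (2 : ℝ≥0∞) ^ (((n : ℝ) + 1) * p) * μ {x | (2 : ℝ≥0∞) ^ (n : ℝ) < W d e x} := by
        rw [lintegral_tsum (fun n => ((mind n).const_mul _).aemeasurable)]
        refine tsum_congr fun n => ?_
        rw [lintegral_const_mul _ (mind n), ← lintegral_indicator_one (mset n)]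
        congr 1
        refine lintegral_congr fun x => ?_
        simp [Set.indicator_apply]
    _ ≤ ∑' n : ℤ, (C0 + 1) * ((2 : ℝ≥0∞) ^ (((n : ℝ) + 1) * p) *
          ∫⁻ x, min 1 (ENNReal.ofReal (Sq d K x / ((2 : ℝ) ^ ((n : ℝ) * (p / p1))) ^ 2)) ^ j ∂μ +
          (2 : ℝ≥0∞) ^ (((n : ℝ) + 1) * p) *
          ∫⁻ x, min 1 (ENNReal.ofReal (Sq e K x / ((2 : ℝ) ^ ((n : ℝ) * (p / p2))) ^ 2)) ^ j ∂μ) := by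
        refine ENNReal.tsum_le_tsum fun n => ?_
        refine (mul_le_mul_right (hlev n) _).trans (le_of_eq ?_)
        ring
    _ ≤ (C0 + 1) * (G1 * I + G2 * J) := by
        rw [ENNReal.tsum_mul_left, ENNReal.tsum_add]
        gcongr
        · exact h1 _ (hd.Sq_meas K) (Sq_nonneg d K)
        · exact h2 _ (he.Sq_meas K) (Sq_nonneg e K)
    _ ≤ (C0 + 1) * ((G1 + G2) * I + (G1 + G2) * J) := by
        gcongr
        · exact le_self_add
        · exact le_add_self
    _ = _ := by ring
end Lenglart
end VP

namespace VP

lemma ofReal_norm_rpow (z : ℂ) {r : ℝ} (hr : 0 ≤ r) : ENNReal.ofReal (‖z‖ ^ r) = ‖z‖ₑ ^ r := by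
  rw [← ENNReal.ofReal_rpow_of_nonneg (norm_nonneg _) hr, ofReal_norm]

lemma exists_pow_two_gt (a : ℝ) : ∃ k : ℕ, a < 2 * ((2 * 2 ^ k : ℕ) : ℝ) := by
  obtain ⟨k, hk⟩ := pow_unbounded_of_one_lt a (one_lt_two)
  exact ⟨k, by push_cast; linarith [show (0:ℝ) < 2 ^ k by positivity]⟩

lemma mul_le_sq_add (a b : ℝ≥0∞) : a * b ≤ a * a + b * b := by
  rcases le_total a b with h | h
  · exact (mul_le_mul_left h b).trans le_add_self
  · exact (mul_le_mul_right h a).trans le_self_add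

section
variable {Ω : Type*} [MeasurableSpace Ω] {μ : Measure Ω}
variable {θ : ℕ → Ω → Ω} {d e : ℕ → Ω → ℂ}

/-- pathwise variation of partial sums and of the area -/
def VS (d : ℕ → Ω → ℂ) (q : ℝ) (K : ℕ) (x : Ω) : ℝ≥0∞ :=
  Var (fun s t => ‖S d t x - S d s x‖ₑ ^ q) 0 K
def VP (d e : ℕ → Ω → ℂ) (r : ℝ) (K : ℕ) (x : Ω) : ℝ≥0∞ :=
  Var (fun s t => ‖Pi d e s t x‖ₑ ^ r) 0 K

lemma VS_le (d e : ℕ → Ω → ℂ) {r : ℝ} (hr : 0 < r) (K x) : VS d (2 * r) K x ≤ Vhat d e r K x := by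
  refine Var_le_of_sum fun a b _ hab _ => ?_
  rw [← ofReal_norm_rpow _ (by positivity)]
  exact S_term d e hr hab x

lemma VP_le (d e : ℕ → Ω → ℂ) {r : ℝ} (hr : 0 < r) (K x) : VP d e r K x ≤ Vhat d e r K x := by
  refine Var_le_of_sum fun a b _ hab _ => ?_
  rw [← ofReal_norm_rpow _ hr.le]
  exact Pi_term d e hr hab x

lemma S_congr {d d' : ℕ → Ω → ℂ} {x : Ω} {K t : ℕ} (h : ∀ i < K, d i x = d' i x) (ht : t ≤ K) :
    S d t x = S d' t x :=
  Finset.sum_congr rfl fun i hi => h i (by have := Finset.mem_range.1 hi; omega)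

lemma S_const (c : ℂ) (d : ℕ → Ω → ℂ) (n x) : S (fun i x => c * d i x) n x = c * S d n x := by
  unfold S; rw [Finset.mul_sum]

lemma VS_congr {d d' : ℕ → Ω → ℂ} {x : Ω} {K : ℕ} (q : ℝ) (h : ∀ i < K, d i x = d' i x) :
    VS d q K x = VS d' q K x := by
  apply le_antisymm <;> refine Var_mono le_rfl le_rfl fun a b _ hab hb => le_of_eq ?_ <;>
  rw [S_congr h hb, S_congr h (hab.trans hb)]

lemma VP_congr {d d' e e' : ℕ → Ω → ℂ} {x : Ω} {K : ℕ} (r : ℝ) (h : ∀ i < K, d i x = d' i x)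
    (h' : ∀ i < K, e i x = e' i x) : VP d e r K x = VP d' e' r K x := by
  have hz : ∀ i < K, Zd d e i x = Zd d' e' i x := fun i hi => by
    unfold Zd; rw [S_congr h hi.le, h' i hi]
  apply le_antisymm <;> refine Var_mono le_rfl le_rfl fun a b _ hab hb => le_of_eq ?_ <;>
  · unfold Pi
    rw [S_congr h (hab.trans hb), S_congr h' hb, S_congr h' (hab.trans hb), S_congr hz hb,
      S_congr hz (hab.trans hb)]

lemma VS_const {a : ℝ} (ha : 0 < a) (d : ℕ → Ω → ℂ) {q : ℝ} (hq : 0 ≤ q) (K x) :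
    VS (fun i x => (a : ℂ) * d i x) q K x = ENNReal.ofReal a ^ q * VS d q K x := by
  unfold VS
  rw [← Var_const_mul]
  congr 1; funext s t
  rw [S_const, S_const, ← mul_sub, enorm_mul, ENNReal.mul_rpow_of_nonneg _ _ hq]
  congr 2
  rw [← ofReal_norm, Complex.norm_real, Real.norm_of_nonneg ha.le]

lemma VP_const {a b : ℝ} (ha : 0 < a) (hb : 0 < b) (d e : ℕ → Ω → ℂ) {r : ℝ} (hr : 0 ≤ r) (K x) :
    VP (fun i x => (a : ℂ) * d i x) (fun i x => (b : ℂ) * e i x) r K x =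
      ENNReal.ofReal (a * b) ^ r * VP d e r K x := by
  unfold VP
  rw [← Var_const_mul]
  congr 1; funext s t
  have : Pi (fun i x => (a : ℂ) * d i x) (fun i x => (b : ℂ) * e i x) s t x =
      ((a * b : ℝ) : ℂ) * Pi d e s t x := by
    have hz : Zd (fun i x => (a : ℂ) * d i x) (fun i x => (b : ℂ) * e i x) =
        fun i x => ((a : ℂ) * b) * Zd d e i x := by
      funext i x; unfold Zd; rw [S_const]; ring
    unfold Pi
    rw [hz, S_const, S_const, S_const, S_const, S_const]; push_cast; ring
  rw [this, enorm_mul, ENNReal.mul_rpow_of_nonneg _ _ hr]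
  congr 2
  rw [← ofReal_norm, Complex.norm_real, Real.norm_of_nonneg (by positivity)]

lemma VS_meas (hd : ∀ i, Measurable (d i)) (q : ℝ) (K) : Measurable (VS d q K) := by
  unfold VS
  refine Var_measurable (fun s t x => ‖S d t x - S d s x‖ₑ ^ q) (fun a b => ?_) 0 K
  have h1 : ∀ n, Measurable (S d n) := fun n => Finset.measurable_sum _ fun i _ => hd i
  have := h1 a; have := h1 b; fun_prop

lemma VP_meas (hd : ∀ i, Measurable (d i)) (he : ∀ i, Measurable (e i)) (r : ℝ) (K) :
    Measurable (VP d e r K) := by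
  unfold VP
  refine Var_measurable (fun s t x => ‖Pi d e s t x‖ₑ ^ r) (fun a b => ?_) 0 K
  have h1 : ∀ n, Measurable (S d n) := fun n => Finset.measurable_sum _ fun i _ => hd i
  have h2 : ∀ n, Measurable (S e n) := fun n => Finset.measurable_sum _ fun i _ => he i
  have h3 : ∀ n, Measurable (S (Zd d e) n) := fun n => Finset.measurable_sum _ fun i _ =>
    (h1 i).mul (he i)
  have := h1 a; have := h2 a; have := h2 b; have := h3 a; have := h3 b
  unfold Pi; fun_prop

theorem V2 (hθ : ∀ n, MeasurePreserving (θ n) μ μ) {r p p1 p2 : ℝ} (hr : 1 < r) (hp : 0 < p)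
    (hp1 : 0 < p1) (hp2 : 0 < p2) (hpp : 1 / p = 1 / p1 + 1 / p2) : ∃ C : ℝ≥0, ∀ (d e : ℕ → Ω → ℂ) (K : ℕ),
    IsDiff θ d → IsDiff θ e → ∫⁻ x, VP d e r K x ^ (p / r) ∂μ ≤
      C * (∫⁻ x, ENNReal.ofReal (Sq d K x) ^ (p1 / 2) ∂μ + ∫⁻ x, ENNReal.ofReal (Sq e K x) ^ (p2 / 2) ∂μ) := by
  obtain ⟨k, hk⟩ := exists_pow_two_gt (max p1 p2)
  obtain ⟨C0, h0⟩ := propA (μ := μ) hθ hr k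
  have hr0 : 0 < r := by linarith
  set j := 2 * 2 ^ k with hj
  obtain ⟨C, hC⟩ := lenglart (θ := θ) (μ := μ) hp hp1 hp2 hpp (j := j)
    ((le_max_left _ _).trans_lt hk) ((le_max_right _ _).trans_lt hk) C0
  refine ⟨C, fun d e K hd he => ?_⟩
  have := hC K (fun d e x => VP d e r K x ^ (1 / r)) ⟨?_, ?_, ?_⟩ ?_ d e hd he
  · refine le_trans (le_of_eq ?_) this
    refine lintegral_congr fun x => ?_
    rw [← ENNReal.rpow_mul]; congr 1; ring
  · intro d e d' e' x h h'
    simp only [VP_congr r h h']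
  · intro a b d e x ha hb
    simp only [VP_const ha hb d e hr0.le, ENNReal.mul_rpow_of_nonneg _ _ (one_div_nonneg.2 hr0.le)]
    rw [← ENNReal.rpow_mul, mul_one_div_cancel hr0.ne', ENNReal.rpow_one]
  · intro d e hd he
    have := VP_meas hd.meas he.meas r K
    fun_prop
  · intro d e hd he
    refine le_trans (lintegral_mono fun x => ?_) (h0 d e K hd he)
    simp only
    rw [← ENNReal.rpow_natCast, ← ENNReal.rpow_mul, one_div_mul_eq_div]
    exact ENNReal.rpow_le_rpow (VP_le d e hr0 K x) (by positivity)

theorem V1 (hθ : ∀ n, MeasurePreserving (θ n) μ μ) {q p : ℝ} (hq : 2 < q) (hp : 0 < p) :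
    ∃ C : ℝ≥0, ∀ (d : ℕ → Ω → ℂ) (K : ℕ), IsDiff θ d → ∫⁻ x, VS d q K x ^ (p / q) ∂μ ≤
      C * ∫⁻ x, ENNReal.ofReal (Sq d K x) ^ (p / 2) ∂μ := by
  obtain ⟨r, rfl⟩ : ∃ r, q = 2 * r := ⟨q / 2, by ring⟩
  have hr : 1 < r := by linarith
  obtain ⟨k, hk⟩ := exists_pow_two_gt p
  obtain ⟨C0, h0⟩ := propA (μ := μ) hθ hr k
  have hr0 : 0 < r := by linarith
  set j := 2 * 2 ^ k with hj
  obtain ⟨C, hC⟩ := lenglart (θ := θ) (μ := μ) (p := p / 2) (by positivity) hp hp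
    (by field_simp; norm_num) (j := j) hk hk (2 * C0)
  refine ⟨2 * C, fun d K hd => ?_⟩
  have hi : 0 ≤ 1 / (2 * r) := by positivity
  have := hC K (fun d e x => VS d (2 * r) K x ^ (1 / (2 * r)) * VS e (2 * r) K x ^ (1 / (2 * r)))
    ⟨?_, ?_, ?_⟩ ?_ d d hd hd
  · have e1 : ∫⁻ x, VS d (2 * r) K x ^ (p / (2 * r)) ∂μ =
      ∫⁻ x, (VS d (2 * r) K x ^ (1 / (2 * r)) * VS d (2 * r) K x ^ (1 / (2 * r))) ^ (p / 2) ∂μ := by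
      refine lintegral_congr fun x => ?_
      rw [← ENNReal.rpow_add_of_nonneg _ _ hi hi, ← ENNReal.rpow_mul]
      congr 1; field_simp; norm_num
    rw [e1]
    refine this.trans (le_of_eq ?_)
    push_cast; ring
  · intro d e d' e' x h h'
    simp only [VS_congr _ h, VS_congr _ h']
  · intro a b d e x ha hb
    simp only [VS_const ha d (by positivity : 0 ≤ 2 * r), VS_const hb e (by positivity : 0 ≤ 2 * r),
      ENNReal.mul_rpow_of_nonneg _ _ hi]
    rw [← ENNReal.rpow_mul, ← ENNReal.rpow_mul, mul_one_div_cancel (by positivity), ENNReal.rpow_one,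
      ENNReal.rpow_one, ENNReal.ofReal_mul ha.le]
    ring
  · intro d e hd he
    have := VS_meas hd.meas (2 * r) K
    have := VS_meas he.meas (2 * r) K
    fun_prop
  · intro d e hd he
    have a1 := h0 d e K hd he
    have a2 := h0 e d K he hd
    have m1 := Vhat_meas hd he r K
    calc _ ≤ ∫⁻ x, Vhat d e r K x ^ ((j : ℝ) / r) + Vhat e d r K x ^ ((j : ℝ) / r) ∂μ := by
          refine lintegral_mono fun x => ?_
          have key : ∀ y : ℝ≥0∞, y ^ ((j : ℝ) / r) = (y ^ (1 / (2 * r))) ^ j * (y ^ (1 / (2 * r))) ^ j := by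
            intro y
            rw [← ENNReal.rpow_natCast, ← ENNReal.rpow_mul,
              ← ENNReal.rpow_add_of_nonneg _ _ (by positivity) (by positivity)]
            congr 1; field_simp; norm_num
          rw [key, key]
          refine le_trans ?_ (mul_le_sq_add _ _)
          simp only
          rw [mul_pow]
          gcongr
          · exact VS_le d e hr0 K x
          · exact VS_le e d hr0 K x
      _ ≤ _ := by
        rw [lintegral_add_left (by fun_prop)]
        refine (add_le_add a1 a2).trans (le_of_eq ?_)
        push_cast; ring

theorem bdg_all (hθ : ∀ n, MeasurePreserving (θ n) μ μ) {p : ℝ} (hp : 0 < p) :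
    ∃ C : ℝ≥0, ∀ (d : ℕ → Ω → ℂ) (K : ℕ), IsDiff θ d → ∫⁻ x, ‖S d K x‖ₑ ^ p ∂μ ≤
      C * ∫⁻ x, ENNReal.ofReal (Sq d K x) ^ (p / 2) ∂μ := by
  obtain ⟨C, h⟩ := V1 (μ := μ) hθ (q := 3) (by norm_num) hp
  refine ⟨C, fun d K hd => le_trans (lintegral_mono fun x => ?_) (h d K hd)⟩
  have h1 := single_le_Var (fun s t => ‖S d t x - S d s x‖ₑ ^ (3:ℝ)) (le_refl 0) (Nat.zero_le K) le_rfl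
  have := ENNReal.rpow_le_rpow h1 (by positivity : 0 ≤ p / 3)
  rw [← ENNReal.rpow_mul, S_zero, sub_zero, mul_div_cancel₀ _ (by norm_num)] at this
  exact this

/-- Garsia -/
lemma rpow_sub_le {a b s : ℝ} (ha : 0 ≤ a) (hab : a ≤ b) (hs : 1 ≤ s) :
    b ^ s ≤ a ^ s + s * (b ^ (s - 1) * (b - a)) := by
  rcases (ha.trans hab).eq_or_lt with h0 | hb
  · have : a = b := le_antisymm hab (by rw [← h0]; exact ha)
    subst this; simp
  have h := one_add_mul_self_le_rpow_one_add (s := a / b - 1) (by have : 0 ≤ a / b := by positivity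
                                                                  linarith) hs
  rw [add_sub_cancel, Real.div_rpow ha hb.le, le_div_iff₀ (by positivity)] at h
  have e : b ^ s = b ^ (s - 1) * b := by
    nth_rewrite 3 [← Real.rpow_one b]
    rw [← Real.rpow_add hb]; congr 1; ring
  have e2 : (1 + s * (a / b - 1)) * b ^ s = b ^ s + s * (b ^ (s - 1) * (a - b)) := by
    rw [e]; field_simp
  rw [e2] at h
  linarith

lemma young_half {A f s : ℝ} (hA : 0 ≤ A) (hf : 0 ≤ f) (hs : 1 ≤ s) :
    s * (A ^ (s - 1) * f) ≤ 1 / 2 * A ^ s + s * (2 * s) ^ (s - 1) * f ^ s := by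
  have hp : ∀ y : ℝ, 0 ≤ y → y ^ (s - 1) * y = y ^ s := by
    intro y hy
    nth_rewrite 2 [← Real.rpow_one y]
    rw [← Real.rpow_add' hy (by linarith)]; congr 1; ring
  rcases le_total (2 * s * f) A with h | h
  · have : s * (A ^ (s - 1) * f) ≤ 1 / 2 * A ^ s := by
      rw [← hp A hA]
      have := mul_le_mul_of_nonneg_left h (Real.rpow_nonneg hA (s - 1))
      linarith
    have h2 : 0 ≤ s * (2 * s) ^ (s - 1) * f ^ s := by positivity
    linarith
  · have : A ^ (s - 1) ≤ (2 * s * f) ^ (s - 1) := Real.rpow_le_rpow hA h (by linarith)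
    rw [Real.mul_rpow (by positivity) hf] at this
    calc s * (A ^ (s - 1) * f) ≤ s * ((2 * s) ^ (s - 1) * f ^ (s - 1) * f) := by gcongr
      _ = s * (2 * s) ^ (s - 1) * f ^ s := by rw [← hp f hf]; ring
      _ ≤ _ := by have : 0 ≤ 1 / 2 * A ^ s := by positivity
                  linarith

theorem garsia (hθ : ∀ n, MeasurePreserving (θ n) μ μ) {p : ℝ} (hp : 2 ≤ p) :
    ∃ C : ℝ≥0, ∀ (d : ℕ → Ω → ℂ) (K : ℕ), IsDiff θ d →
    ∫⁻ x, ENNReal.ofReal (Sq d K x) ^ (p / 2) ∂μ ≠ ∞ →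
    ∫⁻ x, ENNReal.ofReal (Sq d K x) ^ (p / 2) ∂μ ≤ C * ∫⁻ x, ‖S d K x‖ₑ ^ p ∂μ := by
  set s := p / 2 with hs
  have hs1 : 1 ≤ s := by rw [hs]; linarith
  refine ⟨2 * (s * (2 * s) ^ (s - 1)).toNNReal, fun d K hd hfin => ?_⟩
  have e1 : ∫⁻ x, ENNReal.ofReal (Sq d K x) ^ s ∂μ = L μ (fun x => Sq d K x ^ s) :=
    lintegral_congr fun x => ENNReal.ofReal_rpow_of_nonneg (Sq_nonneg _ _ _) (by linarith)
  have e2 : ∫⁻ x, ‖S d K x‖ₑ ^ p ∂μ = L μ (fun x => (‖S d K x‖ ^ 2) ^ s) := by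
    refine lintegral_congr fun x => ?_
    rw [← ofReal_norm_rpow _ (by linarith)]
    congr 1
    simp only
    rw [← Real.rpow_natCast, ← Real.rpow_mul (norm_nonneg _)]
    congr 1; rw [hs]; push_cast; ring
  rw [e1] at hfin
  rw [e1, e2]
  have mS : ∀ n, Measurable (S d n) := fun n => hd.S_pred.meas n
  have mq : ∀ n, Measurable (Sq d n) := fun n => hd.Sq_meas n
  have step1 : ∀ m x, Sq d m x ^ s ≤ s * ∑ n ∈ Finset.range m, Sq d (n + 1) x ^ (s - 1) * ‖d n x‖ ^ 2 := by
    intro m x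
    induction m with
    | zero => simp [Real.zero_rpow (by linarith : s ≠ 0)]
    | succ m ih =>
      rw [Finset.sum_range_succ, mul_add]
      have := rpow_sub_le (Sq_nonneg d m x) (Sq_mono d x (Nat.le_succ m)) hs1
      have e3 : Sq d (m + 1) x - Sq d m x = ‖d m x‖ ^ 2 := by rw [Sq_succ]; ring
      simp only [Nat.succ_eq_add_one, e3] at this
      linarith
  have step2 : ∀ m, L μ (fun x => ∑ n ∈ Finset.range m, Sq d (n + 1) x ^ (s - 1) * ‖d n x‖ ^ 2) ≤
      L μ (fun x => Sq d m x ^ (s - 1) * ‖S d m x‖ ^ 2) := by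
    intro m
    induction m with
    | zero => simp [L]
    | succ m ih =>
      have mdm := hd.meas m
      have m1 := mq (m + 1)
      have h := L_orth hθ hd m (ρ := fun x => Sq d (m + 1) x ^ (s - 1)) (by fun_prop)
        (fun x => Real.rpow_nonneg (Sq_nonneg _ _ _) _)
        (fun x => by rw [hd.Sq_pred'.inv m m le_rfl x]) (mS m) (fun x => hd.S_pred.inv m m le_rfl x)
      simp only [S_succ]
      rw [h]
      simp only [Finset.sum_range_succ]
      have mm : Measurable fun x => ∑ n ∈ Finset.range m, Sq d (n + 1) x ^ (s - 1) * ‖d n x‖ ^ 2 := by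
        refine Finset.measurable_sum _ fun n _ => ?_
        have := hd.meas n; have := mq (n + 1); fun_prop
      refine (L_add_le mm).trans (add_le_add (ih.trans (L_mono fun x => ?_)) le_rfl)
      have := Real.rpow_le_rpow (Sq_nonneg d m x) (Sq_mono d x (Nat.le_succ m)) (by linarith : 0 ≤ s - 1)
      gcongr
  have step3 : L μ (fun x => Sq d K x ^ s) ≤ ENNReal.ofReal (1 / 2) * L μ (fun x => Sq d K x ^ s) +
      ENNReal.ofReal (s * (2 * s) ^ (s - 1)) * L μ (fun x => (‖S d K x‖ ^ 2) ^ s) := by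
    calc _ ≤ L μ (fun x => s * ∑ n ∈ Finset.range K, Sq d (n + 1) x ^ (s - 1) * ‖d n x‖ ^ 2) :=
          L_mono (step1 K)
      _ ≤ ENNReal.ofReal s * L μ (fun x => Sq d K x ^ (s - 1) * ‖S d K x‖ ^ 2) := by
          rw [L_mul (by linarith)]; gcongr; exact step2 K
      _ = L μ (fun x => s * (Sq d K x ^ (s - 1) * ‖S d K x‖ ^ 2)) := by rw [L_mul (by linarith)]
      _ ≤ L μ (fun x => 1 / 2 * Sq d K x ^ s + s * (2 * s) ^ (s - 1) * (‖S d K x‖ ^ 2) ^ s) :=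
          L_mono fun x => young_half (Sq_nonneg _ _ _) (by positivity) hs1
      _ ≤ _ := by
          have := mq K
          refine (L_add_le (by fun_prop)).trans (le_of_eq ?_)
          rw [L_mul (by norm_num), L_mul (by positivity)]
  have := absorb (by norm_num) (by norm_num) hfin step3
  refine this.trans (le_of_eq ?_)
  rw [← mul_assoc]
  congr 1
  push_cast
  congr 1
  norm_num
end
end VP

namespace VP

/-- Jensen for a nonnegative kernel -/
lemma jensen {Ω : Type*} [MeasurableSpace Ω] {μ : Measure Ω} {κ v : Ω → ℝ≥0∞}
    (hκ : AEMeasurable κ μ) (hv : AEMeasurable v μ) {s : ℝ} (hs : 1 < s) :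
    (∫⁻ y, κ y * v y ∂μ) ^ s ≤ (∫⁻ y, κ y ∂μ) ^ (s - 1) * ∫⁻ y, κ y * v y ^ s ∂μ := by
  have hs0 : 0 < s := by linarith
  have hs1 : 0 < s - 1 := by linarith
  have hc : (s / (s - 1)).HolderConjugate s := (Real.HolderConjugate.conjExponent hs).symm
  have h1 : ∀ y, κ y * v y = (κ y) ^ (1 - 1 / s) * ((κ y) ^ (1 / s) * v y) := by
    intro y
    rw [← mul_assoc, ← ENNReal.rpow_add_of_nonneg]
    · simp
    · rw [sub_nonneg, div_le_one hs0]; exact hs.le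
    · positivity
  have h2 := ENNReal.lintegral_mul_le_Lp_mul_Lq μ hc (f := fun y => (κ y) ^ (1 - 1 / s))
    (g := fun y => (κ y) ^ (1 / s) * v y) (hκ.pow_const _) ((hκ.pow_const _).mul hv)
  have h3 : ∫⁻ y, κ y * v y ∂μ ≤ (∫⁻ y, κ y ∂μ) ^ (1 / (s / (s - 1))) *
      (∫⁻ y, κ y * v y ^ s ∂μ) ^ (1 / s) := by
    calc _ = ∫⁻ y, ((fun y => (κ y) ^ (1 - 1 / s)) * (fun y => (κ y) ^ (1 / s) * v y)) y ∂μ := by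
          apply lintegral_congr; intro y; exact h1 y
      _ ≤ _ := h2
      _ = _ := by
          congr 2
          · apply lintegral_congr; intro y
            rw [← ENNReal.rpow_mul, show (1 - 1 / s) * (s / (s - 1)) = 1 by field_simp, ENNReal.rpow_one]
          · apply lintegral_congr; intro y
            rw [ENNReal.mul_rpow_of_nonneg _ _ hs0.le, ← ENNReal.rpow_mul,
              show 1 / s * s = 1 by field_simp, ENNReal.rpow_one]
  calc _ ≤ ((∫⁻ y, κ y ∂μ) ^ (1 / (s / (s - 1))) * (∫⁻ y, κ y * v y ^ s ∂μ) ^ (1 / s)) ^ s :=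
        ENNReal.rpow_le_rpow h3 hs0.le
    _ = _ := by
        rw [ENNReal.mul_rpow_of_nonneg _ _ hs0.le, ← ENNReal.rpow_mul, ← ENNReal.rpow_mul,
          show 1 / (s / (s - 1)) * s = s - 1 by field_simp, show 1 / s * s = 1 by field_simp, ENNReal.rpow_one]

/-! ### dyadic cells -/

def cell (n : ℤ) (x : ℝ) : ℤ := ⌊(2 : ℝ) ^ n * x⌋

lemma two_zpow_pos (n : ℤ) : (0 : ℝ) < 2 ^ n := by positivity

lemma cell_measurable (n : ℤ) : Measurable (cell n) :=
  Int.measurable_floor.comp (measurable_const.mul measurable_id)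

lemma cell_pred (n : ℤ) (x : ℝ) : cell (n - 1) x = cell n x / 2 := by
  unfold cell
  rw [zpow_sub_one₀ two_ne_zero, show (2 : ℝ) ^ n * 2⁻¹ * x = (2 ^ n * x) / (2 : ℕ) by push_cast; ring,
    Int.floor_div_natCast]
  rfl

lemma cell_eq_mono {m n : ℤ} (h : m ≤ n) {x y : ℝ} (hxy : cell n x = cell n y) :
    cell m x = cell m y := by
  obtain ⟨k, rfl⟩ := Int.le.dest h
  induction k with
  | zero => simpa using hxy
  | succ k ih =>
    apply ih (by omega)
    rw [show m + k = (m + ((k + 1 : ℕ) : ℤ)) - 1 by push_cast; ring, cell_pred, cell_pred, hxy]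

lemma cell_preimage (n c : ℤ) :
    {y | cell n y = c} = Set.Ico ((c : ℝ) / 2 ^ n) ((c + 1) / 2 ^ n) := by
  ext y
  have := two_zpow_pos n
  simp only [cell, Set.mem_setOf_eq, Int.floor_eq_iff, Set.mem_Ico, div_le_iff₀ this, lt_div_iff₀ this,
    mul_comm]

lemma cell_volume (n c : ℤ) : volume {y | cell n y = c} = ENNReal.ofReal ((2 ^ n)⁻¹) := by
  rw [cell_preimage, Real.volume_Ico]; congr 1; ring

def er (n : ℤ) (x y : ℝ) : ℝ := if cell n x = cell n y then 2 ^ n else 0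

lemma er_nonneg (n x y) : 0 ≤ er n x y := by unfold er; split_ifs <;> positivity
lemma er_symm (n x y) : er n x y = er n y x := by unfold er; simp only [eq_comm]
lemma er_meas (n : ℤ) : Measurable (fun z : ℝ × ℝ => er n z.1 z.2) := by
  unfold er
  refine Measurable.ite ?_ measurable_const measurable_const
  exact measurableSet_eq_fun ((cell_measurable n).comp measurable_fst) ((cell_measurable n).comp measurable_snd)
lemma er_meas' (n : ℤ) (x) : Measurable (fun y : ℝ => er n x y) :=
  (er_meas n).comp (measurable_const.prodMk measurable_id)
lemma er_congr {n : ℤ} {x x' : ℝ} (h : cell n x = cell n x') (y) : er n x y = er n x' y := by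
  unfold er; rw [h]

lemma er_eq_ind (n : ℤ) (x y : ℝ) : ENNReal.ofReal (er n x y) =
    {y | cell n y = cell n x}.indicator (fun _ => ENNReal.ofReal (2 ^ n)) y := by
  unfold er Set.indicator
  by_cases h : cell n x = cell n y
  · simp [h]
  · simp [h, Ne.symm h]

lemma lint_er (n : ℤ) (x : ℝ) : ∫⁻ y, ENNReal.ofReal (er n x y) = 1 := by
  simp_rw [er_eq_ind]
  rw [lintegral_indicator (show MeasurableSet {y | cell n y = cell n x} from (cell_measurable n) (measurableSet_singleton _)), lintegral_const,
    Measure.restrict_apply MeasurableSet.univ, Set.univ_inter, cell_volume,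
    ← ENNReal.ofReal_mul (two_zpow_pos n).le, mul_inv_cancel₀ (two_zpow_pos n).ne', ENNReal.ofReal_one]

lemma lint_er' (n : ℤ) (y : ℝ) : ∫⁻ x, ENNReal.ofReal (er n x y) = 1 := by
  simp_rw [er_symm n _ y]; exact lint_er n y

def EE (n : ℤ) (v : ℝ → ℝ≥0∞) (x : ℝ) : ℝ≥0∞ := ∫⁻ y, ENNReal.ofReal (er n x y) * v y

lemma EE_congr {n : ℤ} {v : ℝ → ℝ≥0∞} {x x' : ℝ} (h : cell n x = cell n x') : EE n v x = EE n v x' := by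
  unfold EE; simp_rw [er_congr h]

lemma EE_meas (n : ℤ) {v : ℝ → ℝ≥0∞} (hv : Measurable v) : Measurable (EE n v) := by
  unfold EE
  apply Measurable.lintegral_prod_right' (f := fun z : ℝ × ℝ => ENNReal.ofReal (er n z.1 z.2) * v z.2)
  exact (er_meas n).ennreal_ofReal.mul (hv.comp measurable_snd)

lemma EE_dual (n : ℤ) {v ρ : ℝ → ℝ≥0∞} (hv : Measurable v) (hρ : Measurable ρ)
    (hc : ∀ x y, cell n x = cell n y → ρ x = ρ y) : ∫⁻ x, ρ x * EE n v x = ∫⁻ x, ρ x * v x := by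
  unfold EE
  calc _ = ∫⁻ x, ∫⁻ y, ρ x * (ENNReal.ofReal (er n x y) * v y) := by
        apply lintegral_congr; intro x
        rw [lintegral_const_mul]
        exact (er_meas' n x).ennreal_ofReal.mul hv
    _ = ∫⁻ y, ∫⁻ x, ρ x * (ENNReal.ofReal (er n x y) * v y) := by
        apply lintegral_lintegral_swap
        apply Measurable.aemeasurable
        exact (hρ.comp measurable_fst).mul ((er_meas n).ennreal_ofReal.mul (hv.comp measurable_snd))
    _ = ∫⁻ y, ∫⁻ x, (ρ y * v y) * ENNReal.ofReal (er n x y) := by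
        apply lintegral_congr; intro y; apply lintegral_congr; intro x
        by_cases h : cell n x = cell n y
        · rw [hc x y h]; ring
        · simp [er, h]
    _ = _ := by
        apply lintegral_congr; intro y
        rw [lintegral_const_mul, lint_er', mul_one]
        exact ((er_meas n).comp (measurable_id.prodMk measurable_const)).ennreal_ofReal

lemma EE_jensen (n : ℤ) {v : ℝ → ℝ≥0∞} (hv : Measurable v) {τ : ℝ} (hτ : 1 < τ) (x) :
    EE n v x ^ τ ≤ EE n (fun y => v y ^ τ) x := by
  have := jensen (μ := volume) (κ := fun y => ENNReal.ofReal (er n x y)) (v := v)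
    (er_meas' n x).ennreal_ofReal.aemeasurable hv.aemeasurable hτ
  rw [lint_er] at this
  simpa [EE] using this

lemma EE_int (n : ℤ) {v : ℝ → ℝ≥0∞} (hv : Measurable v) : ∫⁻ x, EE n v x = ∫⁻ x, v x := by
  simpa using EE_dual n (ρ := fun _ => 1) hv measurable_const (fun _ _ _ => rfl)

lemma EE_ne_top (n : ℤ) {v : ℝ → ℝ≥0∞} (hv : Measurable v) {τ : ℝ} (hτ : 1 < τ)
    (h : ∫⁻ x, v x ^ τ ≠ ∞) (x) : EE n v x ≠ ∞ := by
  have h1 := EE_jensen n hv hτ x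
  have h2 : EE n (fun y => v y ^ τ) x ≤ ENNReal.ofReal (2 ^ n) * ∫⁻ x, v x ^ τ := by
    rw [← lintegral_const_mul _ (hv.pow_const _)]
    apply lintegral_mono; intro y; dsimp only
    gcongr
    unfold er; split_ifs
    · exact le_rfl
    · positivity
  intro h3
  rw [h3, ENNReal.top_rpow_of_pos (by linarith)] at h1
  exact absurd (h1.trans h2) (by simp [ENNReal.mul_eq_top, h])

/-! ### flips -/

def flip (n : ℤ) (x : ℝ) : ℝ := if Even (cell n x) then x + (2 ^ n)⁻¹ else x - (2 ^ n)⁻¹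

lemma cell_add (n : ℤ) (x : ℝ) : cell n (x + (2 ^ n)⁻¹) = cell n x + 1 := by
  unfold cell; rw [mul_add, mul_inv_cancel₀ (two_zpow_pos n).ne', Int.floor_add_one]
lemma cell_sub (n : ℤ) (x : ℝ) : cell n (x - (2 ^ n)⁻¹) = cell n x - 1 := by
  unfold cell; rw [mul_sub, mul_inv_cancel₀ (two_zpow_pos n).ne', Int.floor_sub_one]

lemma cell_flip (n : ℤ) (x : ℝ) :
    cell n (flip n x) = if Even (cell n x) then cell n x + 1 else cell n x - 1 := by
  unfold flip; split_ifs
  · exact cell_add n x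
  · exact cell_sub n x

lemma cell_flip_lt {m n : ℤ} (h : m < n) (x : ℝ) : cell m (flip n x) = cell m x := by
  apply cell_eq_mono (n := n - 1) (by omega)
  rw [cell_pred, cell_pred, cell_flip]
  split_ifs with h
  · obtain ⟨k, hk⟩ := h; omega
  · rw [Int.not_even_iff_odd] at h; obtain ⟨k, hk⟩ := h; omega

lemma flip_meas (n : ℤ) : Measurable (flip n) := by
  unfold flip
  refine Measurable.ite ?_ (measurable_id.add_const _) (measurable_id.sub_const _)
  exact (cell_measurable n) (MeasurableSet.of_discrete (s := {c : ℤ | Even c}))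

lemma flip_mp (n : ℤ) : MeasurePreserving (flip n) volume volume := by
  refine ⟨flip_meas n, ?_⟩
  ext A hA
  rw [Measure.map_apply (flip_meas n) hA]
  have hEv : MeasurableSet {x | Even (cell n x)} :=
    (cell_measurable n) (MeasurableSet.of_discrete (s := {c : ℤ | Even c}))
  rw [← measure_inter_add_diff (flip n ⁻¹' A) hEv, ← measure_inter_add_diff A hEv, add_comm]
  congr 1
  · have : flip n ⁻¹' A \ {x | Even (cell n x)} =
        (fun x => x - (2 ^ n)⁻¹) ⁻¹' (A ∩ {x | Even (cell n x)}) := by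
      ext x
      simp only [Set.mem_diff, Set.mem_preimage, Set.mem_setOf_eq, Set.mem_inter_iff, cell_sub, flip]
      by_cases h : Even (cell n x)
      · have : ¬ Even (cell n x - 1) := by rw [Int.even_sub_one]; simpa using h
        simp [h, this]
      · have : Even (cell n x - 1) := by rw [Int.even_sub_one]; exact h
        simp [h, this]
    rw [this]
    exact (measurePreserving_sub_right volume ((2 ^ n : ℝ)⁻¹)).measure_preimage (hA.inter hEv).nullMeasurableSet
  · have : flip n ⁻¹' A ∩ {x | Even (cell n x)} =
        (fun x => x + (2 ^ n)⁻¹) ⁻¹' (A \ {x | Even (cell n x)}) := by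
      ext x
      simp only [Set.mem_diff, Set.mem_preimage, Set.mem_setOf_eq, Set.mem_inter_iff, cell_add, flip]
      by_cases h : Even (cell n x)
      · have : ¬ Even (cell n x + 1) := by rw [Int.even_add_one]; simpa using h
        simp [h, this]
      · have : Even (cell n x + 1) := by rw [Int.even_add_one]; exact h
        simp [h, this]
    rw [this]
    exact (measurePreserving_add_right volume ((2 ^ n : ℝ)⁻¹)).measure_preimage (hA.diff hEv).nullMeasurableSet

/-! ### dyadic maximal function -/

def mxE (v : ℝ → ℝ≥0∞) (a : ℤ) : ℕ → ℝ → ℝ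
  | 0, x => (EE a v x).toReal
  | k + 1, x => max (mxE v a k x) (EE (a + (k + 1 : ℕ)) v x).toReal

lemma mxE_meas {v : ℝ → ℝ≥0∞} (hv : Measurable v) (a k) : Measurable (mxE v a k) := by
  induction k with
  | zero => exact (EE_meas a hv).ennreal_toReal
  | succ k ih => exact ih.max (EE_meas _ hv).ennreal_toReal

lemma mxE_congr {v : ℝ → ℝ≥0∞} (a k) {x y} (h : cell (a + (k : ℕ)) x = cell (a + (k : ℕ)) y) :
    mxE v a k x = mxE v a k y := by
  induction k with
  | zero => simp only [mxE]; rw [EE_congr (by simpa using h)]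
  | succ k ih =>
    simp only [mxE]; rw [EE_congr h, ih (cell_eq_mono (by push_cast; omega) h)]

lemma le_mxE {v : ℝ → ℝ≥0∞} (a k) (j : ℕ) (hj : j ≤ k) (x) :
    (EE (a + j) v x).toReal ≤ mxE v a k x := by
  induction k with
  | zero => obtain rfl : j = 0 := by omega
            simp [mxE]
  | succ k ih =>
    simp only [mxE]
    rcases Nat.lt_or_ge j (k + 1) with h | h
    · exact (ih (by omega)).trans (le_max_left _ _)
    · obtain rfl : j = k + 1 := by omega
      exact le_max_right _ _

lemma mxE_nonneg {v : ℝ → ℝ≥0∞} (a k x) : 0 ≤ mxE v a k x :=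
  ENNReal.toReal_nonneg.trans (le_mxE a k 0 (by omega) x)

lemma dyadic_hl {τ : ℝ} (hτ : 1 < τ) : ∃ C : ℝ≥0, ∀ (v : ℝ → ℝ≥0∞), Measurable v →
    ∫⁻ x, v x ^ τ ≠ ∞ → ∀ a k, ∫⁻ x, ENNReal.ofReal (mxE v a k x) ^ τ ≤ C * ∫⁻ x, v x ^ τ := by
  have hτ0 : 0 < τ := by linarith
  refine ⟨(τ * ((τ / (τ - 1)) ^ τ / τ)).toNNReal, fun v hv hfin a k => ?_⟩
  have hne := fun n x => EE_ne_top n hv hτ hfin x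
  have hLp : ∀ n, L volume (fun x => (EE n v x).toReal ^ τ) ≤ ∫⁻ x, v x ^ τ := by
    intro n
    unfold L
    rw [← EE_int n (hv.pow_const τ)]
    apply lintegral_mono; intro x; dsimp only
    rw [← ENNReal.ofReal_rpow_of_nonneg ENNReal.toReal_nonneg hτ0.le, ENNReal.ofReal_toReal (hne n x)]
    exact EE_jensen n hv hτ x
  have := doob_gen (μ := volume) (fun k x => (EE (a + (k : ℕ)) v x).toReal) (mxE v a)
    (fun n => (EE_meas _ hv).ennreal_toReal) (fun n x => ENNReal.toReal_nonneg)
    (fun x => by simp [mxE]) (fun n x => rfl) hτ k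
    (fun n _ => ne_top_of_le_ne_top hfin (hLp _)) ?_
  · refine (le_of_eq ?_).trans (this.trans (mul_le_mul' le_rfl (hLp _)))
    unfold L
    apply lintegral_congr; intro x
    rw [ENNReal.ofReal_rpow_of_nonneg (mxE_nonneg a k x) hτ0.le]
  · intro n hn
    apply le_of_eq
    unfold L
    have key : ∀ m, a + (n : ℕ) ≤ m → ∫⁻ x, ENNReal.ofReal (mxE v a n x ^ (τ - 1) * (EE m v x).toReal) =
        ∫⁻ x, ENNReal.ofReal (mxE v a n x ^ (τ - 1)) * v x := by
      intro m hm
      rw [← EE_dual m hv ((mxE_meas hv a n).pow_const _).ennreal_ofReal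
        (fun x y h => by rw [mxE_congr a n (cell_eq_mono hm h)])]
      apply lintegral_congr; intro x
      rw [ENNReal.ofReal_mul (Real.rpow_nonneg (mxE_nonneg _ _ _) _), ENNReal.ofReal_toReal (hne m x)]
    exact (key _ le_rfl).trans (key _ (by push_cast; omega)).symm

end VP

namespace VP

/-- kernel of the averaging operator over the interval of radius `2^{-n}` -/
def ar (n : ℤ) (x y : ℝ) : ℝ := if 2 ^ n * |x - y| ≤ 1 then 2 ^ n else 0

lemma ar_nonneg (n x y) : 0 ≤ ar n x y := by unfold ar; split_ifs <;> positivity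
lemma ar_symm (n x y) : ar n x y = ar n y x := by unfold ar; rw [abs_sub_comm]
lemma ar_meas (n : ℤ) : Measurable (fun z : ℝ × ℝ => ar n z.1 z.2) := by
  unfold ar
  refine Measurable.ite ?_ measurable_const measurable_const
  apply measurableSet_le _ measurable_const
  exact (continuous_const.mul (continuous_fst.sub continuous_snd).abs).measurable
lemma ar_meas' (n : ℤ) (x) : Measurable (fun y : ℝ => ar n x y) :=
  (ar_meas n).comp (measurable_const.prodMk measurable_id)

def AA (n : ℤ) (v : ℝ → ℝ≥0∞) (x : ℝ) : ℝ≥0∞ := ∫⁻ y, ENNReal.ofReal (ar n x y) * v y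

def MM (v : ℝ → ℝ≥0∞) (x : ℝ) : ℝ≥0∞ := ⨆ n : ℤ, AA n v x

lemma AA_meas (n : ℤ) {v : ℝ → ℝ≥0∞} (hv : Measurable v) : Measurable (AA n v) := by
  unfold AA
  apply Measurable.lintegral_prod_right' (f := fun z : ℝ × ℝ => ENNReal.ofReal (ar n z.1 z.2) * v z.2)
  exact (ar_meas n).ennreal_ofReal.mul (hv.comp measurable_snd)

lemma MM_meas {v : ℝ → ℝ≥0∞} (hv : Measurable v) : Measurable (MM v) :=
  Measurable.iSup fun n => AA_meas n hv

lemma third {a b x : ℝ} {j : ℤ} (hj : ¬ (3 : ℤ) ∣ j) (ha : |a - x| ≤ 1 / 8) (hb : |b - x| ≤ 1 / 8)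
    (h1 : ⌊a⌋ ≠ ⌊x⌋) : ⌊b + j / 3⌋ = ⌊x + (j / 3 : ℝ)⌋ := by
  by_contra h2
  -- integer between a and x
  have key : ∀ u w : ℝ, |u - w| ≤ 1 / 8 → ⌊u⌋ ≠ ⌊w⌋ → ∃ p : ℤ, |w - p| ≤ 1 / 8 := by
    intro u w huw hne
    rw [abs_le] at huw
    rcases lt_or_gt_of_ne hne with h | h
    · refine ⟨⌊w⌋, ?_⟩
      have := Int.floor_le w
      have h3 : u < ⌊w⌋ := Int.floor_lt.1 h
      rw [abs_le]; constructor <;> linarith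
    · refine ⟨⌊u⌋, ?_⟩
      have := Int.floor_le u
      have h3 : w < ⌊u⌋ := Int.floor_lt.1 h
      rw [abs_le]; constructor <;> linarith
  obtain ⟨p, hp⟩ := key _ _ ha h1
  obtain ⟨q, hq⟩ := key (b + j / 3) (x + j / 3) (by rwa [add_sub_add_right_eq_sub]) h2
  rw [abs_le] at hp hq
  apply hj
  refine ⟨q - p, ?_⟩
  have h3 : |((3 * (q - p) - j : ℤ) : ℝ)| < 1 := by
    push_cast; rw [abs_lt]; constructor <;> linarith
  have h4 : |3 * (q - p) - j| < 1 := by exact_mod_cast h3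
  rw [Int.abs_lt_one_iff] at h4
  omega

lemma AA_le (N : ℕ) (n : ℤ) (hn : -(N : ℤ) ≤ n) (v : ℝ → ℝ≥0∞) (x : ℝ) :
    AA (n + 3) v x ≤ 8 * (EE n v x + EE n (fun y => v (y - 2 ^ N / 3)) (x + 2 ^ N / 3)) := by
  have hp := two_zpow_pos n
  obtain ⟨k, hk⟩ : ∃ k : ℕ, n + N = k := ⟨(n + N).toNat, by omega⟩
  have hpow : (2 : ℝ) ^ n * 2 ^ N = ((2 ^ k : ℤ) : ℝ) := by
    rw [← zpow_natCast, ← zpow_add₀ two_ne_zero, hk]; simp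
  have h3 : ¬ (3 : ℤ) ∣ 2 ^ k := by
    intro h
    have := Int.prime_three.dvd_of_dvd_pow h
    omega
  have hsh : EE n (fun y => v (y - 2 ^ N / 3)) (x + 2 ^ N / 3) =
      ∫⁻ y, ENNReal.ofReal (er n (x + 2 ^ N / 3) (y + 2 ^ N / 3)) * v y := by
    unfold EE
    rw [← lintegral_add_right_eq_self (fun y => ENNReal.ofReal (er n (x + 2 ^ N / 3) y) * v (y - 2 ^ N / 3)) (2 ^ N / 3)]
    simp
  have h8 : ENNReal.ofReal (2 ^ (n + 3)) = 8 * ENNReal.ofReal (2 ^ n) := by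
    rw [zpow_add₀ two_ne_zero, mul_comm, ENNReal.ofReal_mul (by positivity)]; norm_num
  have near : ∀ y, 2 ^ (n + 3) * |x - y| ≤ 1 → |2 ^ n * y - 2 ^ n * x| ≤ 1 / 8 := by
    intro y hy
    rw [← mul_sub, abs_mul, abs_of_pos hp, abs_sub_comm]
    rw [zpow_add₀ two_ne_zero] at hy
    norm_num at hy ⊢; linarith
  by_cases hA : ∀ y, 2 ^ (n + 3) * |x - y| ≤ 1 → cell n y = cell n x
  · calc AA (n + 3) v x ≤ ∫⁻ y, 8 * (ENNReal.ofReal (er n x y) * v y) := by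
          unfold AA; apply lintegral_mono; intro y; dsimp only
          rw [← mul_assoc]; gcongr
          unfold ar er
          split_ifs with h1 h2
          · rw [h8]
          · exact absurd (hA y h1).symm h2
          · simp
          · simp
      _ = 8 * EE n v x := by rw [lintegral_const_mul' _ _ (by simp)]; rfl
      _ ≤ _ := by gcongr; exact le_self_add
  · push Not at hA
    obtain ⟨a, ha, hne⟩ := hA
    calc AA (n + 3) v x ≤ ∫⁻ y, 8 * (ENNReal.ofReal (er n (x + 2 ^ N / 3) (y + 2 ^ N / 3)) * v y) := by
          unfold AA; apply lintegral_mono; intro y; dsimp only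
          rw [← mul_assoc]; gcongr
          unfold ar er
          split_ifs with h1 h2
          · rw [h8]
          · exfalso; apply h2
            have := third h3 (near a ha) (near y h1) hne
            unfold cell
            rw [mul_add, mul_add, ← mul_div_assoc, hpow]; exact this.symm
          · simp
          · simp
      _ = 8 * EE n (fun y => v (y - 2 ^ N / 3)) (x + 2 ^ N / 3) := by
          rw [lintegral_const_mul' _ _ (by simp), hsh]
      _ ≤ _ := by gcongr; exact le_add_self

/-- Hardy–Littlewood maximal theorem -/
lemma HL {τ : ℝ} (hτ : 1 < τ) : ∃ C : ℝ≥0, ∀ (v : ℝ → ℝ≥0∞), Measurable v →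
    ∫⁻ x, MM v x ^ τ ≤ C * ∫⁻ x, v x ^ τ := by
  obtain ⟨C, hC⟩ := dyadic_hl hτ
  have hτ0 : 0 < τ := by linarith
  refine ⟨8 ^ τ * (2 ^ τ * (C + C)) + 1, fun v hv => ?_⟩
  by_cases hfin : ∫⁻ x, v x ^ τ = ∞
  · rw [hfin, ENNReal.mul_top]; · exact le_top
    push_cast; positivity
  let w : ℕ → ℝ → ℝ≥0∞ := fun N y => v (y - 2 ^ N / 3)
  have hw : ∀ N, Measurable (w N) := fun N => hv.comp (measurable_id.sub_const _)
  have hwi : ∀ N, ∫⁻ x, w N x ^ τ = ∫⁻ x, v x ^ τ := fun N =>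
    lintegral_sub_right_eq_self (fun x => v x ^ τ) _
  let F : ℕ → ℝ → ℝ≥0∞ := fun N x => 8 * (ENNReal.ofReal (mxE v (-N) (2 * N) x) +
    ENNReal.ofReal (mxE (w N) (-N) (2 * N) (x + 2 ^ N / 3)))
  have hm1 : ∀ N : ℕ, Measurable fun x => ENNReal.ofReal (mxE v (-N) (2 * N) x) :=
    fun N => (mxE_meas hv _ _).ennreal_ofReal
  have hm2 : ∀ N : ℕ, Measurable fun x => ENNReal.ofReal (mxE (w N) (-N) (2 * N) (x + 2 ^ N / 3)) :=
    fun N => ((mxE_meas (hw N) _ _).comp (measurable_id.add_const _)).ennreal_ofReal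
  have hF : ∀ N, Measurable (F N) := fun N => ((hm1 N).add (hm2 N)).const_mul _
  have hFi : ∀ N, ∫⁻ x, F N x ^ τ ≤ (8 ^ τ * (2 ^ τ * (C + C)) : ℝ≥0∞) * ∫⁻ x, v x ^ τ := by
    intro N
    calc ∫⁻ x, F N x ^ τ ≤ ∫⁻ x, 8 ^ τ * (2 ^ τ * (ENNReal.ofReal (mxE v (-N) (2 * N) x) ^ τ +
            ENNReal.ofReal (mxE (w N) (-N) (2 * N) (x + 2 ^ N / 3)) ^ τ)) := by
          apply lintegral_mono; intro x
          simp only [F]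
          rw [ENNReal.mul_rpow_of_nonneg _ _ hτ0.le]
          gcongr
          exact add_rpow_le2 _ _ hτ0.le
      _ = 8 ^ τ * (2 ^ τ * ((∫⁻ x, ENNReal.ofReal (mxE v (-N) (2 * N) x) ^ τ) +
            ∫⁻ x, ENNReal.ofReal (mxE (w N) (-N) (2 * N) (x + 2 ^ N / 3)) ^ τ)) := by
          rw [lintegral_const_mul, lintegral_const_mul, lintegral_add_left ((hm1 N).pow_const _)]
          · exact ((hm1 N).pow_const τ).add ((hm2 N).pow_const τ)
          · exact (((hm1 N).pow_const τ).add ((hm2 N).pow_const τ)).const_mul _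
      _ ≤ 8 ^ τ * (2 ^ τ * ((C * ∫⁻ x, v x ^ τ) + C * ∫⁻ x, v x ^ τ)) := by
          gcongr
          · exact hC v hv hfin _ _
          · rw [lintegral_add_right_eq_self (fun x => ENNReal.ofReal (mxE (w N) (-N) (2 * N) x) ^ τ)]
            rw [← hwi N]
            exact hC (w N) (hw N) (by rwa [hwi N]) _ _
      _ = _ := by ring
  have hle : ∀ n : ℤ, ∀ N : ℕ, n.natAbs ≤ N → ∀ x, AA (n + 3) v x ≤ F N x := by
    intro n N hN x
    refine (AA_le N n (by omega) v x).trans ?_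
    simp only [F]
    obtain ⟨k, hk⟩ : ∃ k : ℕ, n = -(N : ℤ) + k := ⟨(n + N).toNat, by omega⟩
    gcongr
    · rw [← ENNReal.ofReal_toReal (EE_ne_top n hv hτ hfin x), hk]
      exact ENNReal.ofReal_le_ofReal (le_mxE _ _ k (by omega) x)
    · rw [← ENNReal.ofReal_toReal (EE_ne_top n (hw N) hτ (by rwa [hwi N]) (x + 2 ^ N / 3)), hk]
      exact ENNReal.ofReal_le_ofReal (le_mxE _ _ k (by omega) _)
  calc ∫⁻ x, MM v x ^ τ ≤ ∫⁻ x, Filter.liminf (fun N => F N x ^ τ) Filter.atTop := by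
        apply lintegral_mono; intro x
        have h1 : MM v x ≤ (Filter.liminf (fun N => F N x ^ τ) Filter.atTop) ^ (1 / τ) := by
          apply iSup_le; intro n
          rw [one_div, ENNReal.le_rpow_inv_iff hτ0]
          apply Filter.le_liminf_of_le
          · isBoundedDefault
          filter_upwards [Filter.eventually_ge_atTop (n - 3).natAbs] with N hN
          have := hle (n - 3) N hN x
          rw [sub_add_cancel] at this
          exact ENNReal.rpow_le_rpow this hτ0.le
        rw [one_div, ENNReal.le_rpow_inv_iff hτ0] at h1
        exact h1
    _ ≤ Filter.liminf (fun N => ∫⁻ x, F N x ^ τ) Filter.atTop :=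
        lintegral_liminf_le fun N => (hF N).pow_const _
    _ ≤ (8 ^ τ * (2 ^ τ * (C + C)) : ℝ≥0∞) * ∫⁻ x, v x ^ τ := by
        apply Filter.liminf_le_of_frequently_le'
        exact Filter.Frequently.of_forall hFi
    _ ≤ _ := by
        push_cast
        rw [ENNReal.coe_rpow_of_nonneg _ hτ0.le, ENNReal.coe_rpow_of_nonneg _ hτ0.le]
        gcongr
        exact le_self_add

/-! ### The standard bump -/

def kb (n : ℤ) (u : ℝ) : ℝ := 2 ^ n / (1 + 2 ^ n * |u|) ^ 2

lemma kb_nonneg (n u) : 0 ≤ kb n u := by unfold kb; positivity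
lemma kb_neg (n u) : kb n (-u) = kb n u := by unfold kb; rw [abs_neg]
lemma kb_cont (n) : Continuous (kb n) := by
  unfold kb
  refine continuous_const.div ((continuous_const.add (continuous_const.mul continuous_abs)).pow 2) ?_
  intro x; positivity

lemma kb_le (n : ℤ) (x y : ℝ) : ENNReal.ofReal (kb n (x - y)) ≤
    4 * ∑' j : ℕ, (2⁻¹ : ℝ≥0∞) ^ j * ENNReal.ofReal (ar (n - j) x y) := by
  have hp := two_zpow_pos n
  obtain ⟨j0, hj0⟩ := pow_unbounded_of_one_lt (2 ^ n * |x - y|) (one_lt_two)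
  have hex : ∃ j : ℕ, 2 ^ n * |x - y| ≤ 2 ^ j := ⟨j0, hj0.le⟩
  classical
  let j := Nat.find hex
  have hj : 2 ^ n * |x - y| ≤ 2 ^ j := Nat.find_spec hex
  have h4 : kb n (x - y) ≤ 4 * ((2⁻¹ : ℝ) ^ j * 2 ^ (n - j)) := by
    rw [zpow_sub₀ two_ne_zero, zpow_natCast]
    unfold kb
    rw [div_le_iff₀ (by positivity)]
    have : (2 : ℝ) ^ j ≤ 2 * (1 + 2 ^ n * |x - y|) := by
      by_cases h0 : j = 0
      · rw [h0]; have : 0 ≤ 2 ^ n * |x - y| := by positivity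
        norm_num; linarith
      · have h1 := Nat.find_min hex (m := j - 1) (by simp only [j] at h0 ⊢; omega)
        push Not at h1
        obtain ⟨i, hi⟩ : ∃ i, j = i + 1 := ⟨j - 1, by omega⟩
        rw [hi] at h1 ⊢
        simp only [Nat.add_sub_cancel] at h1
        rw [pow_succ]; linarith
    have h5 : ((2 : ℝ) ^ j) ^ 2 ≤ (2 * (1 + 2 ^ n * |x - y|)) ^ 2 := by gcongr
    rw [inv_pow]
    field_simp
    linarith
  calc _ ≤ ENNReal.ofReal (4 * ((2⁻¹ : ℝ) ^ j * 2 ^ (n - j))) := ENNReal.ofReal_le_ofReal h4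
    _ = 4 * ((2⁻¹ : ℝ≥0∞) ^ j * ENNReal.ofReal (ar (n - j) x y)) := by
        rw [ENNReal.ofReal_mul (by norm_num), ENNReal.ofReal_mul (by positivity),
          ENNReal.ofReal_pow (by norm_num), ENNReal.ofReal_inv_of_pos (by norm_num)]
        rw [ar, if_pos]
        · norm_num
        · rw [zpow_sub₀ two_ne_zero, zpow_natCast, div_mul_eq_mul_div, div_le_one (by positivity)]; exact hj
    _ ≤ _ := by gcongr; exact ENNReal.le_tsum j

def kk (n : ℤ) (v : ℝ → ℝ≥0∞) (x : ℝ) : ℝ≥0∞ := ∫⁻ y, ENNReal.ofReal (kb n (x - y)) * v y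

lemma kk_le (n : ℤ) {v : ℝ → ℝ≥0∞} (hv : Measurable v) (x : ℝ) : kk n v x ≤ 8 * MM v x := by
  calc kk n v x ≤ ∫⁻ y, 4 * ∑' j : ℕ, (2⁻¹ : ℝ≥0∞) ^ j * (ENNReal.ofReal (ar (n - j) x y) * v y) := by
        apply lintegral_mono; intro y; dsimp only
        refine (mul_le_mul' (kb_le n x y) le_rfl).trans (le_of_eq ?_)
        rw [mul_assoc, ← ENNReal.tsum_mul_right]; simp_rw [mul_assoc]
    _ = 4 * ∑' j : ℕ, (2⁻¹ : ℝ≥0∞) ^ j * AA (n - j) v x := by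
        rw [lintegral_const_mul' _ _ (by simp), lintegral_tsum]
        · congr 2; ext j
          rw [lintegral_const_mul]; · rfl
          exact (ar_meas' _ x).ennreal_ofReal.mul hv
        · intro j
          exact (((ar_meas' _ x).ennreal_ofReal.mul hv).const_mul _).aemeasurable
    _ ≤ 4 * ∑' j : ℕ, (2⁻¹ : ℝ≥0∞) ^ j * MM v x := by
        gcongr with j
        exact le_iSup (fun n : ℤ => AA n v x) _
    _ = 8 * MM v x := by
        rw [ENNReal.tsum_mul_right, ENNReal.tsum_geometric, ENNReal.one_sub_inv_two, inv_inv, ← mul_assoc]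
        norm_num

lemma MM_one (x : ℝ) : MM (fun _ => 1) x ≤ 2 := by
  apply iSup_le; intro n
  unfold AA
  have hp := two_zpow_pos n
  have : ∀ y, ENNReal.ofReal (ar n x y) * 1 =
      (Set.Icc (x - (2 ^ n)⁻¹) (x + (2 ^ n)⁻¹)).indicator (fun _ => ENNReal.ofReal (2 ^ n)) y := by
    intro y
    rw [mul_one]; unfold ar Set.indicator
    have : 2 ^ n * |x - y| ≤ 1 ↔ y ∈ Set.Icc (x - (2 ^ n)⁻¹) (x + (2 ^ n)⁻¹) := by
      rw [mul_comm, ← le_div_iff₀ hp, one_div, abs_le, Set.mem_Icc]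
      constructor <;> rintro ⟨h1, h2⟩ <;> constructor <;> linarith
    simp only [this]
    split_ifs <;> simp
  simp_rw [this]
  rw [lintegral_indicator measurableSet_Icc, lintegral_const, Measure.restrict_apply MeasurableSet.univ,
    Set.univ_inter, Real.volume_Icc, ← ENNReal.ofReal_mul hp.le,
    show (2 : ℝ) ^ n * (x + (2 ^ n)⁻¹ - (x - (2 ^ n)⁻¹)) = 2 by field_simp; ring]
  norm_num

lemma kb_int (n : ℤ) (x : ℝ) : ∫⁻ y, ENNReal.ofReal (kb n (x - y)) ≤ 16 := by
  have := (kk_le n (v := fun _ => 1) measurable_const x).trans (mul_le_mul' le_rfl (MM_one x))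
  simp only [kk, mul_one] at this
  exact this.trans (by norm_num)

lemma kb_int' (n : ℤ) (y : ℝ) : ∫⁻ x, ENNReal.ofReal (kb n (x - y)) ≤ 16 := by
  have := kb_int n y
  simp_rw [← kb_neg n (y - _), neg_sub] at this
  exact this

lemma MM_mono {v w : ℝ → ℝ≥0∞} (h : ∀ x, v x ≤ w x) (x) : MM v x ≤ MM w x := by
  apply iSup_mono; intro n; apply lintegral_mono; intro y; dsimp only; gcongr; exact h y

/-- `M_s` -/
def MS (s : ℝ) (v : ℝ → ℝ≥0∞) (x : ℝ) : ℝ≥0∞ := MM (fun y => v y ^ s) x ^ (1 / s)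

lemma MS_meas {s : ℝ} {v : ℝ → ℝ≥0∞} (hv : Measurable v) : Measurable (MS s v) :=
  (MM_meas (hv.pow_const _)).pow_const _

/-- integrals of kernels dominated by a bump against a weight -/
lemma ker_MS {s : ℝ} (hs : 1 < s) {κ : ℝ → ℝ≥0∞} (hκ : Measurable κ) {v : ℝ → ℝ≥0∞} (hv : Measurable v)
    {c b : ℝ≥0∞} {n : ℤ} {y : ℝ} (h1 : ∀ x, κ x ≤ c * ENNReal.ofReal (kb n (y - x)))
    (h2 : ∫⁻ x, κ x ≤ b) :
    ∫⁻ x, κ x * v x ≤ b ^ (1 - 1 / s) * ((c * 8) ^ (1 / s) * MS s v y) := by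
  have hs0 : 0 < s := by linarith
  have h3 := jensen hκ.aemeasurable hv.aemeasurable hs (μ := volume)
  have h4 : ∫⁻ x, κ x * v x ^ s ≤ c * 8 * MM (fun y => v y ^ s) y := by
    calc _ ≤ ∫⁻ x, c * (ENNReal.ofReal (kb n (y - x)) * v x ^ s) := by
          apply lintegral_mono; intro x; dsimp only
          rw [← mul_assoc]; gcongr; exact h1 x
      _ = c * kk n (fun x => v x ^ s) y := by
          rw [lintegral_const_mul]; · rfl
          exact (((kb_cont n).measurable.comp (measurable_const.sub measurable_id)).ennreal_ofReal).mul (hv.pow_const _)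
      _ ≤ _ := by rw [mul_assoc]; gcongr; exact kk_le n (hv.pow_const _) y
  have h5 : (∫⁻ x, κ x * v x) ≤ (b ^ (s - 1) * (c * 8 * MM (fun y => v y ^ s) y)) ^ (1 / s) := by
    rw [one_div, ENNReal.le_rpow_inv_iff hs0]
    refine h3.trans ?_
    gcongr
  refine h5.trans (le_of_eq ?_)
  rw [ENNReal.mul_rpow_of_nonneg _ _ (by positivity), ENNReal.mul_rpow_of_nonneg _ _ (by positivity),
    ← ENNReal.rpow_mul, show (s - 1) * (1 / s) = 1 - 1 / s by field_simp]
  rfl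

end VP

namespace VP

/-- bounded integrable measurable functions -/
structure Nice (G : ℝ → ℂ) : Prop where
  meas : Measurable G
  bdd : ∃ B : ℝ≥0, ∀ x, ‖G x‖ₑ ≤ B
  fin : ∫⁻ x, ‖G x‖ₑ ≠ ∞

lemma Nice.integrable {G : ℝ → ℂ} (h : Nice G) : Integrable G :=
  ⟨h.meas.aestronglyMeasurable, lt_top_iff_ne_top.2 h.fin⟩

lemma Nice.add {G H : ℝ → ℂ} (hG : Nice G) (hH : Nice H) : Nice (fun x => G x + H x) := by
  obtain ⟨B, hB⟩ := hG.bdd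
  obtain ⟨B', hB'⟩ := hH.bdd
  refine ⟨hG.meas.add hH.meas, ⟨B + B', fun x => ?_⟩, ?_⟩
  · push_cast; exact (enorm_add_le _ _).trans (add_le_add (hB x) (hB' x))
  · exact (hG.integrable.add hH.integrable).2.ne

lemma Nice.zero : Nice (fun _ => 0) := ⟨measurable_const, ⟨0, by simp⟩, by simp⟩

lemma Nice.sum {ι : Type*} (s : Finset ι) {G : ι → ℝ → ℂ} (h : ∀ i ∈ s, Nice (G i)) :
    Nice (fun x => ∑ i ∈ s, G i x) := by
  classical
  induction s using Finset.induction_on with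
  | empty => simpa using Nice.zero
  | insert a s ha ih =>
    simp only [Finset.sum_insert ha]
    exact (h a (by simp)).add (ih fun i hi => h i (by simp [hi]))

lemma Nice.mul_bdd {G m : ℝ → ℂ} (h : Nice G) (hm : Measurable m) {c : ℝ≥0} (hc : ∀ x, ‖m x‖ₑ ≤ c) :
    Nice (fun x => G x * m x) := by
  obtain ⟨B, hB⟩ := h.bdd
  refine ⟨h.meas.mul hm, ⟨B * c, fun x => ?_⟩, ?_⟩
  · push_cast; rw [enorm_mul]; exact mul_le_mul' (hB x) (hc x)
  · apply ne_top_of_le_ne_top (b := (∫⁻ x, ‖G x‖ₑ) * c) (ENNReal.mul_ne_top h.fin ENNReal.coe_ne_top)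
    rw [← lintegral_mul_const' _ _ ENNReal.coe_ne_top]
    apply lintegral_mono; intro x; dsimp only; rw [enorm_mul]; exact mul_le_mul' le_rfl (hc x)

lemma Nice.rpow_fin {G : ℝ → ℂ} (h : Nice G) {p : ℝ} (hp : 1 ≤ p) : ∫⁻ x, ‖G x‖ₑ ^ p ≠ ∞ := by
  obtain ⟨B, hB⟩ := h.bdd
  apply ne_top_of_le_ne_top (b := (∫⁻ x, ‖G x‖ₑ) * (B : ℝ≥0∞) ^ (p - 1))
    (ENNReal.mul_ne_top h.fin (ENNReal.rpow_ne_top_of_nonneg (by linarith) ENNReal.coe_ne_top))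
  rw [← lintegral_mul_const' _ _ (ENNReal.rpow_ne_top_of_nonneg (by linarith) ENNReal.coe_ne_top)]
  apply lintegral_mono; intro x; dsimp only
  calc ‖G x‖ₑ ^ p = ‖G x‖ₑ * ‖G x‖ₑ ^ (p - 1) := by
        nth_rw 2 [← ENNReal.rpow_one (‖G x‖ₑ)]
        rw [← ENNReal.rpow_add_of_nonneg _ _ zero_le_one (by linarith)]; congr 1; ring
    _ ≤ _ := by gcongr; exact hB x

structure SK (K : ℝ → ℝ → ℂ) : Prop where
  meas : Measurable (fun z : ℝ × ℝ => K z.1 z.2)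
  row : ∃ A : ℝ≥0, ∀ x, ∫⁻ y, ‖K x y‖ₑ ≤ A
  col : ∃ B : ℝ≥0, ∀ y, ∫⁻ x, ‖K x y‖ₑ ≤ B

def Top (K : ℝ → ℝ → ℂ) (G : ℝ → ℂ) (x : ℝ) : ℂ := ∫ y, K x y * G y
def KC (K1 K2 : ℝ → ℝ → ℂ) (x y : ℝ) : ℂ := ∫ z, K1 x z * K2 z y
def KT (K : ℝ → ℝ → ℂ) (x y : ℝ) : ℂ := K y x

lemma SK.T {K} (h : SK K) : SK (KT K) := ⟨h.meas.comp measurable_swap, h.col, h.row⟩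

lemma SK.meas_row {K} (h : SK K) (x) : Measurable (K x) :=
  h.meas.comp (measurable_const.prodMk measurable_id)
lemma SK.meas_col {K} (h : SK K) (y) : Measurable (fun x => K x y) :=
  h.meas.comp (measurable_id.prodMk measurable_const)

lemma SK.int_row {K} (h : SK K) (x) : Integrable (K x) := by
  obtain ⟨A, hA⟩ := h.row
  exact ⟨(h.meas_row x).aestronglyMeasurable, lt_of_le_of_lt (hA x) ENNReal.coe_lt_top⟩

lemma SK.int_mul {K} (h : SK K) {G} (hG : Measurable G) {B : ℝ≥0} (hB : ∀ x, ‖G x‖ₑ ≤ B) (x) :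
    Integrable (fun y => K x y * G y) := by
  obtain ⟨A, hA⟩ := h.row
  refine ⟨((h.meas_row x).mul hG).aestronglyMeasurable, ?_⟩
  have : ∫⁻ y, ‖K x y * G y‖ₑ ≤ A * B := by
    calc _ ≤ ∫⁻ y, ‖K x y‖ₑ * B := by
          apply lintegral_mono; intro y; dsimp only; rw [enorm_mul]; exact mul_le_mul' le_rfl (hB y)
      _ = (∫⁻ y, ‖K x y‖ₑ) * B := lintegral_mul_const' _ _ ENNReal.coe_ne_top
      _ ≤ _ := mul_le_mul' (hA x) le_rfl
  exact lt_of_le_of_lt this (ENNReal.mul_lt_top ENNReal.coe_lt_top ENNReal.coe_lt_top)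

lemma SK.sub {K K'} (h : SK K) (h' : SK K') : SK (fun x y => K x y - K' x y) := by
  obtain ⟨A, hA⟩ := h.row
  obtain ⟨A', hA'⟩ := h'.row
  obtain ⟨B, hB⟩ := h.col
  obtain ⟨B', hB'⟩ := h'.col
  refine ⟨h.meas.sub h'.meas, ⟨A + A', fun x => ?_⟩, ⟨B + B', fun y => ?_⟩⟩
  · calc _ ≤ ∫⁻ y, (‖K x y‖ₑ + ‖K' x y‖ₑ) := lintegral_mono fun y => enorm_sub_le
      _ = _ := lintegral_add_left (h.meas_row x).enorm _
      _ ≤ _ := by push_cast; exact add_le_add (hA x) (hA' x)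
  · calc _ ≤ ∫⁻ x, (‖K x y‖ₑ + ‖K' x y‖ₑ) := lintegral_mono fun y => enorm_sub_le
      _ = _ := lintegral_add_left (h.meas_col y).enorm _
      _ ≤ _ := by push_cast; exact add_le_add (hB y) (hB' y)

lemma Top_enorm (K G x) : ‖Top K G x‖ₑ ≤ ∫⁻ y, ‖K x y‖ₑ * ‖G y‖ₑ := by
  unfold Top
  refine (enorm_integral_le_lintegral_enorm _).trans (le_of_eq ?_)
  simp_rw [enorm_mul]

lemma Top_meas {K} (h : SK K) {G} (hG : Measurable G) : Measurable (Top K G) := by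
  unfold Top
  have : StronglyMeasurable (fun z : ℝ × ℝ => K z.1 z.2 * G z.2) :=
    (h.meas.mul (hG.comp measurable_snd)).stronglyMeasurable
  exact this.integral_prod_right'.measurable

lemma SK.nice {K} (h : SK K) {G} (hG : Nice G) : Nice (Top K G) := by
  obtain ⟨A, hA⟩ := h.row
  obtain ⟨B, hB⟩ := h.col
  obtain ⟨b, hb⟩ := hG.bdd
  refine ⟨Top_meas h hG.meas, ⟨A * b, fun x => ?_⟩, ?_⟩
  · refine (Top_enorm K G x).trans ?_
    calc _ ≤ ∫⁻ y, ‖K x y‖ₑ * b := by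
          apply lintegral_mono; intro y; exact mul_le_mul' le_rfl (hb y)
      _ = (∫⁻ y, ‖K x y‖ₑ) * b := lintegral_mul_const' _ _ ENNReal.coe_ne_top
      _ ≤ _ := by push_cast; exact mul_le_mul' (hA x) le_rfl
  · apply ne_top_of_le_ne_top (ENNReal.mul_ne_top ENNReal.coe_ne_top hG.fin : (B : ℝ≥0∞) * _ ≠ ∞)
    calc _ ≤ ∫⁻ x, ∫⁻ y, ‖K x y‖ₑ * ‖G y‖ₑ := lintegral_mono fun x => Top_enorm K G x
      _ = ∫⁻ y, ∫⁻ x, ‖K x y‖ₑ * ‖G y‖ₑ := by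
          apply lintegral_lintegral_swap
          exact (h.meas.enorm.mul (hG.meas.comp measurable_snd).enorm).aemeasurable
      _ ≤ ∫⁻ y, B * ‖G y‖ₑ := by
          apply lintegral_mono; intro y; dsimp only
          rw [lintegral_mul_const _ (h.meas_col y).enorm]
          exact mul_le_mul' (hB y) le_rfl
      _ = _ := lintegral_const_mul' _ _ ENNReal.coe_ne_top

lemma Top_comp {K1 K2} (h1 : SK K1) (h2 : SK K2) {G} (hG : Nice G) (x) :
    Top K1 (Top K2 G) x = Top (KC K1 K2) G x := by
  obtain ⟨A, hA⟩ := h1.row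
  obtain ⟨A2, hA2⟩ := h2.row
  obtain ⟨b, hb⟩ := hG.bdd
  have hm : Measurable (fun p : ℝ × ℝ => K1 x p.1 * (K2 p.1 p.2 * G p.2)) :=
    ((h1.meas_row x).comp measurable_fst).mul (h2.meas.mul (hG.meas.comp measurable_snd))
  unfold Top KC
  calc ∫ z, K1 x z * ∫ y, K2 z y * G y = ∫ z, ∫ y, K1 x z * (K2 z y * G y) := by
        simp_rw [integral_const_mul]
    _ = ∫ y, ∫ z, K1 x z * (K2 z y * G y) := by
        apply integral_integral_swap
        refine ⟨hm.aestronglyMeasurable, ?_⟩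
        unfold HasFiniteIntegral Function.uncurry
        rw [lintegral_prod _ hm.enorm.aemeasurable]
        refine lt_of_le_of_lt (b := (A : ℝ≥0∞) * (A2 * b)) ?_
          (ENNReal.mul_lt_top ENNReal.coe_lt_top (ENNReal.mul_lt_top ENNReal.coe_lt_top ENNReal.coe_lt_top))
        calc _ ≤ ∫⁻ z, ‖K1 x z‖ₑ * (A2 * b) := by
              apply lintegral_mono; intro z
              calc _ ≤ ∫⁻ y, ‖K1 x z‖ₑ * (‖K2 z y‖ₑ * b) := by
                    apply lintegral_mono; intro y; dsimp only
                    rw [enorm_mul, enorm_mul]; gcongr; exact hb y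
                _ = ‖K1 x z‖ₑ * ((∫⁻ y, ‖K2 z y‖ₑ) * b) := by
                    rw [lintegral_const_mul' _ _ (by simp), lintegral_mul_const' _ _ (by simp)]
                _ ≤ _ := mul_le_mul' le_rfl (mul_le_mul' (hA2 z) le_rfl)
          _ = (∫⁻ z, ‖K1 x z‖ₑ) * (A2 * b) :=
              lintegral_mul_const' _ _ (ENNReal.mul_ne_top ENNReal.coe_ne_top ENNReal.coe_ne_top)
          _ ≤ _ := by gcongr; exact hA x
    _ = ∫ y, (∫ z, K1 x z * K2 z y) * G y := by
        congr 1; ext y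
        rw [← integral_mul_const]
        congr 1; ext z; ring

lemma Top_dual {K} (h : SK K) {G H} (hG : Nice G) (hH : Nice H) :
    ∫ x, Top K G x * H x = ∫ y, G y * Top (KT K) H y := by
  obtain ⟨A, hA⟩ := h.row
  obtain ⟨b, hb⟩ := hG.bdd
  have hm : Measurable (fun p : ℝ × ℝ => K p.1 p.2 * G p.2 * H p.1) :=
    (h.meas.mul (hG.meas.comp measurable_snd)).mul (hH.meas.comp measurable_fst)
  unfold Top KT
  calc _ = ∫ x, ∫ y, K x y * G y * H x := by simp_rw [integral_mul_const]
    _ = ∫ y, ∫ x, K x y * G y * H x := by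
        apply integral_integral_swap
        refine ⟨hm.aestronglyMeasurable, ?_⟩
        unfold HasFiniteIntegral Function.uncurry
        rw [lintegral_prod _ hm.enorm.aemeasurable]
        refine lt_of_le_of_lt (b := (A : ℝ≥0∞) * b * ∫⁻ x, ‖H x‖ₑ) ?_
          (ENNReal.mul_lt_top (ENNReal.mul_lt_top ENNReal.coe_lt_top ENNReal.coe_lt_top) hH.fin.lt_top)
        rw [← lintegral_const_mul' _ _ (ENNReal.mul_ne_top ENNReal.coe_ne_top ENNReal.coe_ne_top)]
        apply lintegral_mono; intro x
        calc _ ≤ ∫⁻ y, ‖K x y‖ₑ * (b * ‖H x‖ₑ) := by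
              apply lintegral_mono; intro y; dsimp only
              rw [enorm_mul, enorm_mul, mul_assoc]; gcongr; exact hb y
          _ = (∫⁻ y, ‖K x y‖ₑ) * (b * ‖H x‖ₑ) :=
              lintegral_mul_const' _ _ (ENNReal.mul_ne_top ENNReal.coe_ne_top (by simp))
          _ ≤ _ := by dsimp only; rw [mul_assoc]; gcongr; exact hA x
    _ = _ := by
        congr 1; ext y
        rw [← integral_const_mul]
        congr 1; ext x; ring

/-- weighted `L²` bound for kernel operators -/
lemma Top_weight {K} (h : SK K) {G} (hG : Measurable G) {w W : ℝ → ℝ≥0∞} (hw : Measurable w)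
    {A : ℝ≥0∞} (hA : ∀ x, ∫⁻ y, ‖K x y‖ₑ ≤ A) (hW : ∀ y, ∫⁻ x, ‖K x y‖ₑ * w x ≤ W y) :
    ∫⁻ x, ‖Top K G x‖ₑ ^ (2 : ℝ) * w x ≤ A * ∫⁻ y, ‖G y‖ₑ ^ (2 : ℝ) * W y := by
  obtain ⟨A0, hA0⟩ := h.row
  obtain ⟨A', hA', hle⟩ : ∃ A' : ℝ≥0∞, (∀ x, ∫⁻ y, ‖K x y‖ₑ ≤ A') ∧ A' ≤ A ∧ A' ≠ ∞ :=
    ⟨⨆ x, ∫⁻ y, ‖K x y‖ₑ, fun x => le_iSup (fun x => ∫⁻ y, ‖K x y‖ₑ) x, iSup_le hA,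
      ne_top_of_le_ne_top ENNReal.coe_ne_top (iSup_le hA0)⟩
  have h1 : ∀ x, ‖Top K G x‖ₑ ^ (2 : ℝ) ≤ A' * ∫⁻ y, ‖K x y‖ₑ * ‖G y‖ₑ ^ (2 : ℝ) := by
    intro x
    refine (ENNReal.rpow_le_rpow (Top_enorm K G x) (by norm_num)).trans ?_
    refine (jensen (h.meas_row x).enorm.aemeasurable hG.enorm.aemeasurable (by norm_num)).trans ?_
    gcongr
    norm_num
    exact hA' x
  have hm : Measurable (fun p : ℝ × ℝ => ‖K p.1 p.2‖ₑ * ‖G p.2‖ₑ ^ (2 : ℝ) * w p.1) :=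
    (h.meas.enorm.mul ((hG.comp measurable_snd).enorm.pow_const _)).mul (hw.comp measurable_fst)
  calc _ ≤ ∫⁻ x, A' * ∫⁻ y, ‖K x y‖ₑ * ‖G y‖ₑ ^ (2 : ℝ) * w x := by
        apply lintegral_mono; intro x; dsimp only
        rw [lintegral_mul_const (w x) (show Measurable fun y => ‖K x y‖ₑ * ‖G y‖ₑ ^ (2 : ℝ) from (h.meas_row x).enorm.mul (hG.enorm.pow_const _)), ← mul_assoc]
        gcongr; exact h1 x
    _ = A' * ∫⁻ y, ∫⁻ x, ‖K x y‖ₑ * ‖G y‖ₑ ^ (2 : ℝ) * w x := by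
        rw [lintegral_const_mul' _ _ hle.2, lintegral_lintegral_swap hm.aemeasurable]
    _ ≤ A * ∫⁻ y, ‖G y‖ₑ ^ (2 : ℝ) * W y := by
        gcongr with y
        · exact hle.1
        · calc _ = ∫⁻ x, ‖G y‖ₑ ^ (2 : ℝ) * (‖K x y‖ₑ * w x) := by
                apply lintegral_congr; intro x; ring
            _ = ‖G y‖ₑ ^ (2 : ℝ) * ∫⁻ x, ‖K x y‖ₑ * w x :=
                lintegral_const_mul _ ((h.meas_col y).enorm.mul hw)
            _ ≤ _ := by gcongr; exact hW y

/-! ### Dyadic projections -/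
def kE (n : ℤ) (x y : ℝ) : ℂ := (er n x y : ℂ)
def kD (n : ℤ) (x y : ℝ) : ℂ := kE n x y - kE (n - 1) x y

lemma kE_enorm (n x y) : ‖kE n x y‖ₑ = ENNReal.ofReal (er n x y) := by
  unfold kE
  rw [← ofReal_norm, Complex.norm_real, Real.norm_of_nonneg (er_nonneg n x y)]

lemma kE_SK (n) : SK (kE n) :=
  ⟨Complex.measurable_ofReal.comp (er_meas n), ⟨1, fun x => by simp_rw [kE_enorm, lint_er]; simp⟩,
    ⟨1, fun x => by simp_rw [kE_enorm, lint_er']; simp⟩⟩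

lemma kD_SK (n) : SK (kD n) := (kE_SK n).sub (kE_SK _)

lemma kE_symm (n) : KT (kE n) = kE n := by ext x y; simp [KT, kE, er_symm n y x]
lemma kD_symm (n) : KT (kD n) = kD n := by
  ext x y; simp [KT, kD, kE, er_symm n y x, er_symm (n - 1) y x]

lemma er_flip (n : ℤ) (x y : ℝ) : er n (flip n x) y + er n x y = 2 * er (n - 1) x y := by
  unfold er
  rw [cell_flip, cell_pred, cell_pred, zpow_sub_one₀ two_ne_zero]
  by_cases he : Even (cell n x)
  · simp only [he, if_true]
    obtain ⟨k, hk⟩ := he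
    by_cases h1 : cell n x = cell n y
    · rw [if_neg (by omega), if_pos h1, if_pos (by omega)]; ring
    · by_cases h2 : cell n x + 1 = cell n y
      · rw [if_pos h2, if_neg h1, if_pos (by omega)]; ring
      · rw [if_neg h2, if_neg h1, if_neg (by omega)]; ring
  · simp only [he, if_false]
    rw [Int.not_even_iff_odd] at he
    obtain ⟨k, hk⟩ := he
    by_cases h1 : cell n x = cell n y
    · rw [if_neg (by omega), if_pos h1, if_pos (by omega)]; ring
    · by_cases h2 : cell n x - 1 = cell n y
      · rw [if_pos h2, if_neg h1, if_pos (by omega)]; ring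
      · rw [if_neg h2, if_neg h1, if_neg (by omega)]; ring

lemma kD_flip (n : ℤ) (x y) : kD n (flip n x) y = - kD n x y := by
  have h1 := er_flip n x y
  have h2 : er (n - 1) (flip n x) y = er (n - 1) x y := er_congr (cell_flip_lt (by omega) x) y
  have h3 : er n (flip n x) y - er (n - 1) x y = - (er n x y - er (n - 1) x y) := by linarith
  unfold kD kE
  rw [h2]
  exact_mod_cast congrArg (fun r : ℝ => (r : ℂ)) h3

lemma kD_inv {m n : ℤ} (h : n < m) (x y) : kD n (flip m x) y = kD n x y := by
  unfold kD kE
  rw [er_congr (cell_flip_lt h x), er_congr (cell_flip_lt (m := n - 1) (by omega) x)]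

lemma Top_kD_flip (n : ℤ) (G x) : Top (kD n) G (flip n x) = - Top (kD n) G x := by
  unfold Top; simp_rw [kD_flip, neg_mul, integral_neg]
lemma Top_kD_inv {m n : ℤ} (h : n < m) (G x) : Top (kD n) G (flip m x) = Top (kD n) G x := by
  unfold Top; simp_rw [kD_inv h]

lemma Top_kD (n : ℤ) {G} (hG : Nice G) (x) : Top (kD n) G x = Top (kE n) G x - Top (kE (n - 1)) G x := by
  obtain ⟨b, hb⟩ := hG.bdd
  unfold Top kD
  simp_rw [sub_mul]
  exact integral_sub ((kE_SK n).int_mul hG.meas hb x) ((kE_SK _).int_mul hG.meas hb x)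

/-- `er n ≤ 4 kb n` -/
lemma er_le_kb (n : ℤ) (x y : ℝ) : er n x y ≤ 4 * kb n (x - y) := by
  unfold er; split_ifs with h
  · have hp := two_zpow_pos n
    have h1 : |2 ^ n * x - 2 ^ n * y| < 1 := Int.abs_sub_lt_one_of_floor_eq_floor h
    rw [← mul_sub, abs_mul, abs_of_pos hp] at h1
    unfold kb
    rw [← mul_div_assoc, le_div_iff₀ (by positivity), mul_comm 4]
    have h0 : 0 ≤ 2 ^ n * |x - y| := by positivity
    apply mul_le_mul_of_nonneg_left _ hp.le
    nlinarith
  · have := kb_nonneg n (x - y); positivity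

lemma kb_pred (n : ℤ) (u : ℝ) : kb (n - 1) u ≤ 2 * kb n u := by
  have hp := two_zpow_pos n
  unfold kb
  rw [zpow_sub_one₀ two_ne_zero, ← mul_div_assoc, div_le_div_iff₀ (by positivity) (by positivity)]
  have h0 : 0 ≤ 2 ^ n * |u| := by positivity
  have h1 : 1 + 2 ^ n * |u| ≤ 2 * (1 + 2 ^ n * 2⁻¹ * |u|) := by linarith
  have h2 : (1 + 2 ^ n * |u|) ^ 2 ≤ (2 * (1 + 2 ^ n * 2⁻¹ * |u|)) ^ 2 := by gcongr
  have h3 := mul_le_mul_of_nonneg_left h2 (show 0 ≤ (2 : ℝ) ^ n * 2⁻¹ by positivity)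
  refine h3.trans (le_of_eq (by ring))

lemma kD_le (n : ℤ) (x y : ℝ) : ‖kD n x y‖ₑ ≤ 12 * ENNReal.ofReal (kb n (x - y)) := by
  have h1 := er_le_kb n x y
  have h2 := er_le_kb (n - 1) x y
  have h3 := kb_pred n (x - y)
  unfold kD
  refine enorm_sub_le.trans ?_
  rw [kE_enorm, kE_enorm, ← ENNReal.ofReal_add (er_nonneg _ _ _) (er_nonneg _ _ _)]
  rw [show (12 : ℝ≥0∞) = ENNReal.ofReal 12 by norm_num, ← ENNReal.ofReal_mul (by norm_num)]
  apply ENNReal.ofReal_le_ofReal; linarith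

end VP

namespace VP

structure Bump (ψ Θ : ℝ → ℂ) (C : ℝ) : Prop where
  pos : 0 ≤ C
  cont : Continuous ψ
  dec : ∀ u, ‖ψ u‖ ≤ C / (1 + |u|) ^ 2
  lip : ∀ u v, |u - v| ≤ 2 → ‖ψ u - ψ v‖ ≤ C * |u - v| / (1 + |v|) ^ 2
  der : ∀ u, HasDerivAt Θ (ψ u) u
  dec' : ∀ u, ‖Θ u‖ ≤ C / (1 + |u|) ^ 2

lemma Bump.refl {ψ Θ C} (h : Bump ψ Θ C) : Bump (fun u => ψ (-u)) (fun u => - Θ (-u)) C where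
  pos := h.pos
  cont := h.cont.comp continuous_neg
  dec u := by simpa using h.dec (-u)
  lip u v huv := by
    have := h.lip (-u) (-v) (by rw [neg_sub_neg, abs_sub_comm]; exact huv)
    rw [neg_sub_neg, abs_sub_comm v u, abs_neg] at this; exact this
  der u := by
    have h1 : HasDerivAt (fun u : ℝ => Θ (-u)) (-(ψ (-u))) u := by
      have := (h.der (-u)).scomp u (hasDerivAt_neg u)
      rw [neg_one_smul] at this
      exact this
    have h2 := h1.neg
    rw [neg_neg] at h2
    exact h2
  dec' u := by simpa using h.dec' (-u)

lemma Bump.of_schwartz (φ : SchwartzMap ℝ ℂ) (h0 : ∫ x, φ x = 0) : ∃ Θ C, Bump φ Θ C := by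
  obtain ⟨C0, hC0⟩ : ∃ C0 : ℝ, ∀ u, (1 + |u|) ^ 4 * ‖φ u‖ ≤ C0 := by
    refine ⟨2 ^ 4 * ((Finset.Iic ((4, 0) : ℕ × ℕ)).sup fun m => SchwartzMap.seminorm ℝ m.1 m.2) φ, fun u => ?_⟩
    have := SchwartzMap.one_add_le_sup_seminorm_apply (𝕜 := ℝ) (m := (4, 0)) (k := 4) (n := 0) le_rfl le_rfl φ u
    rwa [norm_iteratedFDeriv_zero, Real.norm_eq_abs] at this
  obtain ⟨C1, hC1⟩ : ∃ C1 : ℝ, ∀ u, (1 + |u|) ^ 2 * ‖deriv φ u‖ ≤ C1 := by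
    refine ⟨2 ^ 2 * ((Finset.Iic ((2, 1) : ℕ × ℕ)).sup fun m => SchwartzMap.seminorm ℝ m.1 m.2) φ, fun u => ?_⟩
    have := SchwartzMap.one_add_le_sup_seminorm_apply (𝕜 := ℝ) (m := (2, 1)) (k := 2) (n := 1) le_rfl le_rfl φ u
    rwa [norm_iteratedFDeriv_eq_norm_iteratedDeriv, iteratedDeriv_one, Real.norm_eq_abs] at this
  have hC0' : 0 ≤ C0 := le_trans (by positivity) (hC0 0)
  have hC1' : 0 ≤ C1 := le_trans (by positivity) (hC1 0)
  have hb4 : ∀ u, ‖φ u‖ ≤ C0 / (1 + |u|) ^ 4 := fun u => by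
    rw [le_div_iff₀ (by positivity), mul_comm]; exact hC0 u
  have hb1 : ∀ u, ‖deriv φ u‖ ≤ C1 / (1 + |u|) ^ 2 := fun u => by
    rw [le_div_iff₀ (by positivity), mul_comm]; exact hC1 u
  have hintg : Integrable φ := φ.integrable
  let J : ℝ := ∫ t : ℝ, (1 + t ^ 2)⁻¹
  have hJ : Integrable (fun t : ℝ => (1 + t ^ 2)⁻¹) := integrable_inv_one_add_sq
  have hJ0 : 0 ≤ J := integral_nonneg fun t => by positivity
  have tail : ∀ (A : Set ℝ), MeasurableSet A → ∀ u : ℝ, (∀ t ∈ A, |u| ≤ |t|) →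
      ‖∫ t in A, φ t‖ ≤ C0 * J / (1 + |u|) ^ 2 := by
    intro A hAm u hA
    calc ‖∫ t in A, φ t‖ ≤ ∫ t in A, ‖φ t‖ := norm_integral_le_integral_norm _
      _ ≤ ∫ t in A, (C0 / (1 + |u|) ^ 2) * (1 + t ^ 2)⁻¹ := by
          apply setIntegral_mono_on hintg.norm.integrableOn ((hJ.const_mul _).integrableOn) hAm
          intro t ht
          refine (hb4 t).trans ?_
          rw [div_mul_eq_mul_div, ← div_eq_mul_inv, div_div]
          apply div_le_div_of_nonneg_left hC0' (by positivity)
          have h1 := hA t ht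
          have h2 : 1 + t ^ 2 ≤ (1 + |t|) ^ 2 := by
            have : 0 ≤ |t| := abs_nonneg t
            have h3 : |t| ^ 2 = t ^ 2 := sq_abs t
            nlinarith
          calc (1 + t ^ 2) * (1 + |u|) ^ 2 ≤ (1 + |t|) ^ 2 * (1 + |t|) ^ 2 := by gcongr
            _ = _ := by ring
      _ ≤ ∫ t, (C0 / (1 + |u|) ^ 2) * (1 + t ^ 2)⁻¹ := by
          apply setIntegral_le_integral (hJ.const_mul _)
          filter_upwards with t
          simp only [Pi.zero_apply]; positivity
      _ = C0 * J / (1 + |u|) ^ 2 := by rw [integral_const_mul]; ring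
  let Θ : ℝ → ℂ := fun u => ∫ t in Set.Iic u, φ t
  let C : ℝ := C0 + 9 * C1 + C0 * J
  have hC : 0 ≤ C := by positivity
  refine ⟨Θ, C, hC, φ.continuous, fun u => ?_, fun u v huv => ?_, fun u => ?_, fun u => ?_⟩
  · refine (hb4 u).trans ?_
    have h1 : (1 + |u|) ^ 2 ≤ (1 + |u|) ^ 4 := pow_le_pow_right₀ (by linarith [abs_nonneg u]) (by norm_num)
    apply div_le_div₀ hC _ (by positivity) h1
    have : 0 ≤ 9 * C1 + C0 * J := by positivity
    simp only [C]; linarith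
  · have hD : ∀ w ∈ Set.uIcc u v, ‖deriv φ w‖ ≤ C / (1 + |v|) ^ 2 := by
      intro w hw
      refine (hb1 w).trans ?_
      rw [div_le_div_iff₀ (by positivity) (by positivity)]
      have h1 : |w - v| ≤ 2 := by
        rw [abs_sub_comm] at huv ⊢
        exact (Set.abs_sub_right_of_mem_uIcc hw).trans huv
      have h2 : 1 + |v| ≤ 3 * (1 + |w|) := by
        have h3 := abs_sub_abs_le_abs_sub v w
        rw [abs_sub_comm] at h3
        have := abs_nonneg w
        linarith
      calc C1 * (1 + |v|) ^ 2 ≤ C1 * (3 * (1 + |w|)) ^ 2 := by gcongr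
        _ = 9 * C1 * (1 + |w|) ^ 2 := by ring
        _ ≤ C * (1 + |w|) ^ 2 := by
            gcongr
            have : 0 ≤ C0 * J := by positivity
            simp only [C]; linarith
    have h2 := (convex_uIcc u v).norm_image_sub_le_of_norm_deriv_le (f := φ) (C := C / (1 + |v|) ^ 2)
      (fun w _ => φ.differentiableAt) hD (Set.right_mem_uIcc) (Set.left_mem_uIcc)
    rw [Real.norm_eq_abs] at h2
    refine h2.trans (le_of_eq (by ring))
  · have h1 : Θ = fun u => Θ 0 + ∫ t in (0 : ℝ)..u, φ t := by
      ext u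
      rw [← intervalIntegral.integral_Iic_sub_Iic hintg.integrableOn hintg.integrableOn]
      simp [Θ]
    rw [h1]
    exact (intervalIntegral.integral_hasDerivAt_right (hintg.intervalIntegrable)
      (φ.continuous.stronglyMeasurableAtFilter _ _) φ.continuous.continuousAt).const_add _
  · have hle : C0 * J / (1 + |u|) ^ 2 ≤ C / (1 + |u|) ^ 2 := by
      gcongr
      have : 0 ≤ C0 + 9 * C1 := by positivity
      simp only [C]; linarith
    refine le_trans ?_ hle
    rcases le_total u 0 with hu | hu
    · apply tail _ measurableSet_Iic
      intro t ht
      rw [Set.mem_Iic] at ht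
      rw [abs_of_nonpos hu, abs_of_nonpos (ht.trans hu)]; linarith
    · have h1 : Θ u = - ∫ t in Set.Ioi u, φ t := by
        have := intervalIntegral.integral_Iic_add_Ioi (b := u) hintg.integrableOn hintg.integrableOn
        rw [h0] at this
        exact eq_neg_of_add_eq_zero_left this
      rw [h1, norm_neg]
      apply tail _ measurableSet_Ioi
      intro t ht
      rw [Set.mem_Ioi] at ht
      rw [abs_of_nonneg hu, abs_of_nonneg (hu.trans ht.le)]; exact ht.le

def gd (ψ : ℝ → ℂ) (i : ℤ) (u : ℝ) : ℂ := ((2 : ℝ) ^ i : ℝ) • ψ (((2 : ℝ) ^ i) * u)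
def kP (ψ : ℝ → ℂ) (i : ℤ) (x y : ℝ) : ℂ := gd ψ i (x - y)

lemma abs_zmul (i : ℤ) (u : ℝ) : |(2 : ℝ) ^ i * u| = 2 ^ i * |u| := by
  rw [abs_mul, abs_of_pos (two_zpow_pos i)]

section
variable {ψ Θ : ℝ → ℂ} {C : ℝ}

lemma gd_norm (h : Bump ψ Θ C) (i u) : ‖gd ψ i u‖ ≤ C * kb i u := by
  unfold gd kb
  rw [norm_smul, Real.norm_of_nonneg (two_zpow_pos i).le]
  have := h.dec (2 ^ i * u)
  rw [abs_zmul] at this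
  calc _ ≤ 2 ^ i * (C / (1 + 2 ^ i * |u|) ^ 2) := by gcongr
    _ = _ := by ring

lemma gd_cont (h : Bump ψ Θ C) (i) : Continuous (gd ψ i) := by
  unfold gd
  exact (h.cont.comp (continuous_const.mul continuous_id)).const_smul ((2 : ℝ) ^ i)

lemma kP_cont (h : Bump ψ Θ C) (i) : Continuous (fun z : ℝ × ℝ => kP ψ i z.1 z.2) :=
  (gd_cont h i).comp (continuous_fst.sub continuous_snd)

lemma ofReal_of_norm_le {z : ℂ} {a : ℝ} (h : ‖z‖ ≤ a) : ‖z‖ₑ ≤ ENNReal.ofReal a := by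
  rw [← ofReal_norm]; exact ENNReal.ofReal_le_ofReal h

lemma kP_le (h : Bump ψ Θ C) (i x y) : ‖kP ψ i x y‖ₑ ≤ ENNReal.ofReal C * ENNReal.ofReal (kb i (x - y)) := by
  rw [← ENNReal.ofReal_mul h.pos]; exact ofReal_of_norm_le (gd_norm h i _)

lemma row_le {κ : ℝ → ℂ} {c : ℝ≥0∞} (hc : c ≠ ∞) {n x} (h : ∀ y, ‖κ y‖ₑ ≤ c * ENNReal.ofReal (kb n (x - y))) :
    ∫⁻ y, ‖κ y‖ₑ ≤ c * 16 := by
  refine (lintegral_mono h).trans ?_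
  rw [lintegral_const_mul' _ _ hc]
  gcongr; exact kb_int n x

lemma col_le {κ : ℝ → ℂ} {c : ℝ≥0∞} (hc : c ≠ ∞) {n y} (h : ∀ x, ‖κ x‖ₑ ≤ c * ENNReal.ofReal (kb n (x - y))) :
    ∫⁻ x, ‖κ x‖ₑ ≤ c * 16 := by
  refine (lintegral_mono h).trans ?_
  rw [lintegral_const_mul' _ _ hc]
  gcongr; exact kb_int' n y

lemma kP_SK (h : Bump ψ Θ C) (i) : SK (kP ψ i) := by
  refine ⟨(kP_cont h i).measurable, ⟨C.toNNReal * 16, fun x => ?_⟩, ⟨C.toNNReal * 16, fun y => ?_⟩⟩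
  · exact row_le (by simp) (fun y => kP_le h i x y)
  · exact col_le (by simp) (fun x => kP_le h i x y)

/-- integral over a dyadic cell -/
lemma int_er (n : ℤ) (x : ℝ) (g : ℝ → ℂ) : ∫ z, kE n x z * g z =
    (2 : ℝ) ^ n • ∫ z in ((cell n x : ℝ) / 2 ^ n)..((cell n x + 1) / 2 ^ n), g z := by
  have hp := two_zpow_pos n
  rw [intervalIntegral.integral_of_le (by gcongr; linarith), ← integral_Ico_eq_integral_Ioc,
    ← cell_preimage, ← integral_smul, ← integral_indicator (show MeasurableSet {y | cell n y = cell n x} from (cell_measurable n) (measurableSet_singleton _))]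
  congr 1; ext z
  unfold kE er Set.indicator
  by_cases h : cell n x = cell n z
  · simp [h]
  · simp [h, Ne.symm h]

lemma kE_int (n : ℤ) (x : ℝ) : ∫ z, kE n x z = 1 := by
  have := int_er n x (fun _ => 1)
  simp only [mul_one, intervalIntegral.integral_const] at this
  have hp := two_zpow_pos n
  rw [this, smul_smul, show (2 : ℝ) ^ n * ((cell n x + 1) / 2 ^ n - cell n x / 2 ^ n) = 1 by field_simp; ring]
  simp

lemma cell_near {n : ℤ} {x z : ℝ} (h : cell n x = cell n z) : 2 ^ n * |x - z| ≤ 1 := by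
  have h1 : |2 ^ n * x - 2 ^ n * z| < 1 := Int.abs_sub_lt_one_of_floor_eq_floor h
  rw [← mul_sub, abs_zmul] at h1; exact h1.le

/-- fine scales -/
lemma kE_sub (h : Bump ψ Θ C) {n i : ℤ} (hn : i - 1 ≤ n) (x y : ℝ) :
    ‖KC (kE n) (kP ψ i) x y - kP ψ i x y‖ ≤ C * 2 ^ (i - n) * kb i (x - y) := by
  have hp := two_zpow_pos i
  have hpn := two_zpow_pos n
  have hsc : (2 : ℝ) ^ (i - n) ≤ 2 := by
    calc (2 : ℝ) ^ (i - n) ≤ 2 ^ (1 : ℤ) := zpow_le_zpow_right₀ one_le_two (by omega)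
      _ = 2 := by norm_num
  have hi : Integrable (fun z => kE n x z * kP ψ i z y) := by
    apply (kE_SK n).int_mul ((kP_SK h i).meas_col y) (B := (C * 2 ^ i).toNNReal)
    intro z
    refine ofReal_of_norm_le ((gd_norm h i _).trans ?_)
    apply mul_le_mul_of_nonneg_left _ h.pos
    unfold kb
    apply div_le_self hp.le
    have : 0 ≤ 2 ^ i * |z - y| := by positivity
    nlinarith
  have h1 : KC (kE n) (kP ψ i) x y - kP ψ i x y = ∫ z, kE n x z * (kP ψ i z y - kP ψ i x y) := by
    simp_rw [mul_sub]
    rw [integral_sub hi (((kE_SK n).int_row x).mul_const _), integral_mul_const, kE_int, one_mul]; rfl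
  rw [h1]
  have hb : ∀ z, ‖kE n x z * (kP ψ i z y - kP ψ i x y)‖ ≤ er n x z * (C * 2 ^ (i - n) * kb i (x - y)) := by
    intro z
    rw [norm_mul]
    have : ‖kE n x z‖ = er n x z := by unfold kE; rw [Complex.norm_real, Real.norm_of_nonneg (er_nonneg _ _ _)]
    rw [this]
    by_cases hc : cell n x = cell n z
    · apply mul_le_mul_of_nonneg_left _ (er_nonneg _ _ _)
      unfold kP gd kb
      rw [← smul_sub, norm_smul, Real.norm_of_nonneg hp.le]
      have hz : |2 ^ i * (z - y) - 2 ^ i * (x - y)| ≤ 2 ^ (i - n) := by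
        rw [← mul_sub, abs_zmul, sub_sub_sub_cancel_right, abs_sub_comm, zpow_sub₀ two_ne_zero, div_eq_mul_inv]
        gcongr
        rw [← one_div, le_div_iff₀ hpn, mul_comm]; exact cell_near hc
      have h2 := h.lip (2 ^ i * (z - y)) (2 ^ i * (x - y)) (hz.trans hsc)
      rw [abs_zmul i (x - y)] at h2
      calc _ ≤ 2 ^ i * (C * 2 ^ (i - n) / (1 + 2 ^ i * |x - y|) ^ 2) := by
            gcongr
            refine h2.trans ?_
            have := h.pos
            gcongr
        _ = _ := by ring
    · simp [er, hc]
  have hei : ∫ z, er n x z = 1 := by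
    have := kE_int n x
    unfold kE at this
    rw [integral_complex_ofReal] at this
    exact_mod_cast this
  have hei' : Integrable (fun z => er n x z) := by
    by_contra h; rw [integral_undef h] at hei; norm_num at hei
  calc _ ≤ ∫ z, er n x z * (C * 2 ^ (i - n) * kb i (x - y)) :=
        norm_integral_le_of_norm_le (hei'.mul_const _) (Filter.Eventually.of_forall hb)
    _ = _ := by rw [integral_mul_const, hei, one_mul]

lemma endpoint_near (n : ℤ) (x : ℝ) : 2 ^ n * |x - cell n x / 2 ^ n| ≤ 1 ∧
    2 ^ n * |x - (cell n x + 1) / 2 ^ n| ≤ 1 := by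
  have hp := two_zpow_pos n
  have h1 : (cell n x : ℝ) ≤ 2 ^ n * x := Int.floor_le _
  have h2 : 2 ^ n * x < cell n x + 1 := Int.lt_floor_add_one _
  constructor
  · rw [← abs_zmul, mul_sub, mul_div_cancel₀ _ hp.ne', abs_le]; constructor <;> linarith
  · rw [← abs_zmul, mul_sub, mul_div_cancel₀ _ hp.ne', abs_le]; constructor <;> linarith

/-- coarse scales -/
lemma kE_coarse (h : Bump ψ Θ C) (n i : ℤ) (x y : ℝ) :
    ‖KC (kE n) (kP ψ i) x y‖ ≤ C * 2 ^ (n - i) * (kb i (cell n x / 2 ^ n - y) + kb i ((cell n x + 1) / 2 ^ n - y)) := by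
  have hp := two_zpow_pos i
  have hpn := two_zpow_pos n
  have hd : ∀ z : ℝ, HasDerivAt (fun z => Θ (2 ^ i * (z - y))) (kP ψ i z y) z := by
    intro z
    have h1 : HasDerivAt (fun z : ℝ => (2 : ℝ) ^ i * (z - y)) (2 ^ i) z := by
      simpa using ((hasDerivAt_id z).sub_const y).const_mul ((2 : ℝ) ^ i)
    exact (h.der _).scomp z h1
  unfold KC
  rw [int_er, intervalIntegral.integral_eq_sub_of_hasDerivAt (fun z _ => hd z)
    (Continuous.intervalIntegrable ((kP_cont h i).comp (continuous_id.prodMk continuous_const)) _ _),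
    norm_smul, Real.norm_of_nonneg hpn.le]
  have hb : ∀ p : ℝ, ‖Θ (2 ^ i * (p - y))‖ ≤ C / 2 ^ i * kb i (p - y) := by
    intro p
    refine (h.dec' _).trans (le_of_eq ?_)
    rw [abs_zmul]; unfold kb; field_simp
  calc _ ≤ 2 ^ n * (C / 2 ^ i * kb i ((cell n x + 1) / 2 ^ n - y) + C / 2 ^ i * kb i (cell n x / 2 ^ n - y)) := by
        gcongr
        exact (norm_sub_le _ _).trans (add_le_add (hb _) (hb _))
    _ = _ := by rw [zpow_sub₀ two_ne_zero]; ring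

lemma kb_coarse {n i : ℤ} (hni : n ≤ i) {p x : ℝ} (hpx : 2 ^ n * |x - p| ≤ 1) (y : ℝ) :
    2 ^ (n - i) * kb i (p - y) ≤ 4 * kb n (x - y) := by
  have hp := two_zpow_pos i
  have hpn := two_zpow_pos n
  unfold kb
  rw [zpow_sub₀ two_ne_zero, ← mul_div_assoc, div_mul_cancel₀ _ hp.ne', ← mul_div_assoc,
    div_le_div_iff₀ (by positivity) (by positivity)]
  have h1 : (1 : ℝ) + 2 ^ n * |x - y| ≤ 2 * (1 + 2 ^ i * |p - y|) := by
    have h2 : |x - y| ≤ |x - p| + |p - y| := abs_sub_le _ _ _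
    have h3 : (2 : ℝ) ^ n * |x - y| ≤ 2 ^ n * |x - p| + 2 ^ n * |p - y| := by
      rw [← mul_add]; gcongr
    have h4 : (2 : ℝ) ^ n * |p - y| ≤ 2 ^ i * |p - y| := by gcongr; norm_num
    have h5 : 0 ≤ (2 : ℝ) ^ i * |p - y| := by positivity
    linarith
  have h2 : (1 + 2 ^ n * |x - y|) ^ 2 ≤ (2 * (1 + 2 ^ i * |p - y|)) ^ 2 := by gcongr
  have h3 := mul_le_mul_of_nonneg_left h2 hpn.le
  refine h3.trans (le_of_eq (by ring))

lemma KC_kD (h : Bump ψ Θ C) (n i : ℤ) (x y : ℝ) :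
    KC (kD n) (kP ψ i) x y = KC (kE n) (kP ψ i) x y - KC (kE (n - 1)) (kP ψ i) x y := by
  have hi : ∀ n, Integrable (fun z => kE n x z * kP ψ i z y) := by
    intro n
    apply (kE_SK n).int_mul ((kP_SK h i).meas_col y) (B := (C * 2 ^ i).toNNReal)
    intro z
    refine ofReal_of_norm_le ((gd_norm h i _).trans ?_)
    apply mul_le_mul_of_nonneg_left _ h.pos
    unfold kb
    apply div_le_self (two_zpow_pos i).le
    have : 0 ≤ 2 ^ i * |z - y| := by positivity
    nlinarith
  unfold KC kD
  simp_rw [sub_mul]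
  exact integral_sub (hi n) (hi _)

/-- The basic kernel estimate. -/
lemma kernel_left (h : Bump ψ Θ C) : ∃ c : ℝ≥0, ∀ n i : ℤ, ∃ m : ℤ,
    (∀ x y, ‖KC (kD n) (kP ψ i) x y‖ₑ ≤ c * ENNReal.ofReal (kb m (x - y))) ∧
    ∀ x, ∫⁻ y, ‖KC (kD n) (kP ψ i) x y‖ₑ ≤ c * ENNReal.ofReal (2 ^ (-|n - i|)) := by
  refine ⟨(64 * C).toNNReal, fun n i => ?_⟩
  have hC := h.pos
  have hc : ((64 * C).toNNReal : ℝ≥0∞) = ENNReal.ofReal (64 * C) := rfl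
  rw [hc]
  rcases le_or_gt i n with hin | hin
  · have hb : ∀ x y, ‖KC (kD n) (kP ψ i) x y‖ ≤ 3 * C * 2 ^ (i - n) * kb i (x - y) := by
      intro x y
      rw [KC_kD h]
      have h1 := kE_sub h (n := n) (i := i) (by omega) x y
      have h2 := kE_sub h (n := n - 1) (i := i) (by omega) x y
      rw [show i - (n - 1) = (i - n) + 1 by ring, zpow_add_one₀ two_ne_zero] at h2
      calc _ = ‖(KC (kE n) (kP ψ i) x y - kP ψ i x y) - (KC (kE (n - 1)) (kP ψ i) x y - kP ψ i x y)‖ := by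
            congr 1; ring
        _ ≤ _ := norm_sub_le _ _
        _ ≤ _ := by linarith
    have hb' : ∀ x y, ‖KC (kD n) (kP ψ i) x y‖ₑ ≤ ENNReal.ofReal (3 * C * 2 ^ (i - n)) * ENNReal.ofReal (kb i (x - y)) := by
      intro x y
      rw [← ENNReal.ofReal_mul (by positivity)]
      exact ofReal_of_norm_le (hb x y)
    refine ⟨i, fun x y => (hb' x y).trans ?_, fun x => ?_⟩
    · refine mul_le_mul' (ENNReal.ofReal_le_ofReal ?_) le_rfl
      have : (2 : ℝ) ^ (i - n) ≤ 1 := zpow_le_one_of_nonpos₀ one_le_two (by omega)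
      calc 3 * C * 2 ^ (i - n) ≤ 3 * C * 1 := by gcongr
        _ ≤ 64 * C := by linarith
    · refine (row_le (by simp) (hb' x)).trans ?_
      rw [abs_of_nonneg (by omega), neg_sub, ← ENNReal.ofReal_mul (by positivity),
        show (16 : ℝ≥0∞) = ENNReal.ofReal 16 by norm_num, ← ENNReal.ofReal_mul (by positivity)]
      apply ENNReal.ofReal_le_ofReal
      have : 0 ≤ C * 2 ^ (i - n) := by positivity
      linarith
  · refine ⟨n, fun x y => ?_, fun x => ?_⟩
    · rw [← ENNReal.ofReal_mul (by positivity)]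
      apply ofReal_of_norm_le
      rw [KC_kD h]
      have k1 : ∀ n', n' ≤ n → ‖KC (kE n') (kP ψ i) x y‖ ≤ 8 * C * kb n' (x - y) := by
        intro n' hn'
        have e := endpoint_near n' x
        have h1 := kb_coarse (n := n') (i := i) (by omega) e.1 y
        have h2 := kb_coarse (n := n') (i := i) (by omega) e.2 y
        refine (kE_coarse h n' i x y).trans ?_
        calc _ = C * (2 ^ (n' - i) * kb i (cell n' x / 2 ^ n' - y)) +
              C * (2 ^ (n' - i) * kb i ((cell n' x + 1) / 2 ^ n' - y)) := by ring
          _ ≤ C * (4 * kb n' (x - y)) + C * (4 * kb n' (x - y)) := by gcongr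
          _ = _ := by ring
      have h3 := kb_pred n (x - y)
      have h5 := kb_nonneg n (x - y)
      refine (norm_sub_le _ _).trans ?_
      have a1 := k1 n le_rfl
      have a2 := k1 (n - 1) (by omega)
      have a3 : 8 * C * kb (n - 1) (x - y) ≤ 8 * C * (2 * kb n (x - y)) := by gcongr
      have a4 : 0 ≤ C * kb n (x - y) := by positivity
      linarith
    · have k1 : ∀ n' y, ‖KC (kE n') (kP ψ i) x y‖ₑ ≤ ENNReal.ofReal (C * 2 ^ (n' - i)) *
          (ENNReal.ofReal (kb i (cell n' x / 2 ^ n' - y)) + ENNReal.ofReal (kb i ((cell n' x + 1) / 2 ^ n' - y))) := by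
        intro n' y
        rw [← ENNReal.ofReal_add (kb_nonneg _ _) (kb_nonneg _ _), ← ENNReal.ofReal_mul (by positivity)]
        exact ofReal_of_norm_le (kE_coarse h n' i x y)
      have mk : ∀ p : ℝ, Measurable fun y => ENNReal.ofReal (kb i (p - y)) := fun p =>
        ((kb_cont i).measurable.comp (measurable_const.sub measurable_id)).ennreal_ofReal
      have k2 : ∀ n', ∫⁻ y, ‖KC (kE n') (kP ψ i) x y‖ₑ ≤ ENNReal.ofReal (C * 2 ^ (n' - i)) * 32 := by
        intro n'
        refine (lintegral_mono (k1 n')).trans ?_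
        rw [lintegral_const_mul' _ _ (by simp), lintegral_add_left (mk _)]
        gcongr
        refine (add_le_add (kb_int i _) (kb_int i _)).trans (by norm_num)
      have hm : Measurable fun y => ‖KC (kE n) (kP ψ i) x y‖ₑ := by
        have : StronglyMeasurable (fun z : ℝ × ℝ => kE n x z.2 * kP ψ i z.2 z.1) :=
          ((((kE_SK n).meas_row x).comp measurable_snd).mul ((kP_SK h i).meas.comp measurable_swap)).stronglyMeasurable
        exact this.integral_prod_right'.measurable.enorm
      calc _ ≤ ∫⁻ y, (‖KC (kE n) (kP ψ i) x y‖ₑ + ‖KC (kE (n - 1)) (kP ψ i) x y‖ₑ) := by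
            apply lintegral_mono; intro y; dsimp only; rw [KC_kD h]; exact enorm_sub_le
        _ = _ := lintegral_add_left hm _
        _ ≤ ENNReal.ofReal (C * 2 ^ (n - i)) * 32 + ENNReal.ofReal (C * 2 ^ (n - 1 - i)) * 32 :=
            add_le_add (k2 _) (k2 _)
        _ = ENNReal.ofReal (C * 2 ^ (n - i) * 32 + C * 2 ^ (n - 1 - i) * 32) := by
            rw [show (32 : ℝ≥0∞) = ENNReal.ofReal 32 by norm_num, ← ENNReal.ofReal_mul (by positivity),
              ← ENNReal.ofReal_mul (by positivity), ← ENNReal.ofReal_add (by positivity) (by positivity)]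
        _ ≤ _ := by
            rw [abs_of_neg (by omega), neg_neg, ← ENNReal.ofReal_mul (by positivity)]
            apply ENNReal.ofReal_le_ofReal
            rw [show n - 1 - i = n - i - 1 by ring, zpow_sub_one₀ two_ne_zero]
            have : 0 ≤ C * 2 ^ (n - i) := by positivity
            linarith

end
end VP

namespace VP

lemma KC_meas {K1 K2} (h1 : SK K1) (h2 : SK K2) : Measurable (fun z : ℝ × ℝ => KC K1 K2 z.1 z.2) := by
  unfold KC
  have : StronglyMeasurable (fun q : (ℝ × ℝ) × ℝ => K1 q.1.1 q.2 * K2 q.2 q.1.2) :=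
    ((h1.meas.comp ((measurable_fst.comp measurable_fst).prodMk measurable_snd)).mul
      (h2.meas.comp (measurable_snd.prodMk (measurable_snd.comp measurable_fst)))).stronglyMeasurable
  exact this.integral_prod_right'.measurable

lemma KC_row {K1 K2} (h1 : SK K1) (h2 : SK K2) : ∃ A : ℝ≥0, ∀ x, ∫⁻ y, ‖KC K1 K2 x y‖ₑ ≤ A := by
  obtain ⟨A, hA⟩ := h1.row
  obtain ⟨A2, hA2⟩ := h2.row
  refine ⟨A * A2, fun x => ?_⟩
  calc _ ≤ ∫⁻ y, ∫⁻ z, ‖K1 x z‖ₑ * ‖K2 z y‖ₑ := by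
        apply lintegral_mono; intro y
        refine (enorm_integral_le_lintegral_enorm _).trans (le_of_eq ?_)
        simp_rw [enorm_mul]
    _ = ∫⁻ z, ∫⁻ y, ‖K1 x z‖ₑ * ‖K2 z y‖ₑ := by
        apply lintegral_lintegral_swap
        exact (((h1.meas_row x).comp measurable_snd).enorm.mul (h2.meas.comp measurable_swap).enorm).aemeasurable
    _ ≤ ∫⁻ z, ‖K1 x z‖ₑ * A2 := by
        apply lintegral_mono; intro z; dsimp only
        rw [lintegral_const_mul' _ _ (by simp)]; gcongr; exact hA2 z
    _ = (∫⁻ z, ‖K1 x z‖ₑ) * A2 := lintegral_mul_const' _ _ (by simp)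
    _ ≤ _ := by push_cast; gcongr; exact hA x

lemma KC_T (K1 K2) : KT (KC K1 K2) = KC (KT K2) (KT K1) := by
  ext x y; simp only [KT, KC]; congr 1; ext z; ring

lemma SK.comp {K1 K2} (h1 : SK K1) (h2 : SK K2) : SK (KC K1 K2) := by
  refine ⟨KC_meas h1 h2, KC_row h1 h2, ?_⟩
  obtain ⟨B, hB⟩ := KC_row h2.T h1.T
  refine ⟨B, fun y => ?_⟩
  have := hB y
  rw [← KC_T] at this
  exact this

/-- general weighted bound -/
lemma op_weight {s : ℝ} (hs : 1 < s) {K} (h : SK K) {G} (hG : Measurable G) {w : ℝ → ℝ≥0∞} (hw : Measurable w)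
    {A B c : ℝ≥0∞} {m : ℤ} (hA : ∀ x, ∫⁻ y, ‖K x y‖ₑ ≤ A) (hB : ∀ y, ∫⁻ x, ‖K x y‖ₑ ≤ B)
    (hc : ∀ x y, ‖K x y‖ₑ ≤ c * ENNReal.ofReal (kb m (x - y))) :
    ∫⁻ x, ‖Top K G x‖ₑ ^ (2 : ℝ) * w x ≤
      A * B ^ (1 - 1 / s) * (c * 8) ^ (1 / s) * ∫⁻ y, ‖G y‖ₑ ^ (2 : ℝ) * MS s w y := by
  have h1 := Top_weight h hG hw hA (W := fun y => B ^ (1 - 1 / s) * ((c * 8) ^ (1 / s) * MS s w y)) (fun y =>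
    ker_MS hs (h.meas_col y).enorm hw (n := m) (y := y)
      (fun x => by rw [← kb_neg m (y - x), neg_sub]; exact hc x y) (hB y))
  refine h1.trans (le_of_eq ?_)
  have : ∀ y, ‖G y‖ₑ ^ (2 : ℝ) * (B ^ (1 - 1 / s) * ((c * 8) ^ (1 / s) * MS s w y)) =
      (B ^ (1 - 1 / s) * (c * 8) ^ (1 / s)) * (‖G y‖ₑ ^ (2 : ℝ) * MS s w y) := fun y => by ring
  simp_rw [this]
  rw [lintegral_const_mul _ (show Measurable fun y => ‖G y‖ₑ ^ (2 : ℝ) * MS s w y from (hG.enorm.pow_const _).mul (MS_meas hw))]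
  ring

def ga (l : ℤ) : ℝ≥0∞ := ENNReal.ofReal (2 ^ (-|l|))

lemma ga_le_one (l) : ga l ≤ 1 := by
  unfold ga
  rw [ENNReal.ofReal_le_one]
  exact zpow_le_one_of_nonpos₀ one_le_two (by have := abs_nonneg l; omega)

lemma ga_eq (l : ℤ) : ga l = 2⁻¹ ^ l.natAbs := by
  unfold ga
  rw [Int.abs_eq_natAbs, zpow_neg, zpow_natCast, ← inv_pow, ENNReal.ofReal_pow (by norm_num),
    ENNReal.ofReal_inv_of_pos (by norm_num)]
  norm_num

lemma ga_neg (l : ℤ) : ga (-l) = ga l := by unfold ga; rw [abs_neg]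

section
variable {ψ Θ : ℝ → ℂ} {C : ℝ}

lemma wD {s : ℝ} (hs : 1 < s) : ∃ c : ℝ≥0, ∀ n G w, Measurable G → Measurable w →
    ∫⁻ x, ‖Top (kD n) G x‖ₑ ^ (2 : ℝ) * w x ≤ c * ∫⁻ y, ‖G y‖ₑ ^ (2 : ℝ) * MS s w y := by
  have h1 : 0 ≤ 1 - 1 / s := by rw [sub_nonneg, div_le_one (by linarith)]; exact hs.le
  refine ⟨192 * 192 ^ (1 - 1 / s) * (12 * 8) ^ (1 / s), fun n G w hG hw => ?_⟩
  have := op_weight hs (kD_SK n) hG hw (A := 192) (B := 192) (c := 12) (m := n)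
    (fun x => (row_le (by simp) (fun y => kD_le n x y)).trans (by norm_num))
    (fun y => (col_le (by simp) (fun x => kD_le n x y)).trans (by norm_num)) (kD_le n)
  refine this.trans (le_of_eq ?_)
  push_cast
  rw [ENNReal.coe_rpow_of_nonneg _ h1, ENNReal.coe_rpow_of_nonneg _ (by positivity)]
  push_cast
  rfl

lemma wL (h : Bump ψ Θ C) {s : ℝ} (hs : 1 < s) : ∃ c : ℝ≥0, ∀ n i G w, Nice G → Measurable w →
    ∫⁻ x, ‖Top (kD n) (Top (kP ψ i) G) x‖ₑ ^ (2 : ℝ) * w x ≤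
      c * ga (n - i) * ∫⁻ y, ‖G y‖ₑ ^ (2 : ℝ) * MS s w y := by
  have h1 : 0 ≤ 1 - 1 / s := by rw [sub_nonneg, div_le_one (by linarith)]; exact hs.le
  obtain ⟨c, hc⟩ := kernel_left h
  refine ⟨c * (c * 16) ^ (1 - 1 / s) * (c * 8) ^ (1 / s), fun n i G w hG hw => ?_⟩
  obtain ⟨m, hm1, hm2⟩ := hc n i
  have := op_weight hs ((kD_SK n).comp (kP_SK h i)) hG.meas hw (A := c * ga (n - i)) (B := c * 16) (c := c) (m := m)
    hm2 (fun y => col_le (by simp) (fun x => hm1 x y)) hm1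
  simp_rw [Top_comp (kD_SK n) (kP_SK h i) hG]
  refine this.trans (le_of_eq ?_)
  push_cast
  rw [ENNReal.coe_rpow_of_nonneg _ h1, ENNReal.coe_rpow_of_nonneg _ (by positivity)]
  push_cast
  ring

lemma wR (h : Bump ψ Θ C) {s : ℝ} (hs : 1 < s) : ∃ c : ℝ≥0, ∀ n i G w, Nice G → Measurable w →
    ∫⁻ x, ‖Top (kP ψ i) (Top (kD n) G) x‖ₑ ^ (2 : ℝ) * w x ≤
      c * ga (n - i) ^ (1 - 1 / s) * ∫⁻ y, ‖G y‖ₑ ^ (2 : ℝ) * MS s w y := by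
  have h1 : 0 ≤ 1 - 1 / s := by rw [sub_nonneg, div_le_one (by linarith)]; exact hs.le
  obtain ⟨c, hc⟩ := kernel_left h.refl
  refine ⟨c * 16 * c ^ (1 - 1 / s) * (c * 8) ^ (1 / s), fun n i G w hG hw => ?_⟩
  obtain ⟨m, hm1, hm2⟩ := hc n i
  have hk : ∀ x y, KC (kP ψ i) (kD n) x y = KC (kD n) (kP (fun u => ψ (-u)) i) y x := by
    intro x y
    have e1 : KT (kP ψ i) = kP (fun u => ψ (-u)) i := by
      ext a b; simp only [KT, kP, gd]; rw [← mul_neg, neg_sub]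
    have := congrFun (congrFun (KC_T (kP ψ i) (kD n)) y) x
    rw [kD_symm, e1] at this
    exact this
  have hm1' : ∀ x y, ‖KC (kP ψ i) (kD n) x y‖ₑ ≤ c * ENNReal.ofReal (kb m (x - y)) := by
    intro x y; rw [hk, ← kb_neg m (x - y), neg_sub]; exact hm1 y x
  have := op_weight hs ((kP_SK h i).comp (kD_SK n)) hG.meas hw (A := c * 16) (B := c * ga (n - i)) (c := c) (m := m)
    (fun x => row_le (by simp) (hm1' x)) (fun y => by simp_rw [hk]; exact hm2 y) hm1'
  simp_rw [Top_comp (kP_SK h i) (kD_SK n) hG]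
  refine this.trans (le_of_eq ?_)
  rw [ENNReal.mul_rpow_of_nonneg _ _ h1]
  push_cast
  rw [ENNReal.coe_rpow_of_nonneg _ h1, ENNReal.coe_rpow_of_nonneg _ (by positivity)]
  push_cast
  ring

/-- the sandwiched operator -/
def RR (ψ : ℝ → ℂ) (l m i : ℤ) (G : ℝ → ℂ) : ℝ → ℂ := Top (kD (i + l)) (Top (kP ψ i) (Top (kD (i + m)) G))

lemma RR_nice (h : Bump ψ Θ C) (l m i) {G} (hG : Nice G) : Nice (RR ψ l m i G) :=
  (kD_SK _).nice ((kP_SK h i).nice ((kD_SK _).nice hG))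

lemma min_geom {x y : ℝ≥0∞} {Z A : ℝ≥0∞} (h1 : Z ≤ x * A) (h2 : Z ≤ y * A) :
    Z ≤ (x * y) ^ (2⁻¹ : ℝ) * A := by
  rcases le_total x y with h | h
  · refine h1.trans ?_
    gcongr
    calc x = (x * x) ^ (2⁻¹ : ℝ) := by rw [← sq, ← ENNReal.rpow_natCast, ← ENNReal.rpow_mul]; norm_num
      _ ≤ _ := by gcongr
  · refine h2.trans ?_
    gcongr
    calc y = (y * y) ^ (2⁻¹ : ℝ) := by rw [← sq, ← ENNReal.rpow_natCast, ← ENNReal.rpow_mul]; norm_num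
      _ ≤ _ := by gcongr

lemma wRR (h : Bump ψ Θ C) {s : ℝ} (hs : 1 < s) : ∃ c : ℝ≥0, ∀ l m i G w, Nice G → Measurable w →
    ∫⁻ x, ‖RR ψ l m i G x‖ₑ ^ (2 : ℝ) * w x ≤
      c * (ga l * ga m) ^ ((1 - 1 / s) / 2) * ∫⁻ y, ‖G y‖ₑ ^ (2 : ℝ) * MS s (MS s w) y := by
  have hb : 0 < 1 - 1 / s := by rw [sub_pos, div_lt_one (by linarith)]; exact hs
  obtain ⟨c1, h1⟩ := wD hs
  obtain ⟨c2, h2⟩ := wL h hs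
  obtain ⟨c3, h3⟩ := wR h hs
  refine ⟨c2 * c1 + c1 * c3, fun l m i G w hG hw => ?_⟩
  set I := ∫⁻ y, ‖G y‖ₑ ^ (2 : ℝ) * MS s (MS s w) y
  set Z := ∫⁻ x, ‖RR ψ l m i G x‖ₑ ^ (2 : ℝ) * w x
  have hDG := (kD_SK (i + m)).nice hG
  have e1 : Z ≤ (ga l) ^ (1 - 1 / s) * ((c2 * c1 + c1 * c3 : ℝ≥0) * I) := by
    have a1 := h2 (i + l) i _ w hDG hw
    have a2 := h1 (i + m) G _ hG.meas (MS_meas (s := s) hw)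
    rw [add_sub_cancel_left] at a1
    calc Z ≤ _ := a1
      _ ≤ c2 * ga l * (c1 * I) := by gcongr
      _ ≤ c2 * (ga l) ^ (1 - 1 / s) * (c1 * I) := by
          gcongr
          nth_rw 1 [← ENNReal.rpow_one (ga l)]
          apply ENNReal.rpow_le_rpow_of_exponent_ge (ga_le_one l)
          have : 0 < 1 / s := by positivity
          linarith
      _ = (ga l) ^ (1 - 1 / s) * ((c2 * c1) * I) := by ring
      _ ≤ _ := by gcongr; push_cast; exact le_self_add
  have e2 : Z ≤ (ga m) ^ (1 - 1 / s) * ((c2 * c1 + c1 * c3 : ℝ≥0) * I) := by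
    have a1 := h1 (i + l) _ w ((kP_SK h i).nice hDG).meas hw
    have a2 := h3 (i + m) i G _ hG (MS_meas (s := s) hw)
    rw [add_sub_cancel_left] at a2
    calc Z ≤ _ := a1
      _ ≤ c1 * (c3 * (ga m) ^ (1 - 1 / s) * I) := by gcongr
      _ = (ga m) ^ (1 - 1 / s) * ((c1 * c3) * I) := by ring
      _ ≤ _ := by gcongr; push_cast; exact le_add_self
  refine (min_geom e1 e2).trans (le_of_eq ?_)
  rw [← ENNReal.mul_rpow_of_nonneg _ _ hb.le, ← ENNReal.rpow_mul, ← div_eq_mul_inv]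
  ring

lemma MS_Lp {s τ : ℝ} (hs : 1 < s) (hτ : s < τ) : ∃ c : ℝ≥0, ∀ w, Measurable w →
    ∫⁻ x, MS s w x ^ τ ≤ c * ∫⁻ x, w x ^ τ := by
  have hs0 : 0 < s := by linarith
  obtain ⟨c, hc⟩ := HL (τ := τ / s) (by rwa [one_lt_div hs0])
  refine ⟨c, fun w hw => ?_⟩
  have := hc (fun y => w y ^ s) (hw.pow_const _)
  simp_rw [MS, ← ENNReal.rpow_mul] at this ⊢
  rwa [show 1 / s * τ = τ / s by ring, ← mul_div_assoc, mul_div_cancel_left₀ _ hs0.ne'] at *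

lemma MS_const {s : ℝ} (hs : 1 < s) (c : ℝ≥0) (x) : MS s (fun _ => (c : ℝ≥0∞)) x ≤ c * 2 := by
  have hs0 : 0 < s := by linarith
  have h1 : MM (fun _ => (c : ℝ≥0∞) ^ s) x ≤ (c * 2 : ℝ≥0∞) ^ s := by
    have e : ∀ n, AA n (fun _ => (c : ℝ≥0∞) ^ s) x = AA n (fun _ => 1) x * (c : ℝ≥0∞) ^ s := by
      intro n; unfold AA
      rw [← lintegral_mul_const' _ _ (ENNReal.rpow_ne_top_of_nonneg hs0.le ENNReal.coe_ne_top)]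
      simp
    unfold MM
    simp_rw [e]
    rw [← ENNReal.iSup_mul, ENNReal.mul_rpow_of_nonneg _ _ hs0.le, mul_comm]
    gcongr
    refine (MM_one x).trans ?_
    nth_rw 1 [← ENNReal.rpow_one 2]
    exact ENNReal.rpow_le_rpow_of_exponent_le (by norm_num) hs.le
  unfold MS
  rw [one_div, ENNReal.rpow_inv_le_iff hs0]
  exact h1

/-- division lemma -/
lemma div_pow' {Y K X : ℝ≥0∞} {σ : ℝ} (hσ : 1 < σ) (hY : Y ≠ ∞)
    (h : Y ≤ K * X ^ (1 / σ) * Y ^ (1 - 1 / σ)) : Y ≤ K ^ σ * X := by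
  have hσ0 : 0 < σ := by linarith
  have hb : 0 < 1 - 1 / σ := by rw [sub_pos, div_lt_one hσ0]; exact hσ
  by_cases hY0 : Y = 0
  · rw [hY0]; exact zero_le
  have h1 : Y ^ (1 / σ) ≤ K * X ^ (1 / σ) := by
    have h2 : Y ^ (1 / σ) * Y ^ (1 - 1 / σ) ≤ K * X ^ (1 / σ) * Y ^ (1 - 1 / σ) := by
      rw [← ENNReal.rpow_add_of_nonneg _ _ (by positivity) hb.le]; simpa using h
    exact (ENNReal.mul_le_mul_iff_left (by simp [ENNReal.rpow_eq_zero_iff, hY0, hY])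
      (ENNReal.rpow_ne_top_of_nonneg hb.le hY)).1 h2
  have h3 := ENNReal.rpow_le_rpow h1 hσ0.le
  rwa [ENNReal.mul_rpow_of_nonneg _ _ hσ0.le, ← ENNReal.rpow_mul, ← ENNReal.rpow_mul,
    one_div_mul_cancel hσ0.ne', ENNReal.rpow_one, ENNReal.rpow_one] at h3

lemma sum_rpow_fin {ι : Type*} (I : Finset ι) {F : ι → ℝ → ℂ} (hF : ∀ i ∈ I, Nice (F i)) {σ : ℝ} (hσ : 1 ≤ σ) :
    ∫⁻ x, (∑ i ∈ I, ‖F i x‖ₑ ^ (2 : ℝ)) ^ σ ≠ ∞ := by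
  classical
  have hσ0 : 0 < σ := by linarith
  induction I using Finset.induction_on with
  | empty => simp [ENNReal.zero_rpow_of_pos hσ0]
  | insert a s ha ih =>
    have h1 := ih fun i hi => hF i (by simp [hi])
    have h2 := (hF a (by simp)).rpow_fin (p := 2 * σ) (by linarith)
    have h4 : (2 : ℝ≥0∞) ^ σ ≠ ∞ := by simp [hσ0.le]
    apply ne_top_of_le_ne_top (b := 2 ^ σ * ((∫⁻ x, ‖F a x‖ₑ ^ (2 * σ)) + ∫⁻ x, (∑ i ∈ s, ‖F i x‖ₑ ^ (2 : ℝ)) ^ σ))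
      (ENNReal.mul_ne_top h4 (ENNReal.add_ne_top.2 ⟨h2, h1⟩))
    rw [← lintegral_add_left ((hF a (by simp)).meas.enorm.pow_const _), ← lintegral_const_mul' _ _ h4]
    apply lintegral_mono; intro x; dsimp only
    rw [Finset.sum_insert ha, ENNReal.rpow_mul]
    exact add_rpow_le2 _ _ hσ0.le

/-- vector-valued estimate -/
lemma WW (h : Bump ψ Θ C) {σ : ℝ} (hσ : 1 ≤ σ) : ∃ c : ℝ≥0, ∃ a : ℝ, 0 < a ∧
    ∀ l m (I : Finset ℤ) (G : ℤ → ℝ → ℂ), (∀ i, Nice (G i)) →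
    ∫⁻ x, (∑ i ∈ I, ‖RR ψ l m i (G i) x‖ₑ ^ (2 : ℝ)) ^ σ ≤
      c * (ga l * ga m) ^ a * ∫⁻ x, (∑ i ∈ I, ‖G i x‖ₑ ^ (2 : ℝ)) ^ σ := by
  have sumw : ∀ {s : ℝ} {c : ℝ≥0}, (∀ l m i G w, Nice G → Measurable w →
    ∫⁻ x, ‖RR ψ l m i G x‖ₑ ^ (2 : ℝ) * w x ≤
      c * (ga l * ga m) ^ ((1 - 1 / s) / 2) * ∫⁻ y, ‖G y‖ₑ ^ (2 : ℝ) * MS s (MS s w) y) →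
      ∀ l m (I : Finset ℤ) (G : ℤ → ℝ → ℂ) w, (∀ i, Nice (G i)) → Measurable w →
      ∫⁻ x, (∑ i ∈ I, ‖RR ψ l m i (G i) x‖ₑ ^ (2 : ℝ)) * w x ≤
      c * (ga l * ga m) ^ ((1 - 1 / s) / 2) * ∫⁻ y, (∑ i ∈ I, ‖G i y‖ₑ ^ (2 : ℝ)) * MS s (MS s w) y := by
    intro s c hc l m I G w hG hw
    simp_rw [Finset.sum_mul]
    rw [lintegral_finsetSum, lintegral_finsetSum, Finset.mul_sum]
    · exact Finset.sum_le_sum fun i _ => hc l m i (G i) w (hG i) hw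
    · intro i _; exact ((hG i).meas.enorm.pow_const _).mul (MS_meas (MS_meas hw))
    · intro i _; exact ((RR_nice h l m i (hG i)).meas.enorm.pow_const _).mul hw
  rcases hσ.eq_or_lt with rfl | hσ1
  · obtain ⟨c, hc⟩ := wRR h (s := 2) (by norm_num)
    refine ⟨c * 4, (1 - 1 / 2) / 2, by norm_num, fun l m I G hG => ?_⟩
    have := sumw hc l m I G (fun _ => 1) hG measurable_const
    simp only [mul_one] at this
    simp only [ENNReal.rpow_one]
    refine this.trans ?_
    have h4 : ∀ y, MS 2 (MS 2 (fun _ => 1)) y ≤ 4 := by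
      intro y
      have e1 : ∀ z, MS 2 (fun _ => 1) z ≤ 2 := by
        intro z; simpa using MS_const (s := 2) (by norm_num) 1 z
      have e2 : MS 2 (fun _ => 2) y ≤ 4 := by
        have := MS_const (s := 2) (by norm_num) 2 y
        norm_num at this ⊢; exact this
      refine le_trans ?_ e2
      unfold MS
      gcongr
      apply MM_mono; intro z; gcongr; exact e1 z
    calc _ ≤ c * (ga l * ga m) ^ ((1 - 1 / 2 : ℝ) / 2) * ∫⁻ y, (∑ i ∈ I, ‖G i y‖ₑ ^ (2 : ℝ)) * 4 := by
          gcongr with y; exact h4 y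
      _ = _ := by
          rw [lintegral_mul_const' _ _ (by simp)]; push_cast; ring
  · have hσ0 : 0 < σ := by linarith
    have hσm : 0 < σ - 1 := by linarith
    let σ' := σ / (σ - 1)
    have hc' : σ.HolderConjugate σ' := Real.HolderConjugate.conjExponent hσ1
    have hσ'1 : 1 < σ' := hc'.symm.lt
    let s := (1 + σ') / 2
    have hs : 1 < s := by simp only [s]; linarith
    have hsσ : s < σ' := by simp only [s]; linarith
    obtain ⟨c, hc⟩ := wRR h hs
    obtain ⟨M, hM⟩ := MS_Lp hs hsσ
    have hb : 0 < 1 - 1 / s := by rw [sub_pos, div_lt_one (by linarith)]; exact hs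
    refine ⟨(c * (M * M) ^ (1 / σ')) ^ σ, (1 - 1 / s) / 2 * σ, by positivity, fun l m I G hG => ?_⟩
    have hnice := fun i => RR_nice h l m i (hG i)
    have hHm : Measurable (fun x => ∑ i ∈ I, ‖RR ψ l m i (G i) x‖ₑ ^ (2 : ℝ)) :=
      Finset.measurable_sum _ fun i _ => (hnice i).meas.enorm.pow_const _
    have hGm : Measurable (fun x => ∑ i ∈ I, ‖G i x‖ₑ ^ (2 : ℝ)) :=
      Finset.measurable_sum _ fun i _ => (hG i).meas.enorm.pow_const _
    have hfin := sum_rpow_fin I (fun i _ => hnice i) hσ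
    have hsum := sumw hc l m I G (fun x => (∑ i ∈ I, ‖RR ψ l m i (G i) x‖ₑ ^ (2 : ℝ)) ^ (σ - 1)) hG (hHm.pow_const _)
    set H := fun x => ∑ i ∈ I, ‖RR ψ l m i (G i) x‖ₑ ^ (2 : ℝ) with hH
    set Q := fun x => ∑ i ∈ I, ‖G i x‖ₑ ^ (2 : ℝ) with hQ
    have hY : ∫⁻ x, H x ^ σ = ∫⁻ x, H x * H x ^ (σ - 1) := by
      apply lintegral_congr; intro x
      nth_rw 2 [← ENNReal.rpow_one (H x)]
      rw [← ENNReal.rpow_add_of_nonneg _ _ zero_le_one hσm.le]; congr 1; ring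
    have hw : Measurable (fun x => H x ^ (σ - 1)) := hHm.pow_const _
    have hhold := ENNReal.lintegral_mul_le_Lp_mul_Lq volume hc' hGm.aemeasurable
      (MS_meas (s := s) (MS_meas (s := s) hw)).aemeasurable
    have hMM : ∫⁻ x, MS s (MS s fun x => H x ^ (σ - 1)) x ^ σ' ≤ M * M * ∫⁻ x, H x ^ σ := by
      refine (hM _ (MS_meas hw)).trans ?_
      rw [mul_assoc]
      gcongr
      refine (hM _ hw).trans (le_of_eq ?_)
      simp_rw [← ENNReal.rpow_mul]
      rw [show (σ - 1) * σ' = σ by simp only [σ']; field_simp]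
    have hfinal : ∫⁻ x, H x ^ σ ≤ (c * (M * M) ^ (1 / σ') * (ga l * ga m) ^ ((1 - 1 / s) / 2)) *
        (∫⁻ x, Q x ^ σ) ^ (1 / σ) * (∫⁻ x, H x ^ σ) ^ (1 - 1 / σ) := by
      calc ∫⁻ x, H x ^ σ = _ := hY
        _ ≤ _ := hsum
        _ ≤ c * (ga l * ga m) ^ ((1 - 1 / s) / 2) * ((∫⁻ x, Q x ^ σ) ^ (1 / σ) *
            (M * M * ∫⁻ x, H x ^ σ) ^ (1 / σ')) := by
            gcongr
            refine hhold.trans ?_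
            gcongr
        _ = _ := by
            rw [ENNReal.mul_rpow_of_nonneg _ _ (show 0 ≤ 1 / σ' by positivity),
              show 1 / σ' = 1 - 1 / σ by simp only [σ']; field_simp]
            ring
    have := div_pow' hσ1 hfin hfinal
    refine this.trans (le_of_eq ?_)
    rw [ENNReal.mul_rpow_of_nonneg _ _ hσ0.le, ← ENNReal.rpow_mul]
    rw [ENNReal.coe_rpow_of_nonneg _ hσ0.le]; push_cast
    rw [ENNReal.coe_rpow_of_nonneg _ (show 0 ≤ 1 / σ' by positivity)]; push_cast
    rfl

end
end VP

namespace VP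

/-- product space carrying all starting scales at once -/
def nuZ : Measure (ℤ × ℝ) := (Measure.count : Measure ℤ).prod volume
def thZ (k : ℕ) (z : ℤ × ℝ) : ℤ × ℝ := (z.1, flip (z.1 + k) z.2)

lemma thZ_mp (k : ℕ) : MeasurePreserving (thZ k) nuZ nuZ := by
  unfold nuZ thZ
  refine MeasurePreserving.skew_product (MeasurePreserving.id _) (g := fun c x => flip (c + k) x) ?_ ?_
  · exact measurable_from_prod_countable_right fun c => flip_meas (c + k)
  · exact Filter.Eventually.of_forall fun c => (flip_mp _).map_eq

lemma nu_lint {H : ℤ × ℝ → ℝ≥0∞} (hH : Measurable H) : ∫⁻ z, H z ∂nuZ = ∑' c, ∫⁻ x, H (c, x) := by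
  unfold nuZ
  rw [lintegral_prod _ hH.aemeasurable, lintegral_count]

lemma nu_ge {H : ℤ × ℝ → ℝ≥0∞} (hH : Measurable H) (c : ℤ) : ∫⁻ x, H (c, x) ≤ ∫⁻ z, H z ∂nuZ := by
  rw [nu_lint hH]; exact ENNReal.le_tsum c

lemma nu_eq {H : ℤ × ℝ → ℝ≥0∞} (hH : Measurable H) (c : ℤ) (h0 : ∀ c' ≠ c, ∀ x, H (c', x) = 0) :
    ∫⁻ z, H z ∂nuZ = ∫⁻ x, H (c, x) := by
  rw [nu_lint hH]; exact tsum_eq_single c fun c' hc => by simp [h0 c' hc]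

def lf (c : ℤ) (d : ℕ → ℝ → ℂ) (k : ℕ) (z : ℤ × ℝ) : ℂ := if z.1 = c then d k z.2 else 0

lemma lf_diff {c : ℤ} {d : ℕ → ℝ → ℂ} (h : IsDiff (fun k : ℕ => flip (c + k)) d) : IsDiff thZ (lf c d) where
  meas i := measurable_from_prod_countable_right fun c' => by
    unfold lf; by_cases hc : c' = c <;> simp [hc, h.meas i]
  flip i z := by
    unfold lf thZ; dsimp only
    split_ifs with hc
    · rw [hc]; exact h.flip i z.2
    · simp
  inv i j hij z := by
    unfold lf thZ; dsimp only
    split_ifs with hc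
    · rw [hc]; exact h.inv i j hij z.2
    · rfl

lemma lf_S (c d n c' x) : S (lf c d) n (c', x) = if c' = c then S d n x else 0 := by
  unfold S lf; split_ifs <;> simp
lemma lf_Sq (c d n c' x) : Sq (lf c d) n (c', x) = if c' = c then Sq d n x else 0 := by
  unfold Sq lf; split_ifs <;> simp
lemma lf_Pi (c d e s t x) : Pi (lf c d) (lf c e) s t (c, x) = Pi d e s t x := by
  have h : ∀ n, S (Zd (lf c d) (lf c e)) n (c, x) = S (Zd d e) n x := by
    intro n
    unfold S
    refine Finset.sum_congr rfl fun i _ => ?_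
    unfold Zd
    rw [lf_S]; simp [lf]
  unfold Pi
  rw [h, h, lf_S, lf_S, lf_S]; simp

lemma SqL_lift {c : ℤ} {d : ℕ → ℝ → ℂ} (h : IsDiff (fun k : ℕ => flip (c + k)) d) (K : ℕ) {p : ℝ} (hp : 0 < p) :
    ∫⁻ z, ENNReal.ofReal (Sq (lf c d) K z) ^ p ∂nuZ = ∫⁻ x, ENNReal.ofReal (Sq d K x) ^ p := by
  rw [nu_eq (((lf_diff h).Sq_meas K).ennreal_ofReal.pow_const _) c]
  · simp [lf_Sq]
  · intro c' hc x; rw [lf_Sq, if_neg hc]; simp [hp]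

theorem V2D {r p p1 p2 : ℝ} (hr : 1 < r) (hp : 0 < p)
    (hp1 : 0 < p1) (hp2 : 0 < p2) (hpp : 1 / p = 1 / p1 + 1 / p2) : ∃ C : ℝ≥0, ∀ (c : ℤ) (d e : ℕ → ℝ → ℂ) (K : ℕ),
    IsDiff (fun k : ℕ => flip (c + k)) d → IsDiff (fun k : ℕ => flip (c + k)) e → ∫⁻ x, VP d e r K x ^ (p / r) ≤
      C * ((∫⁻ x, ENNReal.ofReal (Sq d K x) ^ (p1 / 2)) + ∫⁻ x, ENNReal.ofReal (Sq e K x) ^ (p2 / 2)) := by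
  obtain ⟨C, hC⟩ := V2 thZ_mp hr hp hp1 hp2 hpp
  refine ⟨C, fun c d e K hd he => ?_⟩
  have := hC _ _ K (lf_diff hd) (lf_diff he)
  rw [SqL_lift hd K (by positivity), SqL_lift he K (by positivity)] at this
  refine le_trans ?_ this
  refine le_trans (le_of_eq ?_) (nu_ge ((VP_meas (lf_diff hd).meas (lf_diff he).meas r K).pow_const _) c)
  simp only [VP, lf_Pi]

theorem V1D {q p : ℝ} (hq : 2 < q) (hp : 0 < p) : ∃ C : ℝ≥0, ∀ (c : ℤ) (d : ℕ → ℝ → ℂ) (K : ℕ),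
    IsDiff (fun k : ℕ => flip (c + k)) d → ∫⁻ x, VS d q K x ^ (p / q) ≤
      C * ∫⁻ x, ENNReal.ofReal (Sq d K x) ^ (p / 2) := by
  obtain ⟨C, hC⟩ := V1 thZ_mp hq hp
  refine ⟨C, fun c d K hd => ?_⟩
  have := hC _ K (lf_diff hd)
  rw [SqL_lift hd K (by positivity)] at this
  refine le_trans ?_ this
  refine le_trans (le_of_eq ?_) (nu_ge ((VS_meas (lf_diff hd).meas q K).pow_const _) c)
  simp only [VS, lf_S, if_true]

theorem bdgD {p : ℝ} (hp : 0 < p) : ∃ C : ℝ≥0, ∀ (c : ℤ) (d : ℕ → ℝ → ℂ) (K : ℕ),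
    IsDiff (fun k : ℕ => flip (c + k)) d → ∫⁻ x, ‖S d K x‖ₑ ^ p ≤
      C * ∫⁻ x, ENNReal.ofReal (Sq d K x) ^ (p / 2) := by
  obtain ⟨C, hC⟩ := bdg_all thZ_mp hp
  refine ⟨C, fun c d K hd => ?_⟩
  have := hC _ K (lf_diff hd)
  rw [SqL_lift hd K (by positivity)] at this
  refine le_trans ?_ this
  have hm : Measurable (S (lf c d) K) := (lf_diff hd).S_pred.meas K
  refine le_trans (le_of_eq ?_) (nu_ge (hm.enorm.pow_const _) c)
  simp only [lf_S, if_true]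

theorem garsiaD {p : ℝ} (hp : 2 ≤ p) : ∃ C : ℝ≥0, ∀ (c : ℤ) (d : ℕ → ℝ → ℂ) (K : ℕ),
    IsDiff (fun k : ℕ => flip (c + k)) d → ∫⁻ x, ENNReal.ofReal (Sq d K x) ^ (p / 2) ≠ ∞ →
    ∫⁻ x, ENNReal.ofReal (Sq d K x) ^ (p / 2) ≤ C * ∫⁻ x, ‖S d K x‖ₑ ^ p := by
  obtain ⟨C, hC⟩ := garsia thZ_mp hp
  refine ⟨C, fun c d K hd hfin => ?_⟩
  have := hC _ K (lf_diff hd)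
  rw [SqL_lift hd K (by positivity)] at this
  refine (this hfin).trans ?_
  have hm : Measurable (S (lf c d) K) := (lf_diff hd).S_pred.meas K
  rw [nu_eq (hm.enorm.pow_const _) c]
  · simp [lf_S]
  · intro c' hc x; rw [lf_S, if_neg hc]; simp; linarith

/-- martingale-difference families indexed by ℤ -/
structure DZ (G : ℤ → ℝ → ℂ) : Prop where
  meas : ∀ n, Measurable (G n)
  flip : ∀ n x, G n (flip n x) = - G n x
  inv : ∀ n m, n < m → ∀ x, G n (VP.flip m x) = G n x

lemma DZ.diff {G} (h : DZ G) (c : ℤ) : IsDiff (fun k : ℕ => VP.flip (c + k)) (fun k => G (c + k)) :=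
  ⟨fun _ => h.meas _, fun _ => h.flip _, fun i j hij => h.inv _ _ (by omega)⟩

lemma DZ.res {G} (h : DZ G) (I : Finset ℤ) : DZ (fun n x => if n ∈ I then G n x else 0) := by
  refine ⟨fun n => ?_, fun n x => ?_, fun n m hnm x => ?_⟩
  · by_cases hn : n ∈ I <;> simp [hn, h.meas n]
  · split_ifs
    · exact h.flip n x
    · simp
  · rw [h.inv n m hnm]

lemma sum_window {E : Type*} [AddCommMonoid E] (c : ℤ) (K : ℕ) (F : ℤ → E) :
    ∑ k ∈ Finset.range K, F (c + k) = ∑ i ∈ Finset.Ico c (c + K), F i := by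
  induction K with
  | zero => simp
  | succ K ih =>
    rw [Finset.sum_range_succ, ih]
    have : Finset.Ico c (c + (K + 1 : ℕ)) = insert (c + K) (Finset.Ico c (c + K)) := by
      ext; simp; omega
    rw [this, Finset.sum_insert (by simp), add_comm]

lemma exists_window (I : Finset ℤ) : ∃ (c : ℤ) (K : ℕ), I ⊆ Finset.Ico c (c + K) := by
  induction I using Finset.induction_on with
  | empty => exact ⟨0, 0, by simp⟩
  | insert a s ha ih =>
    obtain ⟨c, K, h⟩ := ih
    refine ⟨min c a, K + (|c - a|).toNat + 1, fun x hx => ?_⟩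
    have h1 := abs_nonneg (c - a)
    have h2 := le_abs_self (c - a)
    have h3 := neg_abs_le (c - a)
    rw [Finset.mem_insert] at hx
    rw [Finset.mem_Ico]
    push_cast
    rw [Int.toNat_of_nonneg h1]
    rcases hx with rfl | hx
    · omega
    · have := Finset.mem_Ico.1 (h hx); omega

lemma ofReal_sq (z : ℂ) : ENNReal.ofReal (‖z‖ ^ 2) = ‖z‖ₑ ^ (2 : ℝ) := by
  rw [← ofReal_norm_rpow z (by norm_num)]; norm_num

lemma Sq_window (G : ℤ → ℝ → ℂ) (c : ℤ) (K : ℕ) (x : ℝ) :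
    ENNReal.ofReal (Sq (fun k => G (c + k)) K x) = ∑ i ∈ Finset.Ico c (c + K), ‖G i x‖ₑ ^ (2 : ℝ) := by
  rw [← sum_window c K (fun i => ‖G i x‖ₑ ^ (2 : ℝ))]
  unfold Sq
  rw [ENNReal.ofReal_sum_of_nonneg (fun _ _ => by positivity)]
  simp_rw [ofReal_sq]

lemma bdgZ {p : ℝ} (hp : 0 < p) : ∃ C : ℝ≥0, ∀ (G : ℤ → ℝ → ℂ) (I : Finset ℤ), DZ G →
    ∫⁻ x, ‖∑ i ∈ I, G i x‖ₑ ^ p ≤ C * ∫⁻ x, (∑ i ∈ I, ‖G i x‖ₑ ^ (2 : ℝ)) ^ (p / 2) := by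
  obtain ⟨C, hC⟩ := bdgD hp
  refine ⟨C, fun G I hG => ?_⟩
  obtain ⟨c, K, hI⟩ := exists_window I
  have h := hC c _ K ((hG.res I).diff c)
  have e1 : ∀ x, S (fun k : ℕ => (fun n x => if n ∈ I then G n x else 0) (c + k)) K x = ∑ i ∈ I, G i x := by
    intro x
    unfold S
    rw [sum_window c K (fun i => if i ∈ I then G i x else 0), Finset.sum_ite_mem, Finset.inter_eq_right.2 hI]
  have e2 : ∀ x, ENNReal.ofReal (Sq (fun k : ℕ => (fun n x => if n ∈ I then G n x else 0) (c + k)) K x) =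
      ∑ i ∈ I, ‖G i x‖ₑ ^ (2 : ℝ) := by
    intro x
    rw [Sq_window (fun n x => if n ∈ I then G n x else 0)]
    rw [← Finset.sum_subset hI]
    · refine Finset.sum_congr rfl fun i hi => by simp [hi]
    · intro i _ hi; simp [hi]
  simp_rw [e1, e2] at h
  exact h

/-- conditional expectation facts -/
lemma Top_kE_const {n : ℤ} {h : ℝ → ℂ} (hh : ∀ x y, cell n x = cell n y → h x = h y) (x) : Top (kE n) h x = h x := by
  unfold Top
  have : ∀ y, kE n x y * h y = kE n x y * h x := by
    intro y
    by_cases hc : cell n x = cell n y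
    · rw [hh x y hc]
    · simp [kE, er, hc]
  simp_rw [this]
  rw [integral_mul_const, kE_int, one_mul]

lemma Top_kE_cell {n : ℤ} (G : ℝ → ℂ) {x y} (h : cell n x = cell n y) : Top (kE n) G x = Top (kE n) G y := by
  unfold Top kE; simp_rw [er_congr h]

lemma Top_kE_diff {n : ℤ} {h : ℝ → ℂ} (hh : ∀ x, h (flip n x) = - h x) (hm : Measurable h) (x) : Top (kE (n - 1)) h x = 0 := by
  have h1 : ∫ y, kE (n - 1) x y * h y = ∫ y, kE (n - 1) x (flip n y) * h (flip n y) := by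
    have hmm : AEStronglyMeasurable (fun y => kE (n - 1) x y * h y) (Measure.map (flip n) volume) :=
      (((kE_SK (n - 1)).meas_row x).mul hm).aestronglyMeasurable
    have := integral_map (μ := volume) (flip_meas n).aemeasurable hmm
    rwa [(flip_mp n).map_eq] at this
  have h2 : ∀ y, kE (n - 1) x (flip n y) = kE (n - 1) x y := by
    intro y; unfold kE
    rw [er_symm, er_congr (cell_flip_lt (by omega) y), er_symm]
  simp_rw [h2, hh, mul_neg, integral_neg] at h1
  unfold Top
  exact self_eq_neg.1 h1

lemma Top_kD_idem (n : ℤ) {G} (hG : Nice G) : Top (kD n) (Top (kD n) G) = Top (kD n) G := by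
  ext x
  have hN := (kD_SK n).nice hG
  rw [Top_kD n hN, Top_kE_diff (Top_kD_flip n G) hN.meas, sub_zero]
  apply Top_kE_const
  intro y z hyz
  rw [Top_kD n hG, Top_kD n hG, Top_kE_cell G hyz, Top_kE_cell G (cell_eq_mono (by omega) hyz)]

lemma kD_DZ {u : ℤ → ℝ → ℂ} (hu : ∀ n, Nice (u n)) : DZ (fun n => Top (kD n) (u n)) :=
  ⟨fun n => ((kD_SK n).nice (hu n)).meas, fun n => Top_kD_flip n _, fun n m h => Top_kD_inv h _⟩

lemma Top_kE_tendsto {u : ℝ → ℂ} (hu : Nice u) (hc : Continuous u) (x : ℝ) (j : ℤ) :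
    Filter.Tendsto (fun n : ℕ => Top (kE (j + n)) u x) Filter.atTop (nhds (u x)) := by
  rw [Metric.tendsto_atTop]
  intro ε hε
  obtain ⟨δ, hδ, hd⟩ := Metric.continuous_iff.1 hc x (ε / 2) (by positivity)
  obtain ⟨b, hb⟩ := hu.bdd
  obtain ⟨N, hN⟩ : ∃ N : ℕ, ∀ n ≥ N, 1 / 2 ^ (j + n) < δ := by
    have h1 : Filter.Tendsto (fun n : ℕ => ((2 : ℝ) ^ j)⁻¹ * (1 / 2) ^ n) Filter.atTop (nhds 0) := by
      simpa using (tendsto_pow_atTop_nhds_zero_of_lt_one (by norm_num : (0 : ℝ) ≤ 1 / 2) (by norm_num)).const_mul (((2 : ℝ) ^ j)⁻¹)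
    obtain ⟨N, hN⟩ := Filter.eventually_atTop.1 (h1.eventually_lt_const hδ)
    refine ⟨N, fun n hn => ?_⟩
    have := hN n hn
    rw [zpow_add₀ two_ne_zero, zpow_natCast]
    refine lt_of_le_of_lt (le_of_eq ?_) this
    rw [one_div_pow]; field_simp
  refine ⟨N, fun n hn => ?_⟩
  have e : Top (kE (j + n)) u x - u x = ∫ y, kE (j + n) x y * (u y - u x) := by
    unfold Top
    simp_rw [mul_sub]
    rw [integral_sub ((kE_SK _).int_mul hu.meas hb x) (((kE_SK _).int_row x).mul_const _), integral_mul_const,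
      kE_int, one_mul]
  rw [dist_eq_norm, e]
  refine lt_of_le_of_lt (norm_integral_le_of_norm_le (g := fun y => ‖kE (j + n) x y‖ * (ε / 2))
    (((kE_SK _).int_row x).norm.mul_const _) (Filter.Eventually.of_forall fun y => ?_)) ?_
  · rw [norm_mul]
    by_cases h : cell (j + n) x = cell (j + n) y
    · gcongr
      have h1 := cell_near h
      have h2 := hN n hn
      have hp := two_zpow_pos (j + n)
      have h3 : |x - y| ≤ 1 / 2 ^ (j + n : ℤ) := by rw [le_div_iff₀ hp, mul_comm]; exact h1
      have := hd y (by rw [Real.dist_eq, abs_sub_comm]; linarith)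
      rw [dist_eq_norm] at this; exact this.le
    · simp [kE, er, h]
  · have e2 : ∀ y, ‖kE (j + n) x y‖ = er (j + n) x y := fun y => by
      unfold kE; rw [Complex.norm_real, Real.norm_of_nonneg (er_nonneg _ _ _)]
    rw [integral_mul_const]
    have e3 : ∫ y, ‖kE (j + n) x y‖ = 1 := by
      simp_rw [e2]
      rw [integral_eq_lintegral_of_nonneg_ae (Filter.Eventually.of_forall fun y => er_nonneg _ _ _)
        (show Measurable fun y => er (j + n) x y from
          (er_meas (j + n)).comp (measurable_const.prodMk measurable_id)).aestronglyMeasurable]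
      have := lint_er (j + n) x
      simp only [this, ENNReal.toReal_one]
    rw [e3]; linarith

lemma Top_kE_zero {u : ℝ → ℂ} (hu : Nice u) (x : ℝ) (j : ℤ) :
    Filter.Tendsto (fun n : ℕ => Top (kE (j - n)) u x) Filter.atTop (nhds 0) := by
  have h1 : Filter.Tendsto (fun n : ℕ => ((2 : ℝ) ^ j * ∫ y, ‖u y‖) * (1 / 2) ^ n) Filter.atTop (nhds 0) := by
    simpa using (tendsto_pow_atTop_nhds_zero_of_lt_one (by norm_num : (0 : ℝ) ≤ 1 / 2) (by norm_num)).const_mul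
      ((2 : ℝ) ^ j * ∫ y, ‖u y‖)
  refine squeeze_zero_norm (fun n => ?_) h1
  unfold Top
  refine (norm_integral_le_of_norm_le (g := fun y => 2 ^ (j - n : ℤ) * ‖u y‖) (hu.integrable.norm.const_mul _)
    (Filter.Eventually.of_forall fun y => ?_)).trans (le_of_eq ?_)
  · rw [norm_mul]; gcongr
    unfold kE; rw [Complex.norm_real, Real.norm_of_nonneg (er_nonneg _ _ _)]
    unfold er; split_ifs
    · exact le_rfl
    · exact (two_zpow_pos _).le
  · rw [integral_const_mul, zpow_sub₀ two_ne_zero, zpow_natCast, one_div_pow]; field_simp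

lemma sum_D_window {u : ℝ → ℂ} (hu : Nice u) (c : ℤ) (K : ℕ) (x) :
    ∑ i ∈ Finset.Ico c (c + K), Top (kD i) u x = Top (kE (c + K - 1)) u x - Top (kE (c - 1)) u x := by
  induction K with
  | zero => simp
  | succ K ih =>
    have : Finset.Ico c (c + (K + 1 : ℕ)) = insert (c + K) (Finset.Ico c (c + K)) := by
      ext; simp; omega
    rw [this, Finset.sum_insert (by simp), ih, Top_kD _ hu]
    rw [show c + ((K + 1 : ℕ) : ℤ) - 1 = c + K by push_cast; ring]
    ring

lemma sum_D_tendsto {u : ℝ → ℂ} (hu : Nice u) (hc : Continuous u) (x : ℝ) (i : ℤ) :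
    Filter.Tendsto (fun n : ℕ => ∑ m ∈ Finset.Ico (-(n : ℤ)) n, Top (kD (i + m)) u x) Filter.atTop (nhds (u x)) := by
  have h1 := (Top_kE_tendsto hu hc x (i - 1)).sub (Top_kE_zero hu x (i - 1))
  rw [sub_zero] at h1
  refine h1.congr fun n => ?_
  have := sum_D_window hu (i - n) (n + n) x
  rw [show i - n + ((n + n : ℕ) : ℤ) - 1 = i - 1 + n by push_cast; ring, show i - n - 1 = i - 1 - (n : ℤ) by ring] at this
  rw [← this]
  refine Finset.sum_nbij' (fun k => k - i) (fun m => i + m) ?_ ?_ ?_ ?_ ?_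
  · intro a ha; simp at ha ⊢; omega
  · intro a ha; simp at ha ⊢; omega
  · intro a ha; ring
  · intro a ha; ring
  · intro a ha; congr 2; ring

/-- `E_n` under an integral operator with nice kernel rows -/
lemma Top_E_dual {K} (hK : SK K) (hKb : ∀ x, ∃ b : ℝ≥0, ∀ y, ‖K x y‖ₑ ≤ b) {f} (hf : Nice f) (n : ℤ) (x) :
    Top K (Top (kE n) f) x = ∫ y, f y * Top (kE n) (K x) y := by
  have hN : Nice (K x) := ⟨hK.meas_row x, hKb x, by
    obtain ⟨A, hA⟩ := hK.row; exact ne_top_of_le_ne_top ENNReal.coe_ne_top (hA x)⟩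
  have := Top_dual (kE_SK n) hf hN
  rw [kE_symm] at this
  rw [← this]; unfold Top
  simp_rw [mul_comm (K x _)]

lemma Top_kE_bdd {u : ℝ → ℂ} {b : ℝ≥0} (hb : ∀ y, ‖u y‖ₑ ≤ b) (n x) : ‖Top (kE n) u x‖ₑ ≤ b := by
  refine (Top_enorm _ _ _).trans ?_
  calc _ ≤ ∫⁻ y, ‖kE n x y‖ₑ * b := by gcongr with y; exact hb y
    _ = b := by rw [lintegral_mul_const' _ _ ENNReal.coe_ne_top]; simp_rw [kE_enorm]; rw [lint_er, one_mul]

lemma nice_row {K} (hK : SK K) (hKb : ∀ x, ∃ b : ℝ≥0, ∀ y, ‖K x y‖ₑ ≤ b) (x) : Nice (K x) :=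
  ⟨hK.meas_row x, hKb x, by
    obtain ⟨A, hA⟩ := hK.row; exact ne_top_of_le_ne_top ENNReal.coe_ne_top (hA x)⟩

lemma Top_E_lim {K} (hK : SK K) (hKb : ∀ x, ∃ b : ℝ≥0, ∀ y, ‖K x y‖ₑ ≤ b) (hKc : ∀ x, Continuous (K x))
    {f} (hf : Nice f) (x : ℝ) (j : ℤ) :
    Filter.Tendsto (fun n : ℕ => Top K (Top (kE (j + n)) f) x) Filter.atTop (nhds (Top K f x)) := by
  obtain ⟨b, hb⟩ := hKb x
  simp_rw [Top_E_dual hK hKb hf]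
  have : Top K f x = ∫ y, f y * K x y := by unfold Top; simp_rw [mul_comm (K x _)]
  rw [this]
  have hN := nice_row hK hKb x
  refine tendsto_integral_of_dominated_convergence (fun y => ‖f y‖ * b) (fun n => ?_) (hf.integrable.norm.mul_const _)
    (fun n => Filter.Eventually.of_forall fun y => ?_) (Filter.Eventually.of_forall fun y => ?_)
  · exact (hf.meas.mul (Top_meas (kE_SK _) hN.meas)).aestronglyMeasurable
  · rw [norm_mul]; gcongr
    have := Top_kE_bdd hb (j + n) y
    rw [← ofReal_norm, ENNReal.ofReal_le_coe] at this
    exact_mod_cast this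
  · exact (Top_kE_tendsto hN (hKc x) y j).const_mul _

lemma Top_E_lim0 {K} (hK : SK K) (hKb : ∀ x, ∃ b : ℝ≥0, ∀ y, ‖K x y‖ₑ ≤ b)
    {f} (hf : Nice f) (x : ℝ) (j : ℤ) :
    Filter.Tendsto (fun n : ℕ => Top K (Top (kE (j - n)) f) x) Filter.atTop (nhds 0) := by
  obtain ⟨b, hb⟩ := hKb x
  simp_rw [Top_E_dual hK hKb hf]
  have : (0 : ℂ) = ∫ y : ℝ, f y * 0 := by simp
  rw [this]
  have hN := nice_row hK hKb x
  refine tendsto_integral_of_dominated_convergence (fun y => ‖f y‖ * b) (fun n => ?_) (hf.integrable.norm.mul_const _)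
    (fun n => Filter.Eventually.of_forall fun y => ?_) (Filter.Eventually.of_forall fun y => ?_)
  · exact (hf.meas.mul (Top_meas (kE_SK _) hN.meas)).aestronglyMeasurable
  · rw [norm_mul]; gcongr
    have := Top_kE_bdd hb (j - n) y
    rw [← ofReal_norm, ENNReal.ofReal_le_coe] at this
    exact_mod_cast this
  · exact (Top_kE_zero hN y j).const_mul _

end VP

namespace VP

lemma ga_ne_zero (l) : ga l ≠ 0 := by
  unfold ga; simp only [ne_eq, ENNReal.ofReal_eq_zero, not_le]; positivity
lemma ga_ne_top (l) : ga l ≠ ∞ := ENNReal.ofReal_ne_top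

lemma ga_tsum {a : ℝ} (ha : 0 < a) : ∑' l : ℤ, ga l ^ a ≠ ∞ := by
  have hlt : (2⁻¹ : ℝ≥0∞) ^ a < 1 := ENNReal.rpow_lt_one (by norm_num) ha
  have hg := geom_ne_top hlt
  have e : ∀ n : ℕ, (2⁻¹ ^ n : ℝ≥0∞) ^ a = ((2⁻¹ : ℝ≥0∞) ^ a) ^ n := by
    intro n; rw [← ENNReal.rpow_natCast, ← ENNReal.rpow_mul, mul_comm, ENNReal.rpow_mul, ENNReal.rpow_natCast]
  rw [tsum_of_nat_of_neg_add_one ENNReal.summable ENNReal.summable]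
  refine ENNReal.add_ne_top.2 ⟨?_, ?_⟩
  · simp_rw [ga_eq, Int.natAbs_natCast, e]; exact hg
  · refine ne_top_of_le_ne_top hg (ENNReal.tsum_le_tsum fun n => ?_)
    rw [ga_eq, show (-((n : ℤ) + 1)).natAbs = n + 1 by omega, e]
    exact pow_le_pow_right_of_le_one' hlt.le (by omega)

lemma ser_bound {ρ a : ℝ} (hρ : 0 < ρ) (ha : 0 < a) : ∃ C : ℝ≥0, ∀ y : ℤ → ℝ≥0∞,
    (∑' m, y m) ^ ρ ≤ C * ∑' m, ga m ^ (-a) * y m ^ ρ := by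
  have h1 := ga_tsum (a := a / ρ) (by positivity)
  refine ⟨((∑' m, ga m ^ (a / ρ)) ^ ρ).toNNReal, fun y => ?_⟩
  rw [ENNReal.coe_toNNReal (ENNReal.rpow_ne_top_of_nonneg hρ.le h1)]
  have := tsum_mul_rpow_le (fun m => ga m ^ (a / ρ)) (fun m => ga m ^ (-(a / ρ)) * y m) hρ
  have e : ∀ m, ga m ^ (a / ρ) * (ga m ^ (-(a / ρ)) * y m) = y m := by
    intro m
    rw [← mul_assoc, ← ENNReal.rpow_add _ _ (ga_ne_zero m) (ga_ne_top m), add_neg_cancel, ENNReal.rpow_zero, one_mul]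
  simp_rw [e, ENNReal.mul_rpow_of_nonneg _ _ hρ.le, ← ENNReal.rpow_mul] at this
  rwa [show -(a / ρ) * ρ = -a by field_simp] at this

lemma kE_Lp {p : ℝ} (hp : 1 < p) {f} (hf : Measurable f) (n : ℤ) : ∫⁻ x, ‖Top (kE n) f x‖ₑ ^ p ≤ ∫⁻ x, ‖f x‖ₑ ^ p := by
  have m1 : ∀ x, Measurable fun y => ENNReal.ofReal (er n x y) := fun x => by
    have := ((kE_SK n).meas_row x).enorm
    simpa only [kE_enorm] using this
  have m2 : Measurable fun z : ℝ × ℝ => ENNReal.ofReal (er n z.1 z.2) := by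
    have := (kE_SK n).meas.enorm
    simpa only [kE_enorm] using this
  calc _ ≤ ∫⁻ x, ∫⁻ y, ENNReal.ofReal (er n x y) * ‖f y‖ₑ ^ p := by
        gcongr with x
        refine (ENNReal.rpow_le_rpow (Top_enorm _ _ _) (by linarith)).trans ?_
        simp_rw [kE_enorm]
        refine (jensen (m1 x).aemeasurable hf.enorm.aemeasurable hp).trans ?_
        rw [lint_er]; simp
    _ = ∫⁻ y, ∫⁻ x, ENNReal.ofReal (er n x y) * ‖f y‖ₑ ^ p :=
        lintegral_lintegral_swap (m2.mul ((hf.comp measurable_snd).enorm.pow_const _)).aemeasurable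
    _ = ∫⁻ y, ‖f y‖ₑ ^ p := by
        apply lintegral_congr; intro y
        have : Measurable fun x => ENNReal.ofReal (er n x y) := m2.comp (measurable_id.prodMk measurable_const)
        rw [lintegral_mul_const _ this, lint_er', one_mul]

lemma sqD {p : ℝ} (hp : 2 ≤ p) : ∃ C : ℝ≥0, ∀ f (I : Finset ℤ), Nice f →
    ∫⁻ x, (∑ i ∈ I, ‖Top (kD i) f x‖ₑ ^ (2 : ℝ)) ^ (p / 2) ≤ C * ∫⁻ x, ‖f x‖ₑ ^ p := by
  obtain ⟨C, hC⟩ := garsiaD hp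
  have hp0 : 0 < p := by linarith
  refine ⟨C * (2 ^ p * 2), fun f I hf => ?_⟩
  obtain ⟨c, K, hI⟩ := exists_window I
  have h := hC c _ K ((kD_DZ (u := fun _ => f) fun _ => hf).diff c)
  have e2 : ∀ x, ENNReal.ofReal (Sq (fun k : ℕ => Top (kD (c + k)) f) K x) =
      ∑ i ∈ Finset.Ico c (c + K), ‖Top (kD i) f x‖ₑ ^ (2 : ℝ) := fun x =>
    Sq_window (fun n => Top (kD n) f) c K x
  have e1 : ∀ x, S (fun k : ℕ => Top (kD (c + k)) f) K x = Top (kE (c + K - 1)) f x - Top (kE (c - 1)) f x := by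
    intro x; unfold S
    rw [sum_window c K (fun i => Top (kD i) f x), sum_D_window hf]
  simp_rw [e1, e2] at h
  have h' := h (sum_rpow_fin _ (fun i _ => (kD_SK i).nice hf) (by linarith))
  calc _ ≤ ∫⁻ x, (∑ i ∈ Finset.Ico c (c + K), ‖Top (kD i) f x‖ₑ ^ (2 : ℝ)) ^ (p / 2) := by
        gcongr with x
    _ ≤ _ := h'
    _ ≤ C * ∫⁻ x, 2 ^ p * (‖Top (kE (c + K - 1)) f x‖ₑ ^ p + ‖Top (kE (c - 1)) f x‖ₑ ^ p) := by
        gcongr with x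
        refine (ENNReal.rpow_le_rpow enorm_sub_le hp0.le).trans (add_rpow_le2 _ _ hp0.le)
    _ ≤ C * (2 ^ p * ((∫⁻ x, ‖f x‖ₑ ^ p) + ∫⁻ x, ‖f x‖ₑ ^ p)) := by
        rw [lintegral_const_mul' _ _ (by simp [hp0.le]), lintegral_add_left
          ((Top_meas (kE_SK _) hf.meas).enorm.pow_const _)]
        exact mul_le_mul' le_rfl (mul_le_mul' le_rfl (add_le_add (kE_Lp (by linarith) hf.meas _) (kE_Lp (by linarith) hf.meas _)))
    _ = _ := by
        push_cast
        rw [ENNReal.coe_rpow_of_nonneg _ hp0.le]; push_cast; ring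

section
variable {ψ Θ : ℝ → ℂ} {C : ℝ}

lemma kP_bdd (h : Bump ψ Θ C) (i x) : ∃ b : ℝ≥0, ∀ y, ‖kP ψ i x y‖ₑ ≤ b := by
  refine ⟨(C * 2 ^ i).toNNReal, fun y => ?_⟩
  refine ofReal_of_norm_le ((gd_norm h i _).trans ?_)
  have hp := two_zpow_pos i
  have := h.pos
  gcongr
  unfold kb
  exact div_le_self hp.le (one_le_pow₀ (by have := abs_nonneg (x - y); nlinarith))

lemma Top_kP_cont (h : Bump ψ Θ C) (i) {u} (hu : Nice u) : Continuous (Top (kP ψ i) u) := by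
  have hp := two_zpow_pos i
  have hC := h.pos
  unfold Top
  refine continuous_of_dominated (bound := fun y => C * 2 ^ i * ‖u y‖) (fun x => ?_) (fun x =>
    Filter.Eventually.of_forall fun y => ?_) (hu.integrable.norm.const_mul _) (Filter.Eventually.of_forall fun y => ?_)
  · exact (((kP_SK h i).meas_row x).mul hu.meas).aestronglyMeasurable
  · rw [norm_mul]; gcongr
    refine (gd_norm h i _).trans ?_
    gcongr
    unfold kb
    exact div_le_self hp.le (one_le_pow₀ (by have := abs_nonneg (x - y); nlinarith))
  · exact ((gd_cont h i).comp (continuous_id.sub continuous_const)).mul continuous_const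

lemma kP_rowcont (h : Bump ψ Θ C) (i x) : Continuous (kP ψ i x) :=
  (gd_cont h i).comp (continuous_const.sub continuous_id)

lemma Top_lim {K} (hK : SK K) {v : ℕ → ℝ → ℂ} {w : ℝ → ℂ} (hv : ∀ n, Measurable (v n)) {b : ℝ≥0}
    (hb : ∀ n y, ‖v n y‖ₑ ≤ b) (hl : ∀ y, Filter.Tendsto (fun n => v n y) Filter.atTop (nhds (w y))) (x) :
    Filter.Tendsto (fun n => Top K (v n) x) Filter.atTop (nhds (Top K w x)) := by
  unfold Top
  refine tendsto_integral_of_dominated_convergence (fun y => ‖K x y‖ * b) (fun n => ?_) ((hK.int_row x).norm.mul_const _)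
    (fun n => Filter.Eventually.of_forall fun y => ?_) (Filter.Eventually.of_forall fun y => ?_)
  · exact ((hK.meas_row x).mul (hv n)).aestronglyMeasurable
  · rw [norm_mul]; gcongr
    have := hb n y
    rw [← ofReal_norm, ENNReal.ofReal_le_coe] at this
    exact_mod_cast this
  · exact (hl y).const_mul _

lemma Top_bdd {K} (hK : SK K) {b : ℝ≥0} : ∃ b' : ℝ≥0, ∀ v : ℝ → ℂ, (∀ y, ‖v y‖ₑ ≤ b) → ∀ x, ‖Top K v x‖ₑ ≤ b' := by
  obtain ⟨A, hA⟩ := hK.row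
  refine ⟨A * b, fun v hv x => (Top_enorm _ _ _).trans ?_⟩
  calc _ ≤ ∫⁻ y, ‖K x y‖ₑ * b := by gcongr with y; exact hv y
    _ = (∫⁻ y, ‖K x y‖ₑ) * b := lintegral_mul_const' _ _ ENNReal.coe_ne_top
    _ ≤ _ := by push_cast; gcongr; exact hA x

lemma Top_sub {K} (hK : SK K) {u v} (hu : Nice u) (hv : Nice v) (x) :
    Top K (fun y => u y - v y) x = Top K u x - Top K v x := by
  obtain ⟨b, hb⟩ := hu.bdd
  obtain ⟨b', hb'⟩ := hv.bdd
  unfold Top; simp_rw [mul_sub]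
  exact integral_sub (hK.int_mul hu.meas hb x) (hK.int_mul hv.meas hb' x)

lemma Top_sum {ι : Type*} (s : Finset ι) {K} (hK : SK K) {u : ι → ℝ → ℂ} (hu : ∀ i ∈ s, Nice (u i)) (x) :
    Top K (fun y => ∑ i ∈ s, u i y) x = ∑ i ∈ s, Top K (u i) x := by
  unfold Top; simp_rw [Finset.mul_sum]
  refine integral_finset_sum _ fun i hi => ?_
  obtain ⟨b, hb⟩ := (hu i hi).bdd
  exact hK.int_mul (hu i hi).meas hb x

lemma P_window_tendsto (h : Bump ψ Θ C) (i : ℤ) {f} (hf : Nice f) (x) :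
    Filter.Tendsto (fun n : ℕ => ∑ m ∈ Finset.Ico (-(n : ℤ)) n, Top (kP ψ i) (Top (kD (i + m)) f) x)
      Filter.atTop (nhds (Top (kP ψ i) f x)) := by
  have hK := kP_SK h i
  have h1 := (Top_E_lim hK (kP_bdd h i) (kP_rowcont h i) hf x (i - 1)).sub (Top_E_lim0 hK (kP_bdd h i) hf x (i - 1))
  rw [sub_zero] at h1
  refine h1.congr fun n => ?_
  rw [← Top_sub hK ((kE_SK _).nice hf) ((kE_SK _).nice hf), ← Top_sum _ hK fun m _ => (kD_SK _).nice hf]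
  congr 1
  ext y
  have := sum_D_window hf (i - n) (n + n) y
  rw [show i - n + ((n + n : ℕ) : ℤ) - 1 = i - 1 + n by push_cast; ring, show i - n - 1 = i - 1 - (n : ℤ) by ring] at this
  rw [← this]
  refine Finset.sum_nbij' (fun k => k - i) (fun m => i + m) ?_ ?_ ?_ ?_ ?_
  · intro a ha; simp at ha ⊢; omega
  · intro a ha; simp at ha ⊢; omega
  · intro a ha; ring
  · intro a ha; ring
  · intro a ha; congr 2; ring

lemma window_bdd {f} {b : ℝ≥0} (hf : Nice f) (hb : ∀ y, ‖f y‖ₑ ≤ b) (i : ℤ) (n : ℕ) (y) :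
    ‖∑ m ∈ Finset.Ico (-(n : ℤ)) n, Top (kD (i + m)) f y‖ₑ ≤ (2 * b : ℝ≥0) := by
  have := sum_D_window hf (i - n) (n + n) y
  rw [show i - n + ((n + n : ℕ) : ℤ) - 1 = i - 1 + n by push_cast; ring, show i - n - 1 = i - 1 - (n : ℤ) by ring] at this
  have e : ∑ m ∈ Finset.Ico (-(n : ℤ)) n, Top (kD (i + m)) f y = Top (kE (i - 1 + n)) f y - Top (kE (i - 1 - n)) f y := by
    rw [← this]
    refine Finset.sum_nbij' (fun m => i + m) (fun k => k - i) ?_ ?_ ?_ ?_ ?_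
    · intro a ha; simp at ha ⊢; omega
    · intro a ha; simp at ha ⊢; omega
    · intro a ha; ring
    · intro a ha; ring
    · intro a ha; rfl
  rw [e, two_mul]
  push_cast
  exact enorm_sub_le.trans (add_le_add (Top_kE_bdd hb _ _) (Top_kE_bdd hb _ _))

lemma DPf_le (h : Bump ψ Θ C) (l i : ℤ) {f} (hf : Nice f) (x) :
    ‖Top (kD (i + l)) (Top (kP ψ i) f) x‖ₑ ≤ ∑' m, ‖RR ψ l m i f x‖ₑ := by
  have hK := kP_SK h i
  obtain ⟨b, hb⟩ := hf.bdd
  obtain ⟨b', hb'⟩ := Top_bdd hK (b := 2 * b)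
  have hN : ∀ m, Nice (Top (kP ψ i) (Top (kD (i + m)) f)) := fun m => hK.nice ((kD_SK _).nice hf)
  have h1 := Top_lim (kD_SK (i + l)) (v := fun n y => ∑ m ∈ Finset.Ico (-(n : ℤ)) n, Top (kP ψ i) (Top (kD (i + m)) f) y)
    (b := b') (fun n => (Nice.sum _ fun m _ => hN m).meas) (fun n y => by
      rw [← Top_sum _ hK fun m _ => (kD_SK _).nice hf]
      exact hb' _ (window_bdd hf hb i n) y) (fun y => P_window_tendsto h i hf y) x
  refine le_of_tendsto h1.enorm (Filter.Eventually.of_forall fun n => ?_)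
  rw [Top_sum _ (kD_SK _) fun m _ => hN m]
  exact (enorm_sum_le _ _).trans (ENNReal.sum_le_tsum _)

lemma cont_le {ι : Type*} (I : Finset ι) (k : ι → ℤ) {u : ι → ℝ → ℂ} (hu : ∀ i, Nice (u i)) (hc : ∀ i, Continuous (u i)) (x) :
    ‖∑ i ∈ I, u i x‖ₑ ≤ ∑' m : ℤ, ‖∑ i ∈ I, Top (kD (k i + m)) (u i) x‖ₑ := by
  have h1 := tendsto_finset_sum I fun i _ => sum_D_tendsto (hu i) (hc i) x (k i)
  refine le_of_tendsto h1.enorm (Filter.Eventually.of_forall fun n => ?_)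
  rw [Finset.sum_comm]
  exact (enorm_sum_le _ _).trans (ENNReal.sum_le_tsum _)

lemma LP2 (h : Bump ψ Θ C) {p : ℝ} (hp : 2 ≤ p) : ∃ c : ℝ≥0, ∃ a : ℝ, 0 < a ∧ ∀ l (I : Finset ℤ) f, Nice f →
    ∫⁻ x, (∑ i ∈ I, ‖Top (kD (i + l)) (Top (kP ψ i) f) x‖ₑ ^ (2 : ℝ)) ^ (p / 2) ≤
      c * ga l ^ a * ∫⁻ x, ‖f x‖ₑ ^ p := by
  have hσ : 1 ≤ p / 2 := by linarith
  obtain ⟨c1, a, ha, h1⟩ := WW h hσ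
  obtain ⟨c2, h2⟩ := sqD hp
  set σ := p / 2 with hσd
  have hσ0 : 0 < σ := by linarith
  set a1 := a / (2 * (1 + σ)) with ha1
  have ha1p : 0 < a1 := by positivity
  obtain ⟨c3, h3⟩ := ser_bound (ρ := 2) (by norm_num) ha1p
  obtain ⟨c4, h4⟩ := ser_bound hσ0 ha1p
  have hs := ga_tsum (a := a / 2) (by positivity)
  refine ⟨c3 ^ σ * c4 * c1 * c2 * (∑' m, ga m ^ (a / 2)).toNNReal, a, ha, fun l I f hf => ?_⟩
  have hX : ∀ m, ∫⁻ x, (∑ i ∈ I, ‖RR ψ l m i f x‖ₑ ^ (2 : ℝ)) ^ σ ≤ c1 * (ga l * ga m) ^ a * (c2 * ∫⁻ x, ‖f x‖ₑ ^ p) := by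
    intro m
    have e1 : ∀ i, RR ψ l m i (Top (kD (i + m)) f) = RR ψ l m i f := by
      intro i; unfold RR; rw [Top_kD_idem _ hf]
    have := h1 l m I (fun i => Top (kD (i + m)) f) fun i => (kD_SK _).nice hf
    simp_rw [e1] at this
    refine this.trans ?_
    gcongr
    have e2 := h2 f (I.map (addRightEmbedding m)) hf
    simp only [Finset.sum_map, addRightEmbedding_apply] at e2
    exact e2
  have hm : ∀ m, Measurable fun x => (∑ i ∈ I, ‖RR ψ l m i f x‖ₑ ^ (2 : ℝ)) ^ σ := fun m =>
    (Finset.measurable_sum _ fun i _ => (RR_nice h l m i hf).meas.enorm.pow_const _).pow_const _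
  calc _ ≤ ∫⁻ x, (c3 : ℝ≥0∞) ^ σ * (c4 * ∑' m, ga m ^ (-(a / 2)) * (∑ i ∈ I, ‖RR ψ l m i f x‖ₑ ^ (2 : ℝ)) ^ σ) := by
        gcongr with x
        have e1 : ∑ i ∈ I, ‖Top (kD (i + l)) (Top (kP ψ i) f) x‖ₑ ^ (2 : ℝ) ≤
            c3 * ∑' m, ga m ^ (-a1) * ∑ i ∈ I, ‖RR ψ l m i f x‖ₑ ^ (2 : ℝ) := by
          calc _ ≤ ∑ i ∈ I, c3 * ∑' m, ga m ^ (-a1) * ‖RR ψ l m i f x‖ₑ ^ (2 : ℝ) := by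
                gcongr with i hi
                exact (ENNReal.rpow_le_rpow (DPf_le h l i hf x) (by norm_num)).trans (h3 _)
            _ = _ := by
                rw [← Finset.mul_sum]
                congr 1
                simp_rw [Finset.mul_sum]
                exact (Summable.tsum_finsetSum fun _ _ => ENNReal.summable).symm
        refine (ENNReal.rpow_le_rpow e1 hσ0.le).trans ?_
        rw [ENNReal.mul_rpow_of_nonneg _ _ hσ0.le]
        gcongr
        refine (h4 _).trans (le_of_eq ?_)
        congr 1
        refine tsum_congr fun m => ?_
        rw [ENNReal.mul_rpow_of_nonneg _ _ hσ0.le, ← ENNReal.rpow_mul, ← mul_assoc,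
          ← ENNReal.rpow_add _ _ (ga_ne_zero m) (ga_ne_top m)]
        congr 2
        rw [ha1]; field_simp; ring
    _ = (c3 : ℝ≥0∞) ^ σ * (c4 * ∑' m, ga m ^ (-(a / 2)) * ∫⁻ x, (∑ i ∈ I, ‖RR ψ l m i f x‖ₑ ^ (2 : ℝ)) ^ σ) := by
        rw [lintegral_const_mul' _ _ (ENNReal.rpow_ne_top_of_nonneg hσ0.le ENNReal.coe_ne_top),
          lintegral_const_mul' _ _ ENNReal.coe_ne_top,
          lintegral_tsum fun m => ((hm m).const_mul _).aemeasurable]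
        congr 3; ext m
        rw [lintegral_const_mul _ (hm m)]
    _ ≤ (c3 : ℝ≥0∞) ^ σ * (c4 * ∑' m, ga m ^ (a / 2) * (ga l ^ a * (c1 * (c2 * ∫⁻ x, ‖f x‖ₑ ^ p)))) := by
        refine mul_le_mul' le_rfl (mul_le_mul' le_rfl (ENNReal.tsum_le_tsum fun m => ?_))
        refine (mul_le_mul' le_rfl (hX m)).trans (le_of_eq ?_)
        rw [ENNReal.mul_rpow_of_nonneg _ _ ha.le]
        have : ga m ^ (a / 2) = ga m ^ (-(a / 2)) * ga m ^ a := by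
          rw [← ENNReal.rpow_add _ _ (ga_ne_zero m) (ga_ne_top m)]; congr 1; ring
        rw [this]; ring
    _ = _ := by
        rw [ENNReal.tsum_mul_right]
        push_cast
        rw [ENNReal.coe_rpow_of_nonneg _ hσ0.le, ENNReal.coe_toNNReal hs]
        ring

end
end VP

namespace VP
section
variable {ψ Θ : ℝ → ℂ} {C : ℝ}

lemma LPdual (h : Bump ψ Θ C) {p : ℝ} (hp : 2 ≤ p) : ∃ c : ℝ≥0, ∃ a : ℝ, 0 < a ∧ ∀ l (I : Finset ℤ) (g : ℤ → ℝ → ℂ), (∀ i, Nice (g i)) →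
    ∫⁻ x, ‖∑ i ∈ I, Top (kP ψ i) (Top (kD (i + l)) (g i)) x‖ₑ ^ p ≤
      c * ga l ^ a * ∫⁻ x, (∑ i ∈ I, ‖g i x‖ₑ ^ (2 : ℝ)) ^ (p / 2) := by
  have hσ : 1 ≤ p / 2 := by linarith
  have hp0 : 0 < p := by linarith
  obtain ⟨c1, a, ha, h1⟩ := WW h hσ
  obtain ⟨c2, h2⟩ := bdgZ hp0
  obtain ⟨c3, h3⟩ := ser_bound (a := a / 2) hp0 (by positivity)
  have hs := ga_tsum (a := a / 2) (by positivity)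
  refine ⟨c3 * c2 * c1 * (∑' m, ga m ^ (a / 2)).toNNReal, a, ha, fun l I g hg => ?_⟩
  have hN : ∀ i, Nice (Top (kP ψ i) (Top (kD (i + l)) (g i))) := fun i => (kP_SK h i).nice ((kD_SK _).nice (hg i))
  have hc : ∀ i, Continuous (Top (kP ψ i) (Top (kD (i + l)) (g i))) := fun i => Top_kP_cont h i ((kD_SK _).nice (hg i))
  set Y := ∫⁻ x, (∑ i ∈ I, ‖g i x‖ₑ ^ (2 : ℝ)) ^ (p / 2) with hY
  have hm : ∀ m, Measurable fun x => ‖∑ i ∈ I, RR ψ m l i (g i) x‖ₑ ^ p := fun m =>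
    (Nice.sum I fun i _ => RR_nice h m l i (hg i)).meas.enorm.pow_const _
  have hX : ∀ m, ∫⁻ x, ‖∑ i ∈ I, RR ψ m l i (g i) x‖ₑ ^ p ≤ c2 * (c1 * (ga m * ga l) ^ a * Y) := by
    intro m
    have hZ := kD_DZ (u := fun n => Top (kP ψ (n - m)) (Top (kD (n - m + l)) (g (n - m)))) fun n => hN _
    have e := h2 _ (I.map (addRightEmbedding m)) hZ
    simp only [Finset.sum_map, addRightEmbedding_apply, add_sub_cancel_right] at e
    exact e.trans (mul_le_mul' le_rfl (h1 m l I g hg))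
  calc _ ≤ ∫⁻ x, c3 * ∑' m, ga m ^ (-(a / 2)) * ‖∑ i ∈ I, RR ψ m l i (g i) x‖ₑ ^ p := by
        gcongr with x
        exact (ENNReal.rpow_le_rpow (cont_le I (fun i => i) hN hc x) hp0.le).trans (h3 _)
    _ = c3 * ∑' m, ga m ^ (-(a / 2)) * ∫⁻ x, ‖∑ i ∈ I, RR ψ m l i (g i) x‖ₑ ^ p := by
        rw [lintegral_const_mul' _ _ ENNReal.coe_ne_top,
          lintegral_tsum fun m => ((hm m).const_mul _).aemeasurable]
        congr 2; ext m
        rw [lintegral_const_mul _ (hm m)]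
    _ ≤ c3 * ∑' m, ga m ^ (a / 2) * (ga l ^ a * (c1 * (c2 * Y))) := by
        refine mul_le_mul' le_rfl (ENNReal.tsum_le_tsum fun m => ?_)
        refine (mul_le_mul' le_rfl (hX m)).trans (le_of_eq ?_)
        rw [ENNReal.mul_rpow_of_nonneg _ _ ha.le]
        have : ga m ^ (a / 2) = ga m ^ (-(a / 2)) * ga m ^ a := by
          rw [← ENNReal.rpow_add _ _ (ga_ne_zero m) (ga_ne_top m)]; congr 1; ring
        rw [this]; ring
    _ = _ := by
        rw [ENNReal.tsum_mul_right]
        push_cast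
        rw [ENNReal.coe_toNNReal hs]
        ring

lemma Nice.conj {G : ℝ → ℂ} (h : Nice G) : Nice (fun x => (starRingEnd ℂ) (G x)) := by
  obtain ⟨B, hB⟩ := h.bdd
  have e : ∀ z : ℂ, ‖(starRingEnd ℂ) z‖ₑ = ‖z‖ₑ := fun z => by
    rw [← ofReal_norm, ← ofReal_norm, RCLike.norm_conj]
  exact ⟨Complex.continuous_conj.measurable.comp h.meas, ⟨B, fun x => by rw [e]; exact hB x⟩, by simp_rw [e]; exact h.fin⟩

lemma kP_KT (ψ : ℝ → ℂ) (i : ℤ) : KT (kP ψ i) = kP (fun u => ψ (-u)) i := by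
  ext a b; simp only [KT, kP, gd]; rw [← mul_neg, neg_sub]

lemma LP1ε (h : Bump ψ Θ C) {p : ℝ} (hp1 : 1 < p) (hp2 : p < 2) : ∃ c : ℝ≥0, ∃ a : ℝ, 0 < a ∧
    ∀ l (I : Finset ℤ) f, Nice f → ∀ ε : ℝ, 0 < ε →
    ∫⁻ x, (if ε ≤ ∑ i ∈ I, ‖Top (kD (i + l)) (Top (kP ψ i) f) x‖ ^ 2 then
      ENNReal.ofReal ((∑ i ∈ I, ‖Top (kD (i + l)) (Top (kP ψ i) f) x‖ ^ 2) ^ (p / 2)) else 0) ≤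
      c * ga l ^ a * ∫⁻ x, ‖f x‖ₑ ^ p := by
  have hpos : 0 < p - 1 := by linarith
  have hp0 : 0 < p := by linarith
  set q := p / (p - 1) with hq
  have hq2 : 2 ≤ q := by rw [hq, le_div_iff₀ hpos]; linarith
  have hq0 : 0 < q := by linarith
  obtain ⟨c, a, ha, h1⟩ := LPdual h.refl hq2
  refine ⟨c ^ (p - 1), a * (p - 1), by positivity, fun l I f hf ε hε => ?_⟩
  set d := fun i => Top (kD (i + l)) (Top (kP ψ i) f) with hd
  have hdN : ∀ i, Nice (d i) := fun i => (kD_SK _).nice ((kP_SK h i).nice hf)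
  set s : ℝ → ℝ := fun x => ∑ i ∈ I, ‖d i x‖ ^ 2 with hs
  have hs0 : ∀ x, 0 ≤ s x := fun x => Finset.sum_nonneg fun i _ => by positivity
  have hsm : Measurable s := Finset.measurable_sum _ fun i _ => (hdN i).meas.norm.pow_const _
  set w : ℝ → ℝ := fun x => if ε ≤ s x then (s x) ^ ((p - 2) / 2) else 0 with hw
  have hw0 : ∀ x, 0 ≤ w x := fun x => by
    simp only [hw]; split_ifs
    · exact Real.rpow_nonneg (hs0 x) _
    · exact le_rfl
  have hwm : Measurable w := Measurable.ite (measurableSet_le measurable_const hsm) (hsm.pow_const _) measurable_const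
  have hwb : ∀ x, w x ≤ ε ^ ((p - 2) / 2) := fun x => by
    simp only [hw]; split_ifs with hx
    · exact Real.rpow_le_rpow_of_nonpos hε hx (by linarith)
    · positivity
  set g : ℤ → ℝ → ℂ := fun i x => (starRingEnd ℂ) (d i x) * (w x : ℂ) with hg
  have hgN : ∀ i, Nice (g i) := fun i => (hdN i).conj.mul_bdd (Complex.measurable_ofReal.comp hwm)
    (c := (ε ^ ((p - 2) / 2)).toNNReal) fun x => by
      refine ofReal_of_norm_le ?_
      rw [Complex.norm_real, Real.norm_of_nonneg (hw0 x)]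
      exact hwb x
  have key : ∀ x, (if ε ≤ s x then ENNReal.ofReal (s x ^ (p / 2)) else 0) = ENNReal.ofReal (s x * w x) := by
    intro x; simp only [hw]; split_ifs with hx
    · congr 1
      nth_rewrite 2 [← Real.rpow_one (s x)]
      rw [← Real.rpow_add (hε.trans_le hx)]; congr 1; ring
    · simp
  have key2 : ∀ x, (∑ i ∈ I, ‖g i x‖ₑ ^ (2 : ℝ)) ^ (q / 2) = ENNReal.ofReal (s x * w x) := by
    intro x
    have : ∑ i ∈ I, ‖g i x‖ₑ ^ (2 : ℝ) = ENNReal.ofReal (s x * w x ^ 2) := by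
      simp_rw [← ofReal_sq]
      rw [← ENNReal.ofReal_sum_of_nonneg fun i _ => by positivity]
      congr 1
      simp only [hs, hg, norm_mul, RCLike.norm_conj, Complex.norm_real, Finset.sum_mul, mul_pow, Real.norm_eq_abs, sq_abs]
    rw [this, ENNReal.ofReal_rpow_of_nonneg (mul_nonneg (hs0 x) (sq_nonneg _)) (by positivity)]
    congr 1
    simp only [hw]; split_ifs with hx
    · have hsp := hε.trans_le hx
      rw [← Real.rpow_natCast, ← Real.rpow_mul hsp.le]
      nth_rewrite 1 [← Real.rpow_one (s x)]
      nth_rewrite 3 [← Real.rpow_one (s x)]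
      rw [← Real.rpow_add hsp, ← Real.rpow_mul hsp.le, ← Real.rpow_add hsp]
      congr 1
      rw [hq]; push_cast; field_simp; ring
    · simp only [ne_eq, OfNat.ofNat_ne_zero, not_false_eq_true, zero_pow, mul_zero]
      exact Real.zero_rpow (by positivity)
  have goal' : (∫⁻ x, (if ε ≤ s x then ENNReal.ofReal (s x ^ (p / 2)) else 0)) = ∫⁻ x, ENNReal.ofReal (s x * w x) :=
    lintegral_congr key
  refine goal'.le.trans ?_
  set Y := ∫⁻ x, ENNReal.ofReal (s x * w x) with hY
  have hYf : Y ≠ ∞ := by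
    have := sum_rpow_fin I (fun i _ => hgN i) (σ := q / 2) (by linarith)
    simp_rw [key2] at this; exact this
  have hsum : ∀ x, ∑ i ∈ I, d i x * g i x = ((s x * w x : ℝ) : ℂ) := by
    intro x
    simp only [hg, hs, ← mul_assoc, Complex.mul_conj, ← Finset.sum_mul]
    push_cast
    congr 1
    refine Finset.sum_congr rfl fun i _ => ?_
    rw [Complex.normSq_eq_norm_sq]; push_cast; rfl
  have hintg : Integrable (fun x => s x * w x) :=
    ⟨(hsm.mul hwm).aestronglyMeasurable, by
      refine lt_top_iff_ne_top.2 ?_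
      have : ∀ x, ‖s x * w x‖ₑ = ENNReal.ofReal (s x * w x) := fun x =>
        Real.enorm_of_nonneg (mul_nonneg (hs0 x) (hw0 x))
      simp_rw [this]; exact hYf⟩
  set H : ℝ → ℂ := fun x => ∑ i ∈ I, Top (kP (fun u => ψ (-u)) i) (Top (kD (i + l)) (g i)) x with hH
  have hTN : ∀ i, Nice (Top (kP (fun u => ψ (-u)) i) (Top (kD (i + l)) (g i))) := fun i =>
    (kP_SK h.refl i).nice ((kD_SK _).nice (hgN i))
  have hHN : Nice H := Nice.sum I fun i _ => hTN i
  have mulint : ∀ {u v : ℝ → ℂ}, Nice u → Nice v → Integrable fun x => u x * v x := by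
    intro u v hu hv
    obtain ⟨b, hb⟩ := hv.bdd
    exact (hu.mul_bdd hv.meas hb).integrable
  have hdual : ((∫ x, s x * w x : ℝ) : ℂ) = ∫ x, f x * H x := by
    rw [← integral_complex_ofReal]
    simp_rw [← hsum]
    rw [integral_finset_sum _ fun i _ => mulint (hdN i) (hgN i)]
    simp only [hH, Finset.mul_sum]
    rw [integral_finset_sum _ fun i _ => mulint hf (hTN i)]
    refine Finset.sum_congr rfl fun i _ => ?_
    rw [hd, Top_dual (kD_SK _) ((kP_SK h i).nice hf) (hgN i), kD_symm,
      Top_dual (kP_SK h i) hf ((kD_SK _).nice (hgN i)), kP_KT]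
  have hYe : Y = ‖∫ x, f x * H x‖ₑ := by
    rw [← hdual, hY, ← ofReal_integral_eq_lintegral_ofReal hintg
      (Filter.Eventually.of_forall fun x => mul_nonneg (hs0 x) (hw0 x)), ← ofReal_norm, Complex.norm_real,
      Real.norm_of_nonneg (integral_nonneg fun x => mul_nonneg (hs0 x) (hw0 x))]
  have hpq : p.HolderConjugate q := Real.HolderConjugate.conjExponent hp1
  have hq1 : 1 / q = 1 - 1 / p := by
    rw [hq]; field_simp
  have hY2 : Y ≤ (c * ga l ^ a) ^ (1 / q) * (∫⁻ x, ‖f x‖ₑ ^ p) ^ (1 / p) * Y ^ (1 - 1 / p) := by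
    calc Y ≤ ∫⁻ x, ‖f x * H x‖ₑ := by rw [hYe]; exact enorm_integral_le_lintegral_enorm _
      _ = ∫⁻ x, ((fun x => ‖f x‖ₑ) * fun x => ‖H x‖ₑ) x := by simp_rw [enorm_mul]; rfl
      _ ≤ (∫⁻ x, ‖f x‖ₑ ^ p) ^ (1 / p) * (∫⁻ x, ‖H x‖ₑ ^ q) ^ (1 / q) :=
          ENNReal.lintegral_mul_le_Lp_mul_Lq _ hpq hf.meas.enorm.aemeasurable hHN.meas.enorm.aemeasurable
      _ ≤ (∫⁻ x, ‖f x‖ₑ ^ p) ^ (1 / p) * (c * ga l ^ a * Y) ^ (1 / q) := by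
          refine mul_le_mul' le_rfl (ENNReal.rpow_le_rpow ?_ (by positivity))
          have := h1 l I g hgN
          simp_rw [key2] at this
          exact this
      _ = _ := by
          rw [ENNReal.mul_rpow_of_nonneg _ Y (by positivity : 0 ≤ 1 / q), hq1]; ring
  refine (div_pow' hp1 hYf hY2).trans (le_of_eq ?_)
  congr 1
  rw [← ENNReal.rpow_mul, show 1 / q * p = p - 1 by rw [hq]; field_simp, ENNReal.mul_rpow_of_nonneg _ _ hpos.le,
    ← ENNReal.rpow_mul, ENNReal.coe_rpow_of_nonneg _ hpos.le]

lemma LP (h : Bump ψ Θ C) {p : ℝ} (hp : 1 < p) : ∃ c : ℝ≥0, ∃ a : ℝ, 0 < a ∧ ∀ l (I : Finset ℤ) f, Nice f →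
    ∫⁻ x, (∑ i ∈ I, ‖Top (kD (i + l)) (Top (kP ψ i) f) x‖ₑ ^ (2 : ℝ)) ^ (p / 2) ≤
      c * ga l ^ a * ∫⁻ x, ‖f x‖ₑ ^ p := by
  rcases le_or_gt 2 p with hp2 | hp2
  · exact LP2 h hp2
  obtain ⟨c, a, ha, h1⟩ := LP1ε h hp hp2
  refine ⟨c, a, ha, fun l I f hf => ?_⟩
  have h2 := h1 l I f hf
  set s : ℝ → ℝ := fun x => ∑ i ∈ I, ‖Top (kD (i + l)) (Top (kP ψ i) f) x‖ ^ 2 with hs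
  have hs0 : ∀ x, 0 ≤ s x := fun x => Finset.sum_nonneg fun i _ => by positivity
  have hsm : Measurable s := Finset.measurable_sum _ fun i _ => ((kD_SK _).nice ((kP_SK h i).nice hf)).meas.norm.pow_const _
  have e : ∀ x, (∑ i ∈ I, ‖Top (kD (i + l)) (Top (kP ψ i) f) x‖ₑ ^ (2 : ℝ)) ^ (p / 2) = ENNReal.ofReal (s x ^ (p / 2)) := by
    intro x
    rw [← ENNReal.ofReal_rpow_of_nonneg (hs0 x) (by positivity), hs, ENNReal.ofReal_sum_of_nonneg fun i _ => by positivity]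
    simp_rw [ofReal_sq]
  simp_rw [e]
  refine le_of_tendsto' (lintegral_tendsto_of_tendsto_of_monotone
    (f := fun (n : ℕ) x => if 1 / ((n : ℝ) + 1) ≤ s x then ENNReal.ofReal (s x ^ (p / 2)) else 0)
    (fun n => (Measurable.ite (measurableSet_le measurable_const hsm) (hsm.pow_const _).ennreal_ofReal measurable_const).aemeasurable)
    (Filter.Eventually.of_forall fun x => ?_) (Filter.Eventually.of_forall fun x => ?_)) fun n => h2 (1 / ((n : ℝ) + 1)) (by positivity)
  · intro m n hmn
    simp only
    have : 1 / ((n : ℝ) + 1) ≤ 1 / ((m : ℝ) + 1) := by gcongr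
    split_ifs with h3 h4
    · exact le_rfl
    · exact absurd (this.trans h3) h4
    · exact zero_le
    · exact le_rfl
  · rcases (hs0 x).eq_or_lt with h0 | h0
    · rw [← h0, Real.zero_rpow (by positivity)]
      simp
    · obtain ⟨N, hN⟩ := exists_nat_one_div_lt h0
      refine tendsto_const_nhds.congr' ?_
      filter_upwards [Filter.eventually_ge_atTop N] with n hn
      rw [if_pos]
      refine le_trans ?_ hN.le
      gcongr

end
end VP

namespace VP

def I1 (a : ℤ → ℂ) (s t : ℤ) : ℂ := ∑ i ∈ Finset.Ioc s t, a i
def I2 (a b : ℤ → ℂ) (s t : ℤ) : ℂ := ∑ j ∈ Finset.Ioc s t, I1 a s (j - 1) * b j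

lemma Ioc_succ {M : Type*} [AddCommMonoid M] (f : ℤ → M) {s t : ℤ} (h : s ≤ t) :
    ∑ i ∈ Finset.Ioc s (t + 1), f i = ∑ i ∈ Finset.Ioc s t, f i + f (t + 1) := by
  have : Finset.Ioc s (t + 1) = insert (t + 1) (Finset.Ioc s t) := by
    ext i; simp only [Finset.mem_insert, Finset.mem_Ioc]; omega
  rw [this, Finset.sum_insert (by simp), add_comm]

lemma I1_self (a s) : I1 a s s = 0 := by simp [I1]
lemma I2_self (a b s) : I2 a b s s = 0 := by simp [I2]
lemma I1_succ (a) {s t : ℤ} (h : s ≤ t) : I1 a s (t + 1) = I1 a s t + a (t + 1) := Ioc_succ a h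
lemma I2_succ (a b) {s t : ℤ} (h : s ≤ t) : I2 a b s (t + 1) = I2 a b s t + I1 a s t * b (t + 1) := by
  unfold I2; rw [Ioc_succ _ h, add_sub_cancel_right]

lemma I2_shift (a b : ℤ → ℂ) {s t : ℤ} (h : s ≤ t) :
    I2 a b s t = I2 a (fun j => b (j + 1)) s t + (∑ j ∈ Finset.Ioc s t, a j * b (j + 1) - I1 a s t * b (t + 1)) := by
  induction t, h using Int.leInduction with
  | base => simp [I1_self, I2_self]
  | succ t h ih =>
    rw [I2_succ _ _ h, I2_succ _ _ h, Ioc_succ _ h, I1_succ _ h, ih]; ring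

def cross (a b : ℤ → ℂ) (c s t : ℤ) : ℝ≥0∞ :=
  ∑ j ∈ Finset.Ioc s t, ‖a j‖ₑ * ‖b (j + c)‖ₑ + ‖I1 a s t‖ₑ * (if s < t then ‖b (t + c)‖ₑ else 0)

lemma cross_bd (a b : ℤ → ℂ) (c : ℤ) {s t : ℤ} (h : s ≤ t) :
    ‖∑ j ∈ Finset.Ioc s t, a j * b (j + c) - I1 a s t * b (t + c)‖ₑ ≤ cross a b c s t := by
  unfold cross
  refine enorm_sub_le.trans (add_le_add ((enorm_sum_le _ _).trans (by simp_rw [enorm_mul]; exact le_rfl)) ?_)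
  rw [enorm_mul]
  split_ifs with h1
  · exact le_rfl
  · rw [show s = t by omega, I1_self]; simp

lemma I2_shift_pos (a b : ℤ → ℂ) (n : ℕ) {s t : ℤ} (h : s ≤ t) :
    ‖I2 a b s t - I2 a (fun j => b (j + n)) s t‖ₑ ≤ ∑ k ∈ Finset.range n, cross a b (k + 1) s t := by
  induction n with
  | zero => simp
  | succ n ih =>
    rw [Finset.sum_range_succ]
    have e := I2_shift a (fun j => b (j + n)) h
    have : I2 a b s t - I2 a (fun j => b (j + (n + 1 : ℕ))) s t = (I2 a b s t - I2 a (fun j => b (j + n)) s t) +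
        (∑ j ∈ Finset.Ioc s t, a j * b (j + ((n : ℤ) + 1)) - I1 a s t * b (t + ((n : ℤ) + 1))) := by
      rw [e]; push_cast
      simp only [add_assoc, add_comm (1 : ℤ)]
      ring
    rw [this]
    exact (enorm_add_le _ _).trans (add_le_add ih (cross_bd a b _ h))

lemma I2_shift_all (a b : ℤ → ℂ) (c : ℤ) : ∃ J : ℕ → ℤ, ∀ s t : ℤ, s ≤ t →
    ‖I2 a b s t‖ₑ ≤ ‖I2 a (fun j => b (j + c)) s t‖ₑ + ∑ k ∈ Finset.range c.natAbs, cross a b (J k) s t := by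
  have tri : ∀ x y : ℂ, ‖x‖ₑ ≤ ‖y‖ₑ + ‖x - y‖ₑ := fun x y => by
    have := enorm_add_le y (x - y); rwa [add_sub_cancel] at this
  rcases Int.natAbs_eq c with hc | hc
  · refine ⟨fun k => k + 1, fun s t h => (tri _ _).trans (add_le_add le_rfl ?_)⟩
    nth_rewrite 1 [hc]
    exact I2_shift_pos a b _ h
  · set n := c.natAbs
    refine ⟨fun k => k + 1 - n, fun s t h => (tri _ _).trans (add_le_add le_rfl ?_)⟩
    have := I2_shift_pos a (fun j => b (j - n)) n h
    simp only [add_sub_cancel_right] at this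
    rw [← enorm_neg, neg_sub, hc]
    refine this.trans (Finset.sum_le_sum fun k _ => le_of_eq ?_)
    unfold cross
    simp only [add_sub_assoc]

section
variable {ι : Type*} [LinearOrder ι]

lemma Var_mul_le (F G : ι → ι → ℝ≥0∞) (s t : ι) :
    Var (fun a b => F a b * G a b) s t ≤ Var (fun a b => F a b ^ (2 : ℝ)) s t ^ (1 / 2 : ℝ) *
      Var (fun a b => G a b ^ (2 : ℝ)) s t ^ (1 / 2 : ℝ) := by
  refine Var_le fun n N hN h1 h2 => ?_
  refine (ENNReal.inner_le_Lp_mul_Lq (Finset.range n) _ _ Real.HolderConjugate.two_two).trans ?_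
  gcongr
  · exact le_Var (fun a b => F a b ^ (2 : ℝ)) n N hN h1 h2
  · exact le_Var (fun a b => G a b ^ (2 : ℝ)) n N hN h1 h2

lemma Var_sum_le {κ : Type*} (I : Finset κ) (F : κ → ι → ι → ℝ≥0∞) (s t : ι) :
    Var (fun a b => ∑ l ∈ I, F l a b) s t ≤ ∑ l ∈ I, Var (F l) s t := by
  refine Var_le fun n N hN h1 h2 => ?_
  rw [Finset.sum_comm]
  exact Finset.sum_le_sum fun l _ => le_Var (F l) n N hN h1 h2
end

lemma Ioc_consec (c : ℤ → ℝ≥0∞) {s u t : ℤ} (h1 : s ≤ u) (h2 : u ≤ t) :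
    ∑ i ∈ Finset.Ioc s u, c i + ∑ i ∈ Finset.Ioc u t, c i = ∑ i ∈ Finset.Ioc s t, c i := by
  rw [← Finset.sum_union]
  · congr 1; ext i; simp only [Finset.mem_union, Finset.mem_Ioc]; omega
  · rw [Finset.disjoint_left]; intro i hi hj; simp only [Finset.mem_Ioc] at hi hj; omega

lemma Var_le_tsum {F : ℤ → ℤ → ℝ≥0∞} {c : ℤ → ℝ≥0∞} {s t : ℤ}
    (h : ∀ a b, s ≤ a → a ≤ b → b ≤ t → F a b ≤ ∑ n ∈ Finset.Ioc a b, c n) :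
    Var F s t ≤ ∑' n, c n := by
  refine Var_le fun n N hN h1 h2 => ?_
  have : ∀ m ≤ n, ∑ k ∈ Finset.range m, F (N k) (N (k + 1)) ≤ ∑ j ∈ Finset.Ioc (N 0) (N m), c j := by
    intro m hm
    induction m with
    | zero => simp
    | succ m ih =>
      rw [Finset.sum_range_succ, ← Ioc_consec c (hN (Nat.zero_le m)) (hN (Nat.le_succ m))]
      exact add_le_add (ih (by omega)) (h _ _ (h1.trans (hN (by omega))) (hN (by omega))
        ((hN hm).trans h2))
  exact (this n le_rfl).trans (ENNReal.sum_le_tsum _)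

lemma pow_split (x : ℝ≥0∞) {r : ℝ} (hr : 1 ≤ r) : x ^ r = x ^ (r - 1) * x := by
  nth_rewrite 3 [← ENNReal.rpow_one x]
  rw [← ENNReal.rpow_add_of_nonneg _ _ (by linarith) zero_le_one]; congr 1; ring

lemma sum_rpow_le_rpow_sum (c : ℤ → ℝ≥0∞) {r : ℝ} (hr : 1 ≤ r) : ∑' n, c n ^ r ≤ (∑' n, c n) ^ r := by
  rw [pow_split _ hr, ← ENNReal.tsum_mul_left]
  refine ENNReal.tsum_le_tsum fun n => ?_
  rw [pow_split _ hr]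
  gcongr
  exact ENNReal.le_tsum n

def sq2 (a : ℤ → ℂ) : ℝ≥0∞ := ∑' i, ‖a i‖ₑ ^ (2 : ℝ)

lemma tsum_shift (f : ℤ → ℝ≥0∞) (c : ℤ) : ∑' j, f (j + c) = ∑' j, f j := (Equiv.addRight c).tsum_eq f

lemma cross_Var (a b : ℤ → ℂ) (c : ℤ) {r : ℝ} (hr : 1 ≤ r) (s t : ℤ) :
    Var (fun s t => cross a b c s t ^ r) s t ≤ 2 ^ r * ((sq2 a ^ (1 / 2 : ℝ) * sq2 b ^ (1 / 2 : ℝ)) ^ r +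
      Var (fun s t => ‖I1 a s t‖ₑ ^ (2 * r)) s t ^ (1 / 2 : ℝ) * (sq2 b ^ (1 / 2 : ℝ)) ^ r) := by
  have hr0 : 0 < r := by linarith
  calc _ ≤ Var (fun s t => 2 ^ r * ((∑ j ∈ Finset.Ioc s t, ‖a j‖ₑ * ‖b (j + c)‖ₑ) ^ r +
        (‖I1 a s t‖ₑ ^ r * (if s < t then ‖b (t + c)‖ₑ else 0) ^ r))) s t := by
        refine Var_mono le_rfl le_rfl fun s t _ _ _ => ?_
        refine (add_rpow_le2 _ _ hr0.le).trans ?_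
        rw [ENNReal.mul_rpow_of_nonneg ‖I1 a s t‖ₑ _ hr0.le]
    _ ≤ 2 ^ r * (Var (fun s t => (∑ j ∈ Finset.Ioc s t, ‖a j‖ₑ * ‖b (j + c)‖ₑ) ^ r) s t +
        Var (fun s t => (‖I1 a s t‖ₑ ^ r * (if s < t then ‖b (t + c)‖ₑ else 0) ^ r)) s t) := by
        rw [Var_const_mul]
        exact mul_le_mul' le_rfl (Var_add_le _ _ _ _)
    _ ≤ _ := by
        refine mul_le_mul' le_rfl (add_le_add ?_ ?_)
        · set W := ∑' j, ‖a j‖ₑ * ‖b (j + c)‖ₑ with hW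
          have hWle : W ≤ sq2 a ^ (1 / 2 : ℝ) * sq2 b ^ (1 / 2 : ℝ) := by
            refine ENNReal.summable.tsum_le_of_sum_le fun I => ?_
            refine (ENNReal.inner_le_Lp_mul_Lq I _ _ Real.HolderConjugate.two_two).trans ?_
            unfold sq2
            rw [← tsum_shift (fun i => ‖b i‖ₑ ^ (2 : ℝ)) c]
            gcongr
            · exact ENNReal.sum_le_tsum _
            · exact ENNReal.sum_le_tsum _
          refine le_trans ?_ (ENNReal.rpow_le_rpow hWle hr0.le)
          have : Var (fun s t => (∑ j ∈ Finset.Ioc s t, ‖a j‖ₑ * ‖b (j + c)‖ₑ) ^ r) s t ≤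
              ∑' j, W ^ (r - 1) * (‖a j‖ₑ * ‖b (j + c)‖ₑ) := by
            refine Var_le_tsum fun s t _ _ _ => ?_
            rw [← Finset.mul_sum, pow_split _ hr]
            gcongr
            exact ENNReal.sum_le_tsum _
          refine this.trans ?_
          rw [ENNReal.tsum_mul_left, ← pow_split _ hr]
        · refine (Var_mul_le _ _ _ _).trans ?_
          simp_rw [← ENNReal.rpow_mul]
          rw [mul_comm r 2, mul_comm (1 / 2) r]
          refine mul_le_mul' le_rfl ?_
          rw [ENNReal.rpow_mul (sq2 b)]
          refine ENNReal.rpow_le_rpow ?_ (by norm_num)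
          have : Var (fun s t => (if s < t then ‖b (t + c)‖ₑ else 0) ^ (2 * r)) s t ≤ ∑' j, (‖b (j + c)‖ₑ ^ (2 : ℝ)) ^ r := by
            refine Var_le_tsum fun s t _ _ _ => ?_
            split_ifs with h
            · rw [ENNReal.rpow_mul]
              exact Finset.single_le_sum (f := fun j => (‖b (j + c)‖ₑ ^ (2 : ℝ)) ^ r) (fun _ _ => zero_le) (by simp [h])
            · rw [ENNReal.zero_rpow_of_pos (by positivity)]; exact zero_le
          refine this.trans ?_
          rw [tsum_shift (fun j => (‖b j‖ₑ ^ (2 : ℝ)) ^ r) c]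
          exact sum_rpow_le_rpow_sum _ hr

lemma fin_rpow_le (n : ℕ) (y : ℕ → ℝ≥0∞) {r : ℝ} (hr : 0 < r) :
    (∑ k ∈ Finset.range n, y k) ^ r ≤ (n : ℝ≥0∞) ^ r * ∑ k ∈ Finset.range n, y k ^ r := by
  have := tsum_mul_rpow_le (fun _ : Fin n => (1 : ℝ≥0∞)) (fun k => y k) hr
  rw [tsum_fintype, tsum_fintype, tsum_fintype] at this
  simp only [one_mul, Finset.sum_const, Finset.card_univ, Fintype.card_fin, nsmul_eq_mul, mul_one] at this
  rwa [Fin.sum_univ_eq_sum_range (fun k => y k), Fin.sum_univ_eq_sum_range (fun k => y k ^ r)] at this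

lemma shift_Var (a b : ℤ → ℂ) (c : ℤ) {r : ℝ} (hr : 1 ≤ r) (s t : ℤ) :
    Var (fun s t => ‖I2 a b s t‖ₑ ^ r) s t ≤ 2 ^ r * (Var (fun s t => ‖I2 a (fun j => b (j + c)) s t‖ₑ ^ r) s t +
      (c.natAbs : ℝ≥0∞) ^ (r + 1) * (2 ^ r * ((sq2 a ^ (1 / 2 : ℝ) * sq2 b ^ (1 / 2 : ℝ)) ^ r +
      Var (fun s t => ‖I1 a s t‖ₑ ^ (2 * r)) s t ^ (1 / 2 : ℝ) * (sq2 b ^ (1 / 2 : ℝ)) ^ r))) := by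
  have hr0 : 0 < r := by linarith
  obtain ⟨J, hJ⟩ := I2_shift_all a b c
  set B := 2 ^ r * ((sq2 a ^ (1 / 2 : ℝ) * sq2 b ^ (1 / 2 : ℝ)) ^ r +
      Var (fun s t => ‖I1 a s t‖ₑ ^ (2 * r)) s t ^ (1 / 2 : ℝ) * (sq2 b ^ (1 / 2 : ℝ)) ^ r) with hB
  calc _ ≤ Var (fun s t => 2 ^ r * (‖I2 a (fun j => b (j + c)) s t‖ₑ ^ r +
        (c.natAbs : ℝ≥0∞) ^ r * ∑ k ∈ Finset.range c.natAbs, cross a b (J k) s t ^ r)) s t := by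
        refine Var_mono le_rfl le_rfl fun s t _ h _ => ?_
        refine (ENNReal.rpow_le_rpow (hJ s t h) hr0.le).trans ((add_rpow_le2 _ _ hr0.le).trans ?_)
        exact mul_le_mul' le_rfl (add_le_add le_rfl (fin_rpow_le _ _ hr0))
    _ ≤ 2 ^ r * (Var (fun s t => ‖I2 a (fun j => b (j + c)) s t‖ₑ ^ r) s t +
        (c.natAbs : ℝ≥0∞) ^ r * ∑ k ∈ Finset.range c.natAbs, Var (fun s t => cross a b (J k) s t ^ r) s t) := by
        rw [Var_const_mul]
        refine mul_le_mul' le_rfl ((Var_add_le _ _ _ _).trans (add_le_add le_rfl ?_))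
        rw [Var_const_mul]
        exact mul_le_mul' le_rfl (Var_sum_le _ _ _ _)
    _ ≤ 2 ^ r * (Var (fun s t => ‖I2 a (fun j => b (j + c)) s t‖ₑ ^ r) s t +
        (c.natAbs : ℝ≥0∞) ^ r * ∑ k ∈ Finset.range c.natAbs, B) := by
        refine mul_le_mul' le_rfl (add_le_add le_rfl (mul_le_mul' le_rfl (Finset.sum_le_sum fun k _ => ?_)))
        exact cross_Var a b _ hr s t
    _ = _ := by
        rw [Finset.sum_const, Finset.card_range, nsmul_eq_mul, ENNReal.rpow_add_of_nonneg _ _ hr0.le zero_le_one,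
          ENNReal.rpow_one, mul_assoc]

end VP

namespace VP

lemma mulp {p p1 p2 : ℝ} (hp : 0 < p) (hp1 : 0 < p1) (hp2 : 0 < p2) (hpp : 1 / p = 1 / p1 + 1 / p2) (x y : ℝ≥0∞) :
    (x * y) ^ p ≤ x ^ p1 + y ^ p2 := by
  set Z := x ^ p1 + y ^ p2 with hZ
  have hx : x ≤ Z ^ (1 / p1) := by
    rw [one_div, ENNReal.le_rpow_inv_iff hp1]; exact le_self_add
  have hy : y ≤ Z ^ (1 / p2) := by
    rw [one_div, ENNReal.le_rpow_inv_iff hp2]; exact le_add_self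
  calc (x * y) ^ p ≤ (Z ^ (1 / p1) * Z ^ (1 / p2)) ^ p := by gcongr
    _ = Z := by
      rw [← ENNReal.rpow_add_of_nonneg _ _ (by positivity) (by positivity), ← hpp, ← ENNReal.rpow_mul,
        one_div_mul_cancel hp.ne', ENNReal.rpow_one]

lemma Var_Z_le_N (F : ℤ → ℤ → ℝ≥0∞) (b : ℤ) (K : ℕ) :
    Var F b (b + K) ≤ Var (fun s t : ℕ => F (b + s) (b + t)) 0 K := by
  refine Var_le fun n N hN h1 h2 => ?_
  have e : ∀ k, b + ((N k - b).toNat : ℤ) = N k := fun k => by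
    have := h1.trans (hN (Nat.zero_le k)); omega
  have := le_Var (fun s t : ℕ => F (b + s) (b + t)) (s := 0) (t := K) n (fun k => (N k - b).toNat)
    (fun i j hij => Int.toNat_le_toNat (by have := hN hij; omega)) (Nat.zero_le _) (by have := e n; omega)
  simpa only [e] using this

lemma S_I1 (G : ℤ → ℝ → ℂ) (c : ℤ) (x : ℝ) {s t : ℕ} (h : s ≤ t) :
    S (fun k => G (c + k)) t x - S (fun k => G (c + k)) s x = I1 (fun i => G i x) (c - 1 + s) (c - 1 + t) := by
  induction t, h using Nat.le_induction with
  | base => simp [I1_self]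
  | succ t h ih =>
    rw [S_succ, show c - 1 + ((t + 1 : ℕ) : ℤ) = c - 1 + t + 1 by push_cast; ring, I1_succ _ (by omega), ← ih,
      show c - 1 + (t : ℤ) + 1 = c + t by ring]; ring

lemma Pi_I2 (G H : ℤ → ℝ → ℂ) (c : ℤ) (x : ℝ) {s t : ℕ} (h : s ≤ t) :
    Pi (fun k => G (c + k)) (fun k => H (c + k)) s t x = I2 (fun i => G i x) (fun i => H i x) (c - 1 + s) (c - 1 + t) := by
  induction t, h using Nat.le_induction with
  | base => simp [I2_self, Pi_self]
  | succ t h ih =>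
    rw [Pi_succ, show c - 1 + ((t + 1 : ℕ) : ℤ) = c - 1 + t + 1 by push_cast; ring, I2_succ _ _ (by omega), ← ih,
      S_I1 G c x h, show c - 1 + (t : ℤ) + 1 = c + t by ring]

lemma DZ.diff' {G : ℤ → ℝ → ℂ} {l : ℤ} (h : DZ (fun n => G (n - l))) (c : ℤ) :
    IsDiff (fun k : ℕ => VP.flip (c + l + k)) (fun k => G (c + k)) := by
  have := h.diff (c + l)
  simp only [show ∀ k : ℕ, c + l + (k : ℤ) - l = c + k from fun k => by ring] at this
  exact this

lemma Sq_sq2 (G : ℤ → ℝ → ℂ) (c : ℤ) (K : ℕ) (x : ℝ) :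
    ENNReal.ofReal (Sq (fun k => G (c + k)) K x) ≤ sq2 (fun i => G i x) := by
  rw [Sq_window]; exact ENNReal.sum_le_tsum _

def W1 (a : ℤ → ℂ) (q : ℝ) (K : ℕ) : ℝ≥0∞ := Var (fun s t => ‖I1 a s t‖ₑ ^ q) (-(K : ℤ)) K
def W2 (a b : ℤ → ℂ) (r : ℝ) (K : ℕ) : ℝ≥0∞ := Var (fun s t => ‖I2 a b s t‖ₑ ^ r) (-(K : ℤ)) K

lemma V1Z {q p : ℝ} (hq : 2 < q) (hp : 0 < p) : ∃ C : ℝ≥0, ∀ (G : ℤ → ℝ → ℂ) (l : ℤ) (K : ℕ),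
    DZ (fun n => G (n - l)) → ∫⁻ x, W1 (fun i => G i x) q K ^ (p / q) ≤ C * ∫⁻ x, sq2 (fun i => G i x) ^ (p / 2) := by
  obtain ⟨C, hC⟩ := V1D hq hp
  refine ⟨C, fun G l K h => ?_⟩
  have h1 := hC _ _ (2 * K) (h.diff' (-K + 1))
  calc _ ≤ ∫⁻ x, VS (fun k : ℕ => G (-K + 1 + k)) q (2 * K) x ^ (p / q) := by
        gcongr with x
        have := Var_Z_le_N (fun s t => ‖I1 (fun i => G i x) s t‖ₑ ^ q) (-K) (2 * K)
        rw [show -(K : ℤ) + ((2 * K : ℕ) : ℤ) = K by push_cast; ring] at this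
        refine this.trans (Var_mono le_rfl le_rfl fun s t _ hst _ => le_of_eq ?_)
        rw [S_I1 _ _ _ hst, add_sub_cancel_right]
    _ ≤ _ := h1
    _ ≤ _ := by gcongr with x; exact Sq_sq2 G _ _ x

lemma V2A {r p p1 p2 : ℝ} (hr : 1 < r) (hp : 0 < p)
    (hp1 : 0 < p1) (hp2 : 0 < p2) (hpp : 1 / p = 1 / p1 + 1 / p2) : ∃ C : ℝ≥0, ∀ (G H : ℤ → ℝ → ℂ) (l : ℤ) (K : ℕ),
    DZ (fun n => G (n - l)) → DZ (fun n => H (n - l)) → ∫⁻ x, W2 (fun i => G i x) (fun i => H i x) r K ^ (p / r) ≤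
      C * ((∫⁻ x, sq2 (fun i => G i x) ^ (p1 / 2)) + ∫⁻ x, sq2 (fun i => H i x) ^ (p2 / 2)) := by
  obtain ⟨C, hC⟩ := V2D hr hp hp1 hp2 hpp
  refine ⟨C, fun G H l K h h' => ?_⟩
  have h1 := hC _ _ _ (2 * K) (h.diff' (-K + 1)) (h'.diff' (-K + 1))
  calc _ ≤ ∫⁻ x, VP (fun k : ℕ => G (-K + 1 + k)) (fun k : ℕ => H (-K + 1 + k)) r (2 * K) x ^ (p / r) := by
        gcongr with x
        have := Var_Z_le_N (fun s t => ‖I2 (fun i => G i x) (fun i => H i x) s t‖ₑ ^ r) (-K) (2 * K)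
        rw [show -(K : ℤ) + ((2 * K : ℕ) : ℤ) = K by push_cast; ring] at this
        refine this.trans (Var_mono le_rfl le_rfl fun s t _ hst _ => le_of_eq ?_)
        rw [Pi_I2 _ _ _ _ hst, add_sub_cancel_right]
    _ ≤ _ := h1
    _ ≤ _ := by gcongr with x; exacts [Sq_sq2 G _ _ x, Sq_sq2 H _ _ x]

lemma I1_meas {G : ℤ → ℝ → ℂ} (h : ∀ i, Measurable (G i)) (s t) : Measurable fun x => I1 (fun i => G i x) s t :=
  Finset.measurable_sum _ fun i _ => h i
lemma I2_meas {G H : ℤ → ℝ → ℂ} (h : ∀ i, Measurable (G i)) (h' : ∀ i, Measurable (H i)) (s t) :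
    Measurable fun x => I2 (fun i => G i x) (fun i => H i x) s t :=
  Finset.measurable_sum _ fun i _ => (I1_meas h _ _).mul (h' i)
lemma W1_meas {G : ℤ → ℝ → ℂ} (h : ∀ i, Measurable (G i)) (q K) : Measurable fun x => W1 (fun i => G i x) q K :=
  Var_measurable (fun s t x => ‖I1 (fun i => G i x) s t‖ₑ ^ q) (fun s t => (I1_meas h s t).enorm.pow_const _) _ _
lemma W2_meas {G H : ℤ → ℝ → ℂ} (h : ∀ i, Measurable (G i)) (h' : ∀ i, Measurable (H i)) (q K) :
    Measurable fun x => W2 (fun i => G i x) (fun i => H i x) q K :=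
  Var_measurable (fun s t x => ‖I2 (fun i => G i x) (fun i => H i x) s t‖ₑ ^ q)
    (fun s t => (I2_meas h h' s t).enorm.pow_const _) _ _
lemma sq2_meas {G : ℤ → ℝ → ℂ} (h : ∀ i, Measurable (G i)) : Measurable fun x => sq2 (fun i => G i x) :=
  Measurable.ennreal_tsum fun i => (h i).enorm.pow_const _

lemma DZ.meas' {G : ℤ → ℝ → ℂ} {l : ℤ} (h : DZ (fun n => G (n - l))) (i) : Measurable (G i) := by
  have := h.meas (i + l); simpa using this

lemma V2Z {r p p1 p2 : ℝ} (hr : 1 < r) (hp : 0 < p)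
    (hp1 : 0 < p1) (hp2 : 0 < p2) (hpp : 1 / p = 1 / p1 + 1 / p2) : ∃ C : ℝ≥0, ∀ (G H : ℤ → ℝ → ℂ) (l l' : ℤ) (K : ℕ),
    DZ (fun n => G (n - l)) → DZ (fun n => H (n - l')) → ∫⁻ x, W2 (fun i => G i x) (fun i => H i x) r K ^ (p / r) ≤
      C * (1 + ((l - l').natAbs : ℝ≥0∞) ^ ((r + 1) * (p / r))) *
        ((∫⁻ x, sq2 (fun i => G i x) ^ (p1 / 2)) + ∫⁻ x, sq2 (fun i => H i x) ^ (p2 / 2)) := by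
  obtain ⟨C2, h2⟩ := V2A hr hp hp1 hp2 hpp
  obtain ⟨C1, h1⟩ := V1Z (q := 2 * r) (by linarith) hp1
  have hr0 : 0 < r := by linarith
  set ρ := p / r with hρ
  have hρ0 : 0 < ρ := by positivity
  set D : ℝ≥0 := 2 ^ p * 2 ^ ρ with hD
  have hDc : (D : ℝ≥0∞) = (2 ^ r) ^ ρ * 2 ^ ρ := by
    rw [← ENNReal.rpow_mul, show r * ρ = p by rw [hρ]; field_simp]
    rw [hD, ENNReal.coe_mul, ENNReal.coe_rpow_of_nonneg _ hp.le, ENNReal.coe_rpow_of_nonneg _ hρ0.le]; rfl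
  have key : ∀ x y : ℝ≥0∞, (2 ^ r * (x + y)) ^ ρ ≤ D * (x ^ ρ + y ^ ρ) := fun x y => by
    rw [ENNReal.mul_rpow_of_nonneg _ _ hρ0.le, hDc, mul_assoc]
    exact mul_le_mul' le_rfl (add_rpow_le2 _ _ hρ0.le)
  refine ⟨D * (C2 + D * (2 + C1)), fun G H l l' K hG hH => ?_⟩
  set c := l - l' with hc
  set n : ℝ≥0∞ := (c.natAbs : ℝ≥0∞) with hn
  have hH' : DZ (fun n => (fun j => H (j + c)) (n - l)) := by
    simpa only [hc, show ∀ n : ℤ, n - l + (l - l') = n - l' from fun n => by ring] using hH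
  have e2 := h2 G (fun j => H (j + c)) l K hG hH'
  have esq : ∀ x, sq2 (fun i => H (i + c) x) = sq2 (fun i => H i x) := fun x => tsum_shift (fun i => ‖H i x‖ₑ ^ (2 : ℝ)) c
  simp_rw [esq] at e2
  have e1 := h1 G l K hG
  set X := ∫⁻ x, sq2 (fun i => G i x) ^ (p1 / 2)
  set Y := ∫⁻ x, sq2 (fun i => H i x) ^ (p2 / 2)
  have mX : Measurable fun x => sq2 (fun i => G i x) ^ (p1 / 2) := (sq2_meas hG.meas').pow_const _
  have mY : Measurable fun x => sq2 (fun i => H i x) ^ (p2 / 2) := (sq2_meas hH.meas').pow_const _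
  have mV : Measurable fun x => W2 (fun i => G i x) (fun i => H (i + c) x) r K ^ ρ :=
    (W2_meas hG.meas' (fun i => hH.meas' _) _ _).pow_const _
  have mW : Measurable fun x => W1 (fun i => G i x) (2 * r) K ^ (p1 / (2 * r)) := (W1_meas hG.meas' _ _).pow_const _
  have hnt : n ≠ ∞ := ENNReal.natCast_ne_top _
  calc _ ≤ ∫⁻ x, D * (W2 (fun i => G i x) (fun i => H (i + c) x) r K ^ ρ + n ^ ((r + 1) * ρ) * (D *
        ((sq2 (fun i => G i x) ^ (p1 / 2) + sq2 (fun i => H i x) ^ (p2 / 2)) +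
          (W1 (fun i => G i x) (2 * r) K ^ (p1 / (2 * r)) + sq2 (fun i => H i x) ^ (p2 / 2))))) := by
        refine lintegral_mono fun x => ?_
        refine (ENNReal.rpow_le_rpow (shift_Var (fun i => G i x) (fun i => H i x) c hr.le (-(K : ℤ)) K) hρ0.le).trans ?_
        refine (key _ _).trans (mul_le_mul' le_rfl (add_le_add le_rfl ?_))
        rw [ENNReal.mul_rpow_of_nonneg _ _ hρ0.le, ← ENNReal.rpow_mul]
        refine mul_le_mul' le_rfl ((key _ _).trans (mul_le_mul' le_rfl (add_le_add ?_ ?_)))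
        · rw [← ENNReal.rpow_mul, show r * ρ = p by rw [hρ]; field_simp]
          refine (mulp hp hp1 hp2 hpp _ _).trans (le_of_eq ?_)
          rw [← ENNReal.rpow_mul, ← ENNReal.rpow_mul]; congr 2 <;> ring
        · have e3 : ∀ u v : ℝ≥0∞, (u ^ (1 / 2 : ℝ) * v ^ r) ^ ρ = (u ^ (1 / (2 * r)) * v) ^ p := by
            intro u v
            rw [ENNReal.mul_rpow_of_nonneg _ _ hρ0.le, ENNReal.mul_rpow_of_nonneg _ _ hp.le, ← ENNReal.rpow_mul,
              ← ENNReal.rpow_mul, ← ENNReal.rpow_mul]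
            congr 2 <;> rw [hρ] <;> field_simp
          rw [e3]
          refine (mulp hp hp1 hp2 hpp _ _).trans (le_of_eq ?_)
          rw [← ENNReal.rpow_mul, ← ENNReal.rpow_mul]; unfold W1; congr 2 <;> ring
    _ = D * ((∫⁻ x, W2 (fun i => G i x) (fun i => H (i + c) x) r K ^ ρ) + n ^ ((r + 1) * ρ) * (D *
        ((X + Y) + ((∫⁻ x, W1 (fun i => G i x) (2 * r) K ^ (p1 / (2 * r))) + Y)))) := by
        rw [lintegral_const_mul' _ _ ENNReal.coe_ne_top, lintegral_add_left mV,
          lintegral_const_mul' _ _ (ENNReal.rpow_ne_top_of_nonneg (by positivity) hnt),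
          lintegral_const_mul' _ _ ENNReal.coe_ne_top]
        have m1 : Measurable fun x => sq2 (fun i => G i x) ^ (p1 / 2) + sq2 (fun i => H i x) ^ (p2 / 2) := mX.add mY
        rw [lintegral_add_left m1, lintegral_add_left mX, lintegral_add_left mW]
    _ ≤ D * (C2 * (X + Y) + n ^ ((r + 1) * ρ) * (D * ((X + Y) + (C1 * X + Y)))) := by
        refine mul_le_mul' le_rfl (add_le_add e2 (mul_le_mul' le_rfl (mul_le_mul' le_rfl (add_le_add le_rfl (add_le_add e1 le_rfl)))))
    _ ≤ D * (C2 * ((1 + n ^ ((r + 1) * ρ)) * (X + Y)) + (1 + n ^ ((r + 1) * ρ)) * (D * ((2 + C1) * (X + Y)))) := by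
        set m := n ^ ((r + 1) * ρ)
        refine mul_le_mul' le_rfl (add_le_add (mul_le_mul' le_rfl ?_) (mul_le_mul' le_add_self (mul_le_mul' le_rfl ?_)))
        · nth_rewrite 1 [← one_mul (X + Y)]; exact mul_le_mul' le_self_add le_rfl
        · calc (X + Y) + (C1 * X + Y) ≤ (X + Y) + (C1 * X + Y) + (X + C1 * Y) := le_self_add
            _ = _ := by ring
    _ = _ := by push_cast; ring

end VP

namespace VP

lemma I2_swap (a b : ℤ → ℂ) {s t : ℤ} (h : s ≤ t) : I2 a b s t = ∑ i ∈ Finset.Ioc s t, a i * I1 b i t := by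
  induction t, h using Int.leInduction with
  | base => simp [I2]
  | succ t h ih =>
    rw [I2_succ _ _ h, Ioc_succ _ h, I1_self, ih, I1, Finset.sum_mul, mul_zero, add_zero, ← Finset.sum_add_distrib]
    refine Finset.sum_congr rfl fun i hi => ?_
    rw [I1_succ _ (Finset.mem_Ioc.1 hi).2, mul_add]

lemma cont_leW (I : Finset ℤ) (w : ℤ → ℂ) {u : ℤ → ℝ → ℂ} (hu : ∀ i, Nice (u i)) (hc : ∀ i, Continuous (u i)) (x) :
    ‖∑ i ∈ I, w i * u i x‖ₑ ≤ ∑' m : ℤ, ‖∑ i ∈ I, w i * Top (kD (i + m)) (u i) x‖ₑ := by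
  have h1 := tendsto_finset_sum I fun i _ => (sum_D_tendsto (hu i) (hc i) x i).const_mul (w i)
  refine le_of_tendsto h1.enorm (Filter.Eventually.of_forall fun n => ?_)
  simp_rw [Finset.mul_sum]
  rw [Finset.sum_comm]
  exact (enorm_sum_le _ _).trans (ENNReal.sum_le_tsum _)

lemma ser2 {ρ a : ℝ} (hρ : 0 < ρ) (ha : 0 < a) : ∃ C : ℝ≥0, ∀ y : ℤ → ℤ → ℝ≥0∞,
    (∑' l, ∑' m, y l m) ^ ρ ≤ C * ∑' l, ∑' m, (ga l * ga m) ^ (-a) * y l m ^ ρ := by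
  obtain ⟨C, hC⟩ := ser_bound hρ ha
  refine ⟨C * C, fun y => (hC _).trans ?_⟩
  calc _ ≤ (C : ℝ≥0∞) * ∑' l, ga l ^ (-a) * (C * ∑' m, ga m ^ (-a) * y l m ^ ρ) := by
        gcongr with l; exact hC _
    _ = _ := by
        push_cast
        rw [mul_assoc]
        refine congrArg (fun z => (C : ℝ≥0∞) * z) ?_
        rw [← ENNReal.tsum_mul_left]
        refine tsum_congr fun l => ?_
        rw [← ENNReal.tsum_mul_left, ← ENNReal.tsum_mul_left, ← ENNReal.tsum_mul_left]
        refine tsum_congr fun m => ?_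
        rw [ENNReal.mul_rpow_of_ne_top (ga_ne_top l) (ga_ne_top m)]; ring

lemma cnt {κ η : ℝ} (hκ : 0 < κ) (hη : 0 < η) : ∃ C : ℝ≥0, ∀ l l' : ℤ,
    (1 + ((l - l').natAbs : ℝ≥0∞) ^ κ) * (ga l * ga l') ^ η ≤ C := by
  set x : ℝ≥0∞ := 2⁻¹ ^ (η / κ) with hx
  have hx1 : x < 1 := ENNReal.rpow_lt_one (by norm_num) (by positivity)
  have hT := geom_ne_top hx1
  set T := ∑' j : ℕ, x ^ j with hTd
  have hn : ∀ n : ℕ, (n : ℝ≥0∞) * x ^ n ≤ T := fun n => by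
    calc (n : ℝ≥0∞) * x ^ n = ∑ j ∈ Finset.range n, x ^ n := by simp
      _ ≤ ∑ j ∈ Finset.range n, x ^ j := Finset.sum_le_sum fun j hj =>
          pow_le_pow_right_of_le_one' hx1.le (Finset.mem_range.1 hj).le
      _ ≤ T := ENNReal.sum_le_tsum _
  refine ⟨1 + (T ^ κ).toNNReal, fun l l' => ?_⟩
  set n := (l - l').natAbs with hnd
  push_cast
  rw [ENNReal.coe_toNNReal (ENNReal.rpow_ne_top_of_nonneg hκ.le hT), add_mul, one_mul]
  refine add_le_add ?_ ?_
  · exact ENNReal.rpow_le_one (mul_le_one' (ga_le_one l) (ga_le_one l')) hη.le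
  · have : ga l * ga l' ≤ 2⁻¹ ^ n := by
      rw [ga_eq, ga_eq, ← pow_add]
      exact pow_le_pow_right_of_le_one' (by norm_num) (by omega)
    calc _ ≤ (n : ℝ≥0∞) ^ κ * (2⁻¹ ^ n) ^ η := by gcongr
      _ = ((n : ℝ≥0∞) * x ^ n) ^ κ := by
        rw [ENNReal.mul_rpow_of_nonneg _ _ hκ.le, hx, ← ENNReal.rpow_natCast, ← ENNReal.rpow_natCast,
          ← ENNReal.rpow_mul, ← ENNReal.rpow_mul, ← ENNReal.rpow_mul]
        congr 2; field_simp
      _ ≤ _ := by gcongr; exact hn n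

lemma DZ.const_mul {G : ℤ → ℝ → ℂ} (h : DZ G) (c : ℂ) : DZ (fun n x => c * G n x) :=
  ⟨fun n => (h.meas n).const_mul c, fun n x => by rw [h.flip]; ring, fun n m hnm x => by rw [h.inv n m hnm]⟩

lemma I2_const (c d : ℂ) (a b : ℤ → ℂ) (s t) : I2 (fun i => c * a i) (fun i => d * b i) s t = c * d * I2 a b s t := by
  unfold I2 I1; rw [Finset.mul_sum]
  refine Finset.sum_congr rfl fun j _ => ?_
  rw [← Finset.mul_sum]; ring

lemma enorm_ofReal' {a : ℝ} (ha : 0 ≤ a) : ‖(a : ℂ)‖ₑ = ENNReal.ofReal a := by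
  rw [← ofReal_norm, Complex.norm_real, Real.norm_of_nonneg ha]

lemma W2_const {c d : ℝ} (hc : 0 ≤ c) (hd : 0 ≤ d) (a b : ℤ → ℂ) {r : ℝ} (hr : 0 ≤ r) (K) :
    W2 (fun i => (c : ℂ) * a i) (fun i => (d : ℂ) * b i) r K = (ENNReal.ofReal c * ENNReal.ofReal d) ^ r * W2 a b r K := by
  unfold W2; rw [← Var_const_mul]
  congr 1; funext s t
  rw [I2_const, enorm_mul, enorm_mul, enorm_ofReal' hc, enorm_ofReal' hd, ENNReal.mul_rpow_of_nonneg _ _ hr]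

lemma sq2_const {c : ℝ} (hc : 0 ≤ c) (a : ℤ → ℂ) : sq2 (fun i => (c : ℂ) * a i) = ENNReal.ofReal c ^ (2 : ℝ) * sq2 a := by
  unfold sq2; rw [← ENNReal.tsum_mul_left]
  congr 1; ext i
  rw [enorm_mul, enorm_ofReal' hc, ENNReal.mul_rpow_of_nonneg _ _ (by norm_num)]

section
variable {ψ Θ : ℝ → ℂ} {C : ℝ}

def GG (ψ : ℝ → ℂ) (f : ℝ → ℂ) (l i : ℤ) : ℝ → ℂ := Top (kD (i + l)) (Top (kP ψ i) f)

lemma GG_nice (h : Bump ψ Θ C) {f} (hf : Nice f) (l i) : Nice (GG ψ f l i) := (kD_SK _).nice ((kP_SK h i).nice hf)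

lemma GG_DZ (h : Bump ψ Θ C) {f} (hf : Nice f) (l) : DZ (fun n => GG ψ f l (n - l)) := by
  have := kD_DZ (u := fun n => Top (kP ψ (n - l)) f) fun n => (kP_SK h _).nice hf
  simpa only [GG, sub_add_cancel] using this

lemma LPs (h : Bump ψ Θ C) {p : ℝ} (hp : 1 < p) : ∃ c : ℝ≥0, ∃ a : ℝ, 0 < a ∧ ∀ l f, Nice f →
    ∫⁻ x, sq2 (fun i => GG ψ f l i x) ^ (p / 2) ≤ c * ga l ^ a * ∫⁻ x, ‖f x‖ₑ ^ p := by
  obtain ⟨c, a, ha, h1⟩ := LP h hp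
  refine ⟨c, a, ha, fun l f hf => ?_⟩
  refine le_of_tendsto' (lintegral_tendsto_of_tendsto_of_monotone
    (f := fun (n : ℕ) x => (∑ i ∈ Finset.Ico (-(n : ℤ)) n, ‖GG ψ f l i x‖ₑ ^ (2 : ℝ)) ^ (p / 2))
    (fun n => ((Finset.measurable_sum _ fun i _ => (GG_nice h hf l i).meas.enorm.pow_const _).pow_const _).aemeasurable)
    (Filter.Eventually.of_forall fun x => ?_) (Filter.Eventually.of_forall fun x => ?_)) fun n => h1 l _ f hf
  · intro m n hmn
    refine ENNReal.rpow_le_rpow (Finset.sum_le_sum_of_subset (Finset.Ico_subset_Ico ?_ ?_)) (by positivity) <;> omega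
  · refine (ENNReal.continuous_rpow_const.tendsto _).comp ?_
    have ht : Filter.Tendsto (fun n : ℕ => Finset.Ico (-(n : ℤ)) n) Filter.atTop Filter.atTop := by
      refine Filter.tendsto_atTop_finset_of_monotone (fun m n hmn => Finset.Ico_subset_Ico (by omega) (by omega)) fun i => ?_
      exact ⟨i.natAbs + 1, by simp only [Finset.mem_Ico]; omega⟩
    exact (ENNReal.summable.hasSum).comp ht

lemma T1 (h : Bump ψ Θ C) {p q : ℝ} (hp : 1 < p) (hq : 2 < q) : ∃ c : ℝ≥0, ∀ f, Nice f → ∀ K : ℕ,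
    ∫⁻ x, W1 (fun i => Top (kP ψ i) f x) q K ^ (p / q) ≤ c * ∫⁻ x, ‖f x‖ₑ ^ p := by
  obtain ⟨c1, a, ha, h1⟩ := LPs h hp
  obtain ⟨c2, h2⟩ := V1Z hq (by linarith : 0 < p)
  have hq0 : 0 < q := by linarith
  have hp0 : 0 < p := by linarith
  set ρ := p / q with hρ
  have hρ0 : 0 < ρ := by positivity
  set η := a / (2 * (1 + ρ)) with hη
  have hη0 : 0 < η := by positivity
  obtain ⟨c3, h3⟩ := ser_bound hq0 hη0
  obtain ⟨c4, h4⟩ := ser_bound hρ0 hη0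
  have hs := ga_tsum (a := a / 2) (by positivity)
  refine ⟨c3 ^ ρ * c4 * c2 * c1 * (∑' m, ga m ^ (a / 2)).toNNReal, fun f hf K => ?_⟩
  have hm : ∀ l, Measurable fun x => W1 (fun i => GG ψ f l i x) q K ^ ρ := fun l =>
    (W1_meas (fun i => (GG_nice h hf l i).meas) _ _).pow_const _
  calc _ ≤ ∫⁻ x, (c3 : ℝ≥0∞) ^ ρ * (c4 * ∑' l, ga l ^ (-(a / 2)) * W1 (fun i => GG ψ f l i x) q K ^ ρ) := by
        refine lintegral_mono fun x => ?_
        have e1 : W1 (fun i => Top (kP ψ i) f x) q K ≤ c3 * ∑' l, ga l ^ (-η) * W1 (fun i => GG ψ f l i x) q K := by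
          unfold W1
          calc _ ≤ Var (fun s t => c3 * ∑' l, ga l ^ (-η) * ‖I1 (fun i => GG ψ f l i x) s t‖ₑ ^ q) (-(K : ℤ)) K := by
                refine Var_mono le_rfl le_rfl fun s t _ _ _ => ?_
                exact (ENNReal.rpow_le_rpow (cont_le (Finset.Ioc s t) (fun i => i)
                  (fun i => (kP_SK h i).nice hf) (fun i => Top_kP_cont h i hf) x) hq0.le).trans (h3 _)
            _ ≤ _ := by
                rw [Var_const_mul]
                refine mul_le_mul' le_rfl ((Var_tsum_le _ _ _).trans (ENNReal.tsum_le_tsum fun l => le_of_eq ?_))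
                rw [Var_const_mul]
        refine (ENNReal.rpow_le_rpow e1 hρ0.le).trans ?_
        rw [ENNReal.mul_rpow_of_nonneg _ _ hρ0.le]
        refine mul_le_mul' le_rfl ((h4 _).trans (mul_le_mul' le_rfl (ENNReal.tsum_le_tsum fun l => le_of_eq ?_)))
        rw [ENNReal.mul_rpow_of_nonneg _ _ hρ0.le, ← ENNReal.rpow_mul, ← mul_assoc,
          ← ENNReal.rpow_add _ _ (ga_ne_zero l) (ga_ne_top l)]
        congr 2
        rw [hη]; field_simp; ring
    _ = (c3 : ℝ≥0∞) ^ ρ * (c4 * ∑' l, ga l ^ (-(a / 2)) * ∫⁻ x, W1 (fun i => GG ψ f l i x) q K ^ ρ) := by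
        rw [lintegral_const_mul' _ _ (ENNReal.rpow_ne_top_of_nonneg hρ0.le ENNReal.coe_ne_top),
          lintegral_const_mul' _ _ ENNReal.coe_ne_top,
          lintegral_tsum fun m => ((hm m).const_mul _).aemeasurable]
        congr 3; ext m
        rw [lintegral_const_mul _ (hm m)]
    _ ≤ (c3 : ℝ≥0∞) ^ ρ * (c4 * ∑' l, ga l ^ (a / 2) * (c2 * (c1 * ∫⁻ x, ‖f x‖ₑ ^ p))) := by
        refine mul_le_mul' le_rfl (mul_le_mul' le_rfl (ENNReal.tsum_le_tsum fun l => ?_))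
        have := (h2 (fun i => GG ψ f l i) l K (GG_DZ h hf l)).trans (mul_le_mul' le_rfl (h1 l f hf))
        refine (mul_le_mul' le_rfl this).trans (le_of_eq ?_)
        have : ga l ^ (a / 2) = ga l ^ (-(a / 2)) * ga l ^ a := by
          rw [← ENNReal.rpow_add _ _ (ga_ne_zero l) (ga_ne_top l)]; congr 1; ring
        rw [this]; ring
    _ = _ := by
        rw [ENNReal.tsum_mul_right]
        push_cast
        rw [ENNReal.coe_rpow_of_nonneg _ hρ0.le, ENNReal.coe_toNNReal hs]
        ring

lemma I2_GG_le (h : Bump ψ Θ C) {f g} (hf : Nice f) (hg : Nice g) {s t : ℤ} (hst : s ≤ t) (x) :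
    ‖I2 (fun i => Top (kP ψ i) f x) (fun i => Top (kP ψ i) g x) s t‖ₑ ≤
      ∑' l, ∑' l', ‖I2 (fun i => GG ψ f l i x) (fun i => GG ψ g l' i x) s t‖ₑ := by
  rw [ENNReal.tsum_comm]
  unfold I2 at *
  refine (cont_leW (Finset.Ioc s t) (fun j => I1 (fun i => Top (kP ψ i) f x) s (j - 1))
    (fun i => (kP_SK h i).nice hg) (fun i => Top_kP_cont h i hg) x).trans (ENNReal.tsum_le_tsum fun l' => ?_)
  have e := I2_swap (fun i => Top (kP ψ i) f x) (fun i => GG ψ g l' i x) hst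
  unfold I2 at e
  rw [show (∑ i ∈ Finset.Ioc s t, (fun j => I1 (fun i => Top (kP ψ i) f x) s (j - 1)) i * Top (kD (i + l')) (Top (kP ψ i) g) x) = _ from e]
  simp_rw [mul_comm (Top _ _ _)]
  refine (cont_leW (Finset.Ioc s t) (fun i => I1 (fun i => GG ψ g l' i x) i t)
    (fun i => (kP_SK h i).nice hf) (fun i => Top_kP_cont h i hf) x).trans (ENNReal.tsum_le_tsum fun l => le_of_eq ?_)
  have e2 := I2_swap (fun i => GG ψ f l i x) (fun i => GG ψ g l' i x) hst
  unfold I2 at e2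
  rw [e2]
  simp_rw [mul_comm (GG ψ f l _ x)]
  rfl

lemma T2p (h : Bump ψ Θ C) {r p p1 p2 : ℝ} (hr : 1 < r) (hp : 0 < p)
    (hp1 : 1 < p1) (hp2 : 1 < p2) (hpp : 1 / p = 1 / p1 + 1 / p2) : ∃ c : ℝ≥0, ∃ a : ℝ, 0 < a ∧ ∀ f g, Nice f → Nice g →
    ∫⁻ x, ‖f x‖ₑ ^ p1 ≤ 1 → ∫⁻ x, ‖g x‖ₑ ^ p2 ≤ 1 → ∀ (K : ℕ) l l',
    ∫⁻ x, W2 (fun i => GG ψ f l i x) (fun i => GG ψ g l' i x) r K ^ (p / r) ≤ c * (ga l * ga l') ^ a := by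
  have hp10 : 0 < p1 := by linarith
  have hp20 : 0 < p2 := by linarith
  have hr0 : 0 < r := by linarith
  obtain ⟨c1, a1, ha1, h1⟩ := LPs h hp1
  obtain ⟨c2, a2, ha2, h2⟩ := LPs h hp2
  obtain ⟨c3, h3⟩ := V2Z hr hp hp10 hp20 hpp
  set κ := (r + 1) * (p / r) with hκ
  set a0 := min (a1 / p1 * p) (a2 / p2 * p) with ha0
  have ha0p : 0 < a0 := lt_min (by positivity) (by positivity)
  obtain ⟨c4, h4⟩ := cnt (κ := κ) (η := a0 / 2) (by positivity) (by positivity)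
  refine ⟨c4 * c3 * (c1 + c2), a0 / 2, by positivity, fun f g hf hg hf1 hg1 K l l' => ?_⟩
  set u : ℝ := 2 ^ (-|l|) with hu
  set v : ℝ := 2 ^ (-|l'|) with hv
  have hu0 : 0 < u := by positivity
  have hv0 : 0 < v := by positivity
  set s1 := u ^ (-(a1 / p1)) with hs1
  set s2 := v ^ (-(a2 / p2)) with hs2
  have e1 : ENNReal.ofReal s1 = ga l ^ (-(a1 / p1)) := by
    rw [hs1, ← ENNReal.ofReal_rpow_of_pos hu0]; rfl
  have e2 : ENNReal.ofReal s2 = ga l' ^ (-(a2 / p2)) := by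
    rw [hs2, ← ENNReal.ofReal_rpow_of_pos hv0]; rfl
  have hs10 : 0 ≤ s1 := by positivity
  have hs20 : 0 ≤ s2 := by positivity
  have key := h3 (fun i x => (s1 : ℂ) * GG ψ f l i x) (fun i x => (s2 : ℂ) * GG ψ g l' i x) l l' K
    ((GG_DZ h hf l).const_mul _) ((GG_DZ h hg l').const_mul _)
  have gp : ∀ (l : ℤ) (a b : ℝ), ga l ^ a * ga l ^ b = ga l ^ (a + b) := fun l a b =>
    (ENNReal.rpow_add _ _ (ga_ne_zero l) (ga_ne_top l)).symm
  have k1 : ∫⁻ x, sq2 (fun i => (s1 : ℂ) * GG ψ f l i x) ^ (p1 / 2) ≤ c1 := by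
    simp_rw [sq2_const hs10, ENNReal.mul_rpow_of_nonneg _ _ (by positivity : 0 ≤ p1 / 2)]
    rw [lintegral_const_mul _ ((sq2_meas fun i => (GG_nice h hf l i).meas).pow_const _), e1, ← ENNReal.rpow_mul, ← ENNReal.rpow_mul]
    refine (mul_le_mul' le_rfl ((h1 l f hf).trans (mul_le_mul' le_rfl hf1))).trans (le_of_eq ?_)
    rw [mul_one, mul_comm (c1 : ℝ≥0∞), ← mul_assoc, gp, show -(a1 / p1) * (2 * (p1 / 2)) + a1 = 0 by (have : p1 ≠ 0 := by positivity); field_simp; try ring]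
    simp
  have k2 : ∫⁻ x, sq2 (fun i => (s2 : ℂ) * GG ψ g l' i x) ^ (p2 / 2) ≤ c2 := by
    simp_rw [sq2_const hs20, ENNReal.mul_rpow_of_nonneg _ _ (by positivity : 0 ≤ p2 / 2)]
    rw [lintegral_const_mul _ ((sq2_meas fun i => (GG_nice h hg l' i).meas).pow_const _), e2, ← ENNReal.rpow_mul, ← ENNReal.rpow_mul]
    refine (mul_le_mul' le_rfl ((h2 l' g hg).trans (mul_le_mul' le_rfl hg1))).trans (le_of_eq ?_)
    rw [mul_one, mul_comm (c2 : ℝ≥0∞), ← mul_assoc, gp, show -(a2 / p2) * (2 * (p2 / 2)) + a2 = 0 by (have : p2 ≠ 0 := by positivity); field_simp; try ring]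
    simp
  simp_rw [W2_const hs10 hs20 _ _ hr0.le, ENNReal.mul_rpow_of_nonneg _ _ (by positivity : 0 ≤ p / r)] at key
  rw [lintegral_const_mul _ ((W2_meas (fun i => (GG_nice h hf l i).meas) (fun i => (GG_nice h hg l' i).meas) _ _).pow_const _),
    ← ENNReal.rpow_mul, show r * (p / r) = p by field_simp, e1, e2, ENNReal.mul_rpow_of_nonneg _ _ hp.le,
    ← ENNReal.rpow_mul, ← ENNReal.rpow_mul] at key
  set Y := ∫⁻ x, W2 (fun i => GG ψ f l i x) (fun i => GG ψ g l' i x) r K ^ (p / r) with hY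
  set n : ℝ≥0∞ := ((l - l').natAbs : ℝ≥0∞)
  have hge : (ga l * ga l') ^ (-a0) * Y ≤ c3 * (1 + n ^ κ) * (c1 + c2) := by
    refine le_trans (mul_le_mul' ?_ le_rfl) (key.trans (mul_le_mul' le_rfl (add_le_add k1 k2)))
    rw [ENNReal.mul_rpow_of_ne_top (ga_ne_top l) (ga_ne_top l')]
    refine mul_le_mul' (ENNReal.rpow_le_rpow_of_exponent_ge (ga_le_one l) ?_) (ENNReal.rpow_le_rpow_of_exponent_ge (ga_le_one l') ?_)
    · rw [neg_mul]; exact neg_le_neg (min_le_left _ _)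
    · rw [neg_mul]; exact neg_le_neg (min_le_right _ _)
  set w := ga l * ga l' with hw
  have hw0 : w ≠ 0 := mul_ne_zero (ga_ne_zero l) (ga_ne_zero l')
  have hwt : w ≠ ∞ := ENNReal.mul_ne_top (ga_ne_top l) (ga_ne_top l')
  calc Y = w ^ (a0 / 2) * w ^ (a0 / 2) * (w ^ (-a0) * Y) := by
        rw [← ENNReal.rpow_add _ _ hw0 hwt, add_halves, ← mul_assoc, ← ENNReal.rpow_add _ _ hw0 hwt, add_neg_cancel,
          ENNReal.rpow_zero, one_mul]
    _ ≤ w ^ (a0 / 2) * w ^ (a0 / 2) * (c3 * (1 + n ^ κ) * (c1 + c2)) := mul_le_mul' le_rfl hge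
    _ = ((1 + n ^ κ) * w ^ (a0 / 2)) * (c3 * (c1 + c2) * w ^ (a0 / 2)) := by ring
    _ ≤ c4 * (c3 * (c1 + c2) * w ^ (a0 / 2)) := mul_le_mul' (h4 l l') le_rfl
    _ = _ := by push_cast; ring

lemma T2 (h : Bump ψ Θ C) {r p p1 p2 : ℝ} (hr : 1 < r) (hp : 0 < p)
    (hp1 : 1 < p1) (hp2 : 1 < p2) (hpp : 1 / p = 1 / p1 + 1 / p2) : ∃ c : ℝ≥0, ∀ f g, Nice f → Nice g →
    ∫⁻ x, ‖f x‖ₑ ^ p1 ≤ 1 → ∫⁻ x, ‖g x‖ₑ ^ p2 ≤ 1 → ∀ K : ℕ,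
    ∫⁻ x, W2 (fun i => Top (kP ψ i) f x) (fun i => Top (kP ψ i) g x) r K ^ (p / r) ≤ c := by
  obtain ⟨c1, a, ha, h1⟩ := T2p h hr hp hp1 hp2 hpp
  have hr0 : 0 < r := by linarith
  set ρ := p / r with hρ
  have hρ0 : 0 < ρ := by positivity
  set η := a / (2 * (1 + ρ)) with hη
  have hη0 : 0 < η := by positivity
  obtain ⟨c3, h3⟩ := ser2 hr0 hη0
  obtain ⟨c4, h4⟩ := ser2 hρ0 hη0
  have hs := ga_tsum (a := a / 2) (by positivity)
  set S0 := ∑' m, ga m ^ (a / 2) with hS0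
  refine ⟨c3 ^ ρ * c4 * c1 * (S0.toNNReal * S0.toNNReal), fun f g hf hg hf1 hg1 K => ?_⟩
  have hm : ∀ l l', Measurable fun x => W2 (fun i => GG ψ f l i x) (fun i => GG ψ g l' i x) r K ^ ρ := fun l l' =>
    (W2_meas (fun i => (GG_nice h hf l i).meas) (fun i => (GG_nice h hg l' i).meas) _ _).pow_const _
  calc _ ≤ ∫⁻ x, (c3 : ℝ≥0∞) ^ ρ * (c4 * ∑' l, ∑' l', (ga l * ga l') ^ (-(a / 2)) *
        W2 (fun i => GG ψ f l i x) (fun i => GG ψ g l' i x) r K ^ ρ) := by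
        refine lintegral_mono fun x => ?_
        have e1 : W2 (fun i => Top (kP ψ i) f x) (fun i => Top (kP ψ i) g x) r K ≤
            c3 * ∑' l, ∑' l', (ga l * ga l') ^ (-η) * W2 (fun i => GG ψ f l i x) (fun i => GG ψ g l' i x) r K := by
          unfold W2
          calc _ ≤ Var (fun s t => c3 * ∑' l, ∑' l', (ga l * ga l') ^ (-η) *
                ‖I2 (fun i => GG ψ f l i x) (fun i => GG ψ g l' i x) s t‖ₑ ^ r) (-(K : ℤ)) K := by
                refine Var_mono le_rfl le_rfl fun s t _ hst _ => ?_
                exact (ENNReal.rpow_le_rpow (I2_GG_le h hf hg hst x) hr0.le).trans (h3 _)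
            _ ≤ _ := by
                rw [Var_const_mul]
                refine mul_le_mul' le_rfl ((Var_tsum_le _ _ _).trans (ENNReal.tsum_le_tsum fun l => ?_))
                refine (Var_tsum_le _ _ _).trans (ENNReal.tsum_le_tsum fun l' => le_of_eq ?_)
                rw [Var_const_mul]
        refine (ENNReal.rpow_le_rpow e1 hρ0.le).trans ?_
        rw [ENNReal.mul_rpow_of_nonneg _ _ hρ0.le]
        refine mul_le_mul' le_rfl ((h4 _).trans (mul_le_mul' le_rfl (ENNReal.tsum_le_tsum fun l =>
          ENNReal.tsum_le_tsum fun l' => le_of_eq ?_)))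
        rw [ENNReal.mul_rpow_of_nonneg _ _ hρ0.le, ← ENNReal.rpow_mul, ← mul_assoc,
          ← ENNReal.rpow_add _ _ (mul_ne_zero (ga_ne_zero l) (ga_ne_zero l')) (ENNReal.mul_ne_top (ga_ne_top l) (ga_ne_top l'))]
        congr 2
        rw [hη]; field_simp; ring
    _ = (c3 : ℝ≥0∞) ^ ρ * (c4 * ∑' l, ∑' l', (ga l * ga l') ^ (-(a / 2)) *
        ∫⁻ x, W2 (fun i => GG ψ f l i x) (fun i => GG ψ g l' i x) r K ^ ρ) := by
        rw [lintegral_const_mul' _ _ (ENNReal.rpow_ne_top_of_nonneg hρ0.le ENNReal.coe_ne_top),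
          lintegral_const_mul' _ _ ENNReal.coe_ne_top,
          lintegral_tsum fun l => (Measurable.ennreal_tsum fun l' => (hm l l').const_mul _).aemeasurable]
        congr 3; ext l
        rw [lintegral_tsum fun l' => ((hm l l').const_mul _).aemeasurable]
        congr 1; ext l'
        rw [lintegral_const_mul _ (hm l l')]
    _ ≤ (c3 : ℝ≥0∞) ^ ρ * (c4 * ∑' l, ∑' l', (c1 * ga l ^ (a / 2)) * ga l' ^ (a / 2)) := by
        refine mul_le_mul' le_rfl (mul_le_mul' le_rfl (ENNReal.tsum_le_tsum fun l => ENNReal.tsum_le_tsum fun l' => ?_))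
        refine (mul_le_mul' le_rfl (h1 f g hf hg hf1 hg1 K l l')).trans (le_of_eq ?_)
        rw [mul_left_comm, ← ENNReal.rpow_add _ _ (mul_ne_zero (ga_ne_zero l) (ga_ne_zero l')) (ENNReal.mul_ne_top (ga_ne_top l) (ga_ne_top l')),
          show -(a / 2) + a = a / 2 by ring, ENNReal.mul_rpow_of_ne_top (ga_ne_top l) (ga_ne_top l'), mul_assoc]
    _ = _ := by
        simp_rw [ENNReal.tsum_mul_left, ENNReal.tsum_mul_right, ENNReal.tsum_mul_left]
        push_cast
        rw [ENNReal.coe_rpow_of_nonneg _ hρ0.le, ENNReal.coe_toNNReal hs]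
        ring
end
end VP

namespace VP

/-- Iterated sums of `a j, …, a (j+n-1)` over `s < i_1 < ⋯ < i_n ≤ t`. -/
def J (a : ℕ → ℤ → ℂ) : ℕ → ℕ → ℤ → ℤ → ℂ
  | _, 0, _, _ => 1
  | j, n + 1, s, t => ∑ i ∈ Finset.Ioc s t, a j i * J a (j + 1) n i t

lemma J_zero (a j s t) : J a j 0 s t = 1 := rfl
lemma J_succ (a j n s t) : J a j (n + 1) s t = ∑ i ∈ Finset.Ioc s t, a j i * J a (j + 1) n i t := rfl
lemma J_one (a j s t) : J a j 1 s t = I1 (a j) s t := by simp [J_succ, J_zero, I1]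
lemma J_two (a : ℕ → ℤ → ℂ) (j) {s t : ℤ} (h : s ≤ t) : J a j 2 s t = I2 (a j) (a (j + 1)) s t := by
  rw [I2_swap _ _ h, J_succ]; simp_rw [J_one]
lemma J_self (a j n s) : J a j (n + 1) s s = 0 := by simp [J_succ]
lemma J_unit (a j n) (s : ℤ) : J a j (n + 2) s (s + 1) = 0 := by
  rw [J_succ]
  refine Finset.sum_eq_zero fun i hi => ?_
  have : i = s + 1 := by have := Finset.mem_Ioc.1 hi; omega
  rw [this, J_self, mul_zero]

lemma J_chen (a : ℕ → ℤ → ℂ) (n : ℕ) : ∀ (j : ℕ) {s u t : ℤ}, s ≤ u → u ≤ t →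
    J a j n s t = ∑ k ∈ Finset.range (n + 1), J a j k s u * J a (j + k) (n - k) u t := by
  induction n with
  | zero => intro j s u t _ _; simp [J_zero]
  | succ n ih =>
    intro j s u t hsu hut
    rw [Finset.sum_range_succ', J_succ, ← Finset.Ioc_union_Ioc_eq_Ioc hsu hut,
      Finset.sum_union (Finset.disjoint_left.2 fun i h1 h2 => by
        have := Finset.mem_Ioc.1 h1; have := Finset.mem_Ioc.1 h2; omega)]
    congr 1
    · rw [Finset.sum_congr rfl fun i hi => by rw [ih (j + 1) (Finset.mem_Ioc.1 hi).2 hut, Finset.mul_sum], Finset.sum_comm]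
      refine Finset.sum_congr rfl fun k hk => ?_
      rw [J_succ, Finset.sum_mul]
      refine Finset.sum_congr rfl fun i hi => ?_
      rw [show n + 1 - (k + 1) = n - k by omega, show j + (k + 1) = j + 1 + k by omega]; ring
    · simp [J_zero, J_succ]

open scoped Classical in
lemma J_eq (a : ℕ → ℤ → ℂ) (n : ℕ) : ∀ (j : ℕ) (s t : ℤ),
    ∑ v ∈ (Fintype.piFinset fun _ : Fin n => Finset.Ioc s t).filter StrictMono, ∏ m : Fin n, a (j + m) (v m) = J a j n s t := by
  induction n with
  | zero =>
    intro j s t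
    rw [J_zero, Finset.filter_true_of_mem (fun v _ => Subsingleton.strictMono v)]
    simp
  | succ n ih =>
    intro j s t
    rw [J_succ]
    simp_rw [← ih, Finset.mul_sum]
    rw [Finset.sum_sigma']
    refine Finset.sum_bij' (fun v _ => ⟨v 0, Fin.tail v⟩) (fun w _ => Fin.cons w.1 w.2) ?_ ?_ ?_ ?_ ?_
    · intro v hv
      rw [Finset.mem_filter, Fintype.mem_piFinset] at hv
      rw [Finset.mem_sigma, Finset.mem_filter, Fintype.mem_piFinset]
      refine ⟨hv.1 0, fun m => Finset.mem_Ioc.2 ⟨hv.2 (Fin.succ_pos m), (Finset.mem_Ioc.1 (hv.1 m.succ)).2⟩,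
        fun m m' h => hv.2 (Fin.succ_lt_succ_iff.2 h)⟩
    · rintro ⟨i, w⟩ hw
      rw [Finset.mem_sigma, Finset.mem_filter, Fintype.mem_piFinset] at hw
      obtain ⟨h1, h2, h3⟩ := hw
      simp only at h1 h2 h3
      rw [Finset.mem_filter, Fintype.mem_piFinset]
      rw [Finset.mem_Ioc] at h1
      refine ⟨fun m => ?_, fun m m' h => ?_⟩
      · refine Fin.cases ?_ (fun m => ?_) m
        · simpa using h1
        · have := Finset.mem_Ioc.1 (h2 m)
          simp only [Fin.cons_succ, Finset.mem_Ioc]; omega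
      · induction m' using Fin.cases with
        | zero => exact absurd h (by simp)
        | succ m' =>
          induction m using Fin.cases with
          | zero => simpa using (Finset.mem_Ioc.1 (h2 m')).1
          | succ m => simpa using h3 (Fin.succ_lt_succ_iff.1 h)
    · intro v hv; simp
    · rintro ⟨i, w⟩ hw; simp
    · intro v hv
      rw [Fin.prod_univ_succ]
      simp only [Fin.val_zero, add_zero, Fin.val_succ, Fin.tail]
      congr 1
      refine Finset.prod_congr rfl fun m _ => ?_
      rw [show j + ((m : ℕ) + 1) = j + 1 + m by omega]

lemma sewing {θ : ℝ} (hθ : 1 < θ) (F : ℤ → ℤ → ℂ) (ω : ℤ → ℤ → ℝ) {lo hi : ℤ} {B : ℝ} (hB : 0 ≤ B)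
    (h0 : ∀ s t, lo ≤ s → s ≤ t → t ≤ hi → 0 ≤ ω s t)
    (hs : ∀ s u t, lo ≤ s → s ≤ u → u ≤ t → t ≤ hi → ω s u + ω u t ≤ ω s t)
    (F0 : ∀ s, F s s = 0) (F1 : ∀ s, F s (s + 1) = 0)
    (hF : ∀ s u t, lo ≤ s → s ≤ u → u ≤ t → t ≤ hi → ‖F s t - F s u - F u t‖ ≤ B * ω s t ^ θ)
    (n : ℕ) : ∀ s t, lo ≤ s → s ≤ t → t ≤ hi → (t - s).toNat = n →
      ‖F s t‖ ≤ 2 / (1 - 2 ^ (1 - θ)) * B * ω s t ^ θ := by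
  have h2 : (2 : ℝ) ^ (1 - θ) < 1 := Real.rpow_lt_one_of_one_lt_of_neg (by norm_num) (by linarith)
  set D := 2 / (1 - (2 : ℝ) ^ (1 - θ)) with hD
  have hD0 : 0 ≤ D := div_nonneg (by norm_num) (by linarith)
  have hDe : D * 2 ^ (1 - θ) + 2 = D := by
    have : (1 - (2 : ℝ) ^ (1 - θ)) ≠ 0 := by linarith
    rw [hD]; field_simp; ring
  induction n using Nat.strong_induction_on with
  | _ n ih =>
    intro s t hls hst hth hn
    have w0 := h0 s t hls hst hth
    have hR : 0 ≤ D * B * ω s t ^ θ := by positivity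
    rcases hst.eq_or_lt with h | h
    · subst h; rw [F0, norm_zero]; exact hR
    have ex : ∃ m : ℕ, s + 1 + m = t ∨ ω s t / 2 < ω s (s + 1 + m) := ⟨(t - s - 1).toNat, Or.inl (by omega)⟩
    set m := Nat.find ex with hm
    have hmle : s + 1 + m ≤ t := by
      have : m ≤ (t - s - 1).toNat := Nat.find_min' ex (Or.inl (by omega))
      omega
    have hw1 : ω s (s + m) ≤ ω s t / 2 := by
      rcases Nat.eq_zero_or_pos m with h' | h'
      · have := hs s s t hls le_rfl hst hth
        rw [h']; simp only [Nat.cast_zero, add_zero]; linarith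
      · have := Nat.find_min ex (m := m - 1) (by omega)
        push Not at this
        have := this.2
        rwa [show s + 1 + ((m - 1 : ℕ) : ℤ) = s + m by omega] at this
    have hw2 : ω (s + 1 + m) t ≤ ω s t / 2 := by
      rcases Nat.find_spec ex with h' | h'
      · have := hs s t t hls hst le_rfl hth
        rw [← hm] at h'
        rw [h']; linarith
      · have := hs s (s + 1 + m) t hls (by omega) hmle hth
        rw [← hm] at h'
        linarith
    have i1 := ih _ (by omega) s (s + m) hls (by omega) (by omega) rfl
    have i2 := ih _ (by omega) (s + 1 + m) t (by omega) hmle hth rfl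
    have f1 := hF s (s + 1 + m) t hls (by omega) hmle hth
    have f2 := hF s (s + m) (s + 1 + m) hls (by omega) (by omega) (by omega)
    rw [show s + 1 + (m : ℤ) = s + m + 1 by omega] at *
    rw [F1, sub_zero] at f2
    have hmono : ω s (s + m + 1) ≤ ω s t := by
      have := hs s (s + m + 1) t hls (by omega) hmle hth
      have := h0 (s + m + 1) t (by omega) hmle hth
      linarith
    have g1 : ω s (s + m) ^ θ ≤ (ω s t / 2) ^ θ := Real.rpow_le_rpow (h0 _ _ hls (by omega) (by omega)) hw1 (by linarith)
    have g2 : ω (s + m + 1) t ^ θ ≤ (ω s t / 2) ^ θ := Real.rpow_le_rpow (h0 _ _ (by omega) hmle (by omega)) hw2 (by linarith)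
    have g3 : ω s (s + m + 1) ^ θ ≤ ω s t ^ θ := Real.rpow_le_rpow (h0 _ _ hls (by omega) (by omega)) hmono (by linarith)
    have hDB : 0 ≤ D * B := by positivity
    have e : (ω s t / 2) ^ θ * 2 = 2 ^ (1 - θ) * ω s t ^ θ := by
      rw [Real.div_rpow w0 (by norm_num), Real.rpow_sub (by norm_num), Real.rpow_one]; ring
    have tri : ‖F s t‖ ≤ ‖F s t - F s (s + m + 1) - F (s + m + 1) t‖ + ‖F s (s + m + 1) - F s (s + m)‖ + ‖F s (s + m)‖ + ‖F (s + m + 1) t‖ := by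
      have : F s t = (F s t - F s (s + m + 1) - F (s + m + 1) t) + (F s (s + m + 1) - F s (s + m)) + F s (s + m) + F (s + m + 1) t := by ring
      nth_rw 1 [this]
      exact norm_add₄_le
    have j1 := mul_le_mul_of_nonneg_left g1 hDB
    have j2 := mul_le_mul_of_nonneg_left g2 hDB
    have j3 := mul_le_mul_of_nonneg_left g3 hB
    calc ‖F s t‖ ≤ B * ω s t ^ θ + B * ω s t ^ θ + D * B * (ω s t / 2) ^ θ + D * B * (ω s t / 2) ^ θ := by linarith
      _ = (D * 2 ^ (1 - θ) + 2) * B * ω s t ^ θ := by linear_combination (D * B) * e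
      _ = _ := by rw [hDe]

lemma J_bound {q : ℝ} (hq : 2 < q) (hq3 : q < 3) (n : ℕ) : ∃ D : ℝ, 0 ≤ D ∧ ∀ (M : ℕ) (a : ℕ → ℤ → ℂ) (ω : ℤ → ℤ → ℝ) (lo hi : ℤ),
    (∀ s t, lo ≤ s → s ≤ t → t ≤ hi → 0 ≤ ω s t) →
    (∀ s u t, lo ≤ s → s ≤ u → u ≤ t → t ≤ hi → ω s u + ω u t ≤ ω s t) →
    (∀ j s t, j + 1 ≤ M → lo ≤ s → s ≤ t → t ≤ hi → ‖J a j 1 s t‖ ≤ ω s t ^ (1 / q)) →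
    (∀ j s t, j + 2 ≤ M → lo ≤ s → s ≤ t → t ≤ hi → ‖J a j 2 s t‖ ≤ ω s t ^ (2 / q)) →
    ∀ j s t, j + n ≤ M → lo ≤ s → s ≤ t → t ≤ hi → ‖J a j n s t‖ ≤ D * ω s t ^ ((n : ℝ) / q) := by
  induction n using Nat.strong_induction_on with
  | _ n ih =>
    rcases Nat.lt_or_ge n 3 with hn | hn
    · refine ⟨1, zero_le_one, fun M a ω lo hi h0 hs h1 h2 j s t hj a1 a2 a3 => ?_⟩
      interval_cases n
      · simp [J_zero]
      · simpa using h1 j s t hj a1 a2 a3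
      · simpa using h2 j s t hj a1 a2 a3
    · choose! D hD0 hD using ih
      have hθ : 1 < (n : ℝ) / q := by
        rw [one_lt_div (by linarith)]
        have : (3 : ℝ) ≤ n := by exact_mod_cast hn
        linarith
      set B := ∑ k ∈ Finset.Ico 1 n, D k * D (n - k) with hB
      have hB0 : 0 ≤ B := Finset.sum_nonneg fun k hk => by
        have := Finset.mem_Ico.1 hk
        exact mul_nonneg (hD0 k (by omega)) (hD0 (n - k) (by omega))
      have h22 : (2 : ℝ) ^ (1 - (n : ℝ) / q) < 1 := Real.rpow_lt_one_of_one_lt_of_neg (by norm_num) (by linarith)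
      refine ⟨2 / (1 - 2 ^ (1 - (n : ℝ) / q)) * B, mul_nonneg (div_nonneg (by norm_num) (by linarith)) hB0,
        fun M a ω lo hi h0 hs h1 h2 j s t hj a1 a2 a3 => ?_⟩
      obtain ⟨n', rfl⟩ : ∃ n', n = n' + 2 := ⟨n - 2, by omega⟩
      refine sewing hθ (J a j (n' + 2)) ω hB0 h0 hs (fun s => J_self a j (n' + 1) s) (J_unit a j n') ?_ _ s t a1 a2 a3 rfl
      intro s u t b1 b2 b3 b4
      have hch := J_chen a (n' + 2) j b2 b3
      rw [Finset.sum_range_succ, Finset.range_eq_Ico, Finset.sum_eq_sum_Ico_succ_bot (by omega)] at hch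
      rw [Nat.sub_self, J_zero, J_zero, one_mul, mul_one, add_zero, Nat.sub_zero] at hch
      rw [hch]
      rw [show ∀ x y z : ℂ, x + y + z - z - x = y by intros; ring, hB, Finset.sum_mul]
      refine (norm_sum_le _ _).trans (Finset.sum_le_sum fun k hk => ?_)
      have hk' := Finset.mem_Ico.1 hk
      rw [norm_mul]
      have c1 := hD k (by omega) M a ω lo hi h0 hs h1 h2 j s u (by omega) b1 b2 (by omega)
      have c2 := hD (n' + 2 - k) (by omega) M a ω lo hi h0 hs h1 h2 (j + k) u t (by omega) (by omega) b3 b4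
      have w1 := h0 s u b1 b2 (by omega)
      have w2 := h0 u t (by omega) b3 b4
      have w3 := hs s u t b1 b2 b3 b4
      have hq0 : 0 < q := by linarith
      have d1 : ω s u ^ ((k : ℝ) / q) ≤ ω s t ^ ((k : ℝ) / q) := Real.rpow_le_rpow w1 (by linarith) (by positivity)
      have d2 : ω u t ^ (((n' + 2 - k : ℕ) : ℝ) / q) ≤ ω s t ^ (((n' + 2 - k : ℕ) : ℝ) / q) := Real.rpow_le_rpow w2 (by linarith) (by positivity)
      have hDk := hD0 k (by omega)
      have hDk' := hD0 (n' + 2 - k) (by omega)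
      calc _ ≤ (D k * ω s t ^ ((k : ℝ) / q)) * (D (n' + 2 - k) * ω s t ^ (((n' + 2 - k : ℕ) : ℝ) / q)) :=
            mul_le_mul (c1.trans (mul_le_mul_of_nonneg_left d1 hDk)) (c2.trans (mul_le_mul_of_nonneg_left d2 hDk'))
              (norm_nonneg _) (mul_nonneg hDk (Real.rpow_nonneg (by linarith) _))
        _ = D k * D (n' + 2 - k) * (ω s t ^ ((k : ℝ) / q) * ω s t ^ (((n' + 2 - k : ℕ) : ℝ) / q)) := by ring
        _ = _ := by
            rw [← Real.rpow_add_of_nonneg (by linarith) (by positivity) (by positivity), ← add_div]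
            congr 3
            rw [Nat.cast_sub (by omega)]; ring

end VP

namespace VP

/-- The control associated with the first two levels of the path. -/
def Om (a : ℕ → ℤ → ℂ) (q : ℝ) (M : ℕ) (s t : ℤ) : ℝ≥0∞ :=
  ∑ m ∈ Finset.range M, Var (fun s t => ‖I1 (a m) s t‖ₑ ^ q) s t +
  ∑ m ∈ Finset.range (M - 1), Var (fun s t => ‖I2 (a m) (a (m + 1)) s t‖ₑ ^ (q / 2)) s t

lemma Om_superadd (a q M) {s u t : ℤ} (h1 : s ≤ u) (h2 : u ≤ t) : Om a q M s u + Om a q M u t ≤ Om a q M s t := by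
  unfold Om
  rw [add_add_add_comm, ← Finset.sum_add_distrib, ← Finset.sum_add_distrib]
  exact add_le_add (Finset.sum_le_sum fun m _ => Var_superadd _ h1 h2) (Finset.sum_le_sum fun m _ => Var_superadd _ h1 h2)

lemma Om_mono (a q M) {s t s' t' : ℤ} (h1 : s' ≤ s) (h2 : t ≤ t') : Om a q M s t ≤ Om a q M s' t' := by
  unfold Om
  exact add_le_add (Finset.sum_le_sum fun m _ => Var_mono h1 h2 fun _ _ _ _ _ => le_rfl)
    (Finset.sum_le_sum fun m _ => Var_mono h1 h2 fun _ _ _ _ _ => le_rfl)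

lemma Var_Om_le (a q M) {s t : ℤ} : Var (Om a q M) s t ≤ Om a q M s t := by
  refine Var_le fun n N hN h1 h2 => ?_
  refine le_trans ?_ (Om_mono a q M h1 h2)
  clear h2
  induction n with
  | zero => simp
  | succ n ih =>
    rw [Finset.sum_range_succ]
    exact (add_le_add ih le_rfl).trans (Om_superadd a q M (hN (Nat.zero_le _)) (hN (Nat.le_succ _)))

lemma I1_le_Om (a : ℕ → ℤ → ℂ) (q : ℝ) {M m : ℕ} (hm : m < M) {s t : ℤ} (h : s ≤ t) : ‖I1 (a m) s t‖ₑ ^ q ≤ Om a q M s t :=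
  (single_le_Var (fun s t => ‖I1 (a m) s t‖ₑ ^ q) le_rfl h le_rfl).trans
    ((Finset.single_le_sum (f := fun m => Var (fun s t => ‖I1 (a m) s t‖ₑ ^ q) s t) (fun _ _ => zero_le) (Finset.mem_range.2 hm)).trans
      le_self_add)

lemma I2_le_Om (a : ℕ → ℤ → ℂ) (q : ℝ) {M m : ℕ} (hm : m + 1 < M) {s t : ℤ} (h : s ≤ t) :
    ‖I2 (a m) (a (m + 1)) s t‖ₑ ^ (q / 2) ≤ Om a q M s t :=
  (single_le_Var (fun s t => ‖I2 (a m) (a (m + 1)) s t‖ₑ ^ (q / 2)) le_rfl h le_rfl).trans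
    ((Finset.single_le_sum (f := fun m => Var (fun s t => ‖I2 (a m) (a (m + 1)) s t‖ₑ ^ (q / 2)) s t) (fun _ _ => zero_le)
      (Finset.mem_range.2 (by omega : m < M - 1))).trans le_add_self)

lemma norm_le_of_enorm_rpow {z : ℂ} {e : ℝ} (he : 0 < e) {w : ℝ≥0∞} (hw : w ≠ ∞) (h : ‖z‖ₑ ^ e ≤ w) : ‖z‖ ≤ w.toReal ^ (1 / e) := by
  have h1 : ‖z‖ₑ ≤ w ^ (1 / e) := by rw [one_div, ENNReal.le_rpow_inv_iff he]; exact h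
  have := ENNReal.toReal_mono (ENNReal.rpow_ne_top_of_nonneg (by positivity) hw) h1
  rwa [toReal_enorm, ← ENNReal.toReal_rpow] at this

lemma path {q : ℝ} (hq : 2 < q) (hq3 : q < 3) {M : ℕ} (hM : 1 ≤ M) : ∃ D : ℝ≥0, ∀ (a : ℕ → ℤ → ℂ) (lo hi : ℤ),
    Om a q M lo hi ≠ ∞ → Var (fun s t => ‖J a 0 M s t‖ₑ ^ (q / M)) lo hi ≤ D * Om a q M lo hi := by
  obtain ⟨D, hD0, hD⟩ := J_bound hq hq3 M
  have hq0 : 0 < q := by linarith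
  have hM0 : (0 : ℝ) < M := by exact_mod_cast hM
  refine ⟨D.toNNReal ^ (q / M), fun a lo hi hfin => ?_⟩
  have hf : ∀ {s t}, lo ≤ s → t ≤ hi → Om a q M s t ≠ ∞ := fun h1 h2 => ne_top_of_le_ne_top hfin (Om_mono a q M h1 h2)
  refine le_trans ?_ (mul_le_mul' le_rfl (Var_Om_le a q M))
  rw [← Var_const_mul]
  refine Var_mono le_rfl le_rfl fun s t h1 h2 h3 => ?_
  have := hD M a (fun s t => (Om a q M s t).toReal) lo hi (fun _ _ _ _ _ => ENNReal.toReal_nonneg)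
    (fun s u t k1 k2 k3 k4 => by
      rw [← ENNReal.toReal_add (hf k1 (by omega)) (hf (by omega) k4)]
      exact ENNReal.toReal_mono (hf k1 k4) (Om_superadd a q M k2 k3))
    (fun j s t hj k1 k2 k3 => by
      rw [J_one]
      exact norm_le_of_enorm_rpow hq0 (hf k1 k3) (I1_le_Om a q (by omega) k2))
    (fun j s t hj k1 k2 k3 => by
      rw [J_two _ _ k2, show 2 / q = 1 / (q / 2) by field_simp]
      exact norm_le_of_enorm_rpow (by positivity) (hf k1 k3) (I2_le_Om a q (by omega) k2))
    0 s t (by omega) h1 h2 h3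
  have h4 := ofReal_of_norm_le this
  refine (ENNReal.rpow_le_rpow h4 (by positivity)).trans (le_of_eq ?_)
  rw [ENNReal.ofReal_mul hD0, ENNReal.mul_rpow_of_nonneg _ _ (by positivity), ← ENNReal.ofReal_rpow_of_nonneg ENNReal.toReal_nonneg (by positivity),
    ENNReal.ofReal_toReal (hf h1 h3), ← ENNReal.rpow_mul, show (M : ℝ) / q * (q / M) = 1 by field_simp, ENNReal.rpow_one,
    ENNReal.coe_rpow_of_nonneg _ (by positivity)]
  rfl

lemma J_const (c : ℕ → ℂ) (a : ℕ → ℤ → ℂ) (n : ℕ) : ∀ (j : ℕ) (s t : ℤ),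
    J (fun m i => c m * a m i) j n s t = (∏ k ∈ Finset.range n, c (j + k)) * J a j n s t := by
  induction n with
  | zero => intro j s t; simp [J_zero]
  | succ n ih =>
    intro j s t
    rw [J_succ, J_succ, Finset.prod_range_succ', Finset.mul_sum]
    refine Finset.sum_congr rfl fun i _ => ?_
    rw [ih, add_zero, show ∏ k ∈ Finset.range n, c (j + (k + 1)) = ∏ k ∈ Finset.range n, c (j + 1 + k) from
      Finset.prod_congr rfl fun k _ => by rw [show j + (k + 1) = j + 1 + k by omega]]
    ring

lemma W1_const {c : ℝ} (hc : 0 ≤ c) (a : ℤ → ℂ) {r : ℝ} (hr : 0 ≤ r) (K) :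
    W1 (fun i => (c : ℂ) * a i) r K = ENNReal.ofReal c ^ r * W1 a r K := by
  unfold W1; rw [← Var_const_mul]
  congr 1; funext s t
  rw [I1, ← Finset.mul_sum, enorm_mul, enorm_ofReal' hc, ENNReal.mul_rpow_of_nonneg _ _ hr]; rfl

lemma resc {w : ℝ≥0∞} {z e r : ℝ} (hz : 0 < z) (hr : 0 < r) (he : 0 < e) (h : w ^ (e / r) ≤ ENNReal.ofReal z) :
    ENNReal.ofReal (z ^ (-(1 / e))) ^ r * w ≤ 1 := by
  have hw : w ≤ ENNReal.ofReal z ^ (r / e) := by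
    rw [show r / e = (e / r)⁻¹ by rw [inv_div], ENNReal.le_rpow_inv_iff (by positivity)]; exact h
  have hz0 : ENNReal.ofReal z ≠ 0 := by simpa using hz
  refine (mul_le_mul' le_rfl hw).trans (le_of_eq ?_)
  rw [← ENNReal.ofReal_rpow_of_pos hz, ← ENNReal.rpow_mul, ← ENNReal.rpow_add _ _ hz0 ENNReal.ofReal_ne_top,
    show -(1 / e) * r + r / e = 0 by ring, ENNReal.rpow_zero]

lemma pathZ {q : ℝ} (hq : 2 < q) (hq3 : q < 3) {M : ℕ} (hM : 1 ≤ M) (pm pp : ℕ → ℝ) (hpm : ∀ m, 0 < pm m)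
    (hpp0 : ∀ m, 0 < pp m)
    (hpp : ∀ m, 1 / pp m = 1 / pm m + 1 / pm (m + 1)) {p : ℝ} (hp : 0 < p) (hps : 1 / p = ∑ m ∈ Finset.range M, 1 / pm m) :
    ∃ D : ℝ≥0, ∀ (a : ℕ → ℤ → ℂ) (K : ℕ) (z : ℝ), 0 < z →
      (∀ m < M, W1 (a m) q K ^ (pm m / q) ≤ ENNReal.ofReal z) →
      (∀ m < M - 1, W2 (a m) (a (m + 1)) (q / 2) K ^ (pp m / (q / 2)) ≤ ENNReal.ofReal z) →
      Var (fun s t => ‖J a 0 M s t‖ₑ ^ (q / M)) (-(K : ℤ)) K ^ (p * M / q) ≤ D * ENNReal.ofReal z := by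
  obtain ⟨D, hD⟩ := path hq hq3 hM
  have hq0 : 0 < q := by linarith
  have hM0 : (0 : ℝ) < M := by exact_mod_cast hM
  refine ⟨(D * (M + M)) ^ (p * M / q), fun a K z hz h1 h2 => ?_⟩
  have hz0 : ENNReal.ofReal z ≠ 0 := by simpa using hz
  set c : ℕ → ℝ := fun m => z ^ (-(1 / pm m)) with hc
  have hc0 : ∀ m, 0 ≤ c m := fun m => by simp only [hc]; positivity
  set a' : ℕ → ℤ → ℂ := fun m i => (c m : ℂ) * a m i with ha'
  have hOm : Om a' q M (-(K : ℤ)) K ≤ M + M := by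
    unfold Om
    refine add_le_add ?_ ?_
    · refine (Finset.sum_le_card_nsmul _ _ 1 fun m hm => ?_).trans (by simp)
      have := W1_const (hc0 m) (a m) hq0.le K
      unfold W1 at this
      rw [this]
      exact resc hz hq0 (hpm m) (h1 m (Finset.mem_range.1 hm))
    · refine (Finset.sum_le_card_nsmul _ _ 1 fun m hm => ?_).trans (by simp)
      have := W2_const (hc0 m) (hc0 (m + 1)) (a m) (a (m + 1)) (by positivity : 0 ≤ q / 2) K
      unfold W2 at this
      rw [this, ← ENNReal.ofReal_mul (hc0 m), show c m * c (m + 1) = z ^ (-(1 / pp m)) by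
        simp only [hc]; rw [← Real.rpow_add hz, hpp m]; ring_nf]
      exact resc hz (by positivity) (hpp0 m) (h2 m (Finset.mem_range.1 hm))
  have hV := hD a' (-(K : ℤ)) K (ne_top_of_le_ne_top (by simp) hOm)
  have hprod : ∏ k ∈ Finset.range M, ((c (0 + k) : ℝ) : ℂ) = ((z ^ (-(1 / p)) : ℝ) : ℂ) := by
    rw [← Complex.ofReal_prod]
    congr 1
    simp only [hc, zero_add]
    rw [hps, ← Finset.sum_neg_distrib, Real.rpow_sum_of_pos hz]
  have hzp : 0 ≤ z ^ (-(1 / p)) := by positivity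
  have e : Var (fun s t => ‖J a' 0 M s t‖ₑ ^ (q / M)) (-(K : ℤ)) K =
      ENNReal.ofReal z ^ (-(q / (p * M))) * Var (fun s t => ‖J a 0 M s t‖ₑ ^ (q / M)) (-(K : ℤ)) K := by
    rw [← Var_const_mul]
    congr 1; funext s t
    rw [ha', J_const (fun m => (c m : ℂ)), hprod, enorm_mul, enorm_ofReal' hzp, ENNReal.mul_rpow_of_nonneg _ _ (by positivity),
      ← ENNReal.ofReal_rpow_of_pos hz, ← ENNReal.rpow_mul]
    congr 2; field_simp
  rw [e] at hV
  set V := Var (fun s t => ‖J a 0 M s t‖ₑ ^ (q / M)) (-(K : ℤ)) K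
  have hV2 : V ≤ ENNReal.ofReal z ^ (q / (p * M)) * (D * (M + M)) := by
    calc V = ENNReal.ofReal z ^ (q / (p * M)) * (ENNReal.ofReal z ^ (-(q / (p * M))) * V) := by
          rw [← mul_assoc, ← ENNReal.rpow_add _ _ hz0 ENNReal.ofReal_ne_top, add_neg_cancel, ENNReal.rpow_zero, one_mul]
      _ ≤ _ := mul_le_mul' le_rfl (hV.trans (mul_le_mul' le_rfl hOm))
  refine (ENNReal.rpow_le_rpow hV2 (by positivity)).trans (le_of_eq ?_)
  rw [ENNReal.mul_rpow_of_nonneg _ _ (by positivity), ← ENNReal.rpow_mul, show q / (p * M) * (p * M / q) = 1 by field_simp, ENNReal.rpow_one,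
    mul_comm, ENNReal.coe_rpow_of_nonneg _ (by positivity)]
  push_cast; rfl

end VP

namespace VP
variable {ψ Θ : ℝ → ℂ} {C : ℝ}

def PA (ψ : ℝ → ℂ) (f : ℕ → ℝ → ℂ) (x : ℝ) (m : ℕ) (i : ℤ) : ℂ := Top (kP ψ i) (f m) x
def VJ (a : ℕ → ℤ → ℂ) (r : ℝ) (M K : ℕ) : ℝ≥0∞ := Var (fun s t => ‖J a 0 M s t‖ₑ ^ r) (-(K : ℤ)) K

lemma J_meas {A : ℝ → ℕ → ℤ → ℂ} (h : ∀ m i, Measurable fun x => A x m i) (n : ℕ) : ∀ (j : ℕ) (s t : ℤ),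
    Measurable fun x => J (A x) j n s t := by
  induction n with
  | zero => intro j s t; simp only [J_zero]; exact measurable_const
  | succ n ih =>
    intro j s t
    simp only [J_succ]
    exact Finset.measurable_sum _ fun i _ => (h j i).mul (ih _ _ _)

lemma VJ_meas {A : ℝ → ℕ → ℤ → ℂ} (h : ∀ m i, Measurable fun x => A x m i) (r M K) :
    Measurable fun x => VJ (A x) r M K :=
  Var_measurable (fun s t x => ‖J (A x) 0 M s t‖ₑ ^ r) (fun s t => (J_meas h M 0 s t).enorm.pow_const _) _ _

lemma PA_meas (h : Bump ψ Θ C) {f : ℕ → ℝ → ℂ} (hf : ∀ m, Measurable (f m)) (m i) : Measurable fun x => PA ψ f x m i :=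
  Top_meas (kP_SK h i) (hf m)

lemma eps_le {V Z : ℝ≥0∞} {D : ℝ≥0} (h : ∀ z : ℝ, 0 < z → Z ≤ ENNReal.ofReal z → V ≤ D * ENNReal.ofReal z) : V ≤ (D + 1) * Z := by
  by_cases hZ : Z = ∞
  · rw [hZ, ENNReal.mul_top (by simp)]; exact le_top
  have hd0 : (D : ℝ≥0∞) + 1 ≠ 0 := by simp
  have hdt : (D : ℝ≥0∞) + 1 ≠ ∞ := by simp
  rw [mul_comm, ← ENNReal.div_le_iff_le_mul (Or.inl hd0) (Or.inl hdt)]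
  refine ENNReal.le_of_forall_pos_le_add fun ε hε _ => ?_
  rw [ENNReal.div_le_iff_le_mul (Or.inl hd0) (Or.inl hdt), mul_comm]
  have e : ENNReal.ofReal (Z.toReal + ε) = Z + ε := by
    rw [ENNReal.ofReal_add ENNReal.toReal_nonneg (NNReal.coe_nonneg ε), ENNReal.ofReal_toReal hZ, ENNReal.ofReal_coe_nnreal]
  have hz : 0 < Z.toReal + ε := add_pos_of_nonneg_of_pos ENNReal.toReal_nonneg (by exact_mod_cast hε)
  have := h _ hz (by rw [e]; exact le_self_add)
  rw [e] at this
  exact this.trans (mul_le_mul' le_self_add le_rfl)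

section main
variable {q p : ℝ} {M : ℕ} {pm : ℕ → ℝ}

lemma niceV (h : Bump ψ Θ C) (hq : 2 < q) (hq3 : q < 3) (hM : 1 ≤ M) (hpm : ∀ m, 1 < pm m)
    (hp : 0 < p) (hps : 1 / p = ∑ m ∈ Finset.range M, 1 / pm m) : ∃ D : ℝ≥0, ∀ f : ℕ → ℝ → ℂ, (∀ m, Nice (f m)) →
      (∀ m, ∫⁻ x, ‖f m x‖ₑ ^ pm m ≤ 1) → ∀ K, ∫⁻ x, VJ (PA ψ f x) (q / M) M K ^ (p * M / q) ≤ D := by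
  have hpm0 : ∀ m, 0 < pm m := fun m => by linarith [hpm m]
  set pp : ℕ → ℝ := fun m => (1 / pm m + 1 / pm (m + 1))⁻¹ with hpp
  have hpp0 : ∀ m, 0 < pp m := fun m => by
    have := hpm0 m; have := hpm0 (m + 1); simp only [hpp]; positivity
  have hppe : ∀ m, 1 / pp m = 1 / pm m + 1 / pm (m + 1) := fun m => by simp [hpp]
  obtain ⟨D, hD⟩ := pathZ hq hq3 hM pm pp hpm0 hpp0 hppe hp hps
  choose c1 h1 using fun m => T1 h (hpm m) hq
  choose c2 h2 using fun m => T2 h (by linarith : 1 < q / 2) (hpp0 m) (hpm m) (hpm (m + 1)) (hppe m)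
  refine ⟨(D + 1) * (∑ m ∈ Finset.range M, c1 m + ∑ m ∈ Finset.range (M - 1), c2 m), fun f hf hf1 K => ?_⟩
  have hA := PA_meas h fun m => (hf m).meas
  have m1 : ∀ m, Measurable fun x => W1 (PA ψ f x m) q K ^ (pm m / q) := fun m =>
    (W1_meas (G := fun i x => PA ψ f x m i) (fun i => hA m i) q K).pow_const _
  have m2 : ∀ m, Measurable fun x => W2 (PA ψ f x m) (PA ψ f x (m + 1)) (q / 2) K ^ (pp m / (q / 2)) := fun m =>
    (W2_meas (G := fun i x => PA ψ f x m i) (H := fun i x => PA ψ f x (m + 1) i) (fun i => hA m i) (fun i => hA (m + 1) i) (q / 2) K).pow_const _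
  have hpt : ∀ x, VJ (PA ψ f x) (q / M) M K ^ (p * M / q) ≤ (D + 1) * (∑ m ∈ Finset.range M, W1 (PA ψ f x m) q K ^ (pm m / q) +
      ∑ m ∈ Finset.range (M - 1), W2 (PA ψ f x m) (PA ψ f x (m + 1)) (q / 2) K ^ (pp m / (q / 2))) := fun x => by
    refine eps_le fun z hz hZ => hD (PA ψ f x) K z hz (fun m hm => ?_) (fun m hm => ?_)
    · exact ((Finset.single_le_sum (f := fun m => W1 (PA ψ f x m) q K ^ (pm m / q)) (fun _ _ => zero_le)
        (Finset.mem_range.2 hm)).trans le_self_add).trans hZ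
    · exact ((Finset.single_le_sum (f := fun m => W2 (PA ψ f x m) (PA ψ f x (m + 1)) (q / 2) K ^ (pp m / (q / 2))) (fun _ _ => zero_le)
        (Finset.mem_range.2 hm)).trans le_add_self).trans hZ
  refine (lintegral_mono hpt).trans ?_
  rw [lintegral_const_mul' _ _ (by simp), lintegral_add_left (Finset.measurable_sum _ fun m _ => m1 m),
    lintegral_finsetSum _ fun m _ => m1 m, lintegral_finsetSum _ fun m _ => m2 m]
  push_cast
  refine mul_le_mul' le_rfl (add_le_add (Finset.sum_le_sum fun m _ => ?_) (Finset.sum_le_sum fun m _ => ?_))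
  · exact (h1 m (f m) (hf m) K).trans ((mul_le_mul' le_rfl (hf1 m)).trans (by rw [mul_one]))
  · exact h2 m (f m) (f (m + 1)) (hf m) (hf (m + 1)) (hf1 m) (hf1 (m + 1)) K

lemma J_tendsto {A : ℕ → ℕ → ℤ → ℂ} {a : ℕ → ℤ → ℂ} (h : ∀ m i, Filter.Tendsto (fun n => A n m i) Filter.atTop (nhds (a m i))) (N : ℕ) :
    ∀ (j : ℕ) (s t : ℤ), Filter.Tendsto (fun n => J (A n) j N s t) Filter.atTop (nhds (J a j N s t)) := by
  induction N with
  | zero => intro j s t; simp only [J_zero]; exact tendsto_const_nhds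
  | succ n ih =>
    intro j s t
    simp only [J_succ]
    exact tendsto_finset_sum _ fun i _ => (h j i).mul (ih _ _ _)

lemma VJ_liminf {A : ℕ → ℕ → ℤ → ℂ} {a : ℕ → ℤ → ℂ} (h : ∀ m i, Filter.Tendsto (fun n => A n m i) Filter.atTop (nhds (a m i)))
    {r e : ℝ} (hr : 0 < r) (he : 0 < e) (M K) :
    VJ a r M K ^ e ≤ Filter.liminf (fun n => VJ (A n) r M K ^ e) Filter.atTop := by
  rw [← ENNReal.le_rpow_inv_iff he]
  refine Var_le fun n N hN h1 h2 => ?_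
  rw [ENNReal.le_rpow_inv_iff he]
  have ht : Filter.Tendsto (fun l => (∑ k ∈ Finset.range n, ‖J (A l) 0 M (N k) (N (k + 1))‖ₑ ^ r) ^ e) Filter.atTop
      (nhds ((∑ k ∈ Finset.range n, ‖J a 0 M (N k) (N (k + 1))‖ₑ ^ r) ^ e)) :=
    (tendsto_finset_sum _ fun k _ => (J_tendsto h M 0 _ _).enorm.ennrpow_const r).ennrpow_const e
  rw [← ht.liminf_eq]
  exact Filter.liminf_le_liminf (Filter.Eventually.of_forall fun l =>
    ENNReal.rpow_le_rpow (le_Var (fun s t => ‖J (A l) 0 M s t‖ₑ ^ r) n N hN h1 h2) he.le)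

/-- Truncation. -/
def trn (f : ℝ → ℂ) (n : ℕ) : ℝ → ℂ := Set.indicator ({x | ‖f x‖ ≤ n} ∩ Set.Icc (-(n : ℝ)) n) f

lemma trn_nice {f : ℝ → ℂ} (hf : Measurable f) (n : ℕ) : Nice (trn f n) := by
  have hS : MeasurableSet ({x | ‖f x‖ ≤ n} ∩ Set.Icc (-(n : ℝ)) n) :=
    (measurableSet_le hf.norm measurable_const).inter measurableSet_Icc
  have hb : ∀ x, ‖trn f n x‖ₑ ≤ (Set.Icc (-(n : ℝ)) n).indicator (fun _ => (n : ℝ≥0∞)) x := fun x => by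
    unfold trn
    by_cases hx : x ∈ {x | ‖f x‖ ≤ n} ∩ Set.Icc (-(n : ℝ)) n
    · rw [Set.indicator_of_mem hx, Set.indicator_of_mem hx.2]
      have := ofReal_of_norm_le (z := f x) (a := (n : ℝ)) hx.1
      simpa using this
    · rw [Set.indicator_of_notMem hx]; simp
  refine ⟨hf.indicator hS, ⟨n, fun x => (hb x).trans ?_⟩, ?_⟩
  · by_cases hx : x ∈ Set.Icc (-(n : ℝ)) n
    · rw [Set.indicator_of_mem hx]; simp
    · rw [Set.indicator_of_notMem hx]; simp
  · refine ne_top_of_le_ne_top ?_ (lintegral_mono hb)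
    rw [lintegral_indicator measurableSet_Icc, lintegral_const]
    refine ENNReal.mul_ne_top (by simp) (by simp)

lemma trn_le (f : ℝ → ℂ) (n : ℕ) (x) : ‖trn f n x‖ ≤ ‖f x‖ := norm_indicator_le_norm_self f x

lemma trn_tendsto (f : ℝ → ℂ) (x) : Filter.Tendsto (fun n => trn f n x) Filter.atTop (nhds (f x)) := by
  refine tendsto_const_nhds.congr' ?_
  filter_upwards [Filter.eventually_ge_atTop (⌈max ‖f x‖ |x|⌉₊)] with n hn
  have h1 : max ‖f x‖ |x| ≤ n := (Nat.le_ceil _).trans (by exact_mod_cast hn)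
  have h2 := abs_le.1 ((le_max_right _ _).trans h1)
  have h3 : x ∈ {x | ‖f x‖ ≤ n} ∩ Set.Icc (-(n : ℝ)) n := ⟨(le_max_left _ _).trans h1, h2⟩
  exact (Set.indicator_of_mem h3 f).symm

lemma kf_int (h : Bump ψ Θ C) {p : ℝ} (hp : 1 < p) {f : ℝ → ℂ} (hf : Measurable f) (hf1 : ∫⁻ x, ‖f x‖ₑ ^ p ≤ 1) (i x) :
    Integrable fun y => kP ψ i x y * f y := by
  obtain ⟨b, hb⟩ := kP_bdd h i x
  refine ⟨(((kP_SK h i).meas_row x).mul hf).aestronglyMeasurable, ?_⟩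
  rw [hasFiniteIntegral_iff_enorm]
  have hle : ∀ y, ‖kP ψ i x y * f y‖ₑ ≤ ‖kP ψ i x y‖ₑ + b * ‖f y‖ₑ ^ p := fun y => by
    rw [enorm_mul]
    rcases le_total ‖f y‖ₑ 1 with h1 | h1
    · exact (mul_le_mul' le_rfl h1).trans (by rw [mul_one]; exact le_self_add)
    · refine (mul_le_mul' (hb y) ?_).trans le_add_self
      nth_rw 1 [← ENNReal.rpow_one ‖f y‖ₑ]
      exact ENNReal.rpow_le_rpow_of_exponent_le h1 hp.le
  refine (lintegral_mono hle).trans_lt ?_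
  rw [lintegral_add_left ((kP_SK h i).meas_row x).enorm, lintegral_const_mul' _ _ ENNReal.coe_ne_top]
  exact ENNReal.add_lt_top.2 ⟨((kP_SK h i).int_row x).2, ENNReal.mul_lt_top ENNReal.coe_lt_top (hf1.trans_lt (by simp))⟩

lemma genV (h : Bump ψ Θ C) (hq : 2 < q) (hq3 : q < 3) (hM : 1 ≤ M) (hpm : ∀ m, 1 < pm m)
    (hp : 0 < p) (hps : 1 / p = ∑ m ∈ Finset.range M, 1 / pm m) : ∃ D : ℝ≥0, ∀ f : ℕ → ℝ → ℂ, (∀ m, Measurable (f m)) →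
      (∀ m, ∫⁻ x, ‖f m x‖ₑ ^ pm m ≤ 1) → ∀ K, ∫⁻ x, VJ (PA ψ f x) (q / M) M K ^ (p * M / q) ≤ D := by
  obtain ⟨D, hD⟩ := niceV h hq hq3 hM hpm hp hps
  have hq0 : 0 < q := by linarith
  have hM0 : (0 : ℝ) < M := by exact_mod_cast hM
  refine ⟨D, fun f hf hf1 K => ?_⟩
  have hlim : ∀ x m i, Filter.Tendsto (fun n => PA ψ (fun m => trn (f m) n) x m i) Filter.atTop (nhds (PA ψ f x m i)) := fun x m i => by
    unfold PA Top
    refine tendsto_integral_of_dominated_convergence (fun y => ‖kP ψ i x y * f m y‖)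
      (fun n => (((kP_SK h i).meas_row x).mul (trn_nice (hf m) n).meas).aestronglyMeasurable) (kf_int h (hpm m) (hf m) (hf1 m) i x).norm
      (fun n => Filter.Eventually.of_forall fun y => ?_) (Filter.Eventually.of_forall fun y => (trn_tendsto (f m) y).const_mul _)
    rw [norm_mul, norm_mul]
    exact mul_le_mul_of_nonneg_left (trn_le _ _ _) (norm_nonneg _)
  refine (lintegral_mono fun x => VJ_liminf (hlim x) (by positivity : 0 < q / M) (by positivity : 0 < p * M / q) M K).trans ?_
  refine (lintegral_liminf_le fun n => (VJ_meas (PA_meas h fun m => (trn_nice (hf m) n).meas) _ _ _).pow_const _).trans ?_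
  refine Filter.liminf_le_of_le (by isBoundedDefault) fun b hb => ?_
  obtain ⟨n, hn⟩ := hb.exists
  refine hn.trans (hD _ (fun m => trn_nice (hf m) n) (fun m => (lintegral_mono fun x => ?_).trans (hf1 m)) K)
  refine ENNReal.rpow_le_rpow ?_ (by linarith [hpm m])
  rw [← ofReal_norm, ← ofReal_norm]
  exact ENNReal.ofReal_le_ofReal (trn_le _ _ _)

/-- The full variational expression. -/
def SV (a : ℕ → ℤ → ℂ) (r : ℝ) (M : ℕ) : ℝ≥0∞ :=
  ⨆ (Nk : ℕ → ℤ) (_ : Monotone Nk), (∑' k : ℕ, ‖J a 0 M (Nk k) (Nk (k + 1))‖ₑ ^ r) ^ (1 / r)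

lemma lr_mono (c : ℕ → ℝ≥0∞) {r r' : ℝ} (hr : 0 < r') (hrr : r' ≤ r) : (∑' n, c n ^ r) ^ (1 / r) ≤ (∑' n, c n ^ r') ^ (1 / r') := by
  have hr0 : 0 < r := by linarith
  have hs : (1 : ℝ) ≤ r / r' := by rwa [one_le_div hr]
  have key : ∑' n, (c n ^ r') ^ (r / r') ≤ (∑' n, c n ^ r') ^ (r / r') := by
    rw [pow_split _ hs, ← ENNReal.tsum_mul_left]
    refine ENNReal.tsum_le_tsum fun n => ?_
    rw [pow_split _ hs]
    gcongr
    exact ENNReal.le_tsum n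
  simp_rw [← ENNReal.rpow_mul, show r' * (r / r') = r by field_simp] at key
  refine (ENNReal.rpow_le_rpow key (by positivity)).trans (le_of_eq ?_)
  rw [← ENNReal.rpow_mul]
  congr 1; field_simp

lemma SV_le (a : ℕ → ℤ → ℂ) {r r' : ℝ} (hr : 0 < r') (hrr : r' ≤ r) (M) : SV a r M ≤ (⨆ K, VJ a r' M K) ^ (1 / r') := by
  refine iSup_le fun N => iSup_le fun hN => (lr_mono _ hr hrr).trans (ENNReal.rpow_le_rpow ?_ (by positivity))
  rw [ENNReal.tsum_eq_iSup_nat]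
  refine iSup_le fun n => ?_
  refine le_trans ?_ (le_iSup _ (max (N 0).natAbs (N n).natAbs))
  exact le_Var (fun s t => ‖J a 0 M s t‖ₑ ^ r') n N hN (by omega) (by omega)

lemma VJ_mono (a r M) : Monotone fun K => VJ a r M K := fun K K' h =>
  Var_mono (by omega) (by omega) fun _ _ _ _ _ => le_rfl

lemma genS (h : Bump ψ Θ C) {r : ℝ} (hr : 2 / (M : ℝ) < r) (hM : 1 ≤ M) (hpm : ∀ m, 1 < pm m)
    (hp : 0 < p) (hps : 1 / p = ∑ m ∈ Finset.range M, 1 / pm m) : ∃ D : ℝ≥0, ∀ f : ℕ → ℝ → ℂ, (∀ m, Measurable (f m)) →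
      (∀ m, ∫⁻ x, ‖f m x‖ₑ ^ pm m ≤ 1) → ∫⁻ x, SV (PA ψ f x) r M ^ p ≤ D := by
  have hM0 : (0 : ℝ) < M := by exact_mod_cast hM
  set q : ℝ := min (r * M) (5 / 2) with hqd
  have hq : 2 < q := lt_min (by rwa [div_lt_iff₀ hM0] at hr) (by norm_num)
  have hq3 : q < 3 := (min_le_right _ _).trans_lt (by norm_num)
  have hq0 : 0 < q := by linarith
  have hqr : q / M ≤ r := by rw [div_le_iff₀ hM0]; exact min_le_left _ _
  obtain ⟨D, hD⟩ := genV h hq hq3 hM hpm hp hps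
  refine ⟨D, fun f hf hf1 => ?_⟩
  have he : 0 < p * M / q := by positivity
  calc _ ≤ ∫⁻ x, ⨆ K, VJ (PA ψ f x) (q / M) M K ^ (p * M / q) := by
        refine lintegral_mono fun x => ?_
        refine (ENNReal.rpow_le_rpow (SV_le _ (by positivity : 0 < q / M) hqr M) hp.le).trans ?_
        rw [← ENNReal.rpow_mul, show 1 / (q / M) * p = p * M / q by field_simp]
        exact le_of_eq ((ENNReal.orderIsoRpow _ he).map_iSup _)
    _ = ⨆ K, ∫⁻ x, VJ (PA ψ f x) (q / M) M K ^ (p * M / q) :=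
        lintegral_iSup (fun K => (VJ_meas (PA_meas h hf) _ _ _).pow_const _)
          fun K K' hK x => ENNReal.rpow_le_rpow (VJ_mono _ _ _ hK) he.le
    _ ≤ D := iSup_le fun K => hD f hf hf1 K

end main
end VP

namespace VP
variable {ψ Θ : ℝ → ℂ} {C : ℝ}

lemma norml (ψ : ℝ → ℂ) {p : ℝ} (hp : 1 < p) {f : ℝ → ℂ} (hf : MemLp f (ENNReal.ofReal p)) : ∃ g : ℝ → ℂ, Measurable g ∧
    ∫⁻ x, ‖g x‖ₑ ^ p ≤ 1 ∧ ∀ i x, Top (kP ψ i) f x = ((eLpNorm f (ENNReal.ofReal p) volume).toReal : ℂ) * Top (kP ψ i) g x := by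
  have hp0 : 0 < p := by linarith
  have hP0 : ENNReal.ofReal p ≠ 0 := by simpa using hp0
  set l := eLpNorm f (ENNReal.ofReal p) volume with hl
  have hlt : l ≠ ∞ := hf.2.ne
  by_cases h0 : l = 0
  · refine ⟨fun _ => 0, measurable_const, by simp [hp0], fun i x => ?_⟩
    have hz : f =ᵐ[volume] 0 := (eLpNorm_eq_zero_iff hf.1 hP0).1 h0
    rw [h0]
    simp only [ENNReal.toReal_zero, Complex.ofReal_zero, zero_mul]
    unfold Top
    rw [integral_congr_ae (g := fun _ => 0) (hz.mono fun y hy => by simp [hy])]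
    simp
  · obtain ⟨g0, hg0, hfg⟩ := hf.1
    have hg0m : Measurable g0 := hg0.measurable
    have hlr : 0 < l.toReal := ENNReal.toReal_pos h0 hlt
    have hlc : (l.toReal : ℂ) ≠ 0 := by exact_mod_cast hlr.ne'
    refine ⟨fun x => ((l.toReal⁻¹ : ℝ) : ℂ) * g0 x, measurable_const.mul hg0m, ?_, fun i x => ?_⟩
    · have e1 : l ^ p = ∫⁻ x, ‖g0 x‖ₑ ^ p := by
        rw [hl, eLpNorm_congr_ae hfg, eLpNorm_eq_lintegral_rpow_enorm_toReal hP0 ENNReal.ofReal_ne_top,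
          ENNReal.toReal_ofReal hp0.le, ← ENNReal.rpow_mul, one_div_mul_cancel hp0.ne', ENNReal.rpow_one]
      simp_rw [enorm_mul, enorm_ofReal' (inv_nonneg.2 hlr.le), ENNReal.mul_rpow_of_nonneg _ _ hp0.le]
      rw [lintegral_const_mul' _ _ (ENNReal.rpow_ne_top_of_nonneg hp0.le ENNReal.ofReal_ne_top), ← e1,
        ← ENNReal.mul_rpow_of_nonneg _ _ hp0.le, ENNReal.ofReal_inv_of_pos hlr, ENNReal.ofReal_toReal hlt,
        ENNReal.inv_mul_cancel h0 hlt, ENNReal.one_rpow]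
    · unfold Top
      rw [← integral_const_mul]
      refine integral_congr_ae (hfg.mono fun y hy => ?_)
      simp only
      rw [hy]; push_cast; field_simp

lemma int_zero (φ : SchwartzMap ℝ ℂ) {Nb : ℝ}
    (hφ : ∀ ξ : ℝ, 𝓕 (⇑φ) ξ ≠ 0 → (2 : ℝ) ^ (-Nb) < |ξ| ∧ |ξ| < (2 : ℝ) ^ Nb) : ∫ x, φ x = 0 := by
  by_contra h
  have h1 : 𝓕 (⇑φ) (0 : ℝ) = ∫ x, φ x := by simp [Real.fourier_eq]
  have := (hφ 0 (by rwa [h1])).1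
  rw [abs_zero] at this
  exact absurd this (not_lt.2 (by positivity))

end VP

open scoped Classical in
/-- Multilinear variational paraproduct estimate (diagonal-type case obtained via
Lyons' rough path theory): the supremum over all increasing integer sequences
`(N_k)` of the `r`-variation of the `M`-linear paraproduct is bounded on
`L^{p_1} × ⋯ × L^{p_M}`. -/
theorem multilinear_variational_paraproduct
    (M : ℕ) (hM : 1 ≤ M) (r : ℝ) (hr : 2 / (M : ℝ) < r)
    (pm : Fin M → ℝ) (hpm : ∀ m, 1 < pm m)
    (p : ℝ) (hp : 1 / p = ∑ m : Fin M, 1 / pm m)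
    (Nb : ℝ) (hNb : 0 < Nb) (φ : SchwartzMap ℝ ℂ)
    (hφ : ∀ ξ : ℝ, 𝓕 (⇑φ) ξ ≠ 0 → (2 : ℝ) ^ (-Nb) < |ξ| ∧ |ξ| < (2 : ℝ) ^ Nb) :
    ∃ C : ℝ≥0, 0 < C ∧
      ∀ (f : (m : Fin M) → ℝ → ℂ),
      (∀ m, MemLp (f m) (ENNReal.ofReal (pm m))) →
      (∫⁻ x : ℝ,
          (⨆ (Nk : ℕ → ℤ) (_ : Monotone Nk),
            (∑' k : ℕ, (ENNReal.ofReal (norm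
              (∑ v ∈ (Fintype.piFinset fun _ : Fin M =>
                    Finset.Ioc (Nk k) (Nk (k + 1))).filter StrictMono,
                ∏ m : Fin M, conv (dilate φ (v m)) (f m) x))) ^ r) ^ (1 / r)) ^ p)
        ^ (1 / p)
        ≤ (C : ℝ≥0∞) * ∏ m : Fin M, eLpNorm (f m) (ENNReal.ofReal (pm m)) volume := by
  obtain ⟨Θ, C0, hB⟩ := VP.Bump.of_schwartz φ (VP.int_zero φ hφ)
  have hM0 : (0 : ℝ) < M := by exact_mod_cast hM
  have hr0 : 0 < r := lt_trans (by positivity) hr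
  have hp0 : 0 < p := by
    rw [← one_div_pos, hp]
    exact Finset.sum_pos (fun m _ => one_div_pos.2 (by linarith [hpm m])) ⟨⟨0, hM⟩, Finset.mem_univ _⟩
  set pN : ℕ → ℝ := fun m => if h : m < M then pm ⟨m, h⟩ else 2 with hpN
  have hpN1 : ∀ m, 1 < pN m := fun m => by
    simp only [hpN]; split_ifs with h
    · exact hpm _
    · norm_num
  have hpNe : ∀ m : Fin M, pN m = pm m := fun m => by simp [hpN]
  have hps : 1 / p = ∑ m ∈ Finset.range M, 1 / pN m := by
    rw [Finset.sum_range, hp]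
    exact Finset.sum_congr rfl fun m _ => by rw [hpNe]
  obtain ⟨D, hD⟩ := VP.genS hB hr hM hpN1 hp0 hps
  refine ⟨D ^ (1 / p) + 1, by positivity, fun f hf => ?_⟩
  choose g hgm hg1 hg using fun m => VP.norml φ (hpm m) (hf m)
  set G : ℕ → ℝ → ℂ := fun m => if h : m < M then g ⟨m, h⟩ else fun _ => 0 with hG
  have hGe : ∀ m : Fin M, G m = g m := fun m => by simp [hG]
  have hGm : ∀ m, Measurable (G m) := fun m => by
    simp only [hG]; split_ifs with h
    · exact hgm _
    · exact measurable_const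
  have hG1 : ∀ m, ∫⁻ x, ‖G m x‖ₑ ^ pN m ≤ 1 := fun m => by
    by_cases h : m < M
    · simp only [hG, hpN, h, dif_pos]; exact hg1 _
    · simp [hG, hpN, h]
  set Λ : ℝ≥0∞ := ∏ m : Fin M, eLpNorm (f m) (ENNReal.ofReal (pm m)) volume with hΛ
  have hΛt : Λ ≠ ∞ := ENNReal.prod_ne_top fun m _ => (hf m).2.ne
  have hlam : ‖∏ m : Fin M, ((eLpNorm (f m) (ENNReal.ofReal (pm m)) volume).toReal : ℂ)‖ₑ = Λ := by
    rw [← Complex.ofReal_prod, VP.enorm_ofReal' (Finset.prod_nonneg fun _ _ => ENNReal.toReal_nonneg),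
      ENNReal.ofReal_prod_of_nonneg fun _ _ => ENNReal.toReal_nonneg]
    exact Finset.prod_congr rfl fun m _ => ENNReal.ofReal_toReal (hf m).2.ne
  have hJ : ∀ x s t, ∑ v ∈ (Fintype.piFinset fun _ : Fin M => Finset.Ioc s t).filter StrictMono,
      ∏ m : Fin M, conv (dilate φ (v m)) (f m) x =
      (∏ m : Fin M, ((eLpNorm (f m) (ENNReal.ofReal (pm m)) volume).toReal : ℂ)) * VP.J (VP.PA φ G x) 0 M s t := fun x s t => by
    rw [← VP.J_eq, Finset.mul_sum]
    refine Finset.sum_congr rfl fun v _ => ?_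
    rw [← Finset.prod_mul_distrib]
    refine Finset.prod_congr rfl fun m _ => ?_
    refine (hg m (v m) x).trans ?_
    unfold VP.PA
    rw [zero_add, hGe]
  have hpt : ∀ x, (⨆ (Nk : ℕ → ℤ) (_ : Monotone Nk),
            (∑' k : ℕ, (ENNReal.ofReal (norm
              (∑ v ∈ (Fintype.piFinset fun _ : Fin M =>
                    Finset.Ioc (Nk k) (Nk (k + 1))).filter StrictMono,
                ∏ m : Fin M, conv (dilate φ (v m)) (f m) x))) ^ r) ^ (1 / r)) ≤ Λ * VP.SV (VP.PA φ G x) r M := fun x => by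
    refine iSup_le fun N => iSup_le fun hN => ?_
    refine le_trans (le_of_eq ?_) (mul_le_mul' le_rfl (le_iSup₂ (f := fun (Nk : ℕ → ℤ) (_ : Monotone Nk) =>
      (∑' k : ℕ, ‖VP.J (VP.PA φ G x) 0 M (Nk k) (Nk (k + 1))‖ₑ ^ r) ^ (1 / r)) N hN))
    simp_rw [hJ, ofReal_norm, enorm_mul, hlam, ENNReal.mul_rpow_of_nonneg _ _ hr0.le]
    rw [ENNReal.tsum_mul_left, ENNReal.mul_rpow_of_nonneg _ _ (by positivity), ← ENNReal.rpow_mul, mul_one_div_cancel hr0.ne',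
      ENNReal.rpow_one]
  have hintg : (∫⁻ x, (Λ * VP.SV (VP.PA φ G x) r M) ^ p) ≤ Λ ^ p * D := by
    simp_rw [ENNReal.mul_rpow_of_nonneg _ _ hp0.le]
    rw [lintegral_const_mul' _ _ (ENNReal.rpow_ne_top_of_nonneg hp0.le hΛt)]
    exact mul_le_mul' le_rfl (hD G hGm hG1)
  refine (ENNReal.rpow_le_rpow ((lintegral_mono fun x => ENNReal.rpow_le_rpow (hpt x) hp0.le).trans hintg) (by positivity)).trans ?_
  rw [ENNReal.mul_rpow_of_nonneg _ _ (by positivity), ← ENNReal.rpow_mul, mul_one_div_cancel hp0.ne', ENNReal.rpow_one, mul_comm]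
  refine mul_le_mul' ?_ le_rfl
  push_cast
  rw [ENNReal.coe_rpow_of_nonneg _ (by positivity)]
  exact le_self_add

end
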